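/- Let n ≥ 1 be an integer, set β = n + 1/2, and let λ_N, C, B_r be as in the context. Then lim_{N→∞} (2π/λ_N) / R_N = 1, where R_N := (1/4) π^{−1/4} C^{1/4} B_0^{−1/2} N^{−1/2 + 1/(4β)} · (4 C N^{1/β})^{(−1)^n/π} · exp( (2 N^{1−1/(2β)}/√(πC)) ∑_{r=0}^{n} (−1)^r (B_r/C^r) N^{−r/β} ). -/

import Mathlib

open MeasureTheory Real Filter Topology Polynomial
/-- `C(β) = 4 (Γ(β)²/Γ(2β))^{1/β}`. -/
noncomputable def Ccoef (β : ℝ) : ℝ :=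
  4 * (Real.Gamma β ^ 2 / Real.Gamma (2 * β)) ^ (1 / β)
/-- `L_s = s · 4^s · Γ(s)² / (2π Γ(2s))`. -/
noncomputable def Lcoef (s : ℝ) : ℝ :=
  s * (4:ℝ) ^ s * Real.Gamma s ^ 2 / (2 * π * Real.Gamma (2 * s))
/-- `γ_m = Γ(m−1/2)/Γ(m+1)` for `m ≥ 0` and `0` for `m < 0`. -/
noncomputable def gammaCoef (m : ℤ) : ℝ :=
  if 0 ≤ m then Real.Gamma ((m : ℝ) - 1/2) / Real.Gamma ((m : ℝ) + 1) else 0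
/-- `δ_m = ∑_{s=1}^n γ_{s−m} / L_{s−1/2}`. -/
noncomputable def deltaCoef (n : ℕ) (m : ℤ) : ℝ :=
  ∑ s ∈ Finset.Icc 1 n, gammaCoef ((s : ℤ) - m) / Lcoef ((s : ℝ) - 1/2)
/-- `a_r = Γ(r+1/2)/((r+1/2) Γ(r+1))`. -/
noncomputable def aCoef (r : ℕ) : ℝ :=
  Real.Gamma ((r : ℝ) + 1/2) / (((r : ℝ) + 1/2) * Real.Gamma ((r : ℝ) + 1))
/-- `B_r = a_r − (L_β/(2β)) δ_{n−r}` for `β = n + 1/2`. -/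
noncomputable def BCoef (n : ℕ) (β : ℝ) (r : ℕ) : ℝ :=
  aCoef r - (Lcoef β / (2 * β)) * deltaCoef n ((n : ℤ) - (r : ℤ))
notation:max "¶" => (by positivity)
notation:max "§" => (by linarith)
notation:max "¢" => (by fun_prop)
notation:max "¡" => (by norm_num)
notation:max "¿" => (by omega)
notation "cexp" => Complex.exp
notation "cch" => Complex.cosh
notation "csh" => Complex.sinh
notation "cxa" => Complex.exp_add
notation "cno" => Complex.norm_of_nonneg
notation "cn0" => Complex.exp_ne_zero
notation "cxm" => Complex.exp_nat_mul
notation "mlm" => mul_le_mul_of_nonneg_left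
notation "mrm" => mul_le_mul_of_nonneg_right
notation "odl" => one_div_le_one_div_of_le
notation "iicm" => intervalIntegral.integral_const_mul
notation "iia" => intervalIntegral.integral_add
notation "cii" => Continuous.intervalIntegrable
notation "mIo" => measurableSet_Ioi
notation "pnl" => pow_le_pow_right₀
notation:max "£" n:max => 2*n+1
notation:max "¥" n:max => 2*n
notation:max "¦" u:max => u^12
notation:max "Rp" => Set.Ioi (0:ℝ)
notation "cj" => starRingEnd ℂ
namespace HK
noncomputable section
open Complex (I I_ne_zero I_sq abs_re_le_norm add_re conj_conj conj_mul' conj_ofNat conj_ofReal conj_re cosh_mul_I div_ofReal_re exp_conj exp_eq_exp_iff_exists_int exp_ofReal_mul_I_im exp_ofReal_mul_I_re exp_pi_mul_I exp_re im_ofReal_mul mem_slitPlane_iff mul_conj' mul_re neg_re normSq_apply normSq_eq_norm_sq norm_exp norm_exp_ofReal_mul_I norm_real ofRealCLM ofRealHom ofReal_cos ofReal_cosh ofReal_im ofReal_pow ofReal_re ofReal_sin ofReal_sinh reCLM re_add_im re_le_norm re_ofReal_mul sinh_mul_I slitPlane slitPlane_ne_zero sq_norm)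
open Set (Icc Ici Ioc_subset_Icc_self Ioi Ioi_subset_Ioi Ioo left_mem_Icc mem_Ici right_mem_Icc uIcc uIcc_of_le uIoc_of_le)
open Finset (mem_Icc mem_range mul_sum range sum_add_distrib sum_congr sum_div sum_eq_single sum_eq_zero sum_le_sum sum_mul sum_mul_sum sum_range_succ)
open intervalIntegral (integral_add_adjacent_intervals integral_comp_mul_deriv integral_comp_neg integral_congr integral_eq_sub_of_hasDerivAt integral_mono_on integral_of_le)
open Metric (ball closedBall)
variable {n N : ℕ} {w ζ z : ℂ} {u φ : ℝ}
def FF (n : ℕ) (ζ : ℂ) (k : ℝ) : ℂ := (k:ℂ)^¥n * ((1+ζ)/(1+ζ*(k:ℂ)^2))^£n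
def E0 (n : ℕ) (ζ : ℂ) : ℂ := ∫ k in (0:ℝ)..1, FF n ζ k
def JJ (n : ℕ) : ℝ := ∫ k in (0:ℝ)..1, k^¥n * (2/(1+k^2))^£n
def nu (n : ℕ) : ℝ := 1/(4*JJ n)
def Eh (n : ℕ) (ζ : ℂ) : ℂ := 4*(nu n:ℂ)*E0 n ζ
lemma JJ_pos (n : ℕ) : 0 < JJ n := by
  apply intervalIntegral.intervalIntegral_pos_of_pos_on
  · apply cii
    have : ∀ x:ℝ, 1+x^2 ≠ 0 := fun x => by positivity
    fun_prop (disch := assumption)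
  · intro x hx; have := hx.1; positivity
  · norm_num
lemma nu_pos (n : ℕ) : 0 < nu n := by have := JJ_pos n; unfold nu; positivity
lemma den_re (h : -1 < ζ.re) {k : ℝ} (hk : k ∈ Icc (0:ℝ) 1) : 0 < (1+ζ*(k:ℂ)^2).re := by
  have : (1+ζ*(k:ℂ)^2).re = 1 + ζ.re*k^2 := by
    rw [← ofReal_pow, add_re, Complex.re_mul_ofReal]; simp
  rw [this]
  have h2 : k^2 ≤ 1 := by nlinarith [hk.1, hk.2]
  rcases le_or_gt 0 ζ.re with h1 | h1
  · positivity
  · nlinarith [sq_nonneg k]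
lemma den_ne (h : -1 < ζ.re) {k : ℝ} (hk : k ∈ Icc (0:ℝ) 1) : 1+ζ*(k:ℂ)^2 ≠ 0 := by
  intro h0; have := den_re h hk; rw [h0] at this; simp at this
lemma FF_cont (h : -1 < ζ.re) : ContinuousOn (FF n ζ) (Icc 0 1) := by
  unfold FF
  have : ∀ k ∈ Icc (0:ℝ) 1, 1+ζ*(k:ℂ)^2 ≠ 0 := fun k hk => den_ne h hk
  fun_prop (disch := assumption)
lemma E0_deriv (n : ℕ) (h : -1 < ζ.re) : ∃ D, HasDerivAt (E0 n) D ζ ∧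
    ζ * D = 1/2 - ((2*n+1:ℝ):ℂ)/2 * ((1-ζ)/(1+ζ)) * E0 n ζ := by
  let F' : ℂ → ℝ → ℂ := fun ζ k => (k:ℂ)^¥n * ((2*n+1:ℕ)*((1+ζ)/(1+ζ*(k:ℂ)^2))^¥n *
    ((1-(k:ℂ)^2)/(1+ζ*(k:ℂ)^2)^2))
  have hr : 0 < (1+ζ.re)/2 := §
  have hre : ∀ x ∈ closedBall ζ ((1+ζ.re)/2), -1 < x.re := by
    intro x hx
    have h1 := abs_re_le_norm (x-ζ)
    rw [Metric.mem_closedBall, dist_eq_norm] at hx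
    have := abs_le.1 (h1.trans hx)
    simp at this; linarith
  have hFc : ContinuousOn (fun p : ℂ × ℝ => F' p.1 p.2) (closedBall ζ ((1+ζ.re)/2) ×ˢ Icc 0 1) := by
    have : ∀ p ∈ closedBall ζ ((1+ζ.re)/2) ×ˢ Icc (0:ℝ) 1, 1+p.1*(p.2:ℂ)^2 ≠ 0 :=
      fun p hp => den_ne (hre _ hp.1) hp.2
    have h2 : ∀ p ∈ closedBall ζ ((1+ζ.re)/2) ×ˢ Icc (0:ℝ) 1, (1+p.1*(p.2:ℂ)^2)^2 ≠ 0 :=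
      fun p hp => pow_ne_zero _ (this p hp)
    simp only [F']
    fun_prop (disch := assumption)
  obtain ⟨B, hB⟩ := ((isCompact_closedBall ζ ((1+ζ.re)/2)).prod isCompact_Icc).exists_bound_of_continuousOn hFc
  have hu : uIcc (0:ℝ) 1 = Icc 0 1 := uIcc_of_le zero_le_one
  have hF'c : ContinuousOn (F' ζ) (Icc 0 1) := by
    refine hFc.comp (f := fun k => (ζ,k)) ¢ (fun k hk => ⟨Metric.mem_closedBall_self hr.le, hk⟩)
  have hd := intervalIntegral.hasDerivAt_integral_of_dominated_loc_of_deriv_le (μ := volume) (F := FF n) (F' := F')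
    (x₀ := ζ) (s := closedBall ζ ((1+ζ.re)/2)) (a := 0) (b := 1) (bound := fun _ => B)
    (Metric.closedBall_mem_nhds _ hr)
    (by
      filter_upwards [Metric.closedBall_mem_nhds _ hr] with x hx
      apply ContinuousOn.aestronglyMeasurable _ measurableSet_uIoc
      exact (FF_cont (hre x hx)).mono (by rw [uIoc_of_le zero_le_one]; exact Ioc_subset_Icc_self))
    (ContinuousOn.intervalIntegrable (by rw [hu]; exact FF_cont h))
    (by
      apply ContinuousOn.aestronglyMeasurable _ measurableSet_uIoc
      exact hF'c.mono (by rw [uIoc_of_le zero_le_one]; exact Ioc_subset_Icc_self))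
    (by
      refine Eventually.of_forall fun t ht x hx => ?_
      rw [uIoc_of_le zero_le_one] at ht
      exact hB (x,t) ⟨hx, Ioc_subset_Icc_self ht⟩)
    (by simp)
    (by
      refine Eventually.of_forall fun t ht x hx => ?_
      rw [uIoc_of_le zero_le_one] at ht
      have hne := den_ne (hre x hx) (Ioc_subset_Icc_self ht)
      have h1 : HasDerivAt (fun x : ℂ => (1+x)/(1+x*(t:ℂ)^2)) ((1-(t:ℂ)^2)/(1+x*(t:ℂ)^2)^2) x := by
        have := ((hasDerivAt_id x).const_add 1).div (((hasDerivAt_id x).mul_const ((t:ℂ)^2)).const_add 1) hne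
        refine this.congr_deriv ?_
        simp; ring
      simpa [FF, F'] using ((h1.pow £n).const_mul ((t:ℂ)^¥n)))
  refine ⟨_, hd.2, ?_⟩
  have hz : (1:ℂ)+ζ ≠ 0 := by
    intro h0; have := congrArg Complex.re h0; simp at this; linarith
  -- FTC
  let g : ℝ → ℂ := fun k => (k:ℂ)^£n * ((1+ζ)/(1+ζ*(k:ℂ)^2))^£n/2
  have hg : ∀ k ∈ uIcc (0:ℝ) 1, HasDerivAt g (ζ * F' ζ k + ((2*n+1:ℝ):ℂ)/2 * ((1-ζ)/(1+ζ)) * FF n ζ k) k := by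
    intro k hk
    rw [hu] at hk
    have hne := den_ne h hk
    have hk1 : HasDerivAt (fun k:ℝ => (k:ℂ)) 1 k := ofRealCLM.hasDerivAt
    have h2 : HasDerivAt (fun k : ℝ => (1+ζ)/(1+ζ*(k:ℂ)^2)) (-(1+ζ)*(ζ*(2*k))/(1+ζ*(k:ℂ)^2)^2) k := by
      have := (hasDerivAt_const k (1+ζ)).div (((hk1.pow 2).const_mul ζ).const_add 1) hne
      refine this.congr_deriv ?_
      simp; ring
    have h3 := ((hk1.pow £n).mul (h2.pow £n)).div_const 2
    refine h3.congr_deriv ?_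
    simp only [F', FF, Pi.pow_apply]
    push_cast
    simp only [pow_succ _ ¥n]
    generalize ((1 + ζ) / (1 + ζ * (k:ℂ) ^ 2)) ^ (2 * n) = Q
    field_simp
    ring
  have hint : IntervalIntegrable (fun k => ζ * F' ζ k + ((2*n+1:ℝ):ℂ)/2 * ((1-ζ)/(1+ζ)) * FF n ζ k) volume 0 1 := by
    apply ContinuousOn.intervalIntegrable
    rw [hu]
    exact (continuousOn_const.mul hF'c).add (continuousOn_const.mul (FF_cont h))
  have hI := integral_eq_sub_of_hasDerivAt hg hint
  rw [iia (hd.1.const_mul _) ((ContinuousOn.intervalIntegrable (by rw [hu]; exact FF_cont h)).const_mul _), iicm, iicm] at hI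
  have h1 : g 1 - g 0 = 1/2 := by simp [g, div_self hz]
  rw [h1] at hI
  rw [E0, ← hI]; ring
lemma Eh_deriv (n : ℕ) (h : -1 < ζ.re) : ∃ D, HasDerivAt (Eh n) D ζ ∧
    ζ * D = 2*(nu n:ℂ) - ((2*n+1:ℝ):ℂ)/2 * ((1-ζ)/(1+ζ)) * Eh n ζ := by
  obtain ⟨D, h1, h2⟩ := E0_deriv n h
  refine ⟨_, h1.const_mul (4*(nu n:ℂ)), ?_⟩
  rw [Eh]; linear_combination 4*(nu n:ℂ)*h2
lemma frac_bd (h : ‖ζ‖ ≤ 1) {k : ℝ} (hk : k ∈ Ioo (0:ℝ) 1) :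
    1+ζ*(k:ℂ)^2 ≠ 0 ∧ ‖(1+ζ)/(1+ζ*(k:ℂ)^2)‖ ≤ 4 := by
  have hk2 : k^2 < 1 := by nlinarith [hk.1, hk.2]
  have e : ‖(k:ℂ)^2‖ = k^2 := by rw [norm_pow]; simp
  have h1 : 1 - k^2 ≤ ‖1+ζ*(k:ℂ)^2‖ := by
    have := norm_sub_norm_le (1:ℂ) (-(ζ*(k:ℂ)^2))
    rw [norm_neg, norm_mul, e, norm_one, sub_neg_eq_add] at this
    nlinarith [sq_nonneg k]
  have h2 : ‖1+ζ‖*k^2 - (1-k^2) ≤ ‖1+ζ*(k:ℂ)^2‖ := by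
    have : 1+ζ*(k:ℂ)^2 = (1+ζ)*(k:ℂ)^2 + (1-(k:ℂ)^2) := by ring
    rw [this]
    have h3 := norm_sub_norm_le ((1+ζ)*(k:ℂ)^2) (-(1-(k:ℂ)^2))
    rw [norm_neg, sub_neg_eq_add, norm_mul, e] at h3
    have h4 : ‖(1-(k:ℂ)^2)‖ = 1-k^2 := by
      rw [show (1-(k:ℂ)^2) = ((1-k^2:ℝ):ℂ) by push_cast; ring, norm_real, norm_of_nonneg §]
    linarith
  have h5 : ‖1+ζ‖ ≤ 2 := (norm_add_le _ _).trans (by rw [norm_one]; linarith)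
  have hpos : 0 < ‖1+ζ*(k:ℂ)^2‖ := §
  refine ⟨norm_pos_iff.1 hpos, ?_⟩
  rw [norm_div, div_le_iff₀ hpos]
  nlinarith [norm_nonneg (1+ζ), sq_nonneg k]
lemma FF_bd (h : ‖ζ‖ ≤ 1) {k : ℝ} (hk : k ∈ Ioo (0:ℝ) 1) : ‖FF n ζ k‖ ≤ 4^£n := by
  rw [FF, norm_mul, norm_pow, norm_pow]
  have h1 := pow_le_pow_left₀ (norm_nonneg _) (frac_bd h hk).2 £n
  have h2 : ‖(k:ℂ)‖^¥n ≤ 1 := pow_le_one₀ (norm_nonneg _) (by simp [abs_le]; constructor <;> linarith [hk.1,hk.2])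
  calc _ ≤ 1 * 4^£n := mul_le_mul h2 h1 ¶ ¡
    _ = _ := one_mul _
lemma ae_Ioo : ∀ᵐ t : ℝ ∂volume, t ∈ Set.uIoc (0:ℝ) 1 → t ∈ Ioo (0:ℝ) 1 := by
  have : ∀ᵐ t : ℝ ∂volume, t ≠ 1 := by simp [ae_iff]
  filter_upwards [this] with t ht h
  rw [uIoc_of_le zero_le_one] at h
  exact ⟨h.1, lt_of_le_of_ne h.2 ht⟩
lemma Eh_cont (n : ℕ) : ContinuousOn (Eh n) (closedBall 0 1) := by
  unfold Eh
  refine continuousOn_const.mul (g := E0 n) ?_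
  intro ζ0 hζ
  refine intervalIntegral.continuousWithinAt_of_dominated_interval (bound := fun _ => 4^£n) ?_ ?_ (by simp) ?_
  · refine Eventually.of_forall fun x => Measurable.aestronglyMeasurable ?_
    unfold FF; fun_prop
  · filter_upwards [self_mem_nhdsWithin] with x hx
    filter_upwards [ae_Ioo] with t ht h
    exact FF_bd (by simpa using hx) (ht h)
  · filter_upwards [ae_Ioo] with t ht h
    have := (frac_bd (by simpa using hζ : ‖ζ0‖ ≤ 1) (ht h)).1
    unfold FF
    apply ContinuousAt.continuousWithinAt
    fun_prop (disch := assumption)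
lemma Eh_bd (n : ℕ) : ∃ C, 0 < C ∧ ∀ ζ : ℂ, ‖ζ‖ ≤ 1 → ‖Eh n ζ‖ ≤ C := by
  obtain ⟨C, hC⟩ := (isCompact_closedBall (0:ℂ) 1).exists_bound_of_continuousOn (Eh_cont n)
  exact ⟨max C 1, by positivity, fun ζ h => (hC ζ (by simpa using h)).trans (le_max_left _ _)⟩
lemma FF_conj (n : ℕ) (ζ : ℂ) (k : ℝ) : FF n (cj ζ) k = cj (FF n ζ k) := by
  simp [FF]
lemma Eh_conj (n : ℕ) (ζ : ℂ) : Eh n (cj ζ) = cj (Eh n ζ) := by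
  simp only [Eh, E0, FF_conj, map_mul, conj_ofReal]
  rw [integral_of_le zero_le_one, integral_of_le zero_le_one, integral_conj]
  simp [conj_ofNat]
lemma Eh_neg_one (n : ℕ) : Eh n (-1) = 0 := by
  simp [Eh, E0, FF]
lemma Eh_one (n : ℕ) : Eh n 1 = 1 := by
  have : E0 n 1 = (JJ n : ℂ) := by
    rw [E0, JJ, ← intervalIntegral.integral_ofReal]
    congr 1; ext k; simp [FF]; norm_num
  have h := JJ_pos n
  rw [Eh, this, nu]
  have : (JJ n:ℂ) ≠ 0 := by exact_mod_cast h.ne'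
  push_cast; field_simp
lemma Eh_real (n : ℕ) (r : ℝ) : Eh n (r:ℂ) = ((4*nu n * ∫ k in (0:ℝ)..1, k^¥n * ((1+r)/(1+r*k^2))^£n : ℝ):ℂ) := by
  rw [Eh, E0]; push_cast
  rw [← intervalIntegral.integral_ofReal]
  congr 2; ext k; simp [FF]
lemma Eh_real_im (n : ℕ) (r : ℝ) : (Eh n (r:ℂ)).im = 0 := by
  rw [Eh_real]; exact ofReal_im _
lemma Eh_real_nonneg (n : ℕ) {r : ℝ} (h : -1 ≤ r) : 0 ≤ (Eh n (r:ℂ)).re := by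
  rw [Eh_real, ofReal_re]
  have := nu_pos n
  apply mul_nonneg ¶
  apply intervalIntegral.integral_nonneg zero_le_one
  intro k hk
  have : 0 ≤ 1 + r*k^2 := by
    have : k^2 ≤ 1 := by nlinarith [hk.1, hk.2]
    nlinarith [sq_nonneg k]
  have h1 : 0 ≤ 1 + r := §
  have := hk.1
  positivity
lemma Eh_exp_deriv (n : ℕ) {s : ℂ} (h : -1 < (cexp (-s)).re) :
    HasDerivAt (fun s => Eh n (cexp (-s)))
      (((2*n+1:ℝ):ℂ)/2 * (csh (s/2)/cch (s/2)) * Eh n (cexp (-s)) - 2*(nu n:ℂ)) s := by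
  obtain ⟨D, h1, h2⟩ := Eh_deriv n h
  have h3 := h1.comp s ((hasDerivAt_neg s).cexp)
  refine h3.congr_deriv ?_
  have h4 : (1 - cexp (-s))/(1+cexp (-s)) = csh (s/2)/cch (s/2) := by
    rw [Complex.sinh, Complex.cosh]
    have e1 : cexp (-s) = cexp (-(s/2)) * cexp (-(s/2)) := by rw [← cxa]; congr 1; ring
    have e2 : cexp (s/2) * cexp (-(s/2)) = 1 := by rw [← cxa]; simp
    have h5 : cexp (-(s/2)) ≠ 0 := cn0 _
    have a1 : 1 - cexp (-s) = cexp (-(s/2)) * (cexp (s/2) - cexp (-(s/2))) := by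
      rw [e1]; linear_combination -e2
    have a2 : 1 + cexp (-s) = cexp (-(s/2)) * (cexp (s/2) + cexp (-(s/2))) := by
      rw [e1]; linear_combination -e2
    rw [a1, a2, mul_div_mul_left _ _ h5, div_div_div_cancel_right₀ ¡]
  rw [h4] at h2
  linear_combination -h2
lemma le_of_hasDeriv {f f' : ℝ → ℝ} {a b : ℝ} (hab : a ≤ b) (h : ∀ x ∈ Icc a b, HasDerivAt f (f' x) x)
    (h0 : ∀ x ∈ Icc a b, 0 ≤ f' x) : f a ≤ f b := by
  refine monotoneOn_of_deriv_nonneg (convex_Icc a b) (fun x hx => (h x hx).continuousAt.continuousWithinAt)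
    (fun x hx => (h x (interior_subset hx)).differentiableAt.differentiableWithinAt)
    (fun x hx => ?_) (left_mem_Icc.2 hab) (right_mem_Icc.2 hab) hab
  rw [(h x (interior_subset hx)).deriv]; exact h0 x (interior_subset hx)
lemma exp_I_re_gt (h0 : 0 ≤ φ) (h : φ < π) : -1 < (cexp (φ*I)).re := by
  rw [exp_ofReal_mul_I_re]
  have := cos_pi ▸ cos_lt_cos_of_nonneg_of_le_pi h0 le_rfl h
  exact this
lemma Eh_re_circle (n : ℕ) (h : |φ| ≤ π) : (Eh n (cexp (φ*I))).re = cos (φ/2)^£n := by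
  wlog h0 : 0 ≤ φ with H
  · have := H n (φ := -φ) (by rwa [abs_neg]) §
    rw [neg_div, cos_neg] at this
    rw [← this, ← conj_re, ← Eh_conj, ← exp_conj]
    simp
  rw [abs_of_nonneg h0] at h
  rcases h.eq_or_lt with rfl | h
  · simp [Eh_neg_one]
  have hcos : ∀ x ∈ Icc 0 φ, 0 < cos (x/2) := fun x hx =>
    cos_pos_of_mem_Ioo ⟨by linarith [hx.1], by linarith [hx.2]⟩
  have hd : ∀ x ∈ Icc 0 φ, HasDerivAt (fun x : ℝ => (Eh n (cexp (x*I))).re / cos (x/2)^£n) 0 x := by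
    intro x hx
    have h1 := Eh_exp_deriv n (s := -(x*I)) (by rw [neg_neg]; exact exp_I_re_gt hx.1 (by linarith [hx.2]))
    have h2 : HasDerivAt (fun x:ℝ => -((x:ℂ)*I)) (-I) x := by
      simpa using (ofRealCLM.hasDerivAt (x := x)).mul_const I |>.fun_neg
    have h3 := h1.comp x h2
    have h4 := reCLM.hasFDerivAt.comp_hasDerivAt x h3
    have h5 : HasDerivAt (fun x:ℝ => cos (x/2)^£n) (£n*cos (x/2)^¥n * (-sin (x/2) * (1/2))) x := by
      have := (((hasDerivAt_id x).div_const 2).cos).fun_pow £n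
      simpa using this
    have h6 := h4.div h5 (pow_ne_zero _ (hcos x hx).ne')
    simp only [Function.comp_def, Complex.reCLM_apply, neg_neg] at h6
    refine h6.congr_deriv ?_
    have e1 : (-(x*I))/2 = ((-(x/2) : ℝ):ℂ)*I := by push_cast; ring
    rw [e1, sinh_mul_I, cosh_mul_I, ← ofReal_sin, ← ofReal_cos, sin_neg, cos_neg]
    have hc := (hcos x hx).ne'
    rw [div_eq_zero_iff]; left
    generalize hE : Eh n (cexp (x*I)) = E
    have : ((((2 * n + 1 : ℝ):ℂ) / 2 * (((-sin (x / 2) : ℝ):ℂ) * I / ((cos (x / 2):ℝ):ℂ)) * E - 2 * (nu n:ℂ)) * -I).re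
        = -(£n/2 * (sin (x/2)/cos (x/2)) * E.re) := by
      have : ((((2 * n + 1 : ℝ):ℂ) / 2 * (((-sin (x / 2) : ℝ):ℂ) * I / ((cos (x / 2):ℝ):ℂ)) * E - 2 * (nu n:ℂ)) * -I)
        = ((-(£n/2 * (sin (x/2)/cos (x/2))) : ℝ):ℂ) * E + ((2*nu n:ℝ):ℂ)*I := by
        push_cast; linear_combination (£n/2 * (Complex.sin (x/2)/Complex.cos (x/2)) * E) * I_sq
      rw [this, add_re, re_ofReal_mul, re_ofReal_mul]; simp
    rw [this, pow_succ]
    field_simp; ring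
  have := constant_of_has_deriv_right_zero (fun x hx => (hd x hx).continuousAt.continuousWithinAt)
    (fun x hx => (hd x (Set.Ico_subset_Icc_self hx)).hasDerivWithinAt) φ (right_mem_Icc.2 h0)
  simp [Eh_one] at this
  rw [div_eq_one_iff_eq (pow_ne_zero _ (hcos φ (right_mem_Icc.2 h0)).ne')] at this
  exact this
def Er (n : ℕ) (s : ℝ) : ℝ := (Eh n ((exp (-s) : ℝ):ℂ)).re
lemma Er_coe (n : ℕ) (s : ℝ) : Eh n (cexp (-(s:ℂ))) = (Er n s : ℂ) := by
  have e : cexp (-(s:ℂ)) = ((exp (-s) : ℝ):ℂ) := by push_cast; rfl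
  rw [e]
  apply Complex.ext
  · simp [Er]
  · rw [Eh_real_im]; simp
lemma Er_nonneg (n : ℕ) (s : ℝ) : 0 ≤ Er n s := Eh_real_nonneg n (by linarith [exp_pos (-s)])
lemma Er_deriv (n : ℕ) (s : ℝ) :
    HasDerivAt (Er n) (£n/2 * (sinh (s/2)/cosh (s/2)) * Er n s - 2*nu n) s := by
  have h1 := Eh_exp_deriv n (s := (s:ℂ)) (by
    rw [← Complex.ofReal_neg, Complex.exp_ofReal_re]; linarith [exp_pos (-s)])
  have h4 := h1.real_of_complex
  rw [Er_coe] at h4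
  have e : (fun x:ℝ => (Eh n (cexp (-(x:ℂ)))).re) = Er n := by ext x; rw [Er_coe]; simp
  rw [e] at h4
  refine h4.congr_deriv ?_
  rw [show (s:ℂ)/2 = ((s/2:ℝ):ℂ) by push_cast; rfl, ← ofReal_sinh, ← ofReal_cosh]
  norm_cast
def FR (n : ℕ) (s : ℝ) : ℝ := cosh (s/2)^£n - Er n s
lemma FR_zero (n : ℕ) : FR n 0 = 0 := by simp [FR, Er, Eh_one]
lemma coshpow_deriv (n : ℕ) (s : ℝ) :
    HasDerivAt (fun s => cosh (s/2)^£n) (£n/2 * (sinh (s/2)/cosh (s/2)) * cosh (s/2)^£n) s := by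
  have := (((hasDerivAt_id s).div_const 2).cosh).pow £n
  refine this.congr_deriv ?_
  have := (cosh_pos (s/2)).ne'
  simp only [id, Nat.add_sub_cancel, pow_succ]
  push_cast; field_simp
lemma FR_deriv (n : ℕ) (s : ℝ) :
    HasDerivAt (FR n) (£n/2 * (sinh (s/2)/cosh (s/2)) * FR n s + 2*nu n) s := by
  refine ((coshpow_deriv n s).sub (Er_deriv n s)).congr_deriv ?_
  simp only [FR]; ring
lemma FR_div_deriv (n : ℕ) (s : ℝ) :
    HasDerivAt (fun s => FR n s / cosh (s/2)^£n) (2*nu n / cosh (s/2)^£n) s := by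
  have h := (cosh_pos (s/2)).ne'
  refine ((FR_deriv n s).div (coshpow_deriv n s) (pow_ne_zero _ h)).congr_deriv ?_
  generalize cosh (s/2)^£n = Q at *
  by_cases hQ : Q = 0
  · simp [hQ]
  field_simp; ring
lemma FR_nonneg (n : ℕ) {s : ℝ} (hs : 0 ≤ s) : 0 ≤ FR n s := by
  have := le_of_hasDeriv hs (fun x _ => FR_div_deriv n x) (fun x _ => by
    have := nu_pos n; have := cosh_pos (x/2); positivity)
  simp only [FR_zero, zero_div] at this
  have h := pow_pos (cosh_pos (s/2)) £n
  rwa [le_div_iff₀ h, zero_mul] at this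
lemma tanh_lb {s : ℝ} (hs : 0 ≤ s) : s/(2+s) ≤ sinh (s/2)/cosh (s/2) := by
  have h1 := cosh_pos (s/2)
  rw [div_le_div_iff₀ § h1, sinh_eq, cosh_eq]
  have e : exp (s/2) = exp s * exp (-(s/2)) := by rw [← exp_add]; ring_nf
  rw [e]
  have := add_one_le_exp s
  have := exp_pos (-(s/2))
  nlinarith [mul_nonneg this.le (by linarith : 0 ≤ exp s - (s+1))]
lemma tanh_nonneg' {s : ℝ} (hs : 0 ≤ s) : 0 ≤ sinh (s/2)/cosh (s/2) :=
  le_trans ¶ (tanh_lb hs)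
lemma FR_lb (n : ℕ) {s : ℝ} (hs : 0 ≤ s) : 2*nu n*s ≤ FR n s := by
  have := le_of_hasDeriv (f := fun s => FR n s - 2*nu n*s) hs
    (fun x _ => (FR_deriv n x).sub ((hasDerivAt_id x).const_mul (2*nu n))) (fun x hx => by
      have := FR_nonneg n hx.1
      have := tanh_nonneg' hx.1
      simp only [mul_one, add_sub_cancel_right]; positivity)
  simp [FR_zero] at this; linarith
lemma lam_ub (n : ℕ) {s : ℝ} (hs : 0 ≤ s) :
    2*nu n*s - FR n s ≤ -(£n*nu n * s^3/(3*(2+s))) := by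
  have := le_of_hasDeriv (f := fun s => FR n s - 2*nu n*s - £n*nu n * s^3/(3*(2+s))) hs
    (fun x hx => ((FR_deriv n x).sub ((hasDerivAt_id x).const_mul (2*nu n))).sub
      ((((hasDerivAt_id x).pow 3).const_mul (£n*nu n)).div (((hasDerivAt_id x).const_add 2).const_mul 3)
        (by have := hx.1; simp; linarith))) (fun x hx => by
      have h1 := FR_lb n hx.1
      have h2 := tanh_lb hx.1
      have h3 := hx.1
      have h4 := nu_pos n
      have h5 : 2*nu n*x * (x/(2+x)) ≤ FR n x * (sinh (x/2)/cosh (x/2)) :=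
        mul_le_mul h1 h2 ¶ (FR_nonneg n h3)
      have h6 : (£n*nu n * (3*x^2) * (3*(2+x)) - £n*nu n*x^3*3)/(3*(2+x))^2 ≤ £n/2*(2*nu n*x * (x/(2+x))) := by
        rw [div_le_iff₀ ¶]
        have : £n/2*(2*nu n*x * (x/(2+x))) * (3*(2+x))^2 = £n*nu n*(9*x^2*(2+x)) := by field_simp; try ring
        rw [this]
        have : 0 ≤ £n*nu n * x^3 := ¶
        nlinarith
      have h7 : (2*n+1:ℝ)/2*(2*nu n*x * (x/(2+x))) ≤ (2*n+1:ℝ)/2*(FR n x * (sinh (x/2)/cosh (x/2))) :=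
        mlm h5 ¶
      simp
      linarith)
  simp [FR_zero] at this; linarith
lemma lam_lb (n : ℕ) : ∃ C, 0 < C ∧ ∀ s, 0 ≤ s → s ≤ 1 → -(C*s^3) ≤ 2*nu n*s - FR n s := by
  have hn := nu_pos n
  let B : ℝ := 2*nu n*cosh 1^£n
  have hB : 0 < B := by have := cosh_pos (1:ℝ); positivity
  have hc : ∀ s:ℝ, 0 ≤ s → s ≤ 1 → cosh (s/2) ≤ cosh 1 := fun s h0 h1 => by
    rw [cosh_le_cosh, abs_of_nonneg §, abs_of_nonneg §]; linarith
  have hF : ∀ s, 0 ≤ s → s ≤ 1 → FR n s ≤ B*s := by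
    intro s hs h1
    have := le_of_hasDeriv (f := fun s => 2*nu n*s - FR n s / cosh (s/2)^£n) hs
      (fun x _ => ((hasDerivAt_id x).const_mul (2*nu n)).sub (FR_div_deriv n x)) (fun x _ => by
        have := div_le_self (by positivity : 0 ≤ 2*nu n) (one_le_pow₀ (n := 2*n+1) (one_le_cosh (x/2)))
        linarith)
    simp [FR_zero] at this
    have h := pow_pos (cosh_pos (s/2)) £n
    rw [div_le_iff₀ h] at this
    refine this.trans ?_
    have := pow_le_pow_left₀ (cosh_pos (s/2)).le (hc s hs h1) £n
    calc _ ≤ 2*nu n*s*cosh 1^£n := by gcongr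
      _ = _ := by simp only [B]; ring
  have hsh : ∀ s:ℝ, 0 ≤ s → s ≤ 1 → sinh (s/2)/cosh (s/2) ≤ cosh 1 * s := by
    intro s hs h1
    have h2 : sinh (s/2) ≤ cosh 1 * s := by
      have := le_of_hasDeriv (f := fun s => cosh 1*s - sinh (s/2)) hs
        (fun x _ => ((hasDerivAt_id x).const_mul (cosh 1)).sub (((hasDerivAt_id x).div_const 2).sinh)) (fun x hx => by
          have := hc x hx.1 (hx.2.trans h1)
          have := cosh_pos (x/2)
          simp; linarith)
      simp at this; linarith
    exact (div_le_self (sinh_nonneg_iff.2 §) (one_le_cosh _)).trans h2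
  refine ⟨£n*B*cosh 1, by have := cosh_pos (1:ℝ); positivity, fun s hs h1 => ?_⟩
  have := le_of_hasDeriv (f := fun s => 2*nu n*s - FR n s + £n*B*cosh 1 * s^3) hs
    (fun x _ => (((hasDerivAt_id x).const_mul (2*nu n)).sub (FR_deriv n x)).add (((hasDerivAt_id x).pow 3).const_mul (£n*B*cosh 1)))
    (fun x hx => by
      have h2 := hF x hx.1 (hx.2.trans h1)
      have h3 := hsh x hx.1 (hx.2.trans h1)
      have h4 : (sinh (x/2)/cosh (x/2)) * FR n x ≤ (cosh 1 * x) * (B*x) :=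
        mul_le_mul h3 h2 (FR_nonneg n hx.1) (by have := cosh_pos (1:ℝ); have := hx.1; positivity)
      have h5 := mlm h4 (by positivity : (0:ℝ) ≤ £n/2)
      have h6 : 0 ≤ £n*B*cosh 1*x^2 := by have := cosh_pos (1:ℝ); positivity
      simp
      nlinarith)
  simp [FR_zero] at this; linarith
def qq (w : ℂ) : ℂ := cexp (Complex.log (1+w^2)/2)
def AA (w : ℂ) : ℂ := Complex.log (w + qq w)
lemma slit (h : 0 < w.re) : 1+w^2 ∈ slitPlane := by
  rw [mem_slitPlane_iff]
  have h1 : (1+w^2).re = 1 + w.re^2 - w.im^2 := by simp [pow_two]; ring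
  have h2 : (1+w^2).im = 2*(w.re*w.im) := by simp [pow_two]; ring
  rw [h1, h2]
  by_cases hi : w.im = 0
  · left; rw [hi]; nlinarith
  · right; have := h.ne'; positivity
lemma qq_sq (h : 0 < w.re) : qq w^2 = 1+w^2 := by
  rw [qq, ← cxm, show ((2:ℕ):ℂ)*(Complex.log (1+w^2)/2) = Complex.log (1+w^2) by push_cast; ring,
    Complex.exp_log (slitPlane_ne_zero (slit h))]
lemma exp_half_log_re (h : z ∈ slitPlane) : 0 < (cexp (Complex.log z/2)).re := by
  rw [exp_re]
  refine mul_pos (exp_pos _) (cos_pos_of_mem_Ioo ?_)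
  have e : (Complex.log z/2).im = z.arg/2 := by
    rw [show Complex.log z/2 = Complex.log z * ((1/2:ℝ):ℂ) by push_cast; ring, Complex.im_mul_ofReal, Complex.log_im]; ring
  rw [e]
  have h1 := Complex.neg_pi_lt_arg z
  have h2 := lt_of_le_of_ne (Complex.arg_le_pi z) (Complex.mem_slitPlane_iff_arg.1 h).1
  constructor <;> linarith
lemma qq_re (h : 0 < w.re) : 0 < (qq w).re := exp_half_log_re (slit h)
lemma AA_ne (h : 0 < w.re) : 0 < (w + qq w).re := by
  rw [add_re]; linarith [qq_re h]
lemma AA_ne0 (h : 0 < w.re) : w + qq w ≠ 0 := fun h0 => by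
  have := AA_ne h; rw [h0] at this; simp at this
lemma exp_AA (h : 0 < w.re) : cexp (AA w) = w + qq w := Complex.exp_log (AA_ne0 h)
lemma exp_neg_AA (h : 0 < w.re) : cexp (-AA w) = qq w - w := by
  rw [Complex.exp_neg, exp_AA h]
  apply inv_eq_of_mul_eq_one_right
  linear_combination qq_sq h
lemma sinh_AA (h : 0 < w.re) : csh (AA w) = w := by
  rw [Complex.sinh, exp_AA h, exp_neg_AA h]; ring
lemma cosh_AA (h : 0 < w.re) : cch (AA w) = qq w := by
  rw [Complex.cosh, exp_AA h, exp_neg_AA h]; ring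
lemma AA_im (h : 0 < w.re) : |(AA w).im| < π/2 := by
  rw [AA, Complex.log_im]; exact Complex.abs_arg_lt_pi_div_two_iff.2 (Or.inl (AA_ne h))
lemma sinh_re_im (u : ℂ) : (csh u).re = sinh u.re * cos u.im ∧ (csh u).im = cosh u.re * sin u.im := by
  conv_lhs => rw [← re_add_im u]
  conv_rhs => rw [← re_add_im u]
  rw [Complex.sinh_add, sinh_mul_I, cosh_mul_I, ← ofReal_sin, ← ofReal_cos,
    ← ofReal_sinh, ← ofReal_cosh]
  simp [-ofReal_sin, -ofReal_cos, -ofReal_sinh, -ofReal_cosh]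
lemma cosh_re_im (u : ℂ) : (cch u).re = cosh u.re * cos u.im ∧ (cch u).im = sinh u.re * sin u.im := by
  conv_lhs => rw [← re_add_im u]
  conv_rhs => rw [← re_add_im u]
  rw [Complex.cosh_add, sinh_mul_I, cosh_mul_I, ← ofReal_sin, ← ofReal_cos,
    ← ofReal_sinh, ← ofReal_cosh]
  simp [-ofReal_sin, -ofReal_cos, -ofReal_sinh, -ofReal_cosh]
lemma cos_AA (h : 0 < w.re) : 0 < cos (AA w).im :=
  cos_pos_of_mem_Ioo ⟨by linarith [(abs_lt.1 (AA_im h)).1], (abs_lt.1 (AA_im h)).2⟩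
lemma AA_re (h : 0 < w.re) : 0 < (AA w).re := by
  have := (sinh_re_im (AA w)).1
  rw [sinh_AA h] at this
  rw [this] at h
  exact sinh_pos_iff.1 (pos_of_mul_pos_left h (cos_AA (by rw [this]; exact h)).le)
lemma AA_lb (h : 0 < w.re) : arsinh w.re ≤ (AA w).re := by
  have h1 := (sinh_re_im (AA w)).1
  rw [sinh_AA h] at h1
  have h2 : w.re ≤ sinh (AA w).re := by
    rw [h1]; exact mul_le_of_le_one_right (sinh_nonneg_iff.2 (AA_re h).le) (cos_le_one _)
  rw [← arsinh_sinh (AA w).re]; exact arsinh_le_arsinh.2 h2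
lemma AA_lb' (h : 0 < w.re) {p : ℝ} (hp : 1 ≤ p) (hw : p ≤ |w.im|) : arcosh p ≤ (AA w).re := by
  have h1 := (sinh_re_im (AA w)).2
  rw [sinh_AA h] at h1
  have h2 : p ≤ cosh (AA w).re := by
    refine hw.trans ?_
    rw [h1, abs_mul, abs_of_pos (cosh_pos _)]
    exact mul_le_of_le_one_right (cosh_pos _).le (abs_sin_le_one _)
  rw [← arcosh_cosh (AA_re h).le]
  exact (arcosh_le_arcosh § (cosh_pos _)).2 h2
lemma AA_deriv (h : 0 < w.re) : HasDerivAt AA (1/qq w) w := by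
  have h1 : HasDerivAt (fun w : ℂ => 1 + w^2) (2*w) w := by
    simpa using ((hasDerivAt_id w).fun_pow 2).const_add 1
  have h2 : HasDerivAt qq (w/qq w) w := by
    refine ((h1.clog (slit h)).div_const 2).cexp.congr_deriv ?_
    have := qq_sq h
    have h0 := slitPlane_ne_zero (slit h)
    have hq : qq w ≠ 0 := cn0 _
    change qq w * _ = _
    rw [← this]; field_simp
  refine (((hasDerivAt_id w).add h2).clog (mem_slitPlane_iff.2 (Or.inl (AA_ne h)))).congr_deriv ?_
  have hq : qq w ≠ 0 := cn0 _
  have := AA_ne0 h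
  simp only [Pi.add_apply, id]
  rw [div_eq_div_iff this hq, add_mul, div_mul_cancel₀ _ hq]; ring
lemma AA_sinh {u : ℂ} (h : 0 < u.re) (h2 : |u.im| < π/2) : 0 < (csh u).re ∧ AA (csh u) = u := by
  have hc : 0 < cos u.im := cos_pos_of_mem_Ioo ⟨by linarith [(abs_lt.1 h2).1], (abs_lt.1 h2).2⟩
  have h3 : 0 < (csh u).re := by rw [(sinh_re_im u).1]; exact mul_pos (sinh_pos_iff.2 h) hc
  have h4 : 0 < (cch u).re := by rw [(cosh_re_im u).1]; exact mul_pos (cosh_pos _) hc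
  refine ⟨h3, ?_⟩
  have h5 : qq (csh u) = cch u := by
    have : (qq (csh u))^2 = cch u^2 := by rw [qq_sq h3, Complex.cosh_sq]; ring
    rcases sq_eq_sq_iff_eq_or_eq_neg.1 this with h | h
    · exact h
    · have h6 := qq_re h3; rw [h, neg_re] at h6; linarith
  rw [AA, h5, Complex.sinh_add_cosh, Complex.log_exp]
  · linarith [(abs_lt.1 h2).1, pi_pos]
  · linarith [(abs_lt.1 h2).2, pi_pos]
lemma AA_ub (h : 0 < w.re) : (AA w).re ≤ w.re + 3/2*‖w‖^2 := by
  have h1 : exp (AA w).re = ‖w + qq w‖ := by rw [← norm_exp, exp_AA h]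
  have hq := qq_re h
  have h2 : ‖qq w - 1‖ ≤ ‖w‖^2 := by
    have e : ‖qq w - 1‖*‖qq w + 1‖ = ‖w‖^2 := by
      rw [← norm_mul, ← norm_pow]; congr 1; linear_combination qq_sq h
    have : 1 ≤ ‖qq w + 1‖ := by
      refine le_trans ?_ (re_le_norm _); simp; exact hq.le
    nlinarith [norm_nonneg (qq w - 1)]
  have h3 : ‖1+w‖ ≤ exp (w.re + ‖w‖^2/2) := by
    have e : ‖1+w‖^2 = 1 + 2*w.re + ‖w‖^2 := by
      rw [sq_norm, sq_norm, normSq_apply, normSq_apply]; simp; ring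
    have : ‖1+w‖^2 ≤ exp (w.re + ‖w‖^2/2)^2 := by
      rw [e, ← exp_nat_mul]
      have := add_one_le_exp (((2:ℕ):ℝ)*(w.re + ‖w‖^2/2))
      push_cast at this ⊢; linarith
    exact le_of_sq_le_sq this (exp_pos _).le
  have h4 : 1 ≤ exp (w.re + ‖w‖^2/2) := one_le_exp ¶
  rw [← exp_le_exp, h1]
  calc ‖w + qq w‖ = ‖(1+w) + (qq w - 1)‖ := by ring_nf
    _ ≤ exp (w.re + ‖w‖^2/2) + ‖w‖^2 := (norm_add_le _ _).trans (add_le_add h3 h2)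
    _ ≤ exp (w.re + ‖w‖^2/2) * (1+‖w‖^2) := by nlinarith [sq_nonneg ‖w‖]
    _ ≤ exp (w.re + ‖w‖^2/2) * exp (‖w‖^2) := by
      gcongr; linarith [add_one_le_exp (‖w‖^2)]
    _ = _ := by rw [← exp_add]; congr 1; ring
def Eg (n : ℕ) (A : ℂ) : ℂ := Eh n (-cexp (-(2*A)))
lemma norm_exp_lt {A : ℂ} (h : 0 < A.re) : ‖-cexp (-(2*A))‖ < 1 := by
  rw [norm_neg, norm_exp, exp_lt_one_iff]; simp; exact h
lemma Eg_deriv (n : ℕ) {A : ℂ} (h : 0 < A.re) : HasDerivAt (Eg n)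
    ((2*n+1:ℝ) * (cch A/csh A) * Eg n A - 4*(nu n:ℂ)) A := by
  have e : ∀ A : ℂ, cexp (-(2*A+π*I)) = -cexp (-(2*A)) := fun A => by
    rw [neg_add, cxa, Complex.exp_neg (π*I), exp_pi_mul_I]; norm_num
  have hlt := norm_exp_lt h
  have h1 := Eh_exp_deriv n (s := 2*A+π*I) (by
    rw [e]
    have := abs_re_le_norm (-cexp (-(2*A)))
    linarith [(abs_le.1 this).1])
  have h2 : HasDerivAt (fun A : ℂ => 2*A+π*I) 2 A := by
    simpa using ((hasDerivAt_id A).const_mul 2).add_const (π*I)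
  have h3 := h1.comp A h2
  simp only [Function.comp_def, e] at h3
  refine h3.congr_deriv ?_
  rw [show (2*A+π*I)/2 = A + π/2*I by ring, Complex.sinh_add, Complex.cosh_add,
    sinh_mul_I, cosh_mul_I]
  simp only [Complex.cos_pi_div_two, Complex.sin_pi_div_two, mul_zero, zero_add, one_mul]
  rw [mul_div_mul_right _ _ I_ne_zero, Eg]; ring
lemma mul_re_pos (h : 0 < w.re) {r : ℝ} (hr : 0 < r) : 0 < ((r:ℂ)*w).re := by
  rw [re_ofReal_mul]; positivity
lemma AA_norm (h : 0 < w.re) {r : ℝ} (hr : 1 ≤ r) : ‖AA (r*w)‖ ≤ (2 + ‖w‖+3/2*‖w‖^2)*r^2 := by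
  have hp := mul_re_pos h (by linarith : 0 < r)
  have h1 := AA_ub hp
  have h2 := AA_im hp
  have h3 : ((r:ℂ)*w).re ≤ r*‖w‖ := by
    rw [re_ofReal_mul]; exact mlm (re_le_norm _) §
  have h4 : ‖(r:ℂ)*w‖ = r*‖w‖ := by rw [norm_mul, norm_real, norm_of_nonneg §]
  have h5 := Complex.norm_le_abs_re_add_abs_im (AA (r*w))
  rw [abs_of_pos (AA_re hp)] at h5
  rw [h4] at h1
  have := pi_lt_four
  nlinarith [norm_nonneg w, mul_nonneg (norm_nonneg w) (by nlinarith : 0 ≤ r^2-r)]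
lemma AA_contOn (h : 0 < w.re) : ContinuousOn (fun r:ℝ => AA (r*w)) (Ici 1) := fun r hr => by
  have h1 := (AA_deriv (mul_re_pos h (by linarith [mem_Ici.1 hr] : 0 < r))).continuousAt
  have h2 : ContinuousAt (fun r:ℝ => (r:ℂ)*w) r := ¢
  exact (ContinuousAt.comp (f := fun r:ℝ => (r:ℂ)*w) h1 h2).continuousWithinAt
lemma int_rpow_two : IntegrableOn (fun r:ℝ => 1/r^2) (Ioi 1) := by
  have := integrableOn_Ioi_rpow_of_lt (by norm_num : (-2:ℝ) < -1) zero_lt_one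
  refine this.congr_fun (fun x hx => ?_) mIo
  have hx0 : (0:ℝ) < x := zero_lt_one.trans hx
  simp only []
  rw [rpow_neg hx0.le]; norm_num
lemma AA_int (hn : 1 ≤ n) (h : 0 < w.re) :
    IntegrableOn (fun r:ℝ => AA (r*w)/(r:ℂ)^(2*n+2)) (Ioi 1) := by
  refine Integrable.mono' (int_rpow_two.const_mul (2 + ‖w‖+3/2*‖w‖^2)) ?_ ?_
  · apply ContinuousOn.aestronglyMeasurable _ mIo
    apply ((AA_contOn h).mono Set.Ioi_subset_Ici_self).div ¢
    intro r hr
    have : (r:ℂ) ≠ 0 := by exact_mod_cast (by linarith [Set.mem_Ioi.1 hr] : (0:ℝ) < r).ne'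
    exact pow_ne_zero _ this
  · refine (ae_restrict_iff' mIo).2 (Eventually.of_forall fun r hr => ?_)
    have hr1 : (1:ℝ) < r := hr
    rw [norm_div, norm_pow, norm_real, norm_of_nonneg §, mul_one_div]
    rw [div_le_div_iff₀ ¶ ¶]
    have := AA_norm h hr1.le
    have h2 : r^2*r^2 ≤ r^(2*n+2) := by rw [← pow_add]; exact pnl hr1.le ¿
    have h3 := mlm h2 (by positivity : 0 ≤ (2 + ‖w‖+3/2*‖w‖^2))
    calc _ ≤ (2 + ‖w‖+3/2*‖w‖^2)*r^2*r^2 := by gcongr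
      _ ≤ _ := §
lemma W_int (hn : 1 ≤ n) (h : 0 < w.re) :
    4*(nu n:ℂ)*AA w + Eg n (AA w) = ∫ r in Ioi (1:ℝ), 4*£n*(nu n:ℂ)*(AA (r*w)/(r:ℂ)^(2*n+2)) := by
  let T : ℝ → ℂ := fun r => (4*(nu n:ℂ)*AA (r*w) + Eg n (AA (r*w)))/(r:ℂ)^£n
  have hT : ∀ r ∈ Ici (1:ℝ), HasDerivAt T (-(4*£n*(nu n:ℂ)*(AA (r*w)/(r:ℂ)^(2*n+2)))) r := by
    intro r hr
    have hr0 : 0 < r := by linarith [mem_Ici.1 hr]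
    have hp := mul_re_pos h hr0
    have hr1 : HasDerivAt (fun r:ℝ => (r:ℂ)) 1 r := ofRealCLM.hasDerivAt
    have h1 : HasDerivAt (fun r:ℝ => AA (r*w)) (1/qq (r*w) * (1*w)) r := by
      have := HasDerivAt.comp (h₂ := AA) (h := fun r:ℝ => (r:ℂ)*w) r (AA_deriv hp) (hr1.mul_const w)
      exact this
    have h2 : HasDerivAt (fun r:ℝ => Eg n (AA (r*w))) _ r := HasDerivAt.comp (h₂ := Eg n) (h := fun r:ℝ => AA (r*w)) r (Eg_deriv n (AA_re hp)) h1
    have hne : (r:ℂ) ≠ 0 := by exact_mod_cast hr0.ne'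
    refine (((h1.const_mul (4*(nu n:ℂ))).add h2).div (hr1.fun_pow £n) (pow_ne_zero _ hne)).congr_deriv ?_
    rw [sinh_AA hp, cosh_AA hp]
    have hq : qq (r*w) ≠ 0 := cn0 _
    have hw : w ≠ 0 := fun h0 => by rw [h0] at h; simp at h
    simp only [Pi.add_apply, Nat.add_sub_cancel]
    generalize Eg n (AA (r*w)) = E
    rw [show 2*n+2 = 2*n+1+1 by ring]
    simp only [pow_succ]
    push_cast
    field_simp
    ring
  have hlim : Tendsto T atTop (𝓝 0) := by
    obtain ⟨C, hC, hE⟩ := Eh_bd n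
    have hb : ∀ᶠ r:ℝ in atTop, ‖T r‖ ≤ (4*nu n*(2 + ‖w‖+3/2*‖w‖^2)+C) * r⁻¹ := by
      filter_upwards [eventually_ge_atTop 1] with r hr
      have hr0 : 0 < r := §
      have hp := mul_re_pos h hr0
      have h1 : ‖4*(nu n:ℂ)*AA (r*w) + Eg n (AA (r*w))‖ ≤ 4*nu n*((2 + ‖w‖+3/2*‖w‖^2)*r^2)+C := by
        refine (norm_add_le _ _).trans (add_le_add ?_ (hE _ (norm_exp_lt (AA_re hp)).le))
        rw [norm_mul, norm_mul, norm_real, norm_of_nonneg (nu_pos n).le]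
        have := AA_norm h hr
        have := nu_pos n
        simp only [Complex.norm_ofNat]
        gcongr
      simp only [T]
      rw [norm_div, norm_pow, norm_real, norm_of_nonneg hr0.le, div_le_iff₀ ¶]
      have e : r⁻¹ * r^£n = r^¥n := by rw [pow_succ]; field_simp
      rw [mul_assoc (4*nu n*(2 + ‖w‖+3/2*‖w‖^2)+C), e]
      have h2 : r^2 ≤ r^¥n := pnl hr ¿
      have h3 : 1 ≤ r^2 := one_le_pow₀ hr
      have := nu_pos n
      calc _ ≤ 4*nu n*((2 + ‖w‖+3/2*‖w‖^2)*r^2)+C*r^2 := by nlinarith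
        _ = (4*nu n*(2 + ‖w‖+3/2*‖w‖^2)+C)*r^2 := by ring
        _ ≤ _ := by gcongr
    refine squeeze_zero_norm' hb ?_
    have := tendsto_inv_atTop_zero.const_mul (4*nu n*(2 + ‖w‖+3/2*‖w‖^2)+C)
    rwa [mul_zero] at this
  have := integral_Ioi_of_hasDerivAt_of_tendsto' hT (((AA_int hn h).const_mul _).neg) hlim
  rw [integral_neg] at this
  have h1 : T 1 = 4*(nu n:ℂ)*AA w + Eg n (AA w) := by simp [T]
  rw [h1] at this; linear_combination this
lemma AA_int_re (hn : 1 ≤ n) (h : 0 < w.re) :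
    IntegrableOn (fun r:ℝ => (AA (r*w)).re/r^(2*n+2)) (Ioi 1) := by
  have := (AA_int hn h).re
  refine this.congr (Eventually.of_forall fun r => ?_)
  simp only [RCLike.re_to_complex]
  rw [← ofReal_pow, div_ofReal_re]
lemma W_re (hn : 1 ≤ n) (h : 0 < w.re) :
    4*nu n*(AA w).re + (Eg n (AA w)).re = 4*£n*nu n* ∫ r in Ioi (1:ℝ), (AA (r*w)).re/r^(2*n+2) := by
  have := congrArg Complex.re (W_int hn h)
  rw [integral_const_mul] at this
  have e1 : (4*£n*(nu n:ℂ)) = ((4*£n*nu n:ℝ):ℂ) := by push_cast; ring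
  have e2 : (4*(nu n:ℂ)) = ((4*nu n:ℝ):ℂ) := by push_cast; ring
  rw [e1, e2, re_ofReal_mul, add_re, re_ofReal_mul] at this
  rw [this]; congr 1
  rw [← RCLike.re_to_complex, ← integral_re (AA_int hn h)]
  refine integral_congr_ae (Eventually.of_forall fun r => ?_)
  simp only [RCLike.re_to_complex]
  rw [← ofReal_pow, div_ofReal_re]
lemma arcosh_le_self (h : 1 ≤ u) : arcosh u ≤ u := by
  rw [← arcosh_cosh (show 0 ≤ u by linarith)]
  rw [arcosh_le_arcosh (by rw [arcosh_cosh §]; linarith) (cosh_pos _), arcosh_cosh §]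
  exact (self_le_sinh_iff.2 §).trans (sinh_lt_cosh u).le
lemma Er_bd (n : ℕ) : ∃ C, 0 < C ∧ ∀ s, 0 ≤ s → Er n s ≤ C := by
  obtain ⟨C, hC, h⟩ := Eh_bd n
  refine ⟨C, hC, fun s hs => (re_le_norm _).trans (h _ ?_)⟩
  rw [norm_real, norm_of_nonneg (exp_pos _).le]; exact exp_le_one_iff.2 §
lemma arcosh_int (hn : 1 ≤ n) {R : ℝ} (hR : 1 ≤ R) :
    IntegrableOn (fun u => 4*£n*nu n*(arcosh u/u^(2*n+2))) (Ioi R) ∧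
    ∫ u in Ioi R, 4*£n*nu n*(arcosh u/u^(2*n+2)) = (4*nu n*arcosh R + Er n (2*arcosh R))/R^£n := by
  let T : ℝ → ℝ := fun u => (4*nu n*arcosh u + Er n (2*arcosh u))/u^£n
  have hν := nu_pos n
  have hcE : Continuous (Er n) := continuous_iff_continuousAt.2 fun s => (Er_deriv n s).continuousAt
  have h1 : ContinuousWithinAt T (Ici R) R := by
    have : ContinuousOn T (Ici 1) := by
      have := continuousOn_arcosh
      refine ((this.const_mul _).add (hcE.comp_continuousOn (this.const_mul _))).div ¢ fun u hu => ?_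
      exact pow_ne_zero _ (by linarith [mem_Ici.1 hu])
    exact (this R hR).mono (Set.Ici_subset_Ici.2 hR)
  have h2 : ∀ u ∈ Ioi R, HasDerivAt T (-(4*£n*nu n*(arcosh u/u^(2*n+2)))) u := by
    intro u hu
    have hu1 : 1 < u := lt_of_le_of_lt hR hu
    have hs : 0 < √(u^2-1) := sqrt_pos.2 (by nlinarith)
    have hA := hasDerivAt_arcosh hu1
    have hB := HasDerivAt.comp (h₂ := Er n) (h := fun u => 2*arcosh u) u (Er_deriv n _) (hA.const_mul 2)
    refine (((hA.const_mul (4*nu n)).add hB).div ((hasDerivAt_id u).fun_pow £n) (by simp; linarith)).congr_deriv ?_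
    rw [show 2*arcosh u/2 = arcosh u by ring, sinh_arcosh hu1.le, cosh_arcosh hu1.le]
    simp only [Pi.add_apply, Nat.add_sub_cancel, id, Function.comp]
    rw [show 2*n+2 = 2*n+1+1 by ring]
    have : u ≠ 0 := §
    simp only [pow_succ]
    push_cast
    field_simp
    ring
  have h3 : ∀ u ∈ Ioi R, -(4*£n*nu n*(arcosh u/u^(2*n+2))) ≤ 0 := by
    intro u hu
    have hu1 : 1 < u := lt_of_le_of_lt hR hu
    have := arcosh_nonneg hu1.le
    have : 0 < u := §
    simp only [Left.neg_nonpos_iff]; positivity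
  have h4 : Tendsto T atTop (𝓝 0) := by
    obtain ⟨C, hC, hE⟩ := Er_bd n
    have := tendsto_inv_atTop_zero.const_mul (4*nu n+C)
    rw [mul_zero] at this
    refine squeeze_zero' ?_ ?_ this
    · filter_upwards [eventually_ge_atTop 1] with u hu
      have := arcosh_nonneg hu; have := Er_nonneg n (2*arcosh u); simp only [T]; positivity
    · filter_upwards [eventually_ge_atTop 1] with u hu
      have hu0 : 0 < u := §
      have := arcosh_nonneg hu
      have e := hE (2*arcosh u) ¶
      have e2 := arcosh_le_self hu
      simp only [T]
      rw [← div_eq_mul_inv, div_le_div_iff₀ ¶ hu0, pow_succ, ← mul_assoc]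
      gcongr
      calc 4*nu n*arcosh u + Er n (2*arcosh u) ≤ 4*nu n*u + C*u := by nlinarith
        _ = (4*nu n+C)*u := by ring
        _ ≤ (4*nu n+C)*u^¥n := by gcongr; exact le_self_pow₀ hu ¿
  have h5 := integrableOn_Ioi_deriv_of_nonpos h1 h2 h3 h4
  have h6 := integral_Ioi_of_hasDerivAt_of_nonpos h1 h2 h3 h4
  refine ⟨by simpa using h5.neg, ?_⟩
  rw [integral_neg] at h6
  rw [show (4*nu n*arcosh R + Er n (2*arcosh R))/R^£n = T R from rfl]; linarith
lemma re_pow_le {p q : ℝ} (hp : 0 < p) (hq : 0 ≤ q) (m : ℕ) (h : 2*(m+1)*q ≤ p) (k : ℕ) (hk : k ≤ m) :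
    let c : ℂ := ⟨p, q⟩
    0 ≤ (c^k).re ∧ 0 ≤ (c^k).im ∧ p*(c^k).im ≤ 2*k*q*(c^k).re ∧ (c^k).re ≤ p^k := by
  intro c
  induction k with
  | zero => simp
  | succ k ih =>
    obtain ⟨h1, h2, h3, h4⟩ := ih ¿
    have e1 : (c^(k+1)).re = p*(c^k).re - q*(c^k).im := by rw [pow_succ, mul_re]; simp [c]; ring
    have e2 : (c^(k+1)).im = p*(c^k).im + q*(c^k).re := by rw [pow_succ, Complex.mul_im]; simp [c]; ring
    rw [e1, e2]
    generalize (c^k).re = X at *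
    generalize (c^k).im = Y at *
    have hkm : (k:ℝ)+1 ≤ m := by exact_mod_cast hk
    have hk0 : (0:ℝ) ≤ k := ¶
    have hb : 2*(k+1)*q ≤ p := by nlinarith
    have hb2 : (2*(k+1)*q)*(2*(k+1)*q) ≤ p*p := mul_self_le_mul_self ¶ hb
    have hb3 : (2*(k+1)*q)*(2*k*q) ≤ p*p := by nlinarith [mul_nonneg hq hq]
    have hqp : q ≤ p := by nlinarith
    have hx : 0 ≤ p*(p*X - q*Y) := by
      have : q*(p*Y) ≤ q*(2*k*q*X) := mlm h3 hq
      have h5 : (2*k*q)*q ≤ p*p := by nlinarith [mul_nonneg hq hq, mul_nonneg hk0 (mul_nonneg hq hq)]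
      nlinarith [mrm h5 h1]
    refine ⟨nonneg_of_mul_nonneg_right hx hp, by positivity, ?_, ?_⟩
    · have h6 : (2*(k+1)*q)*(2*k*q)*X ≤ p*p*X := mrm hb3 h1
      have h7 : (2*(k+1)*q)*(p*Y) ≤ (2*(k+1)*q)*(2*k*q*X) := mlm h3 ¶
      have h8 : p*Y*p ≤ 2*k*q*X*p := mrm h3 hp.le
      push_cast
      have h9 : (p*Y+q*X)*p ≤ (2*k+1)*q*(p*X) := by nlinarith
      have h10 : q*((2*(k+1)*q)*(p*Y)) ≤ q*(p*p*X) := mlm (h7.trans §) hq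
      have h11 : p*(p*(p*Y+q*X)) ≤ p*(2*(k+1)*q*(p*X-q*Y)) := by nlinarith
      exact le_of_mul_le_mul_left h11 hp
    · rw [pow_succ]; nlinarith [mul_nonneg hq h2]
lemma W_ge_arsinh (hn : 1 ≤ n) (h : 0 < w.re) :
    4*nu n*arsinh w.re ≤ 4*nu n*(AA w).re + (Eg n (AA w)).re := by
  have hν := nu_pos n
  rw [W_re hn h]
  have hlt : (-(2*n+2:ℝ)) < -1 := by linarith [show (0:ℝ) ≤ n by positivity]
  have hi := integrableOn_Ioi_rpow_of_lt hlt zero_lt_one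
  have hv := integral_Ioi_rpow_of_lt hlt zero_lt_one
  have : ∫ r in Ioi (1:ℝ), arsinh w.re * r^(-(2*n+2:ℝ)) ≤ ∫ r in Ioi (1:ℝ), (AA (r*w)).re/r^(2*n+2) := by
    refine setIntegral_mono_on (hi.const_mul _) (AA_int_re hn h) mIo fun r hr => ?_
    have hr1 : (1:ℝ) < r := hr
    have hr0 : 0 < r := §
    rw [rpow_neg hr0.le, ← div_eq_mul_inv]
    have e : r^(2*(n:ℝ)+2) = r^(2*n+2) := by rw [← rpow_natCast]; push_cast; rfl
    rw [e]
    gcongr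
    refine le_trans (arsinh_le_arsinh.2 ?_) (AA_lb (mul_re_pos h hr0))
    rw [re_ofReal_mul]; nlinarith
  rw [integral_const_mul, hv, one_rpow] at this
  have h2 : (0:ℝ) < 2*n+1 := ¶
  rw [show -(2*(n:ℝ)+2)+1 = -£n by ring, neg_div_neg_eq] at this
  calc 4*nu n*arsinh w.re = 4*£n*nu n*(arsinh w.re*(1/£n)) := by field_simp
    _ ≤ _ := by gcongr
lemma W_ge_arcosh (hn : 1 ≤ n) (h : 0 < w.re) {p R : ℝ} (hp : 0 < p) (hw : w.im = -p) (hR : 1 ≤ R)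
    (hpR : p ≤ R) :
    p^£n*((4*nu n*arcosh R + Er n (2*arcosh R))/R^£n) ≤ 4*nu n*(AA w).re + (Eg n (AA w)).re := by
  have hν := nu_pos n
  rw [W_re hn h, ← (arcosh_int hn hR).2, ← integral_const_mul, ← integral_const_mul]
  set g : ℝ → ℝ := fun u => 4*£n*nu n*(arcosh u/u^(2*n+2)) with hg
  have e1 := integral_comp_mul_left_Ioi g (R/p) hp
  have e2 := (integrableOn_Ioi_comp_mul_left_iff g (R/p) hp).2 (by
    rw [mul_div_cancel₀ _ hp.ne']; exact (arcosh_int hn hR).1)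
  rw [mul_div_cancel₀ _ hp.ne', smul_eq_mul] at e1
  have hRp : 1 ≤ R/p := (one_le_div hp).2 hpR
  have hint := (AA_int_re hn h).const_mul (4*£n*nu n)
  calc ∫ u in Ioi R, p^£n*g u = ∫ u in Ioi (R/p), p^(2*n+2)*g (p*u) := by
        rw [integral_const_mul (p^£n) g, integral_const_mul (p^(2*n+2)) (fun u => g (p*u)), e1, pow_succ p £n]; field_simp
    _ ≤ ∫ r in Ioi (R/p), 4*£n*nu n*((AA (r*w)).re/r^(2*n+2)) := by
        refine setIntegral_mono_on (e2.const_mul _) (IntegrableOn.mono_set hint (Ioi_subset_Ioi hRp)) mIo fun r hr => ?_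
        have hr1 : R/p < r := hr
        have hr0 : 0 < r := §
        have h3 : R < p*r := by rwa [div_lt_iff₀' hp] at hr1
        have := AA_lb' (mul_re_pos h hr0) (p := p*r) § (by
          rw [im_ofReal_mul, hw, mul_neg, abs_neg, mul_comm, abs_of_pos ¶])
        simp only [hg]
        rw [mul_pow, show p^(2*n+2)*(4*£n*nu n*(arcosh (p*r)/(p^(2*n+2)*r^(2*n+2)))) = 4*£n*nu n*(arcosh (p*r)/r^(2*n+2)) by field_simp]
        gcongr
    _ ≤ _ := by
        refine setIntegral_mono_set hint ?_ (Eventually.of_forall (Ioi_subset_Ioi hRp))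
        refine (ae_restrict_iff' mIo).2 (Eventually.of_forall fun r hr => ?_)
        have hr0 : (0:ℝ) < r := zero_lt_one.trans hr
        have := (AA_re (mul_re_pos h hr0)).le
        simp only [Pi.zero_apply]; positivity
lemma sinh_half_le {d : ℝ} (h0 : 0 ≤ d) (h1 : d ≤ 1) : sinh (d/2) ≤ d := by
  have h := abs_exp_sub_one_le (x := d/2) (by rw [abs_of_nonneg §]; linarith)
  rw [abs_of_nonneg (show 0 ≤ d/2 by linarith)] at h
  have h2 := (abs_le.1 h).2
  have h3 : 1 ≤ (exp (d/2) + exp (-(d/2)))/2 := by rw [← cosh_eq]; exact one_le_cosh _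
  rw [sinh_eq]; linarith
lemma R3_pos (hn : 1 ≤ n) : ∃ C d0, 0 < C ∧ 0 < d0 ∧ d0 ≤ 1 ∧ ∀ d φ : ℝ, 0 < d → d ≤ d0 → 0 < φ → φ ≤ π →
    -(C*d^3) ≤ 2*nu n*d + (Eh n (cexp (-(d+φ*I)))).re - (cch ((d+φ*I)/2)^£n).re := by
  have hν := nu_pos n
  obtain ⟨C, hC, hl⟩ := lam_lb n
  set K : ℝ := 2*£n+3 with hK
  refine ⟨C, min 1 (2*nu n/K^£n), hC, by positivity, min_le_left _ _, fun d φ hd hd0 h0 hπ => ?_⟩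
  have hd1 := hd0.trans (min_le_left _ _)
  have hd2 := hd0.trans (min_le_right _ _)
  set u : ℂ := (d+φ*I)/2 - π/2*I with hu
  have hur : u.re = d/2 := by simp [hu]
  have hui : u.im = φ/2-π/2 := by simp [hu]
  obtain ⟨hw, hA⟩ := AA_sinh (u := u) (by rw [hur]; linarith) (by rw [hui, abs_lt]; constructor <;> linarith)
  have hEg : Eg n u = Eh n (cexp (-(d+φ*I))) := by
    rw [Eg, show -(2*u) = -(d+φ*I) + π*I by rw [hu]; ring, cxa, exp_pi_mul_I]; simp
  set q := sinh (d/2)*sin (φ/2) with hq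
  set p := cosh (d/2)*cos (φ/2) with hp
  have hwre : (csh u).re = q := by
    rw [(sinh_re_im u).1, hur, hui, cos_sub_pi_div_two]
  have hwim : (csh u).im = -p := by
    rw [(sinh_re_im u).2, hur, hui, sin_sub_pi_div_two]; ring
  have hc : cch ((d+φ*I)/2) = ⟨p, q⟩ := by
    obtain ⟨h1, h2⟩ := cosh_re_im ((d+φ*I)/2)
    have e1 : ((d+φ*I)/2 : ℂ).re = d/2 := by simp
    have e2 : ((d+φ*I)/2 : ℂ).im = φ/2 := by simp
    rw [e1, e2] at h1 h2
    exact Complex.ext h1 h2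
  have hp0 : 0 ≤ p := mul_nonneg (cosh_pos _).le (cos_nonneg_of_mem_Icc ⟨by linarith, by linarith⟩)
  have hq0 : 0 < q := by rw [← hwre]; exact hw
  rw [hc, ← hEg]
  have key : 2*nu n*d + (Eg n u).re = 4*nu n*(AA (csh u)).re + (Eg n (AA (csh u))).re := by
    rw [hA, hur]; ring
  rw [key]
  have hC3 : 0 ≤ C*d^3 := ¶
  by_cases hcase : 2*((2*n+1:ℕ)+1)*q ≤ p
  · have hp1 : 0 < p := lt_of_lt_of_le ¶ hcase
    have h1 := (re_pow_le hp1 hq0.le £n hcase £n le_rfl).2.2.2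
    set R := max 1 p with hR
    have hR1 : 1 ≤ R := le_max_left _ _
    have h2 := W_ge_arcosh hn hw hp1 hwim hR1 (le_max_right _ _)
    have hRc : R ≤ cosh (d/2) := max_le (one_le_cosh _) (mul_le_of_le_one_right (cosh_pos _).le (cos_le_one _))
    set h := arcosh R with hh
    have hh0 : 0 ≤ h := arcosh_nonneg hR1
    have hhd : 2*h ≤ d := by
      have := (arcosh_le_arcosh § (cosh_pos _)).2 hRc
      rw [arcosh_cosh §] at this; linarith
    have h3 := hl (2*h) § §
    rw [FR, show 2*h/2 = h by ring, hh, cosh_arcosh hR1] at h3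
    rw [← hh] at h3
    have h4 : (2*h)^3 ≤ d^3 := by gcongr
    have hRp : 0 < R^£n := ¶
    have h5 : (R^£n - C*d^3)/R^£n ≤ (4*nu n*h + Er n (2*h))/R^£n := by
      gcongr; linarith [mlm h4 hC.le]
    have h6 : p^£n - C*d^3 ≤ p^£n*((R^£n - C*d^3)/R^£n) := by
      have h7 : p^£n/R^£n ≤ 1 := (div_le_one hRp).2 (by gcongr; exact le_max_right _ _)
      have : p^£n*((R^£n - C*d^3)/R^£n) = p^£n - p^£n/R^£n*(C*d^3) := by
        rw [sub_div, div_self hRp.ne']; ring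
      rw [this]; linarith [mul_le_of_le_one_left hC3 h7]
    have h8 := mlm h5 (by positivity : 0 ≤ p^£n)
    linarith
  · push Not at hcase
    have h1 := W_ge_arsinh hn hw
    rw [hwre] at h1
    have hqd : q ≤ d := (mul_le_of_le_one_right (sinh_nonneg_iff.2 §) (sin_le_one _)).trans (sinh_half_le hd.le hd1)
    have h2 : q/2 ≤ arsinh q := by
      have h3 : log (1+q) ≤ arsinh q := by
        rw [arsinh]; apply log_le_log §
        have : 1 ≤ √(1+q^2) := one_le_sqrt.2 (by nlinarith)
        linarith
      have h4 := one_sub_inv_le_log_of_pos (show 0 < 1+q by linarith)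
      have h5 : q/2 ≤ 1-(1+q)⁻¹ := by
        rw [show 1-(1+q)⁻¹ = q/(1+q) by field_simp; ring]; gcongr; linarith
      linarith
    have h3 : ((⟨p,q⟩:ℂ)^£n).re ≤ (K*q)^£n := by
      refine (re_le_norm _).trans ?_
      rw [norm_pow]; gcongr
      refine (Complex.norm_le_abs_re_add_abs_im _).trans ?_
      simp only [abs_of_nonneg hp0, abs_of_pos hq0]
      push_cast at hcase
      rw [hK]; linarith
    have h4 : (K*q)^£n ≤ 2*nu n*q := by
      rw [mul_pow]
      have h5 : K^£n*d ≤ 2*nu n := by rwa [le_div_iff₀' ¶] at hd2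
      have h6 : q^£n ≤ d*q := by
        calc q^£n ≤ q^2 := pow_le_pow_of_le_one hq0.le (hqd.trans hd1) ¿
          _ ≤ _ := by nlinarith
      calc _ ≤ K^£n*(d*q) := by gcongr
        _ = K^£n*d*q := by ring
        _ ≤ _ := by gcongr
    linarith [mlm h2 (show 0 ≤ 4*nu n by positivity)]
lemma R3 (hn : 1 ≤ n) : ∃ C d0, 0 < C ∧ 0 < d0 ∧ d0 ≤ 1 ∧ ∀ d φ : ℝ, 0 < d → d ≤ d0 → |φ| ≤ π →
    -(C*d^3) ≤ 2*nu n*d + (Eh n (cexp (-(d+φ*I)))).re - (cch ((d+φ*I)/2)^£n).re := by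
  obtain ⟨C, d0, hC, hd0, hd1, h⟩ := R3_pos hn
  obtain ⟨C', hC', h'⟩ := lam_lb n
  refine ⟨max C C', d0, by positivity, hd0, hd1, fun d φ hd hdd hφ => ?_⟩
  have hd3 : 0 ≤ d^3 := ¶
  have hCd : C*d^3 ≤ max C C'*d^3 := by gcongr; exact le_max_left _ _
  have hCd' : C'*d^3 ≤ max C C'*d^3 := by gcongr; exact le_max_right _ _
  rcases lt_trichotomy φ 0 with h0 | h0 | h0
  · have := h d (-φ) hd hdd § (by linarith [(abs_le.1 hφ).1])
    have e : ((d:ℂ)+((-φ:ℝ):ℂ)*I) = cj (d+φ*I) := by simp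
    have e3 : cj (d+φ*I)/2 = cj ((d+φ*I)/2) := by rw [map_div₀, conj_ofNat]
    rw [e, ← map_neg, exp_conj, Eh_conj, e3, Complex.cosh_conj, ← map_pow, conj_re, conj_re] at this
    linarith
  · subst h0
    have := h' d hd.le (hdd.trans hd1)
    rw [Complex.ofReal_zero, zero_mul, add_zero, Er_coe, ofReal_re]
    have e : (cch ((d:ℂ)/2)^£n).re = cosh (d/2)^£n := by
      rw [show (d:ℂ)/2 = ((d/2:ℝ):ℂ) by push_cast; rfl, ← ofReal_cosh, ← ofReal_pow, ofReal_re]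
    rw [e]; simp only [FR] at this; linarith
  · have := h d φ hd hdd h0 (abs_le.1 hφ).2; linarith
def wb (ρ β : ℝ) : ℂ := ρ*cexp (β*I)
lemma wb_re (ρ β : ℝ) : (wb ρ β).re = ρ*cos β := by
  rw [wb, re_ofReal_mul, exp_ofReal_mul_I_re]
lemma wb_im (ρ β : ℝ) : (wb ρ β).im = ρ*sin β := by
  rw [wb, im_ofReal_mul, exp_ofReal_mul_I_im]
lemma wb_norm {ρ : ℝ} (h : 0 < ρ) (β : ℝ) : ‖wb ρ β‖ = ρ := by
  rw [wb, norm_mul, norm_real, norm_exp_ofReal_mul_I, mul_one, norm_of_nonneg h.le]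
lemma wb_mul (r ρ β : ℝ) : (r:ℂ)*wb ρ β = wb (r*ρ) β := by rw [wb, wb]; push_cast; ring
lemma wb_re_pos {ρ β : ℝ} (h : 0 < ρ) (h0 : 0 ≤ β) (h1 : β ≤ π/4) : 0 < (wb ρ β).re := by
  rw [wb_re]; exact mul_pos h (cos_pos_of_mem_Ioo ⟨by linarith [pi_pos], by linarith [pi_pos]⟩)
lemma qq_one_le (h : 0 < w.re) (h2 : 0 ≤ (w^2).re) : 1 ≤ ‖qq w‖ := by
  have : 1 ≤ ‖qq w‖^2 := by
    rw [← norm_pow, qq_sq h]; refine le_trans ?_ (re_le_norm _); simp only [add_re, Complex.one_re]; linarith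
  nlinarith [norm_nonneg (qq w)]
lemma qq_sub_one (h : 0 < w.re) : ‖qq w - 1‖ ≤ ‖w‖ := by
  have hq := qq_re h
  have e : ‖qq w - 1‖*‖qq w + 1‖ = ‖w‖^2 := by
    rw [← norm_mul, ← norm_pow]; congr 1; linear_combination qq_sq h
  have h1 : ‖qq w - 1‖ ≤ ‖qq w + 1‖ := by
    rw [← sq_le_sq₀ (norm_nonneg _) (norm_nonneg _), sq_norm, sq_norm, normSq_apply, normSq_apply]
    simp; nlinarith
  have := norm_nonneg (qq w - 1)
  nlinarith [norm_nonneg w]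
lemma wb_sq_re {ρ β : ℝ} (h0 : 0 ≤ β) (h1 : β ≤ π/4) : 0 ≤ ((wb ρ β)^2).re := by
  rw [wb, mul_pow, ← cxm, ← ofReal_pow, re_ofReal_mul,
    show ((2:ℕ):ℂ)*(β*I) = ((2*β:ℝ):ℂ)*I by push_cast; ring, exp_ofReal_mul_I_re]
  exact mul_nonneg (sq_nonneg _) (cos_nonneg_of_mem_Icc ⟨by linarith [pi_pos], by linarith [pi_pos]⟩)
lemma R6 {ρ β : ℝ} (h : 0 < ρ) (h0 : 0 ≤ β) (h1 : β ≤ π/4) :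
    |(AA (wb ρ β)).re - (AA ρ).re + ρ*(1-cos β)| ≤ 3/2*ρ^2*β^2 := by
  have hI : ∀ x ∈ Icc 0 β, 0 < (wb ρ x).re := fun x hx => wb_re_pos h hx.1 (hx.2.trans h1)
  have dW : ∀ x : ℝ, HasDerivAt (wb ρ) (I*wb ρ x) x := fun x => by
    have := ((ofRealCLM.hasDerivAt (x := x)).mul_const I).cexp.const_mul (ρ:ℂ)
    refine this.congr_deriv ?_
    simp only [Complex.ofRealCLM_apply, Complex.ofReal_one, wb]; ring
  let f1 : ℝ → ℂ := fun x => I*wb ρ x/qq (wb ρ x)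
  have dA : ∀ x ∈ Icc 0 β, HasDerivAt (fun x => AA (wb ρ x)) (f1 x) x := fun x hx => by
    refine (HasDerivAt.comp (h₂ := AA) (h := wb ρ) x (AA_deriv (hI x hx)) (dW x)).congr_deriv ?_
    simp only [f1]; ring
  have dq : ∀ x ∈ Icc 0 β, HasDerivAt (fun x => qq (wb ρ x)) (wb ρ x/qq (wb ρ x)*(I*wb ρ x)) x := fun x hx => by
    have hw := hI x hx
    have h1 : HasDerivAt (fun w : ℂ => 1 + w^2) (2*wb ρ x) (wb ρ x) := by
      simpa using ((hasDerivAt_id (wb ρ x)).fun_pow 2).const_add 1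
    have h2 : HasDerivAt qq (wb ρ x/qq (wb ρ x)) (wb ρ x) := by
      refine ((h1.clog (slit hw)).div_const 2).cexp.congr_deriv ?_
      have := qq_sq hw
      have h0 := slitPlane_ne_zero (slit hw)
      have hq : qq (wb ρ x) ≠ 0 := cn0 _
      change qq (wb ρ x) * _ = _
      rw [← this]; field_simp
    exact HasDerivAt.comp (h₂ := qq) (h := wb ρ) x h2 (dW x)
  have d1 : ∀ x ∈ Icc 0 β, HasDerivAt f1 (-(wb ρ x/qq (wb ρ x)^3)) x := fun x hx => by
    have hq : qq (wb ρ x) ≠ 0 := cn0 _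
    refine (((dW x).const_mul I).div (dq x hx) hq).congr_deriv ?_
    have e := qq_sq (hI x hx)
    field_simp
    rw [I_sq]; linear_combination (-(wb ρ x)) * e
  have b2 : ∀ x ∈ Icc 0 β, |(-(wb ρ x/qq (wb ρ x)^3)).re + ρ*cos x| ≤ 3*ρ^2 := fun x hx => by
    have hw := hI x hx
    rw [← wb_re, ← add_re]
    refine (abs_re_le_norm _).trans ?_
    have hq : qq (wb ρ x) ≠ 0 := cn0 _
    have hq1 := qq_one_le hw (wb_sq_re hx.1 (hx.2.trans h1))
    have hq2 := qq_sub_one hw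
    rw [wb_norm h] at hq2
    have e : -(wb ρ x/qq (wb ρ x)^3) + wb ρ x = wb ρ x*((qq (wb ρ x)-1)*((qq (wb ρ x))⁻¹+(qq (wb ρ x))⁻¹^2+(qq (wb ρ x))⁻¹^3)) := by
      field_simp; ring
    rw [e, norm_mul, norm_mul, wb_norm h]
    have hi : ‖(qq (wb ρ x))⁻¹‖ ≤ 1 := by rw [norm_inv]; exact inv_le_one_of_one_le₀ hq1
    have h3 : ‖(qq (wb ρ x))⁻¹+(qq (wb ρ x))⁻¹^2+(qq (wb ρ x))⁻¹^3‖ ≤ 3 := by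
      refine (norm_add₃_le).trans ?_
      rw [norm_pow, norm_pow]
      have := pow_le_one₀ (n := 2) (norm_nonneg _) hi
      have := pow_le_one₀ (n := 3) (norm_nonneg _) hi
      linarith
    calc ρ*(‖qq (wb ρ x)-1‖*‖_‖) ≤ ρ*(ρ*3) := by gcongr
      _ = _ := by ring
  let g1 : ℝ → ℝ := fun x => (f1 x).re + ρ*sin x
  have dg1 : ∀ x ∈ Icc 0 β, HasDerivAt g1 ((-(wb ρ x/qq (wb ρ x)^3)).re + ρ*cos x) x := fun x hx =>
    HasDerivAt.add (reCLM.hasFDerivAt.comp_hasDerivAt x (d1 x hx)) ((hasDerivAt_sin x).const_mul ρ)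
  let g : ℝ → ℝ := fun x => (AA (wb ρ x)).re - (AA ρ).re + ρ*(1-cos x)
  have dg : ∀ x ∈ Icc 0 β, HasDerivAt g (g1 x) x := fun x hx => by
    refine (HasDerivAt.add ((HasDerivAt.sub_const _ (reCLM.hasFDerivAt.comp_hasDerivAt x (dA x hx))))
      (((hasDerivAt_cos x).const_sub 1).const_mul ρ)).congr_deriv ?_
    simp only [g1, neg_neg]; rfl
  have w0 : wb ρ 0 = ρ := by simp [wb]
  have g10 : g1 0 = 0 := by
    have : qq (ρ:ℂ) = ((exp (log (1+ρ^2)/2):ℝ):ℂ) := by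
      rw [qq]; push_cast; rw [Complex.ofReal_log ¶]; push_cast; rfl
    simp only [g1, f1, w0, this, sin_zero, mul_zero, add_zero]
    rw [div_ofReal_re]; simp
  have g0 : g 0 = 0 := by simp [g, w0]
  have k1 : ∀ x ∈ Icc 0 β, |g1 x| ≤ 3*ρ^2*x := fun x hx => by
    have hs : ∀ y ∈ Icc 0 x, y ∈ Icc 0 β := fun y hy => ⟨hy.1, hy.2.trans hx.2⟩
    have dl : ∀ y, HasDerivAt (fun y => 3*ρ^2*y) (3*ρ^2) y := fun y => by simpa using (hasDerivAt_id y).const_mul (3*ρ^2)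
    have u1 := le_of_hasDeriv hx.1 (fun y hy => (dl y).sub (dg1 y (hs y hy))) (fun y hy => by linarith [(abs_le.1 (b2 y (hs y hy))).2])
    have u2 := le_of_hasDeriv hx.1 (fun y hy => (dl y).add (dg1 y (hs y hy))) (fun y hy => by linarith [(abs_le.1 (b2 y (hs y hy))).1])
    simp only [Pi.sub_apply, Pi.add_apply, g10] at u1 u2
    rw [abs_le]; constructor <;> linarith
  have dl : ∀ y, HasDerivAt (fun y => 3/2*ρ^2*y^2) (3*ρ^2*y) y := fun y => by
    refine (((hasDerivAt_id y).fun_pow 2).const_mul (3/2*ρ^2)).congr_deriv ?_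
    simp; ring
  have u1 := le_of_hasDeriv h0 (fun y hy => (dl y).sub (dg y hy)) (fun y hy => by linarith [(abs_le.1 (k1 y hy)).2])
  have u2 := le_of_hasDeriv h0 (fun y hy => (dl y).add (dg y hy)) (fun y hy => by linarith [(abs_le.1 (k1 y hy)).1])
  simp only [Pi.sub_apply, Pi.add_apply, g0] at u1 u2
  change |g β| ≤ _
  rw [abs_le]; constructor <;> linarith
def Wr (n : ℕ) (w : ℂ) : ℝ := 4*nu n*(AA w).re + (Eg n (AA w)).re
lemma int_npow {k : ℕ} (hk : 2 ≤ k) : IntegrableOn (fun r:ℝ => (1:ℝ)/r^k) (Ioi 1) ∧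
    ∫ r in Ioi (1:ℝ), (1:ℝ)/r^k = 1/(k-1) := by
  have hk2 : (2:ℝ) ≤ k := by exact_mod_cast hk
  have e : ∀ r ∈ Ioi (1:ℝ), r^(-(k:ℝ)) = 1/r^k := fun r hr => by
    have hx0 : (0:ℝ) < r := zero_lt_one.trans hr
    rw [rpow_neg hx0.le, rpow_natCast, one_div]
  constructor
  · exact (integrableOn_Ioi_rpow_of_lt (by linarith : -(k:ℝ) < -1) zero_lt_one).congr_fun e mIo
  · rw [← setIntegral_congr_fun mIo e, integral_Ioi_rpow_of_lt § zero_lt_one, one_rpow,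
      show -(k:ℝ)+1 = -(k-1) by ring, neg_div_neg_eq]
lemma W_exp (hn : 1 ≤ n) {ρ β : ℝ} (h : 0 < ρ) (h0 : 0 ≤ β) (h1 : β ≤ π/4) :
    |Wr n (wb ρ β) - Wr n ρ + 4*£n*nu n/¥n*ρ*(1-cos β)| ≤ 6*£n*nu n*ρ^2*β^2 := by
  have hν := nu_pos n
  have hw := wb_re_pos h h0 h1
  have hw0 : 0 < (ρ:ℂ).re := by simpa using h
  have i1 := AA_int_re hn hw
  have i2 := AA_int_re hn hw0
  obtain ⟨i3, v3⟩ := int_npow (k := 2*n+1) ¿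
  obtain ⟨i4, v4⟩ := int_npow (k := 2*n) ¿
  have hn1 : (1:ℝ) ≤ n := by exact_mod_cast hn
  have e : Wr n (wb ρ β) - Wr n ρ + 4*£n*nu n/¥n*ρ*(1-cos β) = 4*£n*nu n *
      ∫ r in Ioi (1:ℝ), ((AA (r*wb ρ β)).re/r^(2*n+2) - (AA (r*ρ)).re/r^(2*n+2) + ρ*(1-cos β)*(1/r^£n)) := by
    have i12 : IntegrableOn (fun r:ℝ => (AA (r*wb ρ β)).re/r^(2*n+2) - (AA (r*ρ)).re/r^(2*n+2)) (Ioi 1) := i1.sub i2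
    rw [integral_add i12 (i3.const_mul _), integral_sub i1 i2, integral_const_mul, v3, Wr, Wr, W_re hn hw, W_re hn hw0]
    generalize (∫ r in Ioi (1:ℝ), (AA (r*wb ρ β)).re/r^(2*n+2)) = X
    generalize (∫ r in Ioi (1:ℝ), (AA (r*ρ)).re/r^(2*n+2)) = Y
    rw [show ((2*n+1:ℕ):ℝ)-1 = 2*n by push_cast; ring]
    field_simp
  rw [e, abs_mul, abs_of_pos ¶]
  have : |∫ r in Ioi (1:ℝ), ((AA (r*wb ρ β)).re/r^(2*n+2) - (AA (r*ρ)).re/r^(2*n+2) + ρ*(1-cos β)*(1/r^£n))|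
      ≤ ∫ r in Ioi (1:ℝ), 3/2*ρ^2*β^2*(1/r^¥n) := by
    rw [← norm_eq_abs]
    refine norm_integral_le_of_norm_le (i4.const_mul _) ((ae_restrict_iff' mIo).2 (Eventually.of_forall fun r hr => ?_))
    have hr0 : (0:ℝ) < r := zero_lt_one.trans hr
    have := R6 (mul_pos hr0 h) h0 h1
    rw [wb_mul, norm_eq_abs, show (AA (wb (r*ρ) β)).re/r^(2*n+2) - (AA (r*ρ)).re/r^(2*n+2) + ρ*(1-cos β)*(1/r^£n)
      = ((AA (wb (r*ρ) β)).re - (AA ((r*ρ:ℝ):ℂ)).re + r*ρ*(1-cos β))/r^(2*n+2) by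
        rw [show 2*n+2 = 2*n+1+1 from rfl, pow_succ]; push_cast; field_simp]
    rw [abs_div, abs_of_pos (by positivity : 0 < r^(2*n+2)), div_le_iff₀ ¶]
    refine this.trans (le_of_eq ?_)
    rw [pow_add]; field_simp
  rw [integral_const_mul, v4] at this
  have h5 : 3/2*ρ^2*β^2*(1/((2*n:ℕ)-1:ℝ)) ≤ 3/2*ρ^2*β^2 := by
    refine mul_le_of_le_one_right ¶ ((div_le_one ?_).2 ?_) <;> push_cast <;> linarith
  calc _ ≤ 4*£n*nu n*(3/2*ρ^2*β^2) := by gcongr; linarith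
    _ = _ := by ring
def vv (n N : ℕ) (a : ℝ) (s : ℂ) : ℂ :=
  cexp (-(2*N*s) + (a:ℂ)^£n*(cch (s/2)^£n - Eh n (cexp (-s))))
lemma norm_exp_neg_le {s : ℂ} (h : 0 ≤ s.re) : ‖cexp (-s)‖ ≤ 1 := by
  rw [norm_exp]; simpa using h
lemma vv_cont (n N : ℕ) (a : ℝ) : ContinuousOn (vv n N a) {s | 0 ≤ s.re} := by
  have h : ContinuousOn (fun s => Eh n (cexp (-s))) {s | 0 ≤ s.re} :=
    (Eh_cont n).comp ¢ fun s hs => by simpa using norm_exp_neg_le hs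
  refine Complex.continuous_exp.comp_continuousOn ?_
  refine ContinuousOn.add ¢ (ContinuousOn.mul ¢ (ContinuousOn.sub ?_ h))
  have : Continuous (fun s:ℂ => cch (s/2)^£n) := by
    have := Complex.continuous_cosh; fun_prop
  exact this.continuousOn
lemma Eh_exp_diff (n : ℕ) {s : ℂ} (h : 0 < s.re) : DifferentiableAt ℂ (fun s => Eh n (cexp (-s))) s := by
  have h1 : -1 < (cexp (-s)).re := by
    have := abs_re_le_norm (cexp (-s))
    have h2 : ‖cexp (-s)‖ < 1 := by rw [norm_exp]; simpa using h
    linarith [(abs_le.1 this).1]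
  obtain ⟨D, hD, -⟩ := Eh_deriv n h1
  exact (hD.differentiableAt).comp (f := fun s:ℂ => cexp (-s)) s ¢
lemma vv_diff (n N : ℕ) (a : ℝ) {s : ℂ} (h : 0 < s.re) : DifferentiableAt ℂ (vv n N a) s := by
  have := Eh_exp_diff n h
  unfold vv; fun_prop
lemma vv_conj (n N : ℕ) (a : ℝ) (s : ℂ) : vv n N a (cj s) = cj (vv n N a s) := by
  unfold vv
  rw [← exp_conj]
  simp only [map_add, map_neg, map_mul, map_sub, map_pow, conj_ofReal, map_ofNat, map_natCast, map_div₀, ← Complex.cosh_conj,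
    ← Eh_conj, ← exp_conj]
lemma vv_norm (n N : ℕ) (a : ℝ) (s : ℂ) : ‖vv n N a s‖ =
    exp (-(2*N*s.re) + a^£n*((cch (s/2)^£n).re - (Eh n (cexp (-s))).re)) := by
  rw [vv, norm_exp, add_re, ← ofReal_pow, re_ofReal_mul, Complex.sub_re, neg_re,
    mul_assoc, show (2:ℂ)*(N*s) = ((2*N:ℝ):ℂ)*s by push_cast; ring, re_ofReal_mul]
lemma vv_circle (n N : ℕ) (a : ℝ) (h : |φ| ≤ π) : ‖vv n N a (φ*I)‖ = 1 := by
  rw [vv_norm, show -((φ:ℂ)*I) = ((-φ:ℝ):ℂ)*I by push_cast; ring, Eh_re_circle n (by rwa [abs_neg]),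
    show (φ:ℂ)*I/2 = ((φ/2:ℝ):ℂ)*I by push_cast; ring, cosh_mul_I, ← ofReal_cos, ← ofReal_pow, ofReal_re, neg_div, cos_neg]
  simp
lemma vv_top {a d φ M C : ℝ} (ha : 0 ≤ a) (hN : (N:ℝ) = nu n*a^£n+M)
    (h : -(C*d^3) ≤ 2*nu n*d + (Eh n (cexp (-(d+φ*I)))).re - (cch ((d+φ*I)/2)^£n).re) :
    ‖vv n N a (d+φ*I)‖ ≤ exp (-(2*M*d-C*a^£n*d^3)) := by
  rw [vv_norm, exp_le_exp, hN]
  have := mlm h (pow_nonneg ha £n)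
  simp only [add_re, ofReal_re, mul_re, Complex.I_re, Complex.I_im, ofReal_im, mul_zero, zero_mul, sub_zero, add_zero]
  linarith
lemma vv_side (n N : ℕ) (a y : ℝ) : vv n N a (y+π*I) =
    cexp (((-(2*N*y) - a^£n*(Eh n (-cexp (-y))).re : ℝ):ℂ) + (((-1)^n*(a*sinh (y/2))^£n:ℝ):ℂ)*I) := by
  have e1 : cexp (-((y:ℂ)+π*I)) = -cexp (-y) := by
    rw [neg_add, cxa, Complex.exp_neg (↑π*I), exp_pi_mul_I]; norm_num
  have e2 : cch (((y:ℂ)+π*I)/2) = I*sinh (y/2) := by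
    rw [show ((y:ℂ)+π*I)/2 = ((y/2:ℝ):ℂ)+((π/2:ℝ):ℂ)*I by push_cast; ring, Complex.cosh_add, cosh_mul_I, sinh_mul_I,
      ← ofReal_cos, ← ofReal_sin]; simp; ring
  have e3 : Eh n (-cexp (-y)) = ((Eh n (-cexp (-y))).re:ℂ) := by
    apply Complex.ext; · simp
    · rw [ofReal_im, show -cexp (-(y:ℂ)) = ((-exp (-y):ℝ):ℂ) by push_cast; ring, Eh_real_im]
  have e4 : cexp (-(2*N*((y:ℂ)+π*I))) = cexp (-(2*N*y)) := by
    rw [exp_eq_exp_iff_exists_int]; exact ⟨-N, by push_cast; ring⟩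
  rw [vv, e1, e2, mul_pow, pow_succ I, pow_mul, I_sq, cxa, e4, ← cxa, e3]
  congr 1; push_cast; rw [mul_pow]; simp only [ofReal_re]; ring
lemma vv_side_norm {a y : ℝ} (ha : 0 ≤ a) (hy : 0 ≤ y) : ‖vv n N a (y+π*I)‖ ≤ exp (-(2*N*y)) := by
  rw [vv_side, norm_exp, add_re, re_ofReal_mul, Complex.I_re, mul_zero, add_zero, ofReal_re]
  have h1 := Eh_real_nonneg n (r := -exp (-y)) (by simpa using hy)
  push_cast at h1
  rw [exp_le_exp]
  have := mul_nonneg (pow_nonneg ha £n) h1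
  linarith
lemma vv_side_im {a y : ℝ} (ha : 0 ≤ a) (hy : 0 ≤ y) (hy1 : y ≤ 1) :
    ‖vv n N a (y+π*I) - vv n N a (y-π*I)‖ ≤ 2*(a*y*exp (-(2*N*y))) := by
  have e : (y:ℂ)-π*I = cj (y+π*I) := by simp; ring
  rw [e, vv_conj, Complex.sub_conj, norm_mul, Complex.norm_I, mul_one, norm_real, norm_eq_abs, abs_mul, abs_two]
  refine mlm ?_ zero_le_two
  rw [vv_side, cxa, ← Complex.ofReal_exp, im_ofReal_mul, exp_ofReal_mul_I_im, abs_mul, abs_of_pos (exp_pos _), mul_comm]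
  have h1 := Eh_real_nonneg n (r := -exp (-y)) (by simpa using hy)
  push_cast at h1
  have h2 : 0 ≤ a*sinh (y/2) := mul_nonneg ha (sinh_nonneg_iff.2 §)
  have h3 : a*sinh (y/2) ≤ a*y := mlm (sinh_half_le hy hy1) ha
  refine mul_le_mul (le_trans ?_ h3) ?_ (exp_pos _).le ¶
  · rcases le_total 1 (a*sinh (y/2)) with h | h
    · exact (abs_sin_le_one _).trans h
    · refine abs_sin_le_abs.trans ?_
      rw [abs_mul, abs_pow, abs_neg, abs_one, one_pow, one_mul, abs_of_nonneg ¶]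
      exact pow_le_of_le_one h2 h ¿
  · rw [exp_le_exp]
    have := mul_nonneg (pow_nonneg ha £n) h1
    linarith
structure CD (n N : ℕ) (a d L : ℝ) : Prop where
  ha : 0 ≤ a
  hN : 0 < N
  hd : 0 < d
  hd1 : d ≤ 1
  top : ∀ φ : ℝ, |φ| ≤ π → ‖vv n N a (d+φ*I)‖ ≤ exp (-L)
def Rect (d : ℝ) : Set ℂ := Icc 0 d ×ℂ Icc (-π) π
lemma rect_cauchy {d : ℝ} (hd : 0 < d) {F : ℂ → ℂ} (hc : ContinuousOn F (Rect d))
    (hD : ∀ s : ℂ, 0 < s.re → s.re < d → DifferentiableAt ℂ F s) :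
    ‖∫ φ in -π..π, F (φ*I)‖ ≤ ‖∫ φ in -π..π, F (d+φ*I)‖ + ‖∫ x in (0:ℝ)..d, (F (x+π*I) - F (x-π*I))‖ := by
  have hπ := pi_pos
  have := Complex.integral_boundary_rect_eq_zero_of_continuousOn_of_differentiableOn F ⟨0,-π⟩ ⟨d,π⟩ (by
    simp only [uIcc_of_le hd.le, uIcc_of_le (by linarith : -π ≤ π)]; exact hc) (by
    simp only [min_eq_left hd.le, max_eq_right hd.le]
    intro s hs; exact (hD s hs.1.1 hs.1.2).differentiableWithinAt)
  simp only [Complex.ofReal_zero, zero_add, smul_eq_mul, Complex.ofReal_neg, neg_mul, ← sub_eq_add_neg] at this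
  have i1 : IntervalIntegrable (fun x:ℝ => F (x+π*I)) volume 0 d := by
    refine ContinuousOn.intervalIntegrable (hc.comp ¢ fun x hx => ?_)
    rw [uIcc_of_le hd.le] at hx
    constructor <;> simp [hx.1, hx.2]; linarith
  have i2 : IntervalIntegrable (fun x:ℝ => F (x-π*I)) volume 0 d := by
    refine ContinuousOn.intervalIntegrable (hc.comp ¢ fun x hx => ?_)
    rw [uIcc_of_le hd.le] at hx
    constructor <;> simp [hx.1, hx.2]; linarith
  rw [intervalIntegral.integral_sub i1 i2]
  have h2 : ∫ φ in -π..π, F (φ*I) = (∫ φ in -π..π, F (d+φ*I))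
     + I*((∫ x in (0:ℝ)..d, F (x+π*I)) - ∫ x in (0:ℝ)..d, F (x-π*I)) := by
    linear_combination I*this - (∫ φ in -π..π, F (d+φ*I))*I_sq + (∫ φ in -π..π, F (φ*I))*I_sq
  rw [h2]
  refine (norm_add_le _ _).trans ?_
  rw [norm_mul, Complex.norm_I, one_mul]
lemma int_exp_le {c d : ℝ} (hc : 0 < c) (hd : 0 ≤ d) : ∫ x in (0:ℝ)..d, exp (-(c*x)) ≤ 1/c := by
  have : ∀ x ∈ uIcc 0 d, HasDerivAt (fun x => -(1/c)*exp (-(c*x))) (exp (-(c*x))) x := fun x _ => by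
    refine ((((hasDerivAt_id x).const_mul c).fun_neg.exp).const_mul (-(1/c))).congr_deriv ?_
    simp; field_simp
  rw [integral_eq_sub_of_hasDerivAt this (cii ¢ _ _)]
  have := exp_pos (-(c*d))
  have h2 : 0 < 1/c := ¶
  simp; rw [one_div] at h2; positivity
lemma int_xexp_le {c d : ℝ} (hc : 0 < c) (hd : 0 ≤ d) : ∫ x in (0:ℝ)..d, x*exp (-(c*x)) ≤ 1/c^2 := by
  have : ∀ x ∈ uIcc 0 d, HasDerivAt (fun x => -((x/c+1/c^2)*exp (-(c*x)))) (x*exp (-(c*x))) x := fun x _ => by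
    refine ((((hasDerivAt_id x).div_const c).add_const (1/c^2)).fun_mul ((((hasDerivAt_id x).const_mul c).fun_neg.exp))).fun_neg.congr_deriv ?_
    simp; field_simp; ring
  rw [integral_eq_sub_of_hasDerivAt this (cii ¢ _ _)]
  have := exp_pos (-(c*d))
  have h2 : 0 ≤ (d/c+1/c^2)*exp (-(c*d)) := ¶
  simp; simp at h2; exact h2
section
variable {n N : ℕ} {a d L B l : ℝ} (h : CD n N a d L) {f : ℂ → ℂ} (hl : 0 ≤ l)
  (fc : ContinuousOn f (Rect d)) (fd : ∀ s : ℂ, 0 < s.re → s.re < d → DifferentiableAt ℂ f s)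
  (fb : ∀ s ∈ Rect d, ‖f s‖ ≤ B*exp (-(l*s.re)))
include h fc fd fb
lemma cauchy_pre : ‖∫ φ in -π..π, vv n N a (φ*I)*f (φ*I)‖ ≤ B*(2*π*(exp (-L)*exp (-(l*d)))) +
    ‖∫ x in (0:ℝ)..d, (vv n N a (x+π*I)*f (x+π*I) - vv n N a (x-π*I)*f (x-π*I))‖ := by
  have hπ := pi_pos
  refine (rect_cauchy h.hd (F := fun s => vv n N a s * f s) (((vv_cont n N a).mono fun s hs => hs.1.1).mul fc)
    fun s h0 h1 => (vv_diff n N a h0).mul (fd s h0 h1)).trans (add_le_add_left ?_ _)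
  refine (intervalIntegral.norm_integral_le_of_norm_le_const (C := exp (-L)*(B*exp (-(l*d)))) fun x hx => ?_).trans (le_of_eq ?_)
  · rw [uIoc_of_le §] at hx
    have hm : (d+x*I) ∈ Rect d := by constructor <;> simp [h.hd.le, hx.1.le, hx.2]
    rw [norm_mul]
    refine mul_le_mul (h.top x (abs_le.2 ⟨hx.1.le, hx.2⟩)) ?_ (norm_nonneg _) (exp_pos _).le
    simpa using fb _ hm
  · rw [show π - -π = 2*π by ring, abs_of_pos ¶]; ring
include hl
lemma cauchy1 : ‖∫ φ in -π..π, vv n N a (φ*I)*f (φ*I)‖ ≤ B*(2*π*exp (-L)+1/N) := by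
  have hπ := pi_pos
  have hN : (0:ℝ) < N := by exact_mod_cast h.hN
  have hB : 0 ≤ B := by
    have := (norm_nonneg _).trans (fb 0 ⟨by simp [h.hd.le], by simp [hπ.le]⟩)
    simpa using this
  refine (cauchy_pre h fc fd fb).trans ?_
  rw [mul_add]
  refine add_le_add (mlm (mlm (mul_le_of_le_one_right (exp_pos _).le ?_) ¶) hB) ?_
  · rw [exp_le_one_iff]; have := mul_nonneg hl h.hd.le; linarith
  refine (intervalIntegral.norm_integral_le_of_norm_le h.hd.le (g := fun x => 2*B*exp (-((2*N)*x))) (Eventually.of_forall fun x hx => ?_) (cii ¢ _ _)).trans ?_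
  · have hb : ∀ s ∈ Rect d, ‖f s‖ ≤ B := fun s hs => (fb s hs).trans (mul_le_of_le_one_right hB (by
      rw [exp_le_one_iff]; have := mul_nonneg hl hs.1.1; linarith))
    have h1 : (x+π*I) ∈ Rect d := by constructor <;> simp [hx.1.le, hx.2]; linarith
    have h2 : (x-π*I) ∈ Rect d := by constructor <;> simp [hx.1.le, hx.2]; linarith
    have e : (x:ℂ)-π*I = cj (x+π*I) := by simp; ring
    have h3 := vv_side_norm (n := n) (N := N) h.ha hx.1.le
    refine (norm_sub_le _ _).trans ?_
    rw [norm_mul, norm_mul, e, vv_conj, RCLike.norm_conj, ← e]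
    have := mul_le_mul h3 (hb _ h1) (norm_nonneg _) (exp_pos _).le
    have := mul_le_mul h3 (hb _ h2) (norm_nonneg _) (exp_pos _).le
    linarith
  · rw [iicm]
    calc _ ≤ 2*B*(1/(2*N)) := by gcongr; exact int_exp_le ¶ h.hd.le
      _ = _ := by field_simp
lemma cauchy2 (fp : ∀ x : ℝ, f (x+π*I) = f (x-π*I)) :
    ‖∫ φ in -π..π, vv n N a (φ*I)*f (φ*I)‖ ≤ B*(2*π*(exp (-L)*exp (-(l*d))) + 2*a/(2*N+l)^2) := by
  have hπ := pi_pos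
  have ha := h.ha
  have hN : (0:ℝ) < N := by exact_mod_cast h.hN
  have hB : 0 ≤ B := by
    have := (norm_nonneg _).trans (fb 0 ⟨by simp [h.hd.le], by simp [hπ.le]⟩)
    simpa using this
  refine (cauchy_pre h fc fd fb).trans ?_
  rw [mul_add]
  refine add_le_add le_rfl ?_
  refine (intervalIntegral.norm_integral_le_of_norm_le h.hd.le (g := fun x => 2*a*B*(x*exp (-((2*N+l)*x)))) (Eventually.of_forall fun x hx => ?_) (cii ¢ _ _)).trans ?_
  · have h1 : (x+π*I) ∈ Rect d := by constructor <;> simp [hx.1.le, hx.2]; linarith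
    have h3 := vv_side_im (n := n) (N := N) h.ha hx.1.le (hx.2.trans h.hd1)
    rw [← fp, ← sub_mul, norm_mul]
    refine (mul_le_mul h3 (fb _ h1) (norm_nonneg _) (by have := hx.1.le; positivity)).trans (le_of_eq ?_)
    simp
    rw [show -((2*N+l)*x) = -(2*N*x) + -(l*x) by ring, exp_add]; ring
  · rw [iicm]
    calc _ ≤ 2*a*B*(1/(2*N+l)^2) := by gcongr; exact int_xexp_le ¶ h.hd.le
      _ = _ := by field_simp
end
def eI (φ : ℝ) : ℂ := cexp (φ*I)
lemma eI_norm (φ : ℝ) : ‖eI φ‖ = 1 := norm_exp_ofReal_mul_I φ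
lemma eI_cont : Continuous eI := by unfold eI; fun_prop
lemma eI_neg (φ : ℝ) : eI (-φ) = cj (eI φ) := by
  unfold eI; rw [← exp_conj]; simp
lemma eI_mul (φ : ℝ) : eI φ * eI (-φ) = 1 := by
  unfold eI; rw [← cxa]; simp
lemma eI_ne (φ : ℝ) : eI φ ≠ 0 := cn0 _
lemma one_sub_ne {z w : ℂ} (h : ‖z‖ < 1) (hw : ‖w‖ ≤ 1) : 1 - z*w ≠ 0 := fun h0 => by
  have h1 : z*w = 1 := (sub_eq_zero.1 h0).symm
  have h2 : ‖z*w‖ = 1 := by rw [h1]; simp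
  rw [norm_mul] at h2
  nlinarith [norm_nonneg z, norm_nonneg w]
lemma cauchy_disk {F : ℂ → ℂ} (hF : DiffContOnCl ℂ F (ball 0 1)) (hζ : ‖ζ‖ < 1) :
    ∫ φ in -π..π, F (eI φ)*(1/(1-ζ*eI (-φ))) = 2*π*F ζ := by
  have h := hF.circleIntegral_sub_inv_smul (w := ζ) (by simpa using hζ)
  have hp : Function.Periodic (fun φ:ℝ => F (eI φ)*(1/(1-ζ*eI (-φ)))) (2*π) := fun φ => by
    have e1 : eI (φ+2*π) = eI φ := by
      unfold eI; rw [exp_eq_exp_iff_exists_int]; exact ⟨1, by push_cast; ring⟩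
    have e2 : eI (-(φ+2*π)) = eI (-φ) := by rw [eI_neg, e1, eI_neg]
    simp only [e1, e2]
  have h2 := hp.intervalIntegral_add_eq (-π) 0
  rw [show -π+2*π = π by ring, zero_add] at h2
  rw [h2]
  have h3 : (∮ z in C(0,1), (z-ζ)⁻¹ • F z) = I * ∫ φ in (0:ℝ)..2*π, F (eI φ)*(1/(1-ζ*eI (-φ))) := by
    rw [circleIntegral, ← iicm]
    refine integral_congr fun φ _ => ?_
    have e : circleMap 0 1 φ = eI φ := by simp [circleMap, eI]
    have h4 : 1 - ζ*eI (-φ) ≠ 0 := one_sub_ne hζ (eI_norm _).le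
    have h5 : eI φ - ζ = eI φ*(1-ζ*eI (-φ)) := by linear_combination ζ*eI_mul φ
    simp only [deriv_circleMap, e, smul_eq_mul, h5]
    have := eI_ne φ
    field_simp
  rw [h] at h3
  have hI := I_ne_zero
  rw [smul_eq_mul] at h3
  exact mul_left_cancel₀ hI (by rw [← h3]; ring)
def kk (ζ : ℂ) (φ : ℝ) : ℂ := 1/(1-ζ*eI (-φ))
lemma kk_cont (h : ‖ζ‖ < 1) : Continuous (kk ζ) := by
  have := eI_cont
  unfold kk
  exact continuous_const.div ¢ fun φ => one_sub_ne h (eI_norm _).le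
lemma kk_norm (h : ‖ζ‖ < 1) : ∫ φ in -π..π, ‖kk ζ φ‖^2 = 2*π/(1-‖ζ‖^2) := by
  have hd : DiffContOnCl ℂ (fun w => 1/(1-cj ζ*w)) (ball 0 1) := by
    refine DifferentiableOn.diffContOnCl ?_
    rw [closure_ball 0 one_ne_zero]
    intro w hw
    refine DifferentiableAt.differentiableWithinAt ?_
    exact (differentiableAt_const _).div ¢ (one_sub_ne (by rwa [RCLike.norm_conj]) (by simpa using hw))
  have := cauchy_disk hd h
  have e : ∀ φ, 1/(1-cj ζ*eI φ)*(1/(1-ζ*eI (-φ))) = ((‖kk ζ φ‖^2:ℝ):ℂ) := fun φ => by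
    rw [ofReal_pow, ← conj_mul']; simp [kk, eI_neg]
  simp only [e] at this
  rw [intervalIntegral.integral_ofReal, conj_mul', ← ofReal_pow] at this
  have h2 : (2:ℂ)*π*(1/(1-((‖ζ‖^2:ℝ):ℂ))) = ((2*π/(1-‖ζ‖^2):ℝ):ℂ) := by push_cast; ring
  rw [h2] at this
  exact_mod_cast this
lemma cs_real {α : Type*} [MeasurableSpace α] {μ : Measure α} {f g : α → ℝ} (hf : Integrable (fun x => f x^2) μ) (hg : Integrable (fun x => g x^2) μ)
    (hfg : Integrable (fun x => f x*g x) μ) : (∫ x, f x*g x ∂μ)^2 ≤ (∫ x, f x^2 ∂μ)*∫ x, g x^2 ∂μ := by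
  have h : ∀ c : ℝ, 0 ≤ (∫ x, g x^2 ∂μ)*(c*c) + (-2*∫ x, f x*g x ∂μ)*c + ∫ x, f x^2 ∂μ := fun c => by
    have : ∫ x, (f x-c*g x)^2 ∂μ = (∫ x, g x^2 ∂μ)*(c*c) + (-2*∫ x, f x*g x ∂μ)*c + ∫ x, f x^2 ∂μ := by
      have i1 := hg.mul_const (c*c)
      have i2 := (hfg.const_mul (-2)).mul_const c
      have i3 : Integrable (fun x => g x^2*(c*c)+ -2*(f x*g x)*c) μ := i1.add i2
      rw [← integral_mul_const, ← integral_const_mul, ← integral_mul_const, ← integral_add i1 i2, ← integral_add i3 hf]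
      congr 1; ext x; ring
    rw [← this]; exact integral_nonneg fun x => sq_nonneg _
  have := discrim_le_zero h
  rw [discrim] at this
  nlinarith
lemma cs_circle {F K : ℝ → ℂ} (hF : ContinuousOn F (Icc (-π) π)) (hK : ContinuousOn K (Icc (-π) π)) :
    ‖∫ φ in -π..π, F φ*K φ‖^2 ≤ (∫ φ in -π..π, ‖F φ‖^2)*∫ φ in -π..π, ‖K φ‖^2 := by
  have hπ : -π ≤ π := by linarith [pi_pos]
  have ii : ∀ {f : ℝ → ℝ}, ContinuousOn f (Icc (-π) π) → Integrable f (volume.restrict (Set.Ioc (-π) π)) := fun h =>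
    (h.integrableOn_Icc).mono_set Ioc_subset_Icc_self
  have h1 := intervalIntegral.norm_integral_le_integral_norm (f := fun φ => F φ*K φ) (μ := volume) hπ
  simp only [norm_mul, integral_of_le hπ] at h1 ⊢
  exact (pow_le_pow_left₀ (norm_nonneg _) h1 2).trans (cs_real (ii (hF.norm.pow 2)) (ii (hK.norm.pow 2)) (ii (hF.norm.mul hK.norm)))
def sq1 (ζ : ℂ) : ℂ := (1+ζ)^(((2:ℕ):ℂ)⁻¹)
lemma sq1_sq (ζ : ℂ) : sq1 ζ^2 = 1+ζ := Complex.cpow_nat_inv_pow _ two_ne_zero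
lemma sq1_norm (ζ : ℂ) : ‖sq1 ζ‖^2 = ‖1+ζ‖ := by rw [← norm_pow, sq1_sq]
lemma one_add_slit (h : ‖ζ‖ < 1) : 1+ζ ∈ slitPlane := by
  left
  have := (abs_le.1 (abs_re_le_norm ζ)).1
  simp; linarith
lemma sq1_cont : ContinuousOn sq1 (closedBall 0 1) := by
  intro ζ hζ
  rw [mem_closedBall_zero_iff] at hζ
  refine ContinuousAt.continuousWithinAt ?_
  by_cases h : 1+ζ = 0
  · have h1 : ContinuousAt (fun x:ℂ × ℂ => x.1^x.2) (0, (((2:ℕ):ℂ)⁻¹)) := Complex.continuousAt_cpow_zero_of_re_pos ¡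
    rw [← h] at h1
    exact ContinuousAt.comp (f := fun ζ:ℂ => ((1+ζ, ((2:ℕ):ℂ)⁻¹):ℂ × ℂ)) h1 ¢
  · have h2 : 1+ζ ∈ slitPlane := by
      by_contra h3
      rw [mem_slitPlane_iff, not_or, not_lt, not_not] at h3
      apply h
      have := (abs_le.1 (abs_re_le_norm ζ)).1
      have h4 := h3.1
      simp at h4 h3
      apply Complex.ext <;> simp <;> linarith
    exact ContinuousAt.cpow ¢ continuousAt_const h2
lemma sq1_circle (h : |φ| < π) : sq1 (eI φ) = cexp ((log (2*cos (φ/2)) + φ/2*I)/2) := by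
  obtain ⟨h1, h2⟩ := abs_lt.1 h
  have hc : 0 < cos (φ/2) := cos_pos_of_mem_Ioo ⟨by linarith, by linarith⟩
  have e : 1 + eI φ = ((2*cos (φ/2):ℝ):ℂ)*cexp (φ/2*I) := by
    have h2 : cexp (φ/2*I)*cexp (φ/2*I) = eI φ := by
      rw [← cxa, eI]; congr 1; ring
    have h3 : cexp (-(φ/2)*I)*cexp (φ/2*I) = 1 := by
      rw [← cxa]; simp
    have h4 := Complex.two_cos (φ/2:ℂ)
    push_cast; rw [h4]; linear_combination -h2 - h3
  have hn : 1 + eI φ ≠ 0 := by rw [e]; exact mul_ne_zero (by exact_mod_cast ¶) (cn0 _)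
  rw [sq1, Complex.cpow_def_of_ne_zero hn, e, Complex.log_ofReal_mul ¶ (cn0 _),
    Complex.log_exp (by simp; linarith) (by simp; linarith)]
  congr 1
lemma sq1_refl (h : |φ| < π) : sq1 (eI (-φ)) = cexp (-(φ/2*I))*sq1 (eI φ) := by
  rw [sq1_circle h, sq1_circle (by rwa [abs_neg]), ← cxa, neg_div, cos_neg]
  congr 1; push_cast; ring
def om (n N : ℕ) (a : ℝ) (ζ : ℂ) : ℂ := ζ^N*cexp (-((a:ℂ)^£n*Eh n ζ/2))*sq1 ζ*(1-ζ)
lemma sq1_neg_one : sq1 (-1) = 0 := by simp [sq1]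
lemma om_refl (n N : ℕ) (a : ℝ) (h : |φ| ≤ π) :
    om n N a (eI (-φ)) = -(vv n N a (φ*I)*cexp (-(3*(φ*I)/2)))*om n N a (eI φ) := by
  rcases h.lt_or_eq with h | h
  · have e1 : eI (-φ)^N = cexp (-(2*N*(φ*I)))*eI φ^N := by
      unfold eI; rw [← cxm, ← cxm, ← cxa]; congr 1; push_cast; ring
    have e2 : Eh n (eI (-φ)) + Eh n (eI φ) = 2*cch (φ*I/2)^£n := by
      rw [eI_neg, Eh_conj, add_comm, Complex.add_conj]
      unfold eI
      rw [Eh_re_circle n h.le,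
        show (φ:ℂ)*I/2 = ((φ/2:ℝ):ℂ)*I by push_cast; ring, cosh_mul_I]; push_cast; ring
    have e3 : 1-eI (-φ) = -(eI (-φ)*(1-eI φ)) := by linear_combination -(eI_mul φ)
    have e4 : cexp (-(φ*I)) = eI (-φ) := by unfold eI; push_cast; ring_nf
    have e5 : cexp (-(3*(φ*I)/2)) = cexp (-(φ/2*I))*eI (-φ) := by
      rw [← e4, ← cxa]; congr 1; ring
    have e6 : cexp (-((a:ℂ)^£n*Eh n (eI (-φ))/2)) =
        cexp ((a:ℂ)^£n*(cch (φ*I/2)^£n - Eh n (eI (-φ))))*cexp (-((a:ℂ)^£n*Eh n (eI φ)/2)) := by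
      rw [← cxa]; congr 1; linear_combination (a:ℂ)^£n/2*e2
    unfold om vv
    rw [cxa, e1, sq1_refl h, e3, e5, e4, e6]; ring
  · have e : eI φ = -1 := by
      rcases abs_eq pi_pos.le |>.1 h with h | h <;> rw [h] <;> unfold eI
      · exact exp_pi_mul_I
      · push_cast; rw [neg_mul, Complex.exp_neg, exp_pi_mul_I]; norm_num
    have e' : eI (-φ) = -1 := by rw [eI_neg, e]; simp
    rw [e, e', om, sq1_neg_one]; simp
def wt (n : ℕ) (x : ℝ) : ℝ := exp (-(x^((n:ℝ)+1/2)))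
def NP (n : ℕ) (P : Polynomial ℂ) : ℝ := ∫ x in Rp, ‖P.eval (x:ℂ)‖^2*wt n x
lemma mom_int (n k : ℕ) : IntegrableOn (fun x:ℝ => x^k*wt n x) (Ioi 0) := by
  have := integrableOn_rpow_mul_exp_neg_rpow (s := k) (p := (n:ℝ)+1/2) (by linarith [(Nat.cast_nonneg k : (0:ℝ) ≤ k)]) ¶
  refine this.congr_fun (fun x hx => ?_) mIo
  simp [wt]
lemma normsq_eval (P : Polynomial ℂ) (x : ℝ) : ((‖P.eval (x:ℂ)‖^2:ℝ):ℂ) =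
    ∑ j ∈ range (P.natDegree+1), ∑ k ∈ range (P.natDegree+1), P.coeff j*cj (P.coeff k)*((x^(j+k):ℝ):ℂ) := by
  rw [ofReal_pow, ← mul_conj', Polynomial.eval_eq_sum_range, map_sum, sum_mul_sum]
  refine sum_congr rfl fun j _ => sum_congr rfl fun k _ => ?_
  simp; ring
lemma NP_int (n : ℕ) (P : Polynomial ℂ) : IntegrableOn (fun x:ℝ => ‖P.eval (x:ℂ)‖^2*wt n x) (Ioi 0) := by
  have : IntegrableOn (fun x:ℝ => ((‖P.eval (x:ℂ)‖^2*wt n x:ℝ):ℂ)) (Ioi 0) := by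
    simp only [Complex.ofReal_mul, normsq_eval, sum_mul]
    refine integrable_finsetSum _ fun j _ => integrable_finsetSum _ fun k _ => ?_
    simp only [mul_assoc]
    refine Integrable.const_mul (Integrable.const_mul ?_ _) _
    simp only [← Complex.ofReal_mul]
    exact (mom_int n (j+k)).ofReal
  exact this.re
lemma wt_pos (n : ℕ) (x : ℝ) : 0 < wt n x := exp_pos _
lemma wt_sq (n : ℕ) {t : ℝ} (h : 0 ≤ t) : wt n (t^2) = exp (-(t^£n)) := by
  rw [wt, ← rpow_natCast, ← rpow_mul h, ← rpow_natCast]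
  congr 3; push_cast; ring
lemma subst_cos {a : ℝ} (ha : 0 < a) {f : ℝ → ℝ} (hf : Continuous f) :
    ∫ φ in (0:ℝ)..π, f (a^2*cos (φ/2)^2)*wt n (a^2*cos (φ/2)^2)*(a^2*(cos (φ/2)*sin (φ/2))) = ∫ x in (0:ℝ)..a^2, f x*wt n x := by
  have hw : Continuous (wt n) := by
    unfold wt
    exact continuous_exp.comp (Continuous.neg (continuous_id.rpow_const fun x => Or.inr ¶))
  have hg : ∀ φ ∈ uIcc (0:ℝ) π, HasDerivAt (fun φ => a^2*cos (φ/2)^2) (-(a^2*(cos (φ/2)*sin (φ/2)))) φ := fun φ _ => by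
    refine ((((hasDerivAt_id φ).div_const 2).cos).fun_pow 2 |>.const_mul (a^2)).congr_deriv ?_
    simp only [id]; norm_num; ring_nf; simp
  have := integral_comp_mul_deriv (f := fun φ => a^2*cos (φ/2)^2) (g := fun x => f x*wt n x) hg ¢ ¢
  simp only [Function.comp_apply, cos_pi_div_two, zero_div, cos_zero] at this
  rw [one_pow, mul_one, zero_pow two_ne_zero, mul_zero, intervalIntegral.integral_symm 0 (a^2)] at this
  simp only [mul_neg, intervalIntegral.integral_neg] at this
  exact neg_injective this
def xx (a : ℝ) (ζ : ℂ) : ℂ := (a:ℂ)^2/4*((1+ζ)^2/ζ)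
def Qp (P : Polynomial ℂ) (N : ℕ) (a : ℝ) (ζ : ℂ) : ℂ :=
  ∑ k ∈ range (N+1), P.coeff k*((a:ℂ)^2/4)^k*(1+ζ)^(2*k)*ζ^(N-k)
lemma Qp_eq {P : Polynomial ℂ} (hP : P.natDegree ≤ N) (a : ℝ) (h : ζ ≠ 0) : Qp P N a ζ = P.eval (xx a ζ)*ζ^N := by
  rw [Qp, Polynomial.eval_eq_sum_range' (n := N+1) ¿, sum_mul]
  refine sum_congr rfl fun k hk => ?_
  have e : ζ^N = ζ^k*ζ^(N-k) := by rw [← pow_add]; congr 1; rw [mem_range] at hk; omega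
  rw [e, xx, mul_pow, div_pow ((1+ζ)^2) ζ, ← pow_mul]; field_simp
lemma xx_circle (a φ : ℝ) : xx a (eI φ) = ((a^2*cos (φ/2)^2:ℝ):ℂ) := by
  have h := eI_ne φ
  have e : eI φ + eI (-φ) = ((2*cos φ:ℝ):ℂ) := by
    have := Complex.two_cos (φ:ℂ); push_cast; rw [this]; unfold eI; push_cast; ring
  have e2 : cos φ = 2*cos (φ/2)^2-1 := by rw [← cos_two_mul]; ring_nf
  have e3 : (1+eI φ)^2/eI φ = 2 + (eI φ+eI (-φ)) := by rw [div_eq_iff h]; linear_combination -eI_mul φ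
  rw [xx, e3, e, e2]; push_cast; ring
def GG (n N : ℕ) (a : ℝ) (P : Polynomial ℂ) (ζ : ℂ) : ℂ :=
  Qp P N a ζ*cexp (-((a:ℂ)^£n*Eh n ζ/2))*sq1 ζ*(1-ζ)
lemma GG_eq {P : Polynomial ℂ} (hP : P.natDegree ≤ N) (a : ℝ) (h : ζ ≠ 0) : GG n N a P ζ = P.eval (xx a ζ)*om n N a ζ := by
  rw [GG, Qp_eq hP a h, om]; ring
lemma GG_diff (n N : ℕ) (a : ℝ) (P : Polynomial ℂ) : DiffContOnCl ℂ (GG n N a P) (ball 0 1) := by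
  constructor
  · intro ζ hζ
    rw [mem_ball_zero_iff] at hζ
    have h1 : -1 < ζ.re := by linarith [(abs_le.1 (abs_re_le_norm ζ)).1]
    obtain ⟨D, hD, -⟩ := Eh_deriv n h1
    have h2 := hD.differentiableAt
    have h3 : DifferentiableAt ℂ sq1 ζ := by
      unfold sq1
      exact DifferentiableAt.cpow ¢ ¢ (one_add_slit hζ)
    refine DifferentiableAt.differentiableWithinAt ?_
    unfold GG Qp; fun_prop
  · rw [closure_ball 0 one_ne_zero]
    have := Eh_cont n
    have := sq1_cont
    unfold GG Qp; fun_prop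
lemma om_cont (n N : ℕ) (a : ℝ) : Continuous (fun φ => om n N a (eI φ)) := by
  have h0 := eI_cont
  have hm : ∀ φ, eI φ ∈ closedBall (0:ℂ) 1 := fun φ => by simp [eI_norm]
  have h1 : Continuous (fun φ => Eh n (eI φ)) := (Eh_cont n).comp_continuous h0 hm
  have h2 : Continuous (fun φ => sq1 (eI φ)) := sq1_cont.comp_continuous h0 hm
  unfold om; fun_prop
lemma om_norm (n N : ℕ) {a : ℝ} (ha : 0 < a) (h : |φ| ≤ π) :
    ‖om n N a (eI φ)‖^2 = 8*(cos (φ/2)*sin (φ/2)^2)*wt n (a^2*cos (φ/2)^2) := by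
  have hc : 0 ≤ cos (φ/2) := by
    obtain ⟨h1, h2⟩ := abs_le.1 h
    exact cos_nonneg_of_mem_Icc ⟨by linarith, by linarith⟩
  have e1 : ‖1+eI φ‖ = 2*cos (φ/2) := by
    have := congrArg norm (xx_circle 1 φ)
    simp only [xx, norm_mul, norm_div, norm_pow, eI_norm, norm_real, norm_eq_abs, abs_one, one_pow, one_mul, div_one, abs_of_nonneg hc] at this
    norm_num at this
    rw [← abs_of_nonneg (norm_nonneg (1+eI φ)), ← abs_of_nonneg (by positivity : 0 ≤ 2*cos (φ/2)), ← sq_eq_sq_iff_abs_eq_abs]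
    linarith
  have e2 : ‖1-eI φ‖^2 = 4*sin (φ/2)^2 := by
    have h1 : ‖1+eI φ‖^2+‖1-eI φ‖^2 = 4 := by
      have := parallelogram_law_with_norm ℝ (1:ℂ) (eI φ)
      rw [eI_norm, norm_one] at this; nlinarith
    rw [e1] at h1
    nlinarith [sin_sq_add_cos_sq (φ/2)]
  rw [om, norm_mul, norm_mul, norm_mul, mul_pow, mul_pow, mul_pow, sq1_norm, e1, e2, norm_pow, eI_norm, one_pow, one_pow, one_mul,
    norm_exp, ← mul_pow, wt_sq n ¶]
  have e3 : (-((a:ℂ)^£n*Eh n (eI φ)/2)).re = -((a*cos (φ/2))^£n/2) := by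
    rw [show -((a:ℂ)^£n*Eh n (eI φ)/2) = ((-(a^£n/2):ℝ):ℂ)*Eh n (eI φ) by push_cast; ring, re_ofReal_mul]
    unfold eI; rw [Eh_re_circle n h, mul_pow]; ring
  rw [e3, ← exp_nat_mul]; push_cast
  rw [show (2:ℝ)*-((a*cos (φ/2))^£n/2) = -(a*cos (φ/2))^£n by ring]; ring
lemma Pom_int (n N : ℕ) {a : ℝ} (ha : 0 < a) (P : Polynomial ℂ) :
    ∫ φ in -π..π, ‖P.eval (xx a (eI φ))*om n N a (eI φ)‖^2 ≤ 16/a^2*NP n P := by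
  have hπ := pi_pos
  have hx : Continuous (fun φ => P.eval (xx a (eI φ))) := by
    simp only [xx_circle]; fun_prop
  have ho := om_cont n N a
  have hw : Continuous (wt n) := by
    unfold wt
    exact continuous_exp.comp (Continuous.neg (continuous_id.rpow_const fun x => Or.inr ¶))
  have e : ∀ φ, |φ| ≤ π → ‖P.eval (xx a (eI φ))*om n N a (eI φ)‖^2 = ‖P.eval ((a^2*cos (φ/2)^2:ℝ):ℂ)‖^2*wt n (a^2*cos (φ/2)^2)*(8*(cos (φ/2)*sin (φ/2)^2)) := fun φ h => by
    rw [norm_mul, mul_pow, om_norm n N ha h, xx_circle]; ring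
  have hc : Continuous (fun φ => ‖P.eval (xx a (eI φ))*om n N a (eI φ)‖^2) := ¢
  have h1 : ∫ φ in -π..π, ‖P.eval (xx a (eI φ))*om n N a (eI φ)‖^2 = 2*∫ φ in (0:ℝ)..π, ‖P.eval (xx a (eI φ))*om n N a (eI φ)‖^2 := by
    rw [← integral_add_adjacent_intervals (b := 0) (hc.intervalIntegrable _ _) (hc.intervalIntegrable _ _), two_mul]
    congr 1
    have := integral_comp_neg (a := 0) (b := π) (fun φ => ‖P.eval (xx a (eI φ))*om n N a (eI φ)‖^2)
    rw [neg_zero] at this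
    rw [← this]
    refine integral_congr fun φ hφ => ?_
    rw [uIcc_of_le hπ.le] at hφ
    rw [e _ (by rw [abs_neg, abs_of_nonneg hφ.1]; exact hφ.2), e _ (by rw [abs_of_nonneg hφ.1]; exact hφ.2), neg_div, cos_neg, sin_neg]; ring
  have h2 : ∫ φ in (0:ℝ)..π, ‖P.eval (xx a (eI φ))*om n N a (eI φ)‖^2 ≤ ∫ φ in (0:ℝ)..π, (8/a^2)*(‖P.eval ((a^2*cos (φ/2)^2:ℝ):ℂ)‖^2*wt n (a^2*cos (φ/2)^2)*(a^2*(cos (φ/2)*sin (φ/2)))) := by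
    refine integral_mono_on hπ.le (hc.intervalIntegrable _ _) (cii ¢ _ _) fun φ hφ => ?_
    rw [e _ (by rw [abs_of_nonneg hφ.1]; exact hφ.2)]
    have c0 : 0 ≤ cos (φ/2) := cos_nonneg_of_mem_Icc ⟨by linarith [hφ.1], by linarith [hφ.2]⟩
    have s0 : 0 ≤ sin (φ/2) := sin_nonneg_of_mem_Icc ⟨by linarith [hφ.1], by linarith [hφ.2]⟩
    have hX : 0 ≤ ‖P.eval ((a^2*cos (φ/2)^2:ℝ):ℂ)‖^2*wt n (a^2*cos (φ/2)^2) := mul_nonneg ¶ (wt_pos _ _).le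
    have := mlm (mul_le_of_le_one_right (mul_nonneg c0 s0) (sin_le_one (φ/2))) hX
    have e9 : ∀ X Y : ℝ, 8/a^2*(X*(a^2*Y)) = 8*(X*Y) := fun X Y => by field_simp
    rw [e9]; linarith
  have h3 := subst_cos (n := n) ha (f := fun x:ℝ => ‖P.eval (x:ℂ)‖^2) ¢
  rw [iicm, h3, integral_of_le (by positivity : 0 ≤ a^2)] at h2
  have h4 : ∫ x in Set.Ioc 0 (a^2), ‖P.eval (x:ℂ)‖^2*wt n x ≤ NP n P :=
    setIntegral_mono_set (NP_int n P) (Eventually.of_forall fun x => mul_nonneg ¶ (wt_pos _ _).le) (Set.Ioc_subset_Ioi_self).eventuallyLE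
  rw [h1]
  calc _ ≤ 2*(8/a^2*NP n P) := by
        have := mlm h4 (by positivity : 0 ≤ 8/a^2)
        linarith
    _ = _ := by ring
def ff (ζ s : ℂ) : ℂ := cexp (-(3*s/2))/((1-ζ*cexp s)*(1-cj ζ*cexp s))
def XX (n N : ℕ) (a : ℝ) (ζ : ℂ) : ℂ := ∫ φ in -π..π, vv n N a (φ*I)*ff ζ (φ*I)
lemma vvI_cont (n N : ℕ) (a : ℝ) : Continuous (fun φ:ℝ => vv n N a (φ*I)) :=
  (vv_cont n N a).comp_continuous ¢ fun φ => by simp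
lemma U1 {P : Polynomial ℂ} (hP : P.natDegree ≤ N) {a : ℝ} (ha : 0 < a) (h : ‖ζ‖ < 1) (h0 : ζ ≠ 0) :
    ‖ζ‖^(2*N)*‖P.eval (xx a ζ)‖^2*exp (-(a^£n*(Eh n ζ).re))*‖1+ζ‖*‖1-ζ‖^2 ≤
      4/(π^2*a^2)*NP n P*(π/(1-‖ζ‖^2)+‖XX n N a ζ‖/2) := by
  have hπ := pi_pos
  set p : ℝ → ℂ := fun φ => P.eval (xx a (eI φ))*om n N a (eI φ)
  have hp : Continuous p := by
    have := om_cont n N a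
    simp only [p, xx_circle]; fun_prop
  have hk := kk_cont h
  have hv := vvI_cont n N a
  set u : ℝ → ℂ := fun φ => -(vv n N a (φ*I)*cexp (-(3*(φ*I)/2)))
  have hu : Continuous u := by simp only [u]; fun_prop
  have hu1 : ∀ φ, |φ| ≤ π → ‖u φ‖ = 1 := fun φ hφ => by
    simp only [u]; rw [norm_neg, norm_mul, vv_circle n N a hφ, one_mul, show -(3*((φ:ℂ)*I)/2) = ((-(3*φ/2):ℝ):ℂ)*I by push_cast; ring, norm_exp_ofReal_mul_I]
  have hx : ∀ φ, xx a (eI (-φ)) = xx a (eI φ) := fun φ => by rw [xx_circle, xx_circle, neg_div, cos_neg]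
  have c1 : ∫ φ in -π..π, p φ*kk ζ φ = 2*π*GG n N a P ζ := by
    rw [← cauchy_disk (GG_diff n N a P) h]
    refine integral_congr fun φ _ => ?_
    simp only [p, kk, GG_eq hP a (eI_ne φ)]
  have c2 : ∫ φ in -π..π, p φ*(u φ*kk ζ (-φ)) = 2*π*GG n N a P ζ := by
    rw [← c1]
    have := integral_comp_neg (a := -π) (b := π) (fun φ => p φ*kk ζ φ)
    rw [neg_neg] at this
    rw [← this]
    refine integral_congr fun φ hφ => ?_
    rw [uIcc_of_le §] at hφ
    simp only [p, hx, om_refl n N a (abs_le.2 hφ), u]; ring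
  have c3 : ∫ φ in -π..π, p φ*(kk ζ φ+u φ*kk ζ (-φ)) = 4*π*GG n N a P ζ := by
    simp only [mul_add]
    rw [iia (cii ¢ _ _) (cii ¢ _ _), c1, c2]; ring
  have c4 := cs_circle (F := p) (K := fun φ => kk ζ φ+u φ*kk ζ (-φ)) hp.continuousOn ¢
  have c5 : ∫ φ in -π..π, ‖kk ζ φ+u φ*kk ζ (-φ)‖^2 ≤ 4*π/(1-‖ζ‖^2)+2*‖XX n N a ζ‖ := by
    have e1 : ∫ φ in -π..π, ‖kk ζ φ+u φ*kk ζ (-φ)‖^2 = ∫ φ in -π..π, (‖kk ζ φ‖^2+‖kk ζ (-φ)‖^2+(-2)*(vv n N a (φ*I)*ff ζ (φ*I)).re) := by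
      refine integral_congr fun φ hφ => ?_
      rw [uIcc_of_le §] at hφ
      have e0 : cj (kk ζ φ)*(u φ*kk ζ (-φ)) = -(vv n N a (φ*I)*ff ζ (φ*I)) := by
        simp only [kk, u, ff, map_div₀, map_sub, map_one, map_mul, ← eI_neg, neg_neg]
        rw [show cexp ((φ:ℂ)*I) = eI φ from rfl]
        have n1 := one_sub_ne h (eI_norm φ).le
        have n2 := one_sub_ne (z := cj ζ) (by rwa [RCLike.norm_conj]) (eI_norm φ).le
        field_simp
      have e2 : ‖kk ζ φ+u φ*kk ζ (-φ)‖^2 = ‖kk ζ φ‖^2+‖u φ*kk ζ (-φ)‖^2+2*(cj (kk ζ φ)*(u φ*kk ζ (-φ))).re := by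
        rw [← normSq_eq_norm_sq, ← normSq_eq_norm_sq, ← normSq_eq_norm_sq, Complex.normSq_add]
        rw [← conj_re (kk ζ φ*_), map_mul cj (kk ζ φ), conj_conj]
      rw [e2, e0, norm_mul, hu1 φ (abs_le.2 hφ), one_mul, neg_re]; ring
    have hff : Continuous (fun φ:ℝ => ff ζ (φ*I)) := by
      unfold ff
      refine Continuous.div ¢ ¢ fun φ => mul_ne_zero (one_sub_ne h (eI_norm φ).le) (one_sub_ne (by rwa [RCLike.norm_conj]) (eI_norm φ).le)
    have hre : Continuous (fun φ:ℝ => (vv n N a (φ*I)*ff ζ (φ*I)).re) := Complex.continuous_re.comp (hv.mul hff)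
    rw [e1, iia (cii ¢ _ _) (cii ¢ _ _),
      iia (cii ¢ _ _) (cii ¢ _ _), kk_norm h,
      integral_comp_neg (fun φ => ‖kk ζ φ‖^2), neg_neg, kk_norm h, iicm]
    have e3 : ∫ φ in -π..π, (vv n N a (φ*I)*ff ζ (φ*I)).re = (XX n N a ζ).re := by
      have := reCLM.intervalIntegral_comp_comm (f := fun φ:ℝ => vv n N a (φ*I)*ff ζ (φ*I)) (a := -π) (b := π) (μ := volume) ((hv.mul hff).intervalIntegrable _ _)
      exact this
    rw [e3]
    have := (abs_le.1 (abs_re_le_norm (XX n N a ζ))).1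
    have e4 : 4*π/(1-‖ζ‖^2) = 2*π/(1-‖ζ‖^2)+2*π/(1-‖ζ‖^2) := by ring
    linarith
  rw [c3] at c4
  have c6 := c4.trans (mul_le_mul (Pom_int n N ha P) c5 (intervalIntegral.integral_nonneg § fun _ _ => by positivity) (by
    have : 0 ≤ NP n P := setIntegral_nonneg mIo fun x _ => mul_nonneg ¶ (wt_pos _ _).le
    positivity))
  have e7 : ‖(4:ℂ)*π*GG n N a P ζ‖^2 = 16*π^2*(‖ζ‖^(2*N)*‖P.eval (xx a ζ)‖^2*exp (-(a^£n*(Eh n ζ).re))*‖1+ζ‖*‖1-ζ‖^2) := by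
    rw [GG_eq hP a h0, om, norm_mul, norm_mul, norm_mul, norm_mul, norm_mul, norm_mul, mul_pow, mul_pow, mul_pow, mul_pow, mul_pow, mul_pow, sq1_norm, norm_exp, norm_pow, ← exp_nat_mul,
      show -((a:ℂ)^£n*Eh n ζ/2) = ((-(a^£n/2):ℝ):ℂ)*Eh n ζ by push_cast; ring, re_ofReal_mul, norm_real, norm_eq_abs, abs_of_pos hπ,
      show ((2:ℕ):ℝ)*(-(a^£n/2)*(Eh n ζ).re) = -(a^£n*(Eh n ζ).re) by push_cast; ring]
    norm_num; ring
  rw [e7] at c6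
  have : 16/a^2*NP n P*(4*π/(1-‖ζ‖^2)+2*‖XX n N a ζ‖) = 16*π^2*(4/(π^2*a^2)*NP n P*(π/(1-‖ζ‖^2)+‖XX n N a ζ‖/2)) := by
    field_simp; ring
  rw [this] at c6
  exact le_of_mul_le_mul_left c6 ¶
def Nf (n : ℕ) (u : ℝ) : ℝ := nu n*¦u^£n+u^(8*n+8)
def dd (n : ℕ) (u : ℝ) : ℝ := 1/u^(8*n+6)
lemma CD_ev (hn : 1 ≤ n) : ∀ᶠ u in atTop, ∀ N : ℕ, (N:ℝ) = Nf n u → CD n N ¦u (dd n u) u := by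
  obtain ⟨C, d0, hC, hd0, hd1, h⟩ := R3 hn
  filter_upwards [eventually_ge_atTop 1, eventually_ge_atTop (1/d0), eventually_ge_atTop C] with u h1 h2 h3 N hN
  have hu : 0 < u := §
  have hν := nu_pos n
  have hd : dd n u ≤ d0 := by
    have : 1/u ≤ d0 := by rw [div_le_iff₀ hu]; rw [div_le_iff₀ hd0] at h2; linarith
    refine le_trans ?_ this
    unfold dd
    exact odl hu (le_self_pow₀ h1 ¿)
  refine ⟨by positivity, ?_, by unfold dd; positivity, hd.trans hd1, fun φ hφ => ?_⟩
  · have : (0:ℝ) < N := by rw [hN]; unfold Nf; positivity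
    exact_mod_cast this
  · refine (vv_top (C := C) ¶ hN (h _ φ (by unfold dd; positivity) hd hφ)).trans ?_
    rw [exp_le_exp, neg_le_neg_iff]
    have e1 : 2*u^(8*n+8)*dd n u = 2*u^2 := by
      unfold dd; rw [show 8*n+8 = 8*n+6+2 by ring, pow_add]; field_simp
    have e2 : C*¦u^£n*dd n u^3 = C/u^6 := by
      unfold dd
      rw [← pow_mul, div_pow, ← pow_mul, show (8*n+6)*3 = 12*£n+6 by ring, pow_add _ (12*£n)]; field_simp
    rw [e1, e2]
    have : C/u^6 ≤ u := by
      rw [div_le_iff₀ ¶]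
      have := one_le_pow₀ h1 (n := 6)
      nlinarith
    nlinarith
lemma XX_triv (n N : ℕ) (a : ℝ) (h : ‖ζ‖ < 1) : ‖XX n N a ζ‖ ≤ 2*π/(1-‖ζ‖^2) := by
  have hπ := pi_pos
  have hk := kk_cont h
  have e : ∫ φ in -π..π, (‖kk ζ φ‖^2+‖kk ζ (-φ)‖^2)/2 = 2*π/(1-‖ζ‖^2) := by
    rw [intervalIntegral.integral_div, iia (cii ¢ _ _) (cii ¢ _ _), kk_norm h,
      integral_comp_neg (fun φ => ‖kk ζ φ‖^2), neg_neg, kk_norm h]; ring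
  rw [← e]
  refine intervalIntegral.norm_integral_le_of_norm_le § (Eventually.of_forall fun φ hφ => ?_) (cii ¢ _ _)
  have e2 : ‖vv n N a (φ*I)*ff ζ (φ*I)‖ = ‖kk ζ φ‖*‖kk ζ (-φ)‖ := by
    have e3 : ‖1 - cj ζ*eI φ‖ = ‖1-ζ*eI (-φ)‖ := by
      rw [← RCLike.norm_conj, map_sub, map_mul, conj_conj, ← eI_neg, map_one]
    rw [norm_mul, vv_circle n N a (abs_le.2 ⟨hφ.1.le, hφ.2⟩), ff, norm_div, norm_mul, show cexp ((φ:ℂ)*I) = eI φ from rfl, e3,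
      show -(3*((φ:ℂ)*I)/2) = ((-(3*φ/2):ℝ):ℂ)*I by push_cast; ring, norm_exp_ofReal_mul_I, kk, kk, norm_div, norm_div, neg_neg, norm_one]
    field_simp
  rw [e2]
  nlinarith [sq_nonneg (‖kk ζ φ‖-‖kk ζ (-φ)‖)]
lemma norm_one_sub_ge {z w : ℂ} {g : ℝ} (h : ‖z‖*‖w‖ ≤ 1-g) : g ≤ ‖1-z*w‖ := by
  have := norm_sub_norm_le (1:ℂ) (z*w)
  rw [norm_one, norm_mul] at this; linarith
lemma XX_le {a d L g : ℝ} (hD : CD n N a d L) (hg : 0 < g) (h : ‖ζ‖*exp d ≤ 1-g) :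
    ‖XX n N a ζ‖ ≤ 1/g^2*(2*π*exp (-L)+1/N) := by
  have hb : ∀ s : ℂ, s.re ≤ d → g ≤ ‖1-ζ*cexp s‖ ∧ g ≤ ‖1-cj ζ*cexp s‖ := fun s hs => by
    have : ‖ζ‖*‖cexp s‖ ≤ 1-g := by
      refine le_trans (mlm ?_ (norm_nonneg _)) h
      rw [norm_exp]; exact exp_le_exp.2 hs
    exact ⟨norm_one_sub_ge this, norm_one_sub_ge (by rwa [RCLike.norm_conj])⟩
  have hne : ∀ s : ℂ, s.re ≤ d → (1-ζ*cexp s)*(1-cj ζ*cexp s) ≠ 0 := fun s hs =>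
    mul_ne_zero (norm_pos_iff.1 (hg.trans_le (hb s hs).1)) (norm_pos_iff.1 (hg.trans_le (hb s hs).2))
  refine cauchy1 hD (f := ff ζ) (l := 0) le_rfl ?_ (fun s _ h1 => ?_) fun s hs => ?_
  · unfold ff; exact ContinuousOn.div ¢ ¢ fun s hs => hne s hs.1.2
  · unfold ff; exact DifferentiableAt.div ¢ ¢ (hne s h1.le)
  · rw [ff, norm_div, norm_mul, zero_mul, neg_zero, exp_zero, mul_one, sq]
    have h1 : ‖cexp (-(3*s/2))‖ ≤ 1 := by
      have := hs.1.1
      rw [norm_exp, exp_le_one_iff, show -(3*s/2) = ((-(3/2):ℝ):ℂ)*s by push_cast; ring, re_ofReal_mul]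
      have : 0 ≤ s.re := this
      linarith
    obtain ⟨h2, h3⟩ := hb s hs.1.2
    gcongr
lemma U3 {P : Polynomial ℂ} (hP : P.natDegree ≤ N) {a : ℝ} (ha : 0 < a) (h : 0 < w.re) :
    ‖P.eval (-((a:ℂ)^2*w^2))‖^2*(2*π^2*a^2*(‖w‖*‖qq w‖^2)) ≤
    NP n P*(exp (4*N*(AA w).re + a^£n*(Eg n (AA w)).re + 3*(AA w).re)*
      (π/(1-exp (-(4*(AA w).re)))+‖XX n N a (-cexp (-(2*AA w)))‖/2)) := by
  have hπ := pi_pos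
  have hA := AA_re h
  have h1 := norm_exp_lt hA
  have hn : ‖-cexp (-(2*AA w))‖ = exp (-(2*(AA w).re)) := by
    rw [norm_neg, norm_exp, neg_re]; simp
  have e0 : cexp (-(2*AA w)) = cexp (-AA w)*cexp (-AA w) := by rw [← cxa]; congr 1; ring
  have e00 : cexp (AA w)*cexp (-AA w) = 1 := by rw [← cxa]; simp
  have e1 : 1 + -cexp (-(2*AA w)) = 2*(w*cexp (-AA w)) := by
    have := sinh_AA h
    rw [Complex.sinh] at this
    rw [e0]; linear_combination 2*cexp (-AA w)*this - e00
  have e2 : 1 - -cexp (-(2*AA w)) = 2*(qq w*cexp (-AA w)) := by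
    have := cosh_AA h
    rw [Complex.cosh] at this
    rw [e0]; linear_combination 2*cexp (-AA w)*this - e00
  have hne : -cexp (-(2*AA w)) ≠ 0 := neg_ne_zero.2 (cn0 _)
  have e3 : xx a (-cexp (-(2*AA w))) = -((a:ℂ)^2*w^2) := by
    have := cn0 (-AA w)
    rw [xx, e1, e0]; field_simp; ring
  have hu := U1 (n := n) hP ha h1 hne
  have hx : ‖cexp (-AA w)‖ = exp (-(AA w).re) := by rw [norm_exp]; simp
  rw [e3, e1, e2, hn, norm_mul, norm_mul, norm_mul, norm_mul, hx, ← exp_nat_mul, ← exp_nat_mul, Complex.norm_ofNat,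
    show Eh n (-cexp (-(2*AA w))) = Eg n (AA w) from rfl] at hu
  set R := (AA w).re
  set X := ‖XX n N a (-cexp (-(2*AA w)))‖
  set p := ‖P.eval (-((a:ℂ)^2*w^2))‖
  rw [show ((2:ℕ):ℝ)*(-(2*R)) = -(4*R) by push_cast; ring] at hu
  set E := (Eg n (AA w)).re
  have k1 : exp (((2*N:ℕ):ℝ)*(-(2*R)))*p^2*exp (-(a^£n*E))*(2*(‖w‖*exp (-R)))*(2*(‖qq w‖*exp (-R)))^2 =
      8*(p^2*(‖w‖*‖qq w‖^2))/(exp (4*N*R+a^£n*E+3*R)) := by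
    rw [div_eq_mul_inv, ← exp_neg, show -(4*N*R+a^£n*E+3*R) = ((2*N:ℕ):ℝ)*(-(2*R)) + -(a^£n*E) + -R + -R + -R by push_cast; ring,
      exp_add, exp_add, exp_add, exp_add]; ring
  rw [k1, div_le_iff₀ (exp_pos _)] at hu
  calc _ = (8*(p^2*(‖w‖*‖qq w‖^2)))*(π^2*a^2/4) := by ring
    _ ≤ _ := mrm hu ¶
    _ = _ := by field_simp
lemma arsinh_lb {x : ℝ} (h : 0 ≤ x) : x/(1+x) ≤ arsinh x := by
  have h1 : log (1+x) ≤ arsinh x := by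
    rw [arsinh]
    refine log_le_log § ?_
    have : (1:ℝ) ≤ √(1+x^2) := one_le_sqrt.2 (by nlinarith)
    linarith
  have h2 := one_sub_inv_le_log_of_pos (show 0 < 1+x by linarith)
  have : 1-(1+x)⁻¹ = x/(1+x) := by field_simp; ring
  linarith
lemma arsinh_lb2 {x : ℝ} (h : 0 ≤ x) : x-x^2 ≤ arsinh x := by
  refine le_trans ?_ (arsinh_lb h)
  rw [le_div_iff₀ §]; nlinarith [pow_nonneg h 3]
lemma one_div_exp_le {t : ℝ} (h : 0 < t) : 1/(1-exp (-t)) ≤ (1+t)/t := by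
  have h1 := add_one_le_exp t
  have h3 : exp (-t) ≤ 1/(1+t) := by
    rw [exp_neg, ← one_div]; exact odl § §
  have h4 : t/(1+t) ≤ 1-exp (-t) := by
    have : 1-1/(1+t) = t/(1+t) := by field_simp; ring
    linarith
  rw [show (1+t)/t = 1/(t/(1+t)) by field_simp]
  exact odl ¶ h4
def H0 (n : ℕ) (u : ℝ) : ℝ := ¦u^£n*Wr n ((1/¦u:ℝ):ℂ)+4*u^(8*n+8)*(AA ((1/¦u:ℝ):ℂ)).re
def kap (n : ℕ) : ℝ := £n*nu n/¥n
def TT (n : ℕ) (u : ℝ) : ℝ := 8*¦u*(2*π*exp (-u)+1/Nf n u)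
def QQ (n : ℕ) (u c : ℝ) : ℝ := exp (8/¦u)/(2*π^2)*(π*((1+10/¦u)*(1+1/¦u))/(4*c)+TT n u)
def C2 (n : ℕ) : ℝ := 6*£n*nu n+6
lemma kap_pos (hn : 1 ≤ n) : 0 < kap n := by
  have := nu_pos n
  have : (0:ℝ) < n := by exact_mod_cast hn
  unfold kap; positivity
lemma C2_pos (n : ℕ) : 0 < C2 n := by have := nu_pos n; unfold C2; positivity
lemma Nf_pos (n : ℕ) (h : 0 < u) : 0 < Nf n u := by have := nu_pos n; unfold Nf; positivity
lemma HH_le (hn : 1 ≤ n) {u β : ℝ} (hu : 1 ≤ u) (h0 : 0 ≤ β) (h1 : β ≤ π/4) :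
    4*Nf n u*(AA (wb (1/¦u) β)).re+¦u^£n*(Eg n (AA (wb (1/¦u) β))).re ≤
    H0 n u - ¦u^¥n*(4*kap n*(1-cos β) - C2 n/¦u*β^2) := by
  have hp : 0 < u := §
  have hn' : (1:ℝ) ≤ n := by exact_mod_cast hn
  have hρ : 0 < 1/¦u := ¶
  have hν := nu_pos n
  have w := (abs_le.1 (W_exp hn hρ h0 h1)).2
  have r := (abs_le.1 (R6 hρ h0 h1)).2
  have e : 4*Nf n u*(AA (wb (1/¦u) β)).re+¦u^£n*(Eg n (AA (wb (1/¦u) β))).re =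
    ¦u^£n*Wr n (wb (1/¦u) β) + 4*u^(8*n+8)*(AA (wb (1/¦u) β)).re := by
    rw [Wr, Nf]; ring
  rw [e, H0]
  have k1 := mlm w (show 0 ≤ ¦u^£n by positivity)
  have k2 := mlm r (show 0 ≤ 4*u^(8*n+8) by positivity)
  have a1 : ¦u^£n*(4*£n*nu n/¥n*(1/¦u)*(1-cos β)) = ¦u^¥n*(4*kap n*(1-cos β)) := by
    rw [kap, pow_succ]; field_simp
  have a2 : ¦u^£n*(6*£n*nu n*(1/¦u)^2*β^2) = ¦u^¥n*((6*£n*nu n)/¦u*β^2) := by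
    rw [pow_succ]; field_simp
  have a3 : 4*u^(8*n+8)*(3/2*(1/¦u)^2*β^2) ≤ ¦u^¥n*(6/¦u*β^2) := by
    have : u^(8*n+8) ≤ ¦u^¥n*¦u := by
      rw [← pow_mul, ← pow_add]; exact pnl hu ¿
    calc _ = 6*(1/¦u)^2*β^2*u^(8*n+8) := by ring
      _ ≤ 6*(1/¦u)^2*β^2*(¦u^¥n*¦u) := mlm this ¶
      _ = _ := by field_simp
  have a4 : 0 ≤ 4*u^(8*n+8)*(1/¦u*(1-cos β)) := by
    have := cos_le_one β
    have : 0 ≤ 1-cos β := §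
    positivity
  have a5 : ¦u^¥n*(C2 n/¦u*β^2) = ¦u^¥n*((6*£n*nu n)/¦u*β^2)+¦u^¥n*(6/¦u*β^2) := by
    rw [C2]; ring
  rw [mul_add, a1, a2, mul_sub] at k1
  rw [mul_add, mul_sub] at k2
  rw [mul_sub _ (4*kap n*(1-cos β)), a5]
  linarith
lemma near1 (hn : 1 ≤ n) : ∀ᶠ u in atTop, ∀ N : ℕ, (N:ℝ) = Nf n u → ∀ P : Polynomial ℂ, P.natDegree ≤ N →
    ∀ β, 0 ≤ β → β ≤ π/4 → ‖P.eval (-eI (2*β))‖^2 ≤ NP n P*(exp (H0 n u)*(QQ n u (cos β)*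
      exp (-(¦u^¥n*(4*kap n*(1-cos β) - C2 n/¦u*β^2))))) := by
  filter_upwards [CD_ev hn, eventually_ge_atTop 2] with u hcd hu N hN P hP β h0 h1
  have hD := hcd N hN
  have hu1 : 1 ≤ u := §
  have hp : 0 < u := §
  have hπ := pi_pos
  have hNp := Nf_pos n hp
  set ρ := 1/¦u with hρd
  have hρ : 0 < ρ := ¶
  have hρs : ρ ≤ 1/4 := by
    rw [hρd]; apply odl ¡
    calc (4:ℝ) ≤ 2^12 := ¡
      _ ≤ ¦u := by gcongr
  have hre := wb_re_pos hρ h0 h1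
  have hc : √2/2 ≤ cos β := by
    rw [← cos_pi_div_four]; exact cos_le_cos_of_nonneg_of_le_pi h0 § h1
  have hs2 : (1.4:ℝ) ≤ √2 := le_sqrt_of_sq_le ¡
  have hcp : 0 < cos β := §
  have key := U3 (n := n) hP (show 0 < ¦u by positivity) hre
  rw [wb_norm hρ] at key
  have hq := qq_one_le hre (wb_sq_re h0 h1)
  have e1 : -(((¦u:ℝ):ℂ)^2*(wb ρ β)^2) = -eI (2*β) := by
    rw [wb, eI, mul_pow, ← cxm, hρd]
    have : (u:ℂ) ≠ 0 := by exact_mod_cast hp.ne'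
    push_cast
    rw [show (2:ℂ)*β*I = 2*(β*I) by ring]
    field_simp
  rw [e1] at key
  set R := (AA (wb ρ β)).re with hR
  have hRu : R ≤ 2*ρ := by
    have := AA_ub hre
    rw [wb_norm hρ, wb_re] at this
    have c1 := cos_le_one β
    have : ρ*cos β ≤ ρ*1 := by gcongr
    nlinarith
  have hRl : ρ*cos β/(1+ρ) ≤ R := by
    have l1 := AA_lb hre
    rw [wb_re] at l1
    have l2 := arsinh_lb (show 0 ≤ ρ*cos β by positivity)
    refine le_trans ?_ (l2.trans l1)
    gcongr
    nlinarith [cos_le_one β]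
  have hRp : 0 < R := AA_re hre
  have hR2 : ρ ≤ 2*R := by
    have : ρ/2 ≤ ρ*cos β/(1+ρ) := by
      rw [le_div_iff₀ §]
      have : ρ*0.7 ≤ ρ*cos β := by gcongr; linarith
      nlinarith
    linarith
  have hX : ‖XX n N ¦u (-cexp (-(2*AA (wb ρ β))))‖ ≤ 2*¦u*TT n u := by
    have hn1 : ‖-cexp (-(2*AA (wb ρ β)))‖ = exp (-(2*R)) := by
      rw [norm_neg, norm_exp, neg_re]; simp [hR]
    refine (XX_le hD (g := ρ/4) ¶ ?_).trans (le_of_eq ?_)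
    · rw [hn1, ← exp_add]
      have hd : dd n u ≤ ρ/2 := by
        rw [dd, hρd, div_div]
        apply odl ¶
        calc ¦u*2 ≤ ¦u*u := by gcongr
          _ = u^13 := by ring
          _ ≤ _ := pnl hu1 ¿
      have h3 : exp (-(2*R)+dd n u) ≤ exp (-(ρ/2)) := exp_le_exp.2 §
      have h4 : exp (-(ρ/2)) ≤ 1/(1+ρ/2) := by
        rw [exp_neg, ← one_div]; exact odl § (by linarith [add_one_le_exp (ρ/2)])
      have h5 : 1/(1+ρ/2) ≤ 1-ρ/4 := by rw [div_le_iff₀ §]; nlinarith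
      linarith
    · rw [TT, hN, hρd]; field_simp; ring
  have hT : 0 ≤ TT n u := by unfold TT; positivity
  have hE := HH_le hn hu1 h0 h1
  rw [← hρd, ← hN, ← hR] at hE
  set Hx := 4*(N:ℝ)*R+¦u^£n*(Eg n (AA (wb ρ β))).re
  set Y := ¦u^¥n*(4*kap n*(1-cos β) - C2 n/¦u*β^2)
  have hexp : exp (Hx+3*R) ≤ exp (H0 n u)*exp (-Y)*exp (8/¦u) := by
    rw [← exp_add, ← exp_add, exp_le_exp]
    have : 8/¦u = 8*ρ := by rw [hρd]; ring
    rw [this]; linarith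
  have hNP : 0 ≤ NP n P := by
    unfold NP; exact setIntegral_nonneg mIo fun x _ => mul_nonneg ¶ (wt_pos n x).le
  have hpr : π/(1-exp (-(4*R)))+‖XX n N ¦u (-cexp (-(2*AA (wb ρ β))))‖/2 ≤
      ¦u*(π*((1+10/¦u)*(1+1/¦u))/(4*cos β)+TT n u) := by
    have h3 := one_div_exp_le (show 0 < 4*R by linarith)
    have h4 : (1+4*R)/(4*R) ≤ ¦u*(((1+10/¦u)*(1+1/¦u))/(4*cos β)) := by
      rw [div_le_iff₀ §]
      have h5 : ρ*cos β ≤ R*(1+ρ) := by rwa [div_le_iff₀ §] at hRl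
      have h6 : cos β ≤ ¦u*(R*(1+ρ)) := by
        calc cos β = ¦u*(ρ*cos β) := by rw [hρd]; field_simp
          _ ≤ _ := by gcongr
      have e10 : 10/¦u = 10*ρ := by rw [hρd]; ring
      rw [e10, ← hρd]
      have h7 : 1 ≤ ¦u*(R*(1+ρ))/cos β := by rwa [le_div_iff₀ hcp, one_mul]
      calc 1+4*R ≤ (1+10*ρ)*1 := §
        _ ≤ (1+10*ρ)*(¦u*(R*(1+ρ))/cos β) := by gcongr
        _ = _ := by field_simp
    have h5 := mlm (h3.trans h4) hπ.le
    have e1 : π/(1-exp (-(4*R))) = π*(1/(1-exp (-(4*R)))) := by ring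
    have e2 : ¦u*(π*((1+10/¦u)*(1+1/¦u))/(4*cos β)+TT n u) = π*(¦u*(((1+10/¦u)*(1+1/¦u))/(4*cos β)))+¦u*TT n u := by ring
    rw [e1, e2]; linarith
  have hfin := key.trans (mlm (mul_le_mul hexp hpr (by
    have : exp (-(4*R)) < 1 := exp_lt_one_iff.2 §
    have : 0 < 1-exp (-(4*R)) := §
    positivity) ¶) hNP)
  have hl : ‖P.eval (-eI (2*β))‖^2*(2*π^2*¦u) ≤ ‖P.eval (-eI (2*β))‖^2*(2*π^2*¦u^2*(ρ*‖qq (wb ρ β)‖^2)) := by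
    apply mlm _ ¶
    calc 2*π^2*¦u = 2*π^2*¦u^2*(ρ*1^2) := by rw [hρd]; field_simp
      _ ≤ _ := by gcongr
  have hl2 := hl.trans hfin
  rw [← le_div_iff₀ ¶] at hl2
  refine hl2.trans (le_of_eq ?_)
  rw [QQ]; field_simp
lemma NP_nonneg (n : ℕ) (P : Polynomial ℂ) : 0 ≤ NP n P := by
  unfold NP; exact setIntegral_nonneg mIo fun x _ => mul_nonneg ¶ (wt_pos n x).le
lemma W_ub (hn : 1 ≤ n) (h : 0 < w.re) :
    Wr n w ≤ 4*£n*nu n*(w.re/¥n+3/2*‖w‖^2) := by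
  have hν := nu_pos n
  have hn' : (1:ℝ) ≤ n := by exact_mod_cast hn
  rw [Wr, W_re hn h]
  apply mlm _ ¶
  obtain ⟨i1, j1⟩ := int_npow (k := 2*n+1) ¿
  obtain ⟨i2, j2⟩ := int_npow (k := 2*n) ¿
  have i12 : IntegrableOn (fun r:ℝ => w.re*(1/r^£n)+3/2*‖w‖^2*(1/r^¥n)) (Ioi 1) := (i1.const_mul _).add (i2.const_mul _)
  refine (setIntegral_mono_on (AA_int_re hn h) i12 mIo fun r hr => ?_).trans ?_
  · have hr1 : (1:ℝ) < r := hr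
    have hr0 : 0 < r := §
    have := AA_ub (mul_re_pos h hr0)
    rw [norm_mul, re_ofReal_mul, norm_real, norm_of_nonneg hr0.le] at this
    refine (div_le_div_of_nonneg_right this ¶).trans (le_of_eq ?_)
    rw [pow_succ r £n, pow_succ r ¥n]; field_simp
  · rw [integral_add (i1.const_mul _) (i2.const_mul _), integral_const_mul, integral_const_mul, j1, j2]
    have h2 : 1/(((2*n:ℕ):ℝ)-1) ≤ 1 := by
      rw [div_le_one (by push_cast; linarith)]; push_cast; linarith
    have h3 : 1/(((2*n+1:ℕ):ℝ)-1) = 1/¥n := by push_cast; ring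
    rw [h3]
    have := mlm h2 (show 0 ≤ 3/2*‖w‖^2 by positivity)
    have e : w.re*(1/(2*(n:ℝ))) = w.re/¥n := by ring
    linarith
lemma W_lb (hn : 1 ≤ n) {ρ : ℝ} (h : 0 < ρ) :
    4*£n*nu n*(ρ/¥n-ρ^2) ≤ Wr n (ρ:ℂ) := by
  have hν := nu_pos n
  have hn' : (1:ℝ) ≤ n := by exact_mod_cast hn
  have h' : 0 < (ρ:ℂ).re := h
  rw [Wr, W_re hn h']
  apply mlm _ ¶
  obtain ⟨i1, j1⟩ := int_npow (k := 2*n+1) ¿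
  obtain ⟨i2, j2⟩ := int_npow (k := 2*n) ¿
  have i12 : IntegrableOn (fun r:ℝ => ρ*(1/r^£n)-ρ^2*(1/r^¥n)) (Ioi 1) := (i1.const_mul _).sub (i2.const_mul _)
  refine le_trans ?_ (setIntegral_mono_on i12 (AA_int_re hn h') mIo fun r hr => ?_)
  · rw [integral_sub (i1.const_mul _) (i2.const_mul _), integral_const_mul, integral_const_mul, j1, j2]
    have h2 : 1/(((2*n:ℕ):ℝ)-1) ≤ 1 := by
      rw [div_le_one (by push_cast; linarith)]; push_cast; linarith
    have h3 : 1/(((2*n+1:ℕ):ℝ)-1) = 1/¥n := by push_cast; ring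
    rw [h3]
    have := mlm h2 (show 0 ≤ ρ^2 by positivity)
    have e : ρ*(1/(2*(n:ℝ))) = ρ/¥n := by ring
    linarith
  · have hr1 : (1:ℝ) < r := hr
    have hr0 : 0 < r := §
    have := AA_lb (mul_re_pos h' hr0)
    rw [re_ofReal_mul, ofReal_re] at this
    have h2 := (arsinh_lb2 (show 0 ≤ r*ρ by positivity)).trans this
    refine le_trans (le_of_eq ?_) (div_le_div_of_nonneg_right h2 ¶)
    rw [pow_succ r £n, pow_succ r ¥n]; field_simp
set_option maxHeartbeats 1000000 in
lemma far0 (hn : 1 ≤ n) : ∀ᶠ u in atTop, ∀ N : ℕ, (N:ℝ) = Nf n u → ∀ P : Polynomial ℂ, P.natDegree ≤ N →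
    ∀ v : ℂ, 0 < v.re → v.re ≤ 3/4 → 1/2 ≤ ‖v‖ → ‖v‖^2 ≤ 5/2 → ‖P.eval (-v^2)‖^2*v.re ≤ 
     100*(NP n P*(exp (H0 n u)*exp (-(¦u^¥n*(kap n/2))))) := by
  have hk := kap_pos hn
  have hν := nu_pos n
  filter_upwards [eventually_ge_atTop 2, eventually_ge_atTop ((20*£n*nu n+50)/(kap n/2))] with u hu hu2 N hN P hP v h0 h1 h2 h3
  have hu1 : 1 ≤ u := §
  have hp : 0 < u := §
  have hπ := pi_pos
  have hn' : (1:ℝ) ≤ n := by exact_mod_cast hn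
  set ρ := 1/¦u with hρd
  have hρ : 0 < ρ := ¶
  have hρs : ρ ≤ 1/100 := by
    rw [hρd]; apply odl ¡
    calc (100:ℝ) ≤ 2^12 := ¡
      _ ≤ ¦u := by gcongr
  have hre : 0 < ((ρ:ℂ)*v).re := mul_re_pos h0 hρ
  have key := U3 (n := n) hP (show 0 < ¦u by positivity) hre
  have e1 : -(((¦u:ℝ):ℂ)^2*((ρ:ℂ)*v)^2) = -v^2 := by
    have : (u:ℂ) ≠ 0 := by exact_mod_cast hp.ne'
    rw [hρd]; push_cast; field_simp
  have hnw : ‖(ρ:ℂ)*v‖ = ρ*‖v‖ := by rw [norm_mul, norm_real, norm_of_nonneg hρ.le]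
  rw [e1, hnw] at key
  have hwr : ((ρ:ℂ)*v).re = ρ*v.re := re_ofReal_mul _ _
  set w := (ρ:ℂ)*v with hw
  set R := (AA w).re with hR
  have hRp : 0 < R := AA_re hre
  have hn2 : ‖w‖^2 ≤ 5/2*ρ^2 := by
    rw [hnw, mul_pow]; nlinarith only [h3, sq_nonneg ρ]
  have hRu : R ≤ ρ := by
    have := AA_ub hre
    rw [hwr] at this
    nlinarith only [this, hn2, h1, hρ, hρs]
  have hRl : ρ*v.re/2 ≤ R := by
    have l1 := AA_lb hre
    have l2 := arsinh_lb hre.le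
    refine le_trans ?_ (l2.trans l1)
    rw [hwr]
    gcongr
    nlinarith only [h1, hρ, hρs]
  have hq : 1/2 ≤ ‖qq w‖^2 := by
    rw [← norm_pow, qq_sq hre]
    have := norm_sub_norm_le (1:ℂ) (-w^2)
    rw [norm_one, norm_neg, norm_pow, sub_neg_eq_add] at this
    nlinarith only [this, hn2, hρs, hρ]
  have hXt := XX_triv (n := n) (N := N) (a := ¦u) (norm_exp_lt (A := AA w) hRp)
  have hn1 : ‖-cexp (-(2*AA w))‖^2 = exp (-(4*R)) := by
    rw [norm_neg, norm_exp, ← exp_nat_mul]; simp [hR]; ring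
  rw [hn1] at hXt
  have h5 := one_div_exp_le (show 0 < 4*R by linarith)
  have h6 : (1+4*R)/(4*R) ≤ 1/(ρ*v.re) := by
    rw [div_le_div_iff₀ § ¶]
    have : (1+4*R)*(ρ*v.re) ≤ 2*(2*R) := mul_le_mul (by linarith only [hRu, hρs]) (by linarith only [hRl]) ¶ ¡
    linarith only [this]
  have hpr : π/(1-exp (-(4*R)))+‖XX n N ¦u (-cexp (-(2*AA w)))‖/2 ≤ 2*π*(¦u/v.re) := by
    have h7 := mlm (h5.trans h6) hπ.le
    have e1 : π/(1-exp (-(4*R))) = π*(1/(1-exp (-(4*R)))) := by ring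
    have e2 : 2*π/(1-exp (-(4*R))) = 2*(π*(1/(1-exp (-(4*R))))) := by ring
    have e3 : 2*π*(¦u/v.re) = 2*(π*(1/(ρ*v.re))) := by rw [hρd]; field_simp
    rw [e2] at hXt
    rw [e1, e3]; linarith
  have hexp : 4*N*R + ¦u^£n*(Eg n (AA w)).re + 3*R ≤ H0 n u + -(¦u^¥n*(kap n/2)) + 1 := by
    have e : 4*N*R+¦u^£n*(Eg n (AA w)).re =
      ¦u^£n*Wr n w + 4*u^(8*n+8)*R := by
      rw [Wr, hN, Nf]; ring
    rw [e, H0, ← hρd]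
    have k1 := mlm (W_ub hn hre) (show 0 ≤ ¦u^£n by positivity)
    have k2 := mlm (W_lb hn hρ) (show 0 ≤ ¦u^£n by positivity)
    have k3 : 0 ≤ 4*u^(8*n+8)*(AA (ρ:ℂ)).re := by
      have := AA_re (w := (ρ:ℂ)) hρ
      positivity
    have k4 : 4*£n*nu n*(w.re/¥n+3/2*‖w‖^2) - 4*£n*nu n*(ρ/¥n-ρ^2) ≤ -(kap n*ρ) + 20*£n*nu n*ρ^2 := by
      have a1 : 4*£n*nu n*(w.re/¥n) ≤ 3*kap n*ρ := by
        rw [hwr, kap]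
        calc _ = 4*(£n*nu n/¥n)*ρ*v.re := by ring
          _ ≤ 4*(£n*nu n/¥n)*ρ*(3/4) := by gcongr
          _ = _ := by ring
      have a2 : 4*£n*nu n*(ρ/¥n) = 4*kap n*ρ := by rw [kap]; ring
      have a3 := mlm hn2 (show 0 ≤ 4*£n*nu n*(3/2) by positivity)
      have a4 : 0 ≤ £n*nu n*ρ^2 := ¶
      linarith only [a1, a2, a3, a4]
    have k5 := mlm k4 (show 0 ≤ ¦u^£n by positivity)
    have k6 : ¦u^£n*(-(kap n*ρ)+20*£n*nu n*ρ^2) = ¦u^¥n*(-kap n + 20*£n*nu n/¦u) := by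
      rw [pow_succ, hρd]; field_simp
    have k7 : 4*u^(8*n+8)*R ≤ ¦u^¥n*(50/¦u) := by
      have : u^(8*n+8) ≤ ¦u^¥n := by
        rw [← pow_mul]; exact pnl hu1 ¿
      calc _ ≤ 4*¦u^¥n*ρ := by gcongr
        _ = ¦u^¥n*(4/¦u) := by rw [hρd]; ring
        _ ≤ _ := by gcongr; norm_num
    have k8 : ¦u^¥n*((20*£n*nu n+50)/¦u) ≤ ¦u^¥n*(kap n/2) := by
      apply mlm _ ¶
      rw [div_le_iff₀ ¶] at hu2 ⊢
      refine hu2.trans ?_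
      have : u ≤ ¦u := le_self_pow₀ hu1 ¡
      rw [mul_comm]; gcongr
    have k9 : ¦u^¥n*((20*£n*nu n+50)/¦u) = ¦u^¥n*(20*£n*nu n/¦u) + ¦u^¥n*(50/¦u) := by ring
    rw [k9] at k8
    rw [k6, mul_add, mul_sub] at k5
    have k10 : 3*R ≤ 1 := by linarith only [hRu, hρs]
    have k11 : ¦u^¥n*(-kap n) = -(¦u^¥n*(kap n/2)) - ¦u^¥n*(kap n/2) := by ring
    linarith only [k1, k2, k3, k5, k7, k8, k10, k11]
  have hNP := NP_nonneg n P
  have hE : exp (4*N*R + ¦u^£n*(Eg n (AA w)).re + 3*R) ≤ exp (H0 n u)*exp (-(¦u^¥n*(kap n/2)))*3 := by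
    refine (exp_le_exp.2 hexp).trans ?_
    rw [exp_add, exp_add]
    gcongr
    linarith [exp_one_lt_d9]
  have hfin := key.trans (mlm (mul_le_mul hE hpr (by
    have : exp (-(4*R)) < 1 := exp_lt_one_iff.2 §
    have : 0 < 1-exp (-(4*R)) := §
    positivity) ¶) hNP)
  set Z := NP n P*(exp (H0 n u)*exp (-(¦u^¥n*(kap n/2)))) with hZ
  have hZ0 : 0 ≤ Z := ¶
  have hl : ‖P.eval (-v^2)‖^2*(π^2*¦u/2) ≤ ‖P.eval (-v^2)‖^2*(2*π^2*¦u^2*(ρ*‖v‖*‖qq w‖^2)) := by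
    apply mlm _ ¶
    calc π^2*¦u/2 = 2*π^2*¦u^2*(ρ*(1/2)*(1/2)) := by rw [hρd]; field_simp
      _ ≤ _ := by gcongr
  have hl2 := hl.trans hfin
  have hl3 : ‖P.eval (-v^2)‖^2*v.re*(π^2*¦u/2) ≤ Z*(6*π*¦u) := by
    calc _ = ‖P.eval (-v^2)‖^2*(π^2*¦u/2)*v.re := by ring
      _ ≤ _ := mrm hl2 h0.le
      _ = _ := by rw [hZ]; field_simp; ring
  rw [← le_div_iff₀ ¶] at hl3
  refine hl3.trans ?_
  rw [div_le_iff₀ ¶]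
  have : 6*π*¦u ≤ 100*(π^2*¦u/2) := by
    have h8 : π*3 ≤ π*π := by gcongr; exact pi_gt_three.le
    have h9 := mrm h8 (show 0 ≤ ¦u by positivity)
    have h10 : 0 < π*¦u := ¶
    nlinarith only [h9, h10]
  calc Z*(6*π*¦u) ≤ Z*(100*(π^2*¦u/2)) := by gcongr
    _ = _ := by ring
lemma sqrt_neg_re (hz : z.re < ‖z‖) : ∃ v : ℂ, 0 < v.re ∧ v^2 = -z ∧ v.re^2 = (‖z‖-z.re)/2 := by
  have hz0 : z ≠ 0 := fun h => by simp [h] at hz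
  have hs : -z ∈ slitPlane := by
    rw [mem_slitPlane_iff]
    by_contra! h
    have h1 : z.im = 0 := by simpa using h.2
    have h2 : 0 ≤ z.re := by simpa using h.1
    have : ‖z‖ = z.re := by
      rw [show z = (z.re:ℂ) from Complex.ext rfl h1, norm_real, norm_of_nonneg h2]; rfl
    linarith
  have h1 := exp_half_log_re hs
  refine ⟨_, h1, ?_, ?_⟩
  · rw [← cxm]; push_cast; rw [mul_div_cancel₀ _ two_ne_zero, Complex.exp_log (neg_ne_zero.2 hz0)]
  · set v := cexp (Complex.log (-z)/2)
    have e : v^2 = -z := by rw [← cxm]; push_cast; rw [mul_div_cancel₀ _ two_ne_zero, Complex.exp_log (neg_ne_zero.2 hz0)]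
    have e2 : ‖z‖ = v.re^2+v.im^2 := by
      rw [← norm_neg, ← e, norm_pow, ← normSq_eq_norm_sq, normSq_apply]; ring
    have e3 : -z.re = v.re^2-v.im^2 := by rw [← neg_re, ← e, sq v, mul_re]; ring
    linarith
set_option maxHeartbeats 1000000 in
lemma far1 (hn : 1 ≤ n) : ∀ᶠ u in atTop, ∀ N : ℕ, (N:ℝ) = Nf n u → ∀ P : Polynomial ℂ, P.natDegree ≤ N →
    ∀ z : ℂ, 0 ≤ z.re → ‖z‖ = 1 → ‖P.eval z‖^2 ≤ 
     1000*(NP n P*(exp (H0 n u)*exp (-(¦u^¥n*(kap n/2))))) := by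
  filter_upwards [far0 hn] with u h N hN P hP z hz0 hz1
  have h := h N hN P hP
  have hNP := NP_nonneg n P
  set Z := NP n P*(exp (H0 n u)*exp (-(¦u^¥n*(kap n/2)))) with hZ
  have hZ0 : 0 ≤ Z := ¶
  have hfr : ∀ y ∈ frontier (ball (1:ℂ) (3/2)), ‖(P*(Polynomial.X-Polynomial.C (5/2))).eval y‖ ≤ √(1350*Z) := by
    intro y hy
    rw [frontier_ball _ ¡, mem_sphere_iff_norm] at hy
    apply le_sqrt_of_sq_le
    rw [Polynomial.eval_mul, Polynomial.eval_sub, Polynomial.eval_X, Polynomial.eval_C, norm_mul, mul_pow]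
    have n0 : ∀ x : ℂ, ‖x‖^2 = x.re^2+x.im^2 := fun x => by rw [← normSq_eq_norm_sq, normSq_apply]; ring
    have e1 := n0 (y-1)
    have e2 := n0 (y-5/2)
    have e3 := n0 y
    have q1 : (y-1).re = y.re-1 := by simp
    have q2 : (y-1).im = y.im := by simp
    have q3 : (y-5/2).re = y.re-5/2 := by simp
    have q4 : (y-5/2).im = y.im := by simp
    rw [hy, q1, q2] at e1
    rw [q3, q4] at e2
    have e4 : ‖y-5/2‖^2 = 3*(5/2-y.re) := §
    have e5 : ‖y‖^2 = 2*y.re+5/4 := §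
    have r1 : -(1/2) ≤ y.re := by nlinarith only [e1, sq_nonneg y.im]
    have r2 : y.re ≤ 5/2 := by nlinarith only [e1, sq_nonneg y.im]
    have r3 : (5/2+2*y.re)/3 ≤ ‖y‖ := abs_le_of_sq_le_sq' (by rw [e5]; nlinarith only [r1, r2]) (norm_nonneg _) |>.2
    rcases eq_or_lt_of_le r2 with r2 | r2
    · rw [e4, r2]; norm_num; linarith
    obtain ⟨v, v1, v2, v3⟩ := sqrt_neg_re (z := y) §
    have v4 : ‖v‖^2 = ‖y‖ := by rw [← norm_pow, v2, norm_neg]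
    have r4 : ‖y‖ ≤ y.re+9/8 := abs_le_of_sq_le_sq' (by rw [e5]; nlinarith only [sq_nonneg (y.re+1/8)]) § |>.2
    have v5 : v.re ≤ 3/4 := abs_le_of_sq_le_sq' (by rw [v3]; linarith) ¡ |>.2
    have r6 : 1/2 ≤ ‖y‖ := §
    have r7 : ‖y‖ ≤ 5/2 := abs_le_of_sq_le_sq' (by rw [e5]; linarith) ¡ |>.2
    have := h v v1 v5 (abs_le_of_sq_le_sq' (by rw [v4]; linarith) (norm_nonneg _) |>.2) (by rw [v4]; exact r7)
    rw [v2, neg_neg] at this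
    have r8 : ‖y-5/2‖^2 ≤ 27/2*v.re := by
      have s1 : v.re^2 ≤ 3/4*v.re := by rw [sq]; gcongr
      have s2 : (5/2-y.re)/6 ≤ v.re^2 := by rw [v3]; linarith
      rw [e4]; linarith only [s1, s2]
    calc _ ≤ ‖P.eval y‖^2*(27/2*v.re) := by gcongr
      _ = 27/2*(‖P.eval y‖^2*v.re) := by ring
      _ ≤ 27/2*(100*Z) := by gcongr
      _ = _ := by ring
  have n0 : ∀ x : ℂ, ‖x‖^2 = x.re^2+x.im^2 := fun x => by rw [← normSq_eq_norm_sq, normSq_apply]; ring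
  have e3 := n0 z
  rw [hz1] at e3
  have m := Complex.norm_le_of_forall_mem_frontier_norm_le (z := z) Metric.isBounded_ball (Differentiable.diffContOnCl (Polynomial.differentiable _)) hfr (by
    apply subset_closure
    rw [mem_ball_iff_norm]
    have e1 := n0 (z-1)
    have q1 : (z-1).re = z.re-1 := by simp
    have q2 : (z-1).im = z.im := by simp
    rw [q1, q2] at e1
    nlinarith only [norm_nonneg (z-1), e1, e3, hz0])
  rw [Polynomial.eval_mul, Polynomial.eval_sub, Polynomial.eval_X, Polynomial.eval_C, norm_mul] at m
  have m2 : 3/2 ≤ ‖z-5/2‖ := by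
    have := norm_sub_norm_le (5/2:ℂ) z
    rw [norm_sub_rev, hz1] at this
    norm_num at this ⊢; linarith
  have m3 : ‖P.eval z‖*(3/2) ≤ √(1350*Z) := le_trans (by gcongr) m
  have m4 : (‖P.eval z‖*(3/2))^2 ≤ 1350*Z := by
    rw [← sq_sqrt (show 0 ≤ 1350*Z by positivity)]; gcongr
  rw [mul_pow] at m4
  linarith
def G0 (n : ℕ) : ℝ := √(π/(2*kap n))/(4*π)
def alf (n : ℕ) (u : ℝ) : ℝ := 2*kap n*(1-1/u^2)-C2 n/¦u
def Lb (n : ℕ) (u : ℝ) : ℝ := 2*(QQ n u (1-1/u^2)*√(π/alf n u))+4*(QQ n u (1/2)*(¦u^n*exp (-¦u^n*(kap n/2))))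
lemma tend_inv (k : ℕ) (hk : k ≠ 0) (c : ℝ) : Tendsto (fun u:ℝ => c/u^k) atTop (𝓝 0) :=
  Tendsto.div_atTop tendsto_const_nhds (tendsto_pow_atTop hk)
lemma TT_lim (hn : 1 ≤ n) : Tendsto (TT n) atTop (𝓝 0) := by
  have h1 : Tendsto (fun u:ℝ => 16*π*(¦u*exp (-u))+8/u^4) atTop (𝓝 (16*π*0+0)) :=
    ((tendsto_pow_mul_exp_neg_atTop_nhds_zero 12).const_mul _).add (tend_inv 4 ¡ 8)
  rw [mul_zero, zero_add] at h1
  have hp := pi_pos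
  have hν := nu_pos n
  refine squeeze_zero' ?_ ?_ h1
  · filter_upwards [eventually_ge_atTop 1] with u hu
    have := Nf_pos n (show 0 < u by linarith)
    unfold TT; positivity
  · filter_upwards [eventually_ge_atTop 1] with u hu
    have h0 : 0 < u := §
    have h2 : u^16 ≤ Nf n u := by
      have : u^16 ≤ u^(8*n+8) := pnl hu ¿
      have : 0 ≤ nu n*¦u^£n := ¶
      unfold Nf; linarith
    have : 1/Nf n u ≤ 1/u^16 := odl ¶ h2
    have h3 : 8*¦u*(1/Nf n u) ≤ 8*¦u*(1/u^16) := by gcongr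
    have h4 : 8*¦u*(1/u^16) = 8/u^4 := by field_simp
    unfold TT; linarith
lemma QQ_lim (hn : 1 ≤ n) {c : ℝ → ℝ} {c0 : ℝ} (hc : Tendsto c atTop (𝓝 c0)) (h0 : c0 ≠ 0) :
    Tendsto (fun u => QQ n u (c u)) atTop (𝓝 (1/(8*π*c0))) := by
  have e : 1/(8*π*c0) = exp 0/(2*π^2)*(π*((1+0)*(1+0))/(4*c0)+0) := by
    rw [exp_zero]; field_simp; ring
  rw [e]
  refine (((continuous_exp.tendsto 0).comp (tend_inv 12 ¡ 8)).div_const _).mul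
    (Tendsto.add (Tendsto.div (Tendsto.const_mul _ ((tendsto_const_nhds.add (tend_inv 12 ¡ 10)).mul (tendsto_const_nhds.add (tend_inv 12 ¡ 1))))
      (hc.const_mul 4) (by simpa using h0)) (TT_lim hn))
lemma Lb_lim (hn : 1 ≤ n) : Tendsto (Lb n) atTop (𝓝 (G0 n)) := by
  have hk := kap_pos hn
  have hπ := pi_pos
  have t1 : Tendsto (fun u:ℝ => 1-1/u^2) atTop (𝓝 (1-0)) := tendsto_const_nhds.sub (tend_inv 2 ¡ 1)
  have t2 : Tendsto (alf n) atTop (𝓝 (2*kap n*(1-0)-0)) := (t1.const_mul _).sub (tend_inv 12 ¡ _)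
  have t3 : Tendsto (fun u => √(π/alf n u)) atTop (𝓝 (√(π/(2*kap n*(1-0)-0)))) :=
    (Tendsto.div tendsto_const_nhds t2 (by simp; exact hk.ne')).sqrt
  have t4 : Tendsto (fun u:ℝ => ¦u^n*exp (-¦u^n*(kap n/2))) atTop (𝓝 0) := by
    have ha : Tendsto (fun u:ℝ => ¦u^n*(kap n/2)) atTop atTop := by
      simp_rw [← pow_mul]
      exact (tendsto_pow_atTop ¿).atTop_mul_const ¶
    have := ((tendsto_pow_mul_exp_neg_atTop_nhds_zero 1).comp ha).const_mul (2/kap n)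
    rw [mul_zero] at this
    refine this.congr fun u => ?_
    simp only [Function.comp, pow_one]
    rw [neg_mul]; field_simp
  have e : G0 n = 2*(1/(8*π*(1-0))*√(π/(2*kap n*(1-0)-0)))+4*(1/(8*π*(1/2))*0) := by
    rw [G0, sub_zero, mul_one, sub_zero]; field_simp; ring
  rw [e]
  exact (((QQ_lim hn t1 ¡).mul t3).const_mul 2).add (((QQ_lim hn tendsto_const_nhds ¡).mul t4).const_mul 4)
lemma QQ_nonneg {u c : ℝ} (hu : 0 < u) (hc : 0 < c) : 0 ≤ QQ n u c := by
  have := Nf_pos n hu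
  have := pi_pos
  unfold QQ TT; positivity
lemma QQ_anti {u c c' : ℝ} (hu : 0 < u) (hc : 0 < c) (h : c ≤ c') : QQ n u c' ≤ QQ n u c := by
  have := pi_pos
  unfold QQ; gcongr
lemma near2 (hn : 1 ≤ n) : ∀ᶠ u in atTop, ∀ β, 0 ≤ β → β ≤ π/4 →
    QQ n u (cos β)*exp (-(¦u^¥n*(4*kap n*(1-cos β) - C2 n/¦u*β^2))) ≤
    QQ n u (1-1/u^2)*exp (-(¦u^¥n*alf n u)*β^2) + QQ n u (1/2)*exp (-¦u^n*(kap n/2)) := by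
  have hk := kap_pos hn
  have hC := C2_pos n
  have t := (tend_inv 12 ¡ (C2 n)).eventually_le_const (show (0:ℝ) < kap n*0.1 by positivity)
  filter_upwards [t, eventually_ge_atTop 2] with u ht hu β h0 h1
  have hp : 0 < u := §
  have hu1 : 1 ≤ u := §
  have hπ := pi_pos
  have hπ4 := pi_lt_four
  have hb1 : β ≤ 1 := §
  have hs2 : (1.4:ℝ) ≤ √2 := le_sqrt_of_sq_le ¡
  have hc : √2/2 ≤ cos β := by
    rw [← cos_pi_div_four]; exact cos_le_cos_of_nonneg_of_le_pi h0 § h1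
  have hq1 : 1/u^2 ≤ 1/4 := by
    apply odl ¡; nlinarith
  have n1 := QQ_nonneg (n := n) (u := u) (c := 1-1/u^2) hp §
  have n2 := QQ_nonneg (n := n) (u := u) (c := 1/2) hp ¡
  have hA : 0 ≤ ¦u^¥n := ¶
  rcases le_total β (1/u) with hb | hb
  · refine le_trans ?_ (le_add_of_nonneg_right ¶)
    have hb2 : β^2 ≤ 1/u^2 := by
      calc β^2 ≤ (1/u)^2 := by gcongr
        _ = _ := by ring
    refine mul_le_mul (QQ_anti hp § (by linarith [one_sub_sq_div_two_le_cos (x := β), sq_nonneg β])) (exp_le_exp.2 ?_) ¶ n1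
    rw [neg_mul, neg_le_neg_iff, mul_assoc]
    apply mlm _ hA
    have hcb := (abs_le.1 (cos_bound (x := β) (by rw [abs_of_nonneg h0]; exact hb1))).2
    rw [abs_of_nonneg h0] at hcb
    have h4 : β^4 ≤ 1/u^2*β^2 := by
      calc β^4 = β^2*β^2 := by ring
        _ ≤ _ := by gcongr
    have h5 : β^2/2*(1-1/u^2) ≤ 1-cos β := by
      have : 0 ≤ β^4 := ¶
      nlinarith
    have h6 := mlm h5 (show 0 ≤ 4*kap n by positivity)
    unfold alf; nlinarith only [h6]
  · refine le_trans ?_ (le_add_of_nonneg_left ¶)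
    refine mul_le_mul (QQ_anti hp ¡ §) (exp_le_exp.2 ?_) ¶ n2
    rw [neg_mul, neg_le_neg_iff]
    have hcq := cos_le_one_sub_mul_cos_sq (x := β) (by rw [abs_of_nonneg h0]; linarith)
    have hb2 : 1/u^2 ≤ β^2 := by
      calc 1/u^2 = (1/u)^2 := by ring
        _ ≤ _ := by gcongr
    have hpi : 0.18 ≤ 2/π^2 := by
      rw [le_div_iff₀ ¶]; nlinarith [pi_lt_d2]
    have h7 : 0.18*β^2 ≤ 1-cos β := by
      have := mrm hpi (sq_nonneg β)
      linarith
    have h8 : kap n/2*β^2 ≤ 4*kap n*(1-cos β) - C2 n/¦u*β^2 := by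
      have a1 := mrm ht (sq_nonneg β)
      have a2 := mlm h7 (show 0 ≤ 4*kap n by positivity)
      have a3 : 0 ≤ kap n*β^2 := ¶
      linarith
    have h9 : ¦u^n ≤ ¦u^¥n*(1/u^2) := by
      rw [mul_one_div, le_div_iff₀ ¶, ← pow_mul, ← pow_mul, ← pow_add]
      exact pnl hu1 ¿
    calc ¦u^n*(kap n/2) ≤ ¦u^¥n*(1/u^2)*(kap n/2) := by gcongr
      _ = ¦u^¥n*(kap n/2*(1/u^2)) := by ring
      _ ≤ ¦u^¥n*(kap n/2*β^2) := by gcongr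
      _ ≤ _ := mlm h8 hA
lemma near3 (hn : 1 ≤ n) : ∀ᶠ u in atTop, 
    4*∫ β in (0:ℝ)..(π/4), (QQ n u (1-1/u^2)*exp (-(¦u^¥n*alf n u)*β^2) + QQ n u (1/2)*exp (-¦u^n*(kap n/2)))
     ≤ (¦u^n)⁻¹*Lb n u := by
  have hk := kap_pos hn
  have t1 : Tendsto (fun u:ℝ => 1-1/u^2) atTop (𝓝 (1-0)) := tendsto_const_nhds.sub (tend_inv 2 ¡ 1)
  have t2 : Tendsto (alf n) atTop (𝓝 (2*kap n*(1-0)-0)) := (t1.const_mul _).sub (tend_inv 12 ¡ _)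
  filter_upwards [t2.eventually_const_lt (show 0 < 2*kap n*(1-0)-0 by simpa using hk), eventually_ge_atTop 2] with u ha hu
  have hp : 0 < u := §
  have hπ := pi_pos
  have hq1 : 1/u^2 ≤ 1/4 := by
    apply odl ¡; nlinarith
  have n1 := QQ_nonneg (n := n) (u := u) (c := 1-1/u^2) hp §
  have n2 := QQ_nonneg (n := n) (u := u) (c := 1/2) hp ¡
  have hA : 0 < ¦u^¥n*alf n u := ¶
  rw [iia (cii ¢ _ _) (cii ¢ _ _),
    iicm, intervalIntegral.integral_const]
  have h1 : ∫ β in (0:ℝ)..(π/4), exp (-(¦u^¥n*alf n u)*β^2) ≤ (¦u^n)⁻¹*√(π/alf n u)/2 := by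
    rw [integral_of_le ¶]
    have e : (¦u^n)⁻¹*√(π/alf n u)/2 = ∫ β in Rp, exp (-(¦u^¥n*alf n u)*β^2) := by
      rw [integral_gaussian_Ioi]
      rw [show π/(¦u^¥n*alf n u) = ((¦u^n)⁻¹)^2*(π/alf n u) by rw [mul_comm 2 n, pow_mul]; field_simp,
        sqrt_mul ¶, sqrt_sq ¶]
    rw [e]
    exact setIntegral_mono_set (integrable_exp_neg_mul_sq hA).integrableOn (Eventually.of_forall fun _ => (exp_pos _).le)
      (Eventually.of_forall fun x hx => hx.1)
  have h2 := mlm h1 n1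
  have h3 : (π/4-0)•(QQ n u (1/2)*exp (-¦u^n*(kap n/2))) ≤ QQ n u (1/2)*exp (-¦u^n*(kap n/2)) := by
    rw [smul_eq_mul]
    have : 0 ≤ QQ n u (1/2)*exp (-¦u^n*(kap n/2)) := ¶
    nlinarith only [this, pi_lt_four]
  have h4 : (¦u^n)⁻¹*Lb n u = 4*(QQ n u (1-1/u^2)*((¦u^n)⁻¹*√(π/alf n u)/2)) + 4*(QQ n u (1/2)*exp (-¦u^n*(kap n/2))) := by
    have : ¦u^n ≠ 0 := ¶
    rw [Lb]; field_simp; ring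
  rw [h4]; linarith
theorem UPPER (hn : 1 ≤ n) {ε : ℝ} (hε : 0 < ε) : ∀ᶠ u in atTop, ∀ N : ℕ, (N:ℝ) = Nf n u → ∀ P : Polynomial ℝ, P.natDegree ≤ N →
    ∫ θ in -π..π, ‖(P.map ofRealHom).eval (eI θ)‖^2 ≤
      NP n (P.map ofRealHom)*(exp (H0 n u)*((¦u^n)⁻¹*(G0 n+ε))) := by
  have hk := kap_pos hn
  have tf : Tendsto (fun u:ℝ => 4000*(¦u^n*exp (-¦u^n*(kap n/2)))) atTop (𝓝 (4000*0)) := by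
    refine Tendsto.const_mul _ ?_
    have ha : Tendsto (fun u:ℝ => ¦u^n*(kap n/2)) atTop atTop := by
      simp_rw [← pow_mul]
      exact (tendsto_pow_atTop ¿).atTop_mul_const ¶
    have := ((tendsto_pow_mul_exp_neg_atTop_nhds_zero 1).comp ha).const_mul (2/kap n)
    rw [mul_zero] at this
    refine this.congr fun u => ?_
    simp only [Function.comp, pow_one]
    rw [neg_mul]; field_simp
  rw [mul_zero] at tf
  filter_upwards [near1 hn, near2 hn, near3 hn, far1 hn, eventually_ge_atTop 1, tf.eventually_le_const (half_pos hε),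
    (Lb_lim hn).eventually_le_const (show G0 n < G0 n+ε/2 by linarith)] with u k1 k2 k3 k4 hu k5 k6 N hN P hP
  have hp : 0 < u := §
  have hπ := pi_pos
  have hPc : (P.map ofRealHom).natDegree ≤ N := (Polynomial.natDegree_map_le).trans hP
  have hcj : ∀ z : ℂ, ‖(P.map ofRealHom).eval (cj z)‖ = ‖(P.map ofRealHom).eval z‖ := fun z => by
    rw [← RCLike.norm_conj ((P.map ofRealHom).eval z), Polynomial.eval_map, Polynomial.eval_map, Polynomial.hom_eval₂]
    congr 2; ext x; simp
  set Q := P.map ofRealHom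
  have hNP := NP_nonneg n Q
  have hco : Continuous fun θ:ℝ => ‖Q.eval (eI θ)‖^2 := by
    have := Q.continuous; have := eI_cont; fun_prop
  have ii : ∀ a b : ℝ, IntervalIntegrable (fun θ:ℝ => ‖Q.eval (eI θ)‖^2) volume a b := fun a b => hco.intervalIntegrable _ _
  have hev : ∫ θ in (-π)..0, ‖Q.eval (eI θ)‖^2 = ∫ θ in (0:ℝ)..π, ‖Q.eval (eI θ)‖^2 := by
    rw [← neg_zero, ← integral_comp_neg, neg_zero]
    exact integral_congr fun x _ => by simp only [eI_neg, hcj]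
  rw [← integral_add_adjacent_intervals (ii (-π) 0) (ii 0 π), hev,
    ← integral_add_adjacent_intervals (ii 0 (π/2)) (ii (π/2) π)]
  have hN2 : ∫ θ in (π/2)..π, ‖Q.eval (eI θ)‖^2 = 2*∫ β in (0:ℝ)..(π/4), ‖Q.eval (-eI (2*β))‖^2 := by
    have := intervalIntegral.integral_comp_sub_mul (a := 0) (b := π/4) (fun θ:ℝ => ‖Q.eval (eI θ)‖^2) (two_ne_zero) π
    rw [show π-2*(π/4) = π/2 by ring, mul_zero, sub_zero, smul_eq_mul] at this
    rw [show (∫ β in (0:ℝ)..(π/4), ‖Q.eval (-eI (2*β))‖^2) = ∫ β in (0:ℝ)..(π/4), ‖Q.eval (eI (π-2*β))‖^2 from ?_, this]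
    · ring
    · refine integral_congr fun x _ => ?_
      have : eI (π-2*x) = cj (-eI (2*x)) := by
        rw [map_neg, ← eI_neg, eI, eI]
        push_cast
        rw [sub_mul, sub_eq_add_neg, cxa, exp_pi_mul_I]; simp
      simp only [this, hcj]
  have hfar : ∫ θ in (0:ℝ)..(π/2), ‖Q.eval (eI θ)‖^2 ≤ 2000*(NP n Q*(exp (H0 n u)*exp (-¦u^n*(kap n/2)))) := by
    have : ∫ θ in (0:ℝ)..(π/2), ‖Q.eval (eI θ)‖^2 ≤ ∫ θ in (0:ℝ)..(π/2), 1000*(NP n Q*(exp (H0 n u)*exp (-¦u^n*(kap n/2)))) := by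
      refine integral_mono_on ¶ (ii _ _) (by simp) fun θ hθ => ?_
      refine (k4 N hN Q hPc (eI θ) ?_ (eI_norm θ)).trans ?_
      · rw [eI, exp_ofReal_mul_I_re]; exact cos_nonneg_of_mem_Icc ⟨by linarith [hθ.1], hθ.2⟩
      · gcongr
        rw [neg_mul, neg_le_neg_iff]
        gcongr <;> first | omega | exact one_le_pow₀ hu
    refine this.trans ?_
    rw [intervalIntegral.integral_const, smul_eq_mul]
    have : 0 ≤ NP n Q*(exp (H0 n u)*exp (-¦u^n*(kap n/2))) := ¶
    nlinarith only [this, pi_lt_four]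
  have hnear : 4*∫ β in (0:ℝ)..(π/4), ‖Q.eval (-eI (2*β))‖^2 ≤ NP n Q*(exp (H0 n u)*((¦u^n)⁻¹*Lb n u)) := by
    have : ∫ β in (0:ℝ)..(π/4), ‖Q.eval (-eI (2*β))‖^2 ≤ ∫ β in (0:ℝ)..(π/4), NP n Q*exp (H0 n u)*(QQ n u (1-1/u^2)*exp (-(¦u^¥n*alf n u)*β^2) + QQ n u (1/2)*exp (-¦u^n*(kap n/2))) := by
      refine integral_mono_on ¶ (cii (by have := Q.continuous; have := eI_cont; fun_prop) _ _) (cii ¢ _ _) fun β hβ => ?_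
      refine (k1 N hN Q hPc β hβ.1 hβ.2).trans ?_
      rw [← mul_assoc]
      exact mlm (k2 β hβ.1 hβ.2) ¶
    rw [iicm] at this
    have h3 := mlm k3 (show 0 ≤ NP n Q*exp (H0 n u) by positivity)
    linarith
  rw [hN2]
  have hf2 : 2*(2000*(NP n Q*(exp (H0 n u)*exp (-¦u^n*(kap n/2))))) ≤ NP n Q*(exp (H0 n u)*((¦u^n)⁻¹*(ε/2))) := by
    have h0 : ¦u^n ≠ 0 := ¶
    calc _ = NP n Q*(exp (H0 n u)*((¦u^n)⁻¹*(4000*(¦u^n*exp (-¦u^n*(kap n/2)))))) := by field_simp; ring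
      _ ≤ _ := by gcongr
  have hn2 : NP n Q*(exp (H0 n u)*((¦u^n)⁻¹*Lb n u)) ≤ NP n Q*(exp (H0 n u)*((¦u^n)⁻¹*(G0 n+ε/2))) := by gcongr
  have e : NP n Q*(exp (H0 n u)*((¦u^n)⁻¹*(G0 n+ε))) = NP n Q*(exp (H0 n u)*((¦u^n)⁻¹*(ε/2))) + NP n Q*(exp (H0 n u)*((¦u^n)⁻¹*(G0 n+ε/2))) := by ring
  rw [e]; linarith
lemma hilb {H : Type*} [NormedAddCommGroup H] [InnerProductSpace ℂ H] [CompleteSpace H] {p q : ℕ → H} (hp : Orthonormal ℂ p) (hq : Orthonormal ℂ q)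
    {c b : ℕ → ℝ} (c0 : ∀ l, 0 ≤ c l) (hc : ∀ k j, ‖inner ℂ (p k) (q j)‖ ≤ c (k+j)) (cs : Summable c) (cη : tsum c ≤ 1/2)
    {g : H} (hg : ∀ k, inner ℂ (p k) g = 0) (hb : ∀ j, ‖inner ℂ (q j) g‖ ≤ b j) (bs : Summable b) :
    ∃ s : H, (∀ k, inner ℂ (p k) s = 0) ∧ (∀ j, inner ℂ (q j) s = 0) ∧ ‖g-s‖^2 ≤ 2*(tsum b)^2 := by
  set V0 := Submodule.span ℂ (Set.range p ∪ Set.range q) with hV0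
  set V := V0.topologicalClosure with hV
  haveI : CompleteSpace V := V0.isClosed_topologicalClosure.completeSpace_coe
  have b0 : 0 ≤ tsum b := tsum_nonneg fun j => (norm_nonneg _).trans (hb j)
  have h0 : ∀ f ∈ V0, ‖inner ℂ f g‖ ≤ √2*tsum b*‖f‖ := by
    intro f hf
    rw [hV0, Submodule.span_union, Submodule.mem_sup] at hf
    obtain ⟨x, hx, y, hy, rfl⟩ := hf
    obtain ⟨α, rfl⟩ := Finsupp.mem_span_range_iff_exists_finsupp.1 hx
    obtain ⟨γ, rfl⟩ := Finsupp.mem_span_range_iff_exists_finsupp.1 hy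
    simp only [Finsupp.sum]
    set A := α.support
    set B := γ.support
    set x := ∑ k ∈ A, α k • p k with hxd
    set y := ∑ j ∈ B, γ j • q j with hyd
    have nx : ‖x‖^2 = ∑ k ∈ A, ‖α k‖^2 := by
      have := hp.inner_sum α α A
      rw [← hxd, inner_self_eq_norm_sq_to_K] at this
      have h2 : (((‖x‖^2:ℝ)):ℂ) = ((∑ k ∈ A, ‖α k‖^2 : ℝ):ℂ) := by
        push_cast; refine this.trans (sum_congr rfl fun k _ => ?_)
        rw [conj_mul']
      exact_mod_cast h2
    have ny : ‖y‖^2 = ∑ k ∈ B, ‖γ k‖^2 := by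
      have := hq.inner_sum γ γ B
      rw [← hyd, inner_self_eq_norm_sq_to_K] at this
      have h2 : (((‖y‖^2:ℝ)):ℂ) = ((∑ k ∈ B, ‖γ k‖^2 : ℝ):ℂ) := by
        push_cast; refine this.trans (sum_congr rfl fun k _ => ?_)
        rw [conj_mul']
      exact_mod_cast h2
    have csum : ∀ (k : ℕ) (F : Finset ℕ), ∑ j ∈ F, c (k+j) ≤ 1/2 := fun k F => by
      rw [show ∑ j ∈ F, c (k+j) = ∑ l ∈ F.map (addLeftEmbedding k), c l by rw [Finset.sum_map]; rfl]
      exact (cs.sum_le_tsum _ fun i _ => c0 i).trans cη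
    have nxy : ‖inner ℂ x y‖ ≤ 1/4*(‖x‖^2+‖y‖^2) := by
      have e1 : ‖inner ℂ x y‖ ≤ ∑ k ∈ A, ∑ j ∈ B, (c (k+j)*(‖α k‖^2/2)+c (k+j)*(‖γ j‖^2/2)) := by
        rw [hxd, hyd, sum_inner]
        refine (norm_sum_le _ _).trans (sum_le_sum fun k _ => ?_)
        rw [inner_sum]
        refine (norm_sum_le _ _).trans (sum_le_sum fun j _ => ?_)
        rw [inner_smul_left, inner_smul_right, norm_mul, norm_mul, RCLike.norm_conj]
        have h1 : ‖α k‖*(‖γ j‖*‖inner ℂ (p k) (q j)‖) ≤ ‖α k‖*(‖γ j‖*c (k+j)) := by gcongr; exact hc k j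
        have h2 := mul_nonneg (c0 (k+j)) (sq_nonneg (‖α k‖-‖γ j‖))
        nlinarith only [h1, h2]
      have e2 : ∑ k ∈ A, ∑ j ∈ B, c (k+j)*(‖α k‖^2/2) ≤ ∑ k ∈ A, 1/2*(‖α k‖^2/2) :=
        sum_le_sum fun k _ => by rw [← sum_mul]; gcongr; exact csum k B
      have e3 : ∑ k ∈ A, ∑ j ∈ B, c (k+j)*(‖γ j‖^2/2) ≤ ∑ j ∈ B, 1/2*(‖γ j‖^2/2) := by
        rw [Finset.sum_comm]
        exact sum_le_sum fun j _ => by rw [← sum_mul]; gcongr; simp_rw [add_comm _ j]; exact csum j A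
      simp_rw [sum_add_distrib] at e1
      rw [← mul_sum, ← sum_div, ← nx] at e2
      rw [← mul_sum, ← sum_div, ← ny] at e3
      linarith
    have nf : ‖y‖^2 ≤ 2*‖x+y‖^2 := by
      have h1 := norm_add_sq (𝕜 := ℂ) x y
      have h2 := (abs_le.1 (abs_re_le_norm (inner ℂ x y))).1
      have h3 : RCLike.re (inner ℂ x y) = (inner ℂ x y).re := rfl
      rw [h3] at h1
      nlinarith [sq_nonneg ‖x‖]
    have ny2 : ‖y‖ ≤ √2*‖x+y‖ := by
      rw [← sqrt_sq (norm_nonneg (x+y)), ← sqrt_mul ¡]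
      exact le_sqrt_of_sq_le nf
    have xg : inner ℂ x g = 0 := by
      rw [hxd, sum_inner]; exact sum_eq_zero fun k _ => by rw [inner_smul_left, hg, mul_zero]
    rw [inner_add_left, xg, zero_add]
    have e4 : ‖inner ℂ y g‖ ≤ ∑ j ∈ B, ‖y‖*b j := by
      conv_lhs => rw [hyd]
      rw [sum_inner]
      refine (norm_sum_le _ _).trans (sum_le_sum fun j hj => ?_)
      rw [inner_smul_left, norm_mul, RCLike.norm_conj]
      have : ‖γ j‖ ≤ ‖y‖ := by
        refine abs_le_of_sq_le_sq' ?_ (norm_nonneg _) |>.2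
        rw [ny]; exact Finset.single_le_sum (f := fun j => ‖γ j‖^2) (fun _ _ => sq_nonneg _) hj
      exact mul_le_mul this (hb j) (norm_nonneg _) (norm_nonneg _)
    rw [← mul_sum] at e4
    calc _ ≤ _ := e4
      _ ≤ (√2*‖x+y‖)*tsum b := by
        gcongr
        · exact Finset.sum_nonneg fun j _ => (norm_nonneg _).trans (hb j)
        · exact bs.sum_le_tsum _ fun j _ => (norm_nonneg _).trans (hb j)
      _ = _ := by ring
  have h1 : ∀ f ∈ V, ‖inner ℂ f g‖ ≤ √2*tsum b*‖f‖ := by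
    intro f hf
    have hcl : IsClosed {f : H | ‖inner ℂ f g‖ ≤ √2*tsum b*‖f‖} := isClosed_le ¢ ¢
    exact closure_minimal (fun f hf => h0 f hf) hcl hf
  set P := V.starProjection g with hP
  have hPV : P ∈ V := V.starProjection_apply_mem g
  have hor : g-P ∈ Vᗮ := V.sub_starProjection_mem_orthogonal g
  have hsub : ∀ x ∈ Set.range p ∪ Set.range q, inner ℂ x (g-P) = 0 := fun x hx =>
    (Submodule.mem_orthogonal _ _).1 hor x (V0.le_topologicalClosure (Submodule.subset_span hx))
  refine ⟨g-P, fun k => hsub _ (Or.inl ⟨k, rfl⟩), fun k => hsub _ (Or.inr ⟨k, rfl⟩), ?_⟩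
  rw [sub_sub_cancel]
  have h2 := h1 P hPV
  have h3 : inner ℂ P g = inner ℂ P P := by
    rw [← sub_eq_zero, ← inner_sub_right]; exact (Submodule.mem_orthogonal _ _).1 hor P hPV
  rw [h3, inner_self_eq_norm_sq_to_K] at h2
  have h4 : ‖P‖^2 ≤ √2*tsum b*‖P‖ := by simpa using h2
  have h5 : ‖P‖ ≤ √2*tsum b := by
    rcases eq_or_lt_of_le (norm_nonneg P) with h | h
    · rw [← h]; positivity
    · nlinarith
  calc ‖P‖^2 ≤ (√2*tsum b)^2 := by gcongr
    _ = _ := by rw [mul_pow, sq_sqrt ¡]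
local instance fact2pi : Fact (0 < 2*π) := ⟨two_pi_pos⟩
abbrev CC := C(AddCircle (2*π), ℂ)
abbrev LL := Lp ℂ 2 (AddCircle.haarAddCircle (T := 2*π))
def tl (f : CC) : LL := ContinuousMap.toLp 2 AddCircle.haarAddCircle ℂ f
lemma ip (f g : CC) : inner ℂ (tl f) (tl g) = (1/(2*π):ℝ) • ∫ φ in -π..π, g (φ:ℝ) * cj (f (φ:ℝ)) := by
  unfold tl
  rw [ContinuousMap.inner_toLp, AddCircle.integral_haarAddCircle, ← AddCircle.intervalIntegral_preimage (2*π) (-π)]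
  rw [show -π+2*π = π by ring, one_div]
lemma fe (k : ℤ) (φ : ℝ) : (fourier k : CC) (φ:ℝ) = eI (k*φ) := by
  rw [fourier_coe_apply]; unfold eI; congr 1
  have : (π:ℂ) ≠ 0 := by exact_mod_cast pi_ne_zero
  push_cast; field_simp
def cm (F : ℂ → ℂ) (hF : ContinuousOn F (closedBall 0 1)) : CC where
  toFun x := F (fourier 1 x)
  continuous_toFun := hF.comp_continuous (fourier 1).continuous fun x => by
    rw [fourier_one]; simpa using (Circle.norm_coe _).le
lemma cme {F : ℂ → ℂ} (hF : ContinuousOn F (closedBall 0 1)) (φ : ℝ) : cm F hF (φ:ℝ) = F (eI φ) := by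
  show F ((fourier 1 : CC) (φ:ℝ)) = _
  rw [fe]; simp
lemma tl_fourier (k : ℤ) : tl (fourier k) = fourierLp 2 k := rfl
lemma tl_mul_le (v f : CC) : ‖tl (v*f)‖ ≤ ‖v‖*‖tl f‖ := by
  refine Lp.norm_le_mul_norm_of_ae_le_mul ?_
  filter_upwards [ContinuousMap.coeFn_toLp (p := 2) (𝕜 := ℂ) AddCircle.haarAddCircle (v*f),
    ContinuousMap.coeFn_toLp (p := 2) (𝕜 := ℂ) AddCircle.haarAddCircle f] with x h1 h2
  unfold tl
  rw [h1, h2, ContinuousMap.mul_apply, norm_mul]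
  exact mrm (v.norm_coe_le_norm x) (norm_nonneg _)
lemma claim (v h : CC) (s : LL) (H : ∀ i, inner ℂ (tl (fourier i)) (tl h) = 0 ∨ inner ℂ (tl (v*fourier i)) s = 0) :
    inner ℂ (tl (v*h)) s = 0 := by
  have h1 := hasSum_fourier_series_L2 (tl h)
  have e : ∀ i, fourierCoeff (tl h) i = inner ℂ (tl (fourier i)) (tl h) := fun i => by
    rw [← fourierBasis_repr, HilbertBasis.repr_apply_apply, coe_fourierBasis]; rfl
  simp only [e] at h1
  have h2 : HasSum (fun i => (inner ℂ (tl (fourier i)) (tl h)) • tl (v*fourier i)) (tl (v*h)) := by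
    unfold HasSum at h1 ⊢
    rw [tendsto_iff_norm_sub_tendsto_zero] at h1 ⊢
    refine squeeze_zero (fun _ => norm_nonneg _) (fun t => ?_) (by simpa using h1.const_mul ‖v‖)
    have := tl_mul_le v (∑ i ∈ t, (inner ℂ (tl (fourier i)) (tl h)) • fourier i - h)
    have e2 : tl (v*(∑ i ∈ t, (inner ℂ (tl (fourier i)) (tl h)) • fourier i - h)) =
        ∑ i ∈ t, (inner ℂ (tl (fourier i)) (tl h)) • tl (v*fourier i) - tl (v*h) := by
      unfold tl; simp only [mul_sub, map_sub, mul_sum, map_sum, mul_smul_comm, map_smul]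
    have e3 : tl (∑ i ∈ t, (inner ℂ (tl (fourier i)) (tl h)) • fourier i - h) =
        ∑ i ∈ t, (inner ℂ (tl (fourier i)) (tl h)) • fourierLp 2 i - tl h := by
      simp only [← tl_fourier]
      unfold tl; simp only [map_sub, map_sum, map_smul]
    rw [e2, e3] at this
    exact this
  have h3 := h2.mapL (innerSL ℂ s)
  have h4 : inner ℂ s (tl (v*h)) = 0 := by
    refine h3.unique (hasSum_zero.congr_fun ?_) |>.trans rfl
    intro i
    rcases H i with h | h
    · simp [h]
    · simp [inner_eq_zero_symm.1 h]
  exact inner_eq_zero_symm.1 h4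
lemma hz {F : ℂ → ℂ} (hF : DiffContOnCl ℂ F (ball 0 1)) {k : ℤ} (hk : 0 < k) :
    ∫ φ in -π..π, F (eI φ)*eI (k*φ) = 0 := by
  obtain ⟨m, rfl⟩ := Int.eq_ofNat_of_zero_le hk.le
  have h : DiffContOnCl ℂ (fun z => F z*z^m) (ball 0 1) :=
    hF.smul (Differentiable.diffContOnCl (f := fun z : ℂ => z^m) ¢)
  have := cauchy_disk h (ζ := 0) (by simp)
  have hm : m ≠ 0 := by rintro rfl; simp at hk
  simp only [zero_mul, sub_zero, div_one, mul_one, zero_pow hm, mul_zero] at this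
  rw [← this]
  refine integral_congr fun φ _ => ?_
  simp only [eI, ← cxm]; congr 2; push_cast; ring
lemma eI_conj (x : ℝ) : cj (eI x) = eI (-x) := (eI_neg x).symm
lemma eI_add (x y : ℝ) : eI x*eI y = eI (x+y) := by
  unfold eI; rw [← cxa]; push_cast; ring_nf
theorem LEMA {D Di g : ℂ → ℂ} (hD : DiffContOnCl ℂ D (ball 0 1))
    (hDi : ContinuousOn Di (closedBall 0 1)) (h1 : ∀ z ∈ closedBall (0:ℂ) 1, D z*Di z = 1)
    (hg : DiffContOnCl ℂ g (ball 0 1)) {c b : ℕ → ℝ}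
    (hc : ∀ l : ℕ, ‖∫ φ in -π..π, eI (2*N*φ)*Di (eI φ)*cj (D (eI φ))*eI ((l+2)*φ)‖ ≤ 2*π*c l)
    (hb : ∀ j : ℕ, ‖∫ φ in -π..π, eI (2*N*φ)*Di (eI φ)*cj (D (eI φ))*eI ((j+1)*φ)*cj (g (eI φ))‖ ≤ 2*π*b j)
    (cs : Summable c) (cη : tsum c ≤ 1/2) (bs : Summable b) :
    ∃ S : Polynomial ℂ, S.natDegree ≤ 2*N ∧ ∫ φ in -π..π, ‖g (eI φ) - S.eval (eI φ)*Di (eI φ)‖^2 ≤ 4*π*(tsum b)^2 := by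
  have hDc : ContinuousOn D (closedBall 0 1) := hD.continuousOn_ball
  have hgc : ContinuousOn g (closedBall 0 1) := hg.continuousOn_ball
  have pm : ∀ φ : ℝ, eI φ ∈ closedBall (0:ℂ) 1 := fun φ => by simp [eI_norm]
  have h1' : ∀ φ : ℝ, D (eI φ)*Di (eI φ) = 1 := fun φ => h1 _ (pm φ)
  have h1c : ∀ φ : ℝ, cj (D (eI φ))*cj (Di (eI φ)) = 1 := fun φ => by
    rw [← map_mul, h1', map_one]
  set dC := cm D hDc
  set diC := cm Di hDi
  set gC := cm g hgc
  set vt : CC := fourier (2*N)*diC*star dC with hvt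
  have ve : ∀ φ : ℝ, vt (φ:ℝ) = eI (2*N*φ)*Di (eI φ)*cj (D (eI φ)) := fun φ => by
    simp only [hvt, ContinuousMap.mul_apply, ContinuousMap.star_apply, fe, diC, dC, cme]; push_cast; rfl
  have vu : ∀ φ : ℝ, vt (φ:ℝ)*cj (vt (φ:ℝ)) = 1 := fun φ => by
    rw [ve]; simp only [map_mul, conj_conj, eI_conj]
    linear_combination (eI (2*N*φ)*eI (-(2*N*φ)))*((Di (eI φ)*D (eI φ))*h1c φ+h1' φ)+eI_mul (2*N*φ)
  have pi0 := pi_pos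
  have inn : ∀ {x : ℂ} {y : ℝ}, ‖x‖ ≤ 2*π*y → ‖(1/(2*π):ℝ)•x‖ ≤ y := fun {x y} h => by
    rw [norm_smul, norm_of_nonneg ¶, one_div_mul_eq_div, div_le_iff₀ ¶]; linarith
  have sz : ∀ {x : ℂ}, x = 0 → (1/(2*π):ℝ)•x = 0 := fun {x} h => by rw [h, smul_zero]
  have hp : Orthonormal ℂ (fun k : ℕ => tl (fourier (-((k:ℤ)+1)))) :=
    orthonormal_fourier.comp (fun k : ℕ => -((k:ℤ)+1)) (fun a b h => by simpa using h)
  have hq : Orthonormal ℂ (fun k : ℕ => tl (vt*fourier ((k:ℤ)+1))) := by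
    have h0 : Orthonormal ℂ (fun k : ℕ => tl (fourier ((k:ℤ)+1))) :=
      orthonormal_fourier.comp (fun k : ℕ => ((k:ℤ)+1)) (fun a b h => by simpa using h)
    rw [orthonormal_iff_ite] at h0 ⊢
    intro i j
    rw [← h0 i j, ip, ip]; congr 1
    refine integral_congr fun φ _ => ?_
    simp only [ContinuousMap.mul_apply, map_mul]
    linear_combination ((fourier ((j:ℤ)+1) : CC) (φ:ℝ)*cj ((fourier ((i:ℤ)+1) : CC) (φ:ℝ)))*vu φ
  obtain ⟨s, s1, s2, s3⟩ := hilb hp hq (c := c) (b := b) (g := tl gC) (fun l => by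
      have := (norm_nonneg _).trans (hc l)
      by_contra! h; nlinarith) (fun k j => by
      rw [ip]
      refine inn (le_trans (le_of_eq ?_) (hc (k+j)))
      congr 1
      refine integral_congr fun φ _ => ?_
      simp only [ContinuousMap.mul_apply, ve, fe, eI_conj]
      rw [mul_assoc, eI_add]; congr 2; push_cast; ring) cs cη (fun k => by
      rw [ip]; simp only [fe, eI_conj, gC, cme]
      refine sz ((integral_congr fun φ _ => ?_).trans (hz hg (k := (k:ℤ)+1) ¶))
      congr 2; push_cast; ring) (fun j => by
      rw [← inner_conj_symm, RCLike.norm_conj, ip]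
      refine inn (le_trans (le_of_eq ?_) (hb j))
      congr 1
      refine integral_congr fun φ _ => ?_
      simp only [ContinuousMap.mul_apply, ve, fe, gC, cme]; push_cast; ring) bs
  have k1 : ∀ k : ℤ, k < 0 → inner ℂ (tl (star dC*fourier k)) s = 0 := fun k hk => by
    have := claim 1 (star dC*fourier k) s fun i => by
      rcases lt_or_ge i 0 with hi | hi
      · right
        obtain ⟨m, hm⟩ := Int.eq_ofNat_of_zero_le (show 0 ≤ -i-1 by omega)
        have := s1 m
        rw [one_mul, show i = -((m:ℤ)+1) by omega]; exact this
      · left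
        rw [← inner_conj_symm, ip]
        rw [map_eq_zero]
        refine sz ((integral_congr fun φ _ => ?_).trans (hz hD (k := i-k) ¿))
        simp only [ContinuousMap.mul_apply, ContinuousMap.star_apply, fe, dC, cme, map_mul, RCLike.star_def, conj_conj, eI_conj]
        rw [mul_left_comm, eI_add]; congr 2; push_cast; ring
    rwa [one_mul] at this
  have k2 : ∀ k : ℤ, 2*N < k → inner ℂ (tl (star dC*fourier k)) s = 0 := fun k hk => by
    have := claim vt (dC*fourier (k-2*N)) s fun i => by
      rcases lt_or_ge 0 i with hi | hi
      · right
        obtain ⟨m, hm⟩ := Int.eq_ofNat_of_zero_le (show 0 ≤ i-1 by omega)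
        have := s2 m
        rw [show i = (m:ℤ)+1 by omega]; exact this
      · left
        rw [ip]
        refine sz ((integral_congr fun φ _ => ?_).trans (hz hD (k := k-2*N-i) ¿))
        simp only [ContinuousMap.mul_apply, fe, dC, cme, eI_conj]
        rw [mul_assoc, eI_add]; congr 2; push_cast; ring
    rw [← this]; congr 2
    ext x
    induction x using QuotientAddGroup.induction_on with
    | H φ =>
      change (star dC*fourier k : CC) ((φ:ℝ) : AddCircle (2*π)) = (vt*(dC*fourier (k-2*N)) : CC) ((φ:ℝ) : AddCircle (2*π))
      simp only [ContinuousMap.mul_apply, ve, fe, dC, cme, ContinuousMap.star_apply, RCLike.star_def]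
      have : eI (k*φ) = eI (2*N*φ)*eI (((k-2*N:ℤ):ℝ)*φ) := by rw [eI_add]; congr 1; push_cast; ring
      rw [this]
      linear_combination (-(eI (2*N*φ)*eI (((k-2*N:ℤ):ℝ)*φ)*cj (D (eI φ))))*h1' φ
  let S : Polynomial ℂ := ∑ k ∈ range (2*N+1), Polynomial.C (inner ℂ (tl (star dC*fourier (k:ℤ))) s)*Polynomial.X^k
  let SC : CC := ∑ k ∈ range (2*N+1), (inner ℂ (tl (star dC*fourier (k:ℤ))) s) • fourier (k:ℤ)
  have Se : ∀ φ : ℝ, SC (φ:ℝ) = S.eval (eI φ) := fun φ => by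
    simp only [SC, S, ContinuousMap.sum_apply, ContinuousMap.smul_apply, Polynomial.eval_finsetSum, Polynomial.eval_mul,
      Polynomial.eval_C, Polynomial.eval_pow, Polynomial.eval_X, smul_eq_mul, fe]
    refine sum_congr rfl fun k _ => ?_
    congr 1; unfold eI; rw [← cxm]; congr 1; push_cast; ring
  have od : ∀ k l : ℤ, inner ℂ (tl (star dC*fourier k)) (tl (diC*fourier l)) = if k = l then 1 else 0 := fun k l => by
    rw [← (orthonormal_iff_ite.1 (orthonormal_fourier (T := 2*π))) k l, ← tl_fourier, ← tl_fourier, ip, ip]; congr 1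
    refine integral_congr fun φ _ => ?_
    simp only [ContinuousMap.mul_apply, fe, dC, diC, cme, ContinuousMap.star_apply, RCLike.star_def, map_mul, conj_conj]
    linear_combination (eI (l*φ)*cj (eI (k*φ)))*h1' φ
  have k3 : ∀ k : ℤ, inner ℂ (tl (star dC*fourier k)) (s - tl (diC*SC)) = 0 := fun k => by
    have e : tl (diC*SC) = ∑ k ∈ range (2*N+1), (inner ℂ (tl (star dC*fourier (k:ℤ))) s) • tl (diC*fourier (k:ℤ)) := by
      unfold tl SC; simp only [mul_sum, map_sum, mul_smul_comm, map_smul]; rfl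
    rw [inner_sub_right, e, inner_sum]
    simp only [inner_smul_right, od, mul_ite, mul_one, mul_zero]
    by_cases h : 0 ≤ k ∧ k ≤ 2*N
    · obtain ⟨m, rfl⟩ := Int.eq_ofNat_of_zero_le h.1
      have : m ∈ range (2*N+1) := by simp; omega
      simp only [Nat.cast_inj, Finset.sum_ite_eq, this, if_true, sub_self]
    · rw [sum_eq_zero, sub_zero]
      · rcases lt_or_ge k 0 with h2 | h2
        · exact k1 k h2
        · exact k2 k ¿
      · intro j hj
        rw [if_neg]; simp at hj; omega
  have k4 : s = tl (diC*SC) := by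
    rw [← sub_eq_zero]
    refine (fourierBasis (T := 2*π)).repr.map_eq_zero_iff.1 (lp.ext (funext fun k => ?_))
    rw [HilbertBasis.repr_apply_apply, coe_fourierBasis, ← tl_fourier]
    have := claim (star dC) (star diC*fourier k) _ fun i => Or.inr (k3 i)
    rw [← mul_assoc] at this
    rw [show star dC*star diC = 1 by
      ext x
      induction x using QuotientAddGroup.induction_on with
      | H φ =>
        change (star dC*star diC : CC) ((φ:ℝ) : AddCircle (2*π)) = 1
        simpa only [ContinuousMap.mul_apply, dC, diC, cme, ContinuousMap.star_apply, RCLike.star_def] using h1c φ, one_mul] at this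
    simpa using this
  refine ⟨S, ?_, ?_⟩
  · refine Polynomial.natDegree_sum_le_of_forall_le _ _ fun k hk => (Polynomial.natDegree_C_mul_X_pow_le _ _).trans ?_
    simp at hk; omega
  · have e : tl gC - s = tl (gC - diC*SC) := by rw [k4]; unfold tl; rw [map_sub]
    rw [e] at s3
    have e2 : ((‖tl (gC - diC*SC)‖^2:ℝ):ℂ) = ((1/(2*π)*∫ φ in -π..π, ‖g (eI φ) - S.eval (eI φ)*Di (eI φ)‖^2 : ℝ):ℂ) := by
      have := inner_self_eq_norm_sq_to_K (𝕜 := ℂ) (tl (gC - diC*SC))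
      push_cast at this ⊢
      refine this.symm.trans ?_
      rw [ip, ← intervalIntegral.integral_ofReal, Complex.real_smul]
      push_cast; congr 1
      refine integral_congr fun φ _ => ?_
      simp only [Pi.sub_apply, Pi.mul_apply, Se, gC, diC, cme, Complex.mul_conj, normSq_eq_norm_sq]
      push_cast; rw [mul_comm (S.eval _)]
    rw [Complex.ofReal_inj.1 e2, one_div_mul_eq_div, div_le_iff₀ ¶] at s3
    linarith
def Di (n : ℕ) (a κ K : ℝ) (z : ℂ) : ℂ := cexp (-((a:ℂ)^£n*Eh n z/2))*sq1 (κ*z)*cexp (K/4*(1+z))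
def Df (n : ℕ) (a κ K : ℝ) (z : ℂ) : ℂ := cexp ((a:ℂ)^£n*Eh n z/2)*(1/sq1 (κ*z))*cexp (-(K/4*(1+z)))
def tau (κ K : ℝ) (s : ℂ) : ℂ := sq1 (κ*cexp (-s))/sq1 (κ*cexp s)*cexp (K/4*(cexp (-s)-cexp s))
def VT (n N : ℕ) (a κ K φ : ℝ) : ℂ := eI (2*N*φ)*Di n a κ K (eI φ)*cj (Df n a κ K (eI φ))
lemma sq1_ne (h : ‖z‖ < 1) : sq1 z ≠ 0 := fun h0 => by
  have := sq1_sq z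
  rw [h0] at this
  exact slitPlane_ne_zero (one_add_slit h) (by rw [← this]; simp)
lemma sq1_diff (h : ‖z‖ < 1) : DifferentiableAt ℂ sq1 z := by
  unfold sq1; exact DifferentiableAt.cpow ¢ ¢ (one_add_slit h)
lemma sq1_conj (h : ‖z‖ < 1) : cj (sq1 z) = sq1 (cj z) := by
  unfold sq1
  have := Complex.conj_cpow (1+z) (((2:ℕ):ℂ)⁻¹) (Complex.slitPlane_arg_ne_pi (one_add_slit h))
  rw [map_inv₀, map_natCast, map_add, map_one] at this; exact this.symm
section
variable {κ : ℝ} (k0 : 0 < κ) (k1 : κ < 1)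
include k0 k1
lemma kz (h : ‖z‖ ≤ 1) : ‖(κ:ℂ)*z‖ < 1 := by
  rw [norm_mul, cno k0.le]; nlinarith
lemma Df_mul (n : ℕ) (a K : ℝ) (h : ‖z‖ ≤ 1) : Df n a κ K z*Di n a κ K z = 1 := by
  have := sq1_ne (kz k0 k1 h)
  have e1 := cxa ((a:ℂ)^£n*Eh n z/2) (-((a:ℂ)^£n*Eh n z/2))
  have e2 := cxa (-((K:ℂ)/4*(1+z))) (K/4*(1+z))
  rw [add_neg_cancel, Complex.exp_zero] at e1
  rw [neg_add_cancel, Complex.exp_zero] at e2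
  unfold Df Di
  calc _ = (cexp ((a:ℂ)^£n*Eh n z/2)*cexp (-((a:ℂ)^£n*Eh n z/2)))*
      (cexp (-((K:ℂ)/4*(1+z)))*cexp (K/4*(1+z)))*((1/sq1 (κ*z))*sq1 (κ*z)) := by ring
    _ = 1 := by rw [← e1, ← e2]; field_simp
lemma DD_diff (n : ℕ) (a K : ℝ) : DiffContOnCl ℂ (Df n a κ K) (ball 0 1) ∧ DiffContOnCl ℂ (Di n a κ K) (ball 0 1) := by
  have hc : ∀ z ∈ closedBall (0:ℂ) 1, ‖(κ:ℂ)*z‖ < 1 := fun z hz => kz k0 k1 (by simpa using hz)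
  have h2 : ContinuousOn (fun z:ℂ => sq1 (κ*z)) (closedBall 0 1) :=
    sq1_cont.comp ¢ fun z hz => by simpa using (hc z hz).le
  have h3 := Eh_cont n
  have h4 : ∀ z ∈ ball (0:ℂ) 1, DifferentiableAt ℂ (Eh n) z ∧ DifferentiableAt ℂ (fun z:ℂ => sq1 (κ*z)) z := fun z hz => by
    rw [mem_ball_zero_iff] at hz
    have h1 : -1 < z.re := by linarith [(abs_le.1 (abs_re_le_norm z)).1]
    obtain ⟨D, hD, -⟩ := Eh_deriv n h1
    exact ⟨hD.differentiableAt, (sq1_diff (kz k0 k1 hz.le)).comp (f := fun z:ℂ => (κ:ℂ)*z) z ¢⟩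
  have h5 : ContinuousOn (fun z:ℂ => 1/sq1 (κ*z)) (closedBall 0 1) := by
    exact ContinuousOn.div ¢ h2 fun z hz => sq1_ne (hc z hz)
  refine ⟨⟨fun z hz => ?_, ?_⟩, fun z hz => ?_, ?_⟩
  · obtain ⟨e1, e2⟩ := h4 z hz
    have e3 : DifferentiableAt ℂ (fun z:ℂ => 1/sq1 (κ*z)) z := by
      exact DifferentiableAt.div ¢ e2 (sq1_ne (hc z (Metric.ball_subset_closedBall hz)))
    exact DifferentiableAt.differentiableWithinAt (by unfold Df; fun_prop)
  · rw [closure_ball 0 one_ne_zero]; unfold Df; fun_prop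
  · obtain ⟨e1, e2⟩ := h4 z hz
    exact DifferentiableAt.differentiableWithinAt (by unfold Di; fun_prop)
  · rw [closure_ball 0 one_ne_zero]; unfold Di; fun_prop
lemma Df_conj (n : ℕ) (a K : ℝ) (h : ‖z‖ ≤ 1) : cj (Df n a κ K z) = Df n a κ K (cj z) := by
  unfold Df
  simp only [map_mul, ← exp_conj, map_div₀, map_one, sq1_conj (kz k0 k1 h), map_neg, map_add, conj_ofReal, map_ofNat, ← Eh_conj, map_pow]
lemma VT_eq (n N : ℕ) (a K : ℝ) (h : |φ| ≤ π) : VT n N a κ K (-φ) = vv n N a (φ*I)*tau κ K (φ*I) := by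
  have e0 : cexp (-(φ*I)) = eI (-φ) := by unfold eI; push_cast; ring_nf
  have e0' : cexp (φ*I) = eI φ := rfl
  have e1 : Eh n (eI (-φ)) + Eh n (eI φ) = 2*cch (φ*I/2)^£n := by
    have := Eh_re_circle n h
    rw [eI_neg, Eh_conj, add_comm, Complex.add_conj, eI, this, show (φ:ℂ)*I/2 = ((φ/2:ℝ):ℂ)*I by push_cast; ring, cosh_mul_I]
    push_cast; ring
  rw [VT, Df_conj k0 k1 n a K (eI_norm _).le, eI_conj, neg_neg, vv, tau, e0, e0', Di, Df, eI]
  rw [show ∀ x1 x2 x3 x4 x5 x6 x7 : ℂ, x1*(x2*x3*x4)*(x5*x6*x7) = (x1*x2*x4*x5*x7)*(x3*x6) by intros; ring, ← cxa, ← cxa,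
    ← cxa, ← cxa, mul_one_div, mul_left_comm, ← cxa, mul_comm]
  congr 2
  push_cast
  linear_combination ((a:ℂ)^£n/2)*e1
end
lemma VTI {a d L κ K B γ γ' : ℝ} (hD : CD n N a d L) (k0 : 0 < κ) {g : ℝ} (hg : 0 < g) (k1 : κ*exp d ≤ 1-g)
    (hK : 0 ≤ K) (hKd : K*d ≤ 1) (hB : 6*(1+1/g) ≤ B) {z w : ℂ} (h1 : 0 < γ) (h2 : 0 < γ') (hz : ‖z‖*exp d ≤ 1-γ) (hw : ‖w‖*exp d ≤ 1-γ') {l : ℕ} :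
    ‖∫ φ in -π..π, VT n N a κ K φ*eI (l*φ)*(kk z φ*kk w φ)‖ ≤ B/(γ*γ')*(2*π*(exp (-L)*exp (-(l*d))) + 2*a/(2*N+l)^2) := by
  have hd := hD.hd
  have hκ : κ < 1 := by nlinarith only [add_one_le_exp d, hd, k1, k0, hg]
  have e : ∫ φ in -π..π, VT n N a κ K φ*eI (l*φ)*(kk z φ*kk w φ) = ∫ φ in -π..π, vv n N a (φ*I)*
      ((fun s => tau κ K s*(cexp (-(l*s))*(1/((1-z*cexp s)*(1-w*cexp s))))) (φ*I)) := by
    have := integral_comp_neg (a := -π) (b := π) (fun φ => VT n N a κ K φ*eI (l*φ)*(kk z φ*kk w φ))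
    rw [neg_neg] at this
    rw [← this]
    refine integral_congr fun φ hφ => ?_
    rw [uIcc_of_le (by linarith [pi_pos])] at hφ
    simp only [VT_eq k0 hκ n N a K (abs_le.2 hφ), kk, neg_neg, eI]
    rw [show ((l*(-φ):ℝ):ℂ)*I = -(l*(φ*I)) by push_cast; ring]
    field_simp
  have gb : ∀ {y : ℂ} {c : ℝ}, ‖y‖*exp d ≤ 1-c → ∀ s : ℂ, s.re ≤ d → c ≤ ‖1-y*cexp s‖ := fun {y c} hy s hs =>
    norm_one_sub_ge (le_trans (mlm (by rw [norm_exp]; exact exp_le_exp.2 hs) (norm_nonneg _)) hy)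
  have hne : ∀ s : ℂ, s.re ≤ d → (1-z*cexp s)*(1-w*cexp s) ≠ 0 := fun s hs =>
    mul_ne_zero (norm_pos_iff.1 (h1.trans_le (gb hz s hs))) (norm_pos_iff.1 (h2.trans_le (gb hw s hs)))
  have kp : ∀ s : ℂ, s.re ≤ d → ‖(κ:ℂ)*cexp s‖ < 1 := fun s hs => by
    rw [norm_mul, cno k0.le, norm_exp]
    nlinarith [exp_le_exp.2 hs]
  have km : ∀ s : ℂ, 0 ≤ s.re → ‖(κ:ℂ)*cexp (-s)‖ < 1 := fun s hs => kp _ (by rw [neg_re]; linarith)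
  rw [e]
  refine cauchy2 hD (f := fun s => tau κ K s*(cexp (-(l*s))*(1/((1-z*cexp s)*(1-w*cexp s))))) (Nat.cast_nonneg l) ?_ (fun s hs0 hs => ?_) (fun s hs => ?_) fun x => ?_
  · have q1 : ContinuousOn (fun s:ℂ => sq1 (κ*cexp s)) (Rect d) := sq1_cont.comp ¢ fun s hs => by
      simpa using (kp s hs.1.2).le
    have q2 : ContinuousOn (fun s:ℂ => sq1 (κ*cexp (-s))) (Rect d) := sq1_cont.comp ¢ fun s hs => by
      simpa using (km s hs.1.1).le
    have q3 := q2.div q1 fun s hs => sq1_ne (kp s hs.1.2)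
    refine ContinuousOn.mul (q3.mul ¢) (ContinuousOn.mul ¢ (ContinuousOn.div ¢ ¢ fun s hs => hne s hs.1.2))
  · have q1 := (sq1_diff (kp s hs.le)).comp (f := fun s:ℂ => (κ:ℂ)*cexp s) s ¢
    have q2 := (sq1_diff (km s hs0.le)).comp (f := fun s:ℂ => (κ:ℂ)*cexp (-s)) s ¢
    have q3 := q2.div q1 (sq1_ne (kp s hs.le))
    exact DifferentiableAt.mul (q3.mul ¢) (DifferentiableAt.mul ¢ (DifferentiableAt.div ¢ ¢ (hne s hs.le)))
  · obtain ⟨hs0, hs1⟩ := hs.1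
    change 0 ≤ s.re at hs0
    change s.re ≤ d at hs1
    have t1 : ‖sq1 (κ*cexp (-s))/sq1 (κ*cexp s)‖ ≤ 2*(1+1/g) := by
      have t2 : ‖sq1 (κ*cexp (-s))/sq1 (κ*cexp s)‖^2 ≤ 2/g := by
        rw [norm_div, div_pow, sq1_norm, sq1_norm]
        have : ‖1+(κ:ℂ)*cexp (-s)‖ ≤ 2 := (norm_add_le _ _).trans (by rw [norm_one]; linarith [km s hs0])
        have h4 := gb (y := -κ) (c := g) (by rwa [norm_neg, cno k0.le]) s hs1
        rw [neg_mul, sub_neg_eq_add] at h4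
        gcongr
      have : 0 < 1/g := ¶
      refine le_of_sq_le_sq (t2.trans ?_) ¶
      rw [show 2/g = 2*(1/g) by ring]
      nlinarith
    have t3 : ‖cexp (K/4*(cexp (-s)-cexp s))‖ ≤ 3 := by
      rw [norm_exp, show (K:ℂ)/4 = ((K/4:ℝ):ℂ) by push_cast; rfl, re_ofReal_mul, Complex.sub_re, exp_re, exp_re, neg_re, Complex.neg_im, cos_neg]
      have c1 := neg_one_le_cos s.im
      have c2 : exp s.re - exp (-s.re) ≤ 4*d := by
        have := hD.hd1
        have e1 := exp_le_exp.2 hs1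
        have e2 := add_one_le_exp (-s.re)
        have e3 := abs_exp_sub_one_sub_id_le (x := d) (by rw [abs_of_pos hd]; exact this)
        have := (abs_le.1 e3).2
        nlinarith
      have c3 : 0 ≤ exp s.re - exp (-s.re) := by linarith [exp_le_exp.2 (show -s.re ≤ s.re by linarith)]
      have c4 : exp (-s.re)*cos s.im - exp s.re*cos s.im ≤ 4*d := by nlinarith
      refine (exp_le_exp.2 (show _ ≤ (1:ℝ) by nlinarith)).trans (by linarith [exp_one_lt_d9])
    have t4 : ‖cexp (-(l*s))‖ = exp (-(l*s.re)) := by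
      rw [norm_exp]; simp
    have g1 := gb hz s hs1
    have g2 := gb hw s hs1
    rw [norm_mul, norm_mul, t4, tau, norm_mul, norm_div (1:ℂ), norm_mul (1-_), norm_one]
    have hB0 : 2*(1+1/g)*3 ≤ B := §
    have : (0:ℝ) < 1+1/g := ¶
    calc _ ≤ (2*(1+1/g)*3)*(exp (-(l*s.re))*(1/(γ*γ'))) := by gcongr
      _ ≤ B*(exp (-(l*s.re))*(1/(γ*γ'))) := by gcongr
      _ = _ := by ring
  · have p1 : cexp (x+π*I) = cexp (x-π*I) := by
      rw [exp_eq_exp_iff_exists_int]; exact ⟨1, by push_cast; ring⟩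
    have p2 : cexp (-(x+π*I)) = cexp (-(x-π*I)) := by
      rw [Complex.exp_neg, p1, Complex.exp_neg]
    have p3 : cexp (-(l*(x+π*I))) = cexp (-(l*(x-π*I))) := by
      rw [exp_eq_exp_iff_exists_int]; exact ⟨-l, by push_cast; ring⟩
    simp only [tau, p1, p2, p3]
def kp (u : ℝ) : ℝ := 1-1/u^13
notation:max "VV" n:max N:max u:max => VT n N (u^12) (kp u) (u^9)
def r0 (u : ℝ) : ℝ := exp (-(2*arsinh (1/¦u)))
structure PP (n N : ℕ) (u : ℝ) : Prop where
  u1 : 100 ≤ u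
  hN : (N:ℝ) = Nf n u
  cd : CD n N ¦u (dd n u) u
  kd : kp u*exp (dd n u) ≤ 1-1/(2*u^13)
  rd : r0 u*exp (dd n u) ≤ 1-1/(4*¦u)
  Kd : u^9*dd n u ≤ 1
  e1 : u^23*(4*π*exp (-u)/dd n u+¦u/N) ≤ 1
  e2 : u^40*(2*π*exp (-u)+2*¦u/(2*N)^2) ≤ 1
lemma PP_ev (hn : 1 ≤ n) : ∀ᶠ u in atTop, ∀ N : ℕ, (N:ℝ) = Nf n u → PP n N u := by
  have hν := nu_pos n
  have t1 := (tendsto_pow_mul_exp_neg_atTop_nhds_zero (8*n+29)).const_mul (4*π)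
  have t2 := (tendsto_pow_mul_exp_neg_atTop_nhds_zero 40).const_mul (2*π)
  rw [mul_zero] at t1 t2
  filter_upwards [eventually_ge_atTop 100, CD_ev hn, t1.eventually_le_const (show (0:ℝ) < 1/2 by norm_num), t2.eventually_le_const (show (0:ℝ) < 1/2 by norm_num),
    eventually_ge_atTop (2/nu n)] with u h1 h2 h3 h4 h5 N hN
  have h6 := h2 N hN
  have u0 : 0 < u := §
  have hd := h6.hd
  have d14 : dd n u ≤ 1/u^14 := by
    unfold dd; exact odl ¶ (pnl § ¿)
  have N0 : (0:ℝ) < N := by exact_mod_cast h6.hN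
  have Nb : nu n*u^36 ≤ N := by
    rw [hN, Nf, ← pow_mul]
    have : u^36 ≤ u^(12*£n) := pnl § ¿
    have : 0 ≤ u^(8*n+8) := ¶
    nlinarith
  have d1 := h6.hd1
  have ed : exp (dd n u) ≤ 1+2*dd n u := by
    have := (abs_le.1 (abs_exp_sub_one_sub_id_le (x := dd n u) (by rw [abs_of_pos hd]; exact d1))).2
    nlinarith
  have νu : 2 ≤ nu n*u := by rw [div_le_iff₀ hν] at h5; linarith
  refine ⟨h1, hN, h6, ?_, ?_, ?_, ?_, ?_⟩
  · have e : (1:ℝ)/u^14 = (1/u^13)*(1/u) := by field_simp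
    have e' : (1:ℝ)/(2*u^13) = (1/u^13)/2 := by field_simp
    have e3 : 1/u ≤ 1/100 := odl ¡ h1
    have e4 : 0 < 1/u^13 := ¶
    have e5 : 1/u^13 ≤ 1 := by rw [div_le_one ¶]; exact one_le_pow₀ §
    rw [e'] ; unfold kp
    generalize 1/u^13 = t at *
    rw [e] at d14
    nlinarith only [d14, e3, e4, e5, ed, hd]
  · have ρ0 : 0 < 1/¦u := ¶
    have ρ1 : 1/¦u ≤ 1 := by rw [div_le_one ¶]; exact one_le_pow₀ §
    have a1 := arsinh_lb ρ0.le
    have a2 : (1/¦u)/2 ≤ 1/¦u/(1+1/¦u) := by gcongr; linarith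
    have d12 : dd n u ≤ (1/¦u)/2 := by
      refine d14.trans ?_
      rw [div_div]; exact odl ¶ (by rw [show u^14 = ¦u*u^2 by ring]; gcongr; nlinarith)
    unfold r0
    rw [← exp_add, show 1/(4*¦u) = (1/¦u)/4 by field_simp]
    generalize 1/¦u = ρ at *
    refine (exp_le_exp.2 (show _ ≤ -(ρ/2) by linarith)).trans ?_
    rw [exp_neg, inv_le_comm₀ (exp_pos _) §]
    refine le_trans ?_ (add_one_le_exp _)
    rw [inv_le_comm₀ § §, inv_le_iff_one_le_mul₀ §]
    nlinarith
  · calc u^9*dd n u ≤ u^9*(1/u^14) := by gcongr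
      _ = 1/u^5 := by field_simp
      _ ≤ 1 := by rw [div_le_one ¶]; exact one_le_pow₀ §
  · have e : u^23*(4*π*exp (-u)/dd n u+¦u/N) = 4*π*(u^(8*n+29)*exp (-u)) + u^35/N := by
      unfold dd; rw [show 8*n+29 = 23+(8*n+6) by omega, pow_add u 23]; field_simp
    have : u^35/N ≤ 1/2 := by
      rw [div_le_iff₀ N0]
      have : u^35*2 ≤ u^35*(nu n*u) := by gcongr
      nlinarith
    linarith
  · have e : u^40*(2*π*exp (-u)+2*¦u/(2*N)^2) = 2*π*(u^40*exp (-u)) + u^52/(2*N^2) := by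
      field_simp
    have : u^52/(2*N^2) ≤ 1/2 := by
      rw [div_le_iff₀ ¶]
      have h7 : u^26 ≤ N := by
        refine le_trans ?_ Nb
        rw [show nu n*u^36 = (nu n*u)*u^35 by ring]
        have : u^26 ≤ u^35 := pnl § ¿
        have : 0 < u^35 := ¶
        nlinarith
      calc u^52 = (u^26)^2 := by ring
        _ ≤ (N:ℝ)^2 := by gcongr
        _ = _ := by ring
    linarith
lemma bbsum {a d L : ℝ} (ha : 0 ≤ a) (hd : 0 < d) (hN : 0 < N) (k : ℕ) :
    ∑ l ∈ range k, (2*π*(exp (-L)*exp (-((l+1:ℕ)*d))) + 2*a/(2*N+(l+1:ℕ))^2) ≤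
      2*π*exp (-L)*((1-exp (-(k*d)))/d) + 2*a*(1/(2*N)-1/(2*N+k)) := by
  have N0 : (0:ℝ) < N := by exact_mod_cast hN
  induction k with
  | zero => simp
  | succ k ih =>
    rw [sum_range_succ]
    have e1 : exp (-((k+1:ℕ)*d)) ≤ (exp (-(k*d))-exp (-((k+1:ℕ)*d)))/d := by
      rw [le_div_iff₀ hd, show -(k*d) = -((k+1:ℕ)*d)+d by push_cast; ring, exp_add]
      nlinarith [add_one_le_exp d, exp_pos (-((k+1:ℕ)*d))]
    have e2 : 1/(2*N+(k+1:ℕ):ℝ)^2 ≤ 1/(2*N+k) - 1/(2*N+(k+1:ℕ)) := by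
      rw [div_sub_div _ _ ¶ ¶, div_le_div_iff₀ ¶ ¶]
      push_cast
      have : (0:ℝ) ≤ k := ¶
      nlinarith
    have e3 : 2*a/(2*N+(k+1:ℕ):ℝ)^2 = 2*a*(1/(2*N+(k+1:ℕ):ℝ)^2) := by ring
    have e4 := mlm e1 (show 0 ≤ 2*π*exp (-L) by positivity)
    have e5 := mlm e2 (show 0 ≤ 2*a by positivity)
    rw [e3]
    have e6 : (1-exp (-((k+1:ℕ)*d)))/d = (1-exp (-(k*d)))/d + (exp (-(k*d))-exp (-((k+1:ℕ)*d)))/d := by ring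
    rw [e6]
    linarith
section
variable {n N : ℕ} {u : ℝ} (hp : PP n N u)
include hp
lemma PP.kp0 : 0 < kp u ∧ kp u < 1 := by
  have u1 := hp.u1
  have : 1 < u^13 := one_lt_pow₀ § ¡
  have h2 : 1/u^13 < 1 := by rw [div_lt_one §]; exact this
  have : 0 < 1/u^13 := ¶
  unfold kp; constructor <;> linarith
lemma PP.VTc {γ γ' : ℝ} {z w : ℂ} (h1 : 0 < γ) (h2 : 0 < γ') (hz : ‖z‖*exp (dd n u) ≤ 1-γ) (hw : ‖w‖*exp (dd n u) ≤ 1-γ') (l : ℕ) :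
    ‖∫ φ in -π..π, VV n N u φ*eI (l*φ)*(kk z φ*kk w φ)‖ ≤ 18*u^13/(γ*γ')*(2*π*(exp (-u)*exp (-(l*dd n u))) + 2*¦u/(2*N+l)^2) := by
  have u1 := hp.u1
  have : 1 ≤ u^13 := one_le_pow₀ §
  exact VTI hp.cd hp.kp0.1 (g := 1/(2*u^13)) ¶ hp.kd ¶ hp.Kd (by rw [one_div_one_div]; linarith) h1 h2 hz hw
lemma PP.r00 : 0 < r0 u ∧ r0 u < 1 := by
  have := hp.u1
  refine ⟨exp_pos _, exp_lt_one_iff.2 ?_⟩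
  have := arsinh_pos_iff.2 (show 0 < 1/¦u by positivity)
  linarith
lemma PP.z0n : ‖(-(r0 u:ℂ))‖ = r0 u := by rw [norm_neg, cno hp.r00.1.le]
lemma PP.SEX : ∃ S : Polynomial ℂ, S.natDegree ≤ 2*N ∧
    ∫ φ in -π..π, ‖1/(1+r0 u*eI φ)-S.eval (eI φ)*Di n ¦u (kp u) (u^9) (eI φ)‖^2 ≤ u^6 := by
  have u1 := hp.u1
  obtain ⟨k0, k1⟩ := hp.kp0
  obtain ⟨r1, r2⟩ := hp.r00
  have hd := hp.cd.hd
  have N0 : (0:ℝ) < N := by exact_mod_cast hp.cd.hN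
  set M : ℕ → ℝ := fun l => 2*π*(exp (-u)*exp (-((l+1:ℕ)*dd n u))) + 2*¦u/(2*N+(l+1:ℕ))^2 with hM
  set η := 4*π*exp (-u)/dd n u+¦u/N with hη
  have M0 : ∀ l, 0 ≤ M l := fun l => by positivity
  have Mη : ∀ k, ∑ l ∈ range k, M l ≤ η := fun k => by
    refine (bbsum ¶ hd hp.cd.hN k).trans ?_
    have a1 : (1-exp (-(k*dd n u)))/dd n u ≤ 1/dd n u := by gcongr; linarith [exp_pos (-(k*dd n u))]
    have a2 := mlm a1 (show 0 ≤ 2*π*exp (-u) by positivity)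
    have a3 : 1/(2*(N:ℝ))-1/(2*N+k) ≤ 1/(2*N) := sub_le_self _ ¶
    have a4 := mlm a3 (show 0 ≤ 2*¦u by positivity)
    have a5 : 2*¦u*(1/(2*N)) = ¦u/N := by field_simp
    have a6 : 2*π*exp (-u)*(1/dd n u) ≤ 4*π*exp (-u)/dd n u := by
      rw [mul_one_div]; gcongr; linarith [pi_pos]
    rw [hη]; linarith
  have Ms := summable_of_sum_range_le M0 Mη
  have Mt := tsum_le_of_sum_range_le M0 Mη
  have hη1 : u^23*η ≤ 1 := hp.e1
  have k00 : ∀ φ, kk 0 φ = 1 := fun φ => by simp [kk]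
  have z1 : ‖(0:ℂ)‖*exp (dd n u) ≤ 1-1 := by simp
  have i0 : ∀ φ, cj (1/(1+r0 u*eI φ)) = kk (-(r0 u:ℂ)) φ := fun φ => by
    rw [kk, map_div₀, map_one, map_add, map_mul, eI_conj, map_one, conj_ofReal, neg_mul, sub_neg_eq_add]
  have hg : DiffContOnCl ℂ (fun z:ℂ => 1/(1+r0 u*z)) (ball 0 1) := by
    refine DifferentiableOn.diffContOnCl ?_
    rw [closure_ball 0 one_ne_zero]
    intro z hz
    rw [mem_closedBall_zero_iff] at hz
    have : (1:ℂ)+r0 u*z ≠ 0 := fun h => by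
      have : ‖(r0 u:ℂ)*z‖ = 1 := by rw [eq_neg_of_add_eq_zero_right h]; simp
      rw [norm_mul, cno r1.le] at this
      nlinarith
    exact DifferentiableAt.differentiableWithinAt (by fun_prop (disch := exact this))
  have Lm := LEMA (N := N) (DD_diff k0 k1 n ¦u (u^9)).1 (DD_diff k0 k1 n ¦u (u^9)).2.continuousOn_ball
    (fun z hz => Df_mul k0 k1 n _ _ (by simpa using hz)) hg
    (c := fun l => 18*u^13/(2*π)*M l) (b := fun l => 18*u^13*(4*¦u)/(2*π)*M l)
  have Lm2 := Lm (fun l => ?_) (fun l => ?_) (Ms.mul_left _) ?_ (Ms.mul_left _)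
  · obtain ⟨S, hS, hS2⟩ := Lm2
    refine ⟨S, hS, hS2.trans ?_⟩
    rw [tsum_mul_left]
    have t0 : 0 ≤ tsum M := tsum_nonneg M0
    have t1 : 18*u^13*(4*¦u)/(2*π)*tsum M ≤ 12*u^2 := by
      calc 18*u^13*(4*¦u)/(2*π)*tsum M ≤ 18*u^13*(4*¦u)/(2*3)*η := by gcongr; exact pi_gt_three.le
        _ = 12*u^2*(u^23*η) := by ring
        _ ≤ 12*u^2 := by nlinarith
    calc 4*π*(18*u^13*(4*¦u)/(2*π)*tsum M)^2 ≤ 4*4*(12*u^2)^2 := by gcongr; exact pi_le_four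
      _ = 2304*u^4 := by ring
      _ ≤ u^2*u^4 := by gcongr; nlinarith
      _ = u^6 := by ring
  · have h := hp.VTc one_pos one_pos z1 z1 (l+2)
    simp only [VT, k00, mul_one, div_one] at h
    push_cast at h
    refine h.trans ?_
    rw [show 2*π*(18*u^13/(2*π)*M l) = 18*u^13*M l by field_simp]
    simp only [hM]; push_cast
    gcongr <;> linarith
  · have h := hp.VTc (z := -(r0 u:ℂ)) (w := 0) (γ := 1/(4*¦u)) ¶ one_pos (by rw [hp.z0n]; exact hp.rd) z1 (l+1)
    simp only [VT, k00, mul_one] at h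
    simp only [i0]
    rw [show 2*π*(18*u^13*(4*¦u)/(2*π)*M l) = 18*u^13*(4*¦u)*M l by field_simp]
    rw [show 18*u^13/(1/(4*¦u)) = 18*u^13*(4*¦u) by field_simp] at h
    simpa [hM] using h
  · rw [tsum_mul_left]
    have t0 : 0 ≤ tsum M := tsum_nonneg M0
    calc 18*u^13/(2*π)*tsum M ≤ 18*u^13/(2*3)*η := by gcongr; exact pi_gt_three.le
      _ ≤ 1/2 := by
        have : 0 ≤ η := ¶
        have h3 : (6:ℝ) ≤ u^10 := le_trans § (le_self_pow₀ § ¡)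
        have : 6*(u^13*η) ≤ u^10*(u^13*η) := by gcongr
        nlinarith
end
lemma dick (k : ℕ) : ∃ p : Polynomial ℂ, p.natDegree ≤ k ∧ ∀ x y : ℂ, x*y = 1 → p.eval (x+y) = x^k+y^k := by
  refine ⟨Polynomial.dickson 1 1 k, ?_, fun x y h => Polynomial.dickson_one_one_eval_add_inv x y h k⟩
  induction k using Nat.strong_induction_on with
  | _ k ih =>
    match k with
    | 0 => rw [Polynomial.dickson_zero]; norm_num
    | 1 => rw [Polynomial.dickson_one]; simp
    | k+2 =>
      rw [Polynomial.dickson_add_two]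
      have h1 := ih (k+1) ¿
      have h0 := ih k ¿
      refine (Polynomial.natDegree_sub_le _ _).trans (max_le ?_ ?_)
      · exact Polynomial.natDegree_mul_le.trans (by rw [Polynomial.natDegree_X]; omega)
      · rw [map_one, one_mul]; omega
lemma refl_eval {S : Polynomial ℂ} (hS : S.natDegree ≤ 2*N) (hz : z ≠ 0) : (S.reflect (2*N)).eval z = z^(2*N)*S.eval z⁻¹ := by
  let _ : Invertible z⁻¹ := invertibleOfNonzero (inv_ne_zero hz)
  have := Polynomial.eval₂_reflect_mul_pow (RingHom.id ℂ) z⁻¹ (2*N) S hS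
  rw [Polynomial.eval₂_id, Polynomial.eval₂_id, invOf_eq_inv, inv_inv] at this
  rw [← this, mul_comm (Polynomial.eval _ _), ← mul_assoc, ← mul_pow, mul_inv_cancel₀ hz, one_pow, one_mul]
lemma SP {a : ℝ} (ha : a ≠ 0) {S : Polynomial ℂ} (hS : S.natDegree ≤ 2*N) : ∃ P : Polynomial ℂ, P.natDegree ≤ N ∧
    ∀ z : ℂ, z ≠ 0 → P.eval (xx a z)*z^N = S.eval z+(S.reflect (2*N)).eval z := by
  choose D hD hD2 using dick
  have ha' : (a:ℂ) ≠ 0 := by exact_mod_cast ha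
  refine ⟨∑ k ∈ range (2*N+1), Polynomial.C (S.coeff k)*(D ((k-N)+(N-k))).comp (Polynomial.C (4/(a:ℂ)^2)*Polynomial.X-Polynomial.C 2), ?_, fun z hz => ?_⟩
  · refine Polynomial.natDegree_sum_le_of_forall_le _ _ fun k hk => ?_
    rw [mem_range] at hk
    refine (Polynomial.natDegree_C_mul_le _ _).trans (Polynomial.natDegree_comp_le.trans ?_)
    have h1 : (Polynomial.C (4/(a:ℂ)^2)*Polynomial.X-Polynomial.C 2).natDegree ≤ 1 := by
      rw [Polynomial.natDegree_sub_C]; exact (Polynomial.natDegree_C_mul_le _ _).trans Polynomial.natDegree_X_le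
    have := hD ((k-N)+(N-k))
    calc _ ≤ N*1 := Nat.mul_le_mul ¿ h1
      _ = N := mul_one _
  · rw [refl_eval hS hz, Polynomial.eval_finsetSum, Polynomial.eval_eq_sum_range' (Nat.lt_succ_of_le hS), Polynomial.eval_eq_sum_range' (Nat.lt_succ_of_le hS),
      mul_sum, sum_mul, ← sum_add_distrib]
    refine sum_congr rfl fun k hk => ?_
    have hk := Nat.lt_succ_iff.1 (mem_range.1 hk)
    have e : 4/(a:ℂ)^2*xx a z-2 = z+z⁻¹ := by unfold xx; field_simp; ring
    simp only [Polynomial.eval_mul, Polynomial.eval_C, Polynomial.eval_comp, Polynomial.eval_sub, Polynomial.eval_X, e, hD2 _ z z⁻¹ (mul_inv_cancel₀ hz)]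
    have : (z^((k-N)+(N-k))+z⁻¹^((k-N)+(N-k)))*z^N = z^k+z^(2*N)*z⁻¹^k := by
      rcases le_total k N with h | h
      · obtain ⟨j, rfl⟩ := Nat.exists_eq_add_of_le h
        rw [show k-(k+j)+(k+j-k) = j by omega, inv_pow, inv_pow]; field_simp; ring
      · obtain ⟨j, rfl⟩ := Nat.exists_eq_add_of_le h
        obtain ⟨i, rfl⟩ := Nat.exists_eq_add_of_le (show j ≤ N by omega)
        rw [show (j+i)+j-(j+i)+((j+i)-((j+i)+j)) = j by omega, inv_pow, inv_pow]; field_simp; ring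
    rw [mul_assoc, this]; ring
lemma intLin {a b c d e f : ℝ → ℝ} {x y : ℝ} (ha : Continuous a) (hb : Continuous b) (hc : Continuous c) (hd : Continuous d) (he : Continuous e) (hf : Continuous f)
    (h : ∀ t, f t ≤ x*(a t+b t+2*c t)+y*(2*d t+2*e t)) : ∫ t in -π..π, f t ≤
      x*((∫ t in -π..π, a t)+(∫ t in -π..π, b t)+2*∫ t in -π..π, c t)+y*(2*(∫ t in -π..π, d t)+2*∫ t in -π..π, e t) := by
  have ii : ∀ {f : ℝ → ℝ}, Continuous f → IntervalIntegrable f volume (-π) π := fun h => h.intervalIntegrable _ _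
  refine (integral_mono_on (by linarith [pi_pos]) (ii hf) (ii ¢) fun t _ => h t).trans (le_of_eq ?_)
  rw [iia (ii ¢) (ii ¢), iicm, iicm,
    iia (ii ¢) (ii ¢), iia (ii ¢) (ii ¢),
    iia (ii ¢) (ii ¢)]
  simp only [iicm]
def Ebd (u : ℝ) : ℝ := (1+1/u)*(4*π/(1-r0 u^2)+2)+4*(1+u)*u^6
lemma PP.LOW1 (hp : PP n N u) : ∃ (P : Polynomial ℂ) (F : ℂ → ℂ), P.natDegree ≤ N ∧ DiffContOnCl ℂ F (ball 0 1) ∧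
    (∀ z : ℂ, z ≠ 0 → ‖z‖ ≤ 1 → P.eval (xx ¦u z)*z^N = F z*Df n ¦u (kp u) (u^9) z) ∧
    (∫ φ in -π..π, ‖F (eI φ)‖^2 ≤ Ebd u) ∧
    ∀ z : ℂ, ‖z‖*exp (dd n u) ≤ 1-1/(8*¦u) → ‖F z-1/(1+r0 u*z)‖ ≤ 3*u^9 := by
  have u1 := hp.u1
  obtain ⟨k0, k1⟩ := hp.kp0
  obtain ⟨r1, r2⟩ := hp.r00
  have hd := hp.cd.hd
  have hπ : -π ≤ π := by linarith [pi_pos]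
  obtain ⟨S, hS, hE⟩ := hp.SEX
  obtain ⟨P, hP, hP2⟩ := SP (a := ¦u) ¶ hS
  have cc := (DD_diff k0 k1 n ¦u (u^9))
  set F : ℂ → ℂ := fun z => (S.eval z+(S.reflect (2*N)).eval z)*Di n ¦u (kp u) (u^9) z with hF
  have Fd : DiffContOnCl ℂ F (ball 0 1) := by
    have : Differentiable ℂ (fun z => S.eval z+(S.reflect (2*N)).eval z) := ¢
    exact this.diffContOnCl.smul cc.2
  have circ : ∀ {G : ℂ → ℂ}, DiffContOnCl ℂ G (ball 0 1) → Continuous fun φ => G (eI φ) := fun h =>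
    h.continuousOn_ball.comp_continuous eI_cont fun φ => by simp [eI_norm]
  have c1 := circ cc.1
  have c2 := circ cc.2
  have cV : Continuous (VT n N ¦u (kp u) (u^9)) := by
    unfold VT
    exact ((eI_cont.comp (by fun_prop : Continuous fun φ:ℝ => 2*N*φ)).mul c2).mul (Complex.continuous_conj.comp c1)
  set z0 : ℂ := -(r0 u:ℂ) with hz0
  have hz0n : ‖z0‖ < 1 := by rw [hp.z0n]; exact r2
  have ck := kk_cont hz0n
  set E : ℝ → ℂ := fun φ => 1/(1+r0 u*eI φ)-S.eval (eI φ)*Di n ¦u (kp u) (u^9) (eI φ) with hEd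
  have g1 : ∀ φ, 1/(1+r0 u*eI φ) = kk z0 (-φ) := fun φ => by rw [kk, neg_neg, hz0, neg_mul, sub_neg_eq_add]
  have cE : Continuous E := by
    simp only [hEd, g1]
    have : Continuous fun φ => S.eval (eI φ) := S.continuous.comp eI_cont
    exact (ck.comp continuous_neg).sub (this.mul c2)
  have kc : ∀ φ, cj (kk z0 φ) = kk z0 (-φ) := fun φ => by
    rw [kk, kk, map_div₀, map_one, map_sub, map_mul, eI_conj, map_one, hz0, map_neg, conj_ofReal]
  have Vn : ∀ φ, ‖VV n N u φ‖ = 1 := fun φ => by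
    rw [VT, norm_mul, norm_mul, eI_norm, Complex.norm_conj, one_mul, ← norm_mul, mul_comm, Df_mul k0 k1 n _ _ (eI_norm φ).le, norm_one]
  have Fe : ∀ φ, F (eI φ) = kk z0 (-φ)+VV n N u φ*kk z0 φ - (E φ+VV n N u φ*E (-φ)) := fun φ => by
    have e1 : (eI φ)⁻¹ = eI (-φ) := by rw [eI_neg, ← Complex.inv_eq_conj (eI_norm φ)]
    have e2 : eI φ^(2*N) = eI (2*N*φ) := by unfold eI; rw [← cxm]; push_cast; ring_nf
    have e3 : VV n N u φ*Di n ¦u (kp u) (u^9) (eI (-φ)) = eI (2*N*φ)*Di n ¦u (kp u) (u^9) (eI φ) := by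
      rw [VT, Df_conj k0 k1 n _ _ (eI_norm φ).le, eI_conj, mul_assoc, Df_mul k0 k1 n _ _ (eI_norm _).le, mul_one]
    simp only [hF, hEd, g1, refl_eval hS (eI_ne φ), e1, e2, neg_neg]
    linear_combination (-(Polynomial.eval (eI (-φ)) S))*e3
  have ii : ∀ {f : ℝ → ℝ}, Continuous f → IntervalIntegrable f volume (-π) π := fun h => h.intervalIntegrable _ _
  have neg : ∀ f : ℝ → ℝ, ∫ φ in -π..π, f (-φ) = ∫ φ in -π..π, f φ := fun f => by
    have := integral_comp_neg (a := -π) (b := π) f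
    rwa [neg_neg] at this
  have rd := hp.rd
  have u0 : 0 < u := §
  refine ⟨P, F, hP, Fd, fun z hz hz1 => ?_, ?_, fun z hz => ?_⟩
  · rw [hP2 z hz, hF]
    linear_combination (-(S.eval z+(S.reflect (2*N)).eval z))*Df_mul k0 k1 n ¦u (u^9) hz1
  · have p1 : ∀ φ, ‖F (eI φ)‖^2 ≤ (1+1/u)*(‖kk z0 (-φ)‖^2+‖kk z0 φ‖^2+2*(VV n N u φ*eI ((0:ℕ)*φ)*(kk z0 φ*kk z0 φ)).re)
        +(1+u)*(2*‖E φ‖^2+2*‖E (-φ)‖^2) := fun φ => by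
      have x1 : ‖kk z0 (-φ)+VV n N u φ*kk z0 φ‖^2 = ‖kk z0 (-φ)‖^2+‖kk z0 φ‖^2+2*(VV n N u φ*eI ((0:ℕ)*φ)*(kk z0 φ*kk z0 φ)).re := by
        rw [sq_norm, Complex.normSq_add, ← sq_norm, ← sq_norm, norm_mul, Vn, one_mul, map_mul, kc φ]
        have : (kk z0 (-φ)*(cj (VV n N u φ)*kk z0 (-φ))).re = (VV n N u φ*eI ((0:ℕ)*φ)*(kk z0 φ*kk z0 φ)).re := by
          rw [← conj_re]
          congr 1
          rw [map_mul, map_mul, kc, neg_neg, conj_conj, show eI ((0:ℕ)*φ) = 1 by simp [eI]]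
          ring
        rw [this]
      rw [← x1, Fe]
      set X := kk z0 (-φ)+VV n N u φ*kk z0 φ
      have y1 : ‖E φ+VV n N u φ*E (-φ)‖ ≤ ‖E φ‖+‖E (-φ)‖ := (norm_add_le _ _).trans (by rw [norm_mul, Vn, one_mul])
      have y2 := norm_sub_le X (E φ+VV n N u φ*E (-φ))
      have y3 : ‖X-(E φ+VV n N u φ*E (-φ))‖^2 ≤ (‖X‖+(‖E φ‖+‖E (-φ)‖))^2 := by gcongr; linarith
      refine y3.trans ?_
      set b := ‖E φ‖+‖E (-φ)‖ with hb
      have y4 : b^2 ≤ 2*‖E φ‖^2+2*‖E (-φ)‖^2 := by rw [hb]; nlinarith [sq_nonneg (‖E φ‖-‖E (-φ)‖)]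
      have y5 : (‖X‖+b)^2 ≤ (1+1/u)*‖X‖^2+(1+u)*b^2 := by
        have : 0 ≤ (‖X‖-u*b)^2/u := ¶
        have e : (‖X‖-u*b)^2/u = (1/u)*‖X‖^2-2*‖X‖*b+u*b^2 := by field_simp; ring
        nlinarith
      have := mlm y4 (show 0 ≤ 1+u by linarith)
      linarith
    have cI : Continuous fun φ => VV n N u φ*eI ((0:ℕ)*φ)*(kk z0 φ*kk z0 φ) := by
      have := eI_cont
      fun_prop
    have := intLin (a := fun φ => ‖kk z0 (-φ)‖^2) (b := fun φ => ‖kk z0 φ‖^2) (c := fun φ => (VV n N u φ*eI ((0:ℕ)*φ)*(kk z0 φ*kk z0 φ)).re)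
      (d := fun φ => ‖E φ‖^2) (e := fun φ => ‖E (-φ)‖^2) (f := fun φ => ‖F (eI φ)‖^2) ¢ ¢ (Complex.continuous_re.comp cI) ¢ ¢ ((circ Fd).norm.pow 2) p1
    refine this.trans ?_
    have n1 := neg (fun φ => ‖E φ‖^2)
    have n2 := neg (fun φ => ‖kk z0 φ‖^2)
    have n3 := kk_norm hz0n
    rw [hp.z0n] at n3
    have n4 : ∫ φ in -π..π, (VV n N u φ*eI ((0:ℕ)*φ)*(kk z0 φ*kk z0 φ)).re ≤ 1 := by
      have q1 := hp.VTc (z := z0) (w := z0) (γ := 1/(4*¦u)) (γ' := 1/(4*¦u)) ¶ ¶ (by rw [hp.z0n]; exact hp.rd) (by rw [hp.z0n]; exact hp.rd) 0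
      have q2 := (re_le_norm _).trans q1
      have q3 : ∫ φ in -π..π, (VV n N u φ*eI ((0:ℕ)*φ)*(kk z0 φ*kk z0 φ)).re = (∫ φ in -π..π, (VV n N u φ*eI ((0:ℕ)*φ)*(kk z0 φ*kk z0 φ))).re :=
        intervalIntegral.intervalIntegral_re (𝕜 := ℂ) (cI.intervalIntegrable _ _)
      rw [q3]
      refine q2.trans ?_
      have := hp.e2
      simp only [Nat.cast_zero, zero_mul, neg_zero, exp_zero, mul_one, add_zero]
      set ε := 2*π*exp (-u)+2*¦u/(2*N)^2
      have : 0 ≤ ε := ¶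
      rw [show 18*u^13/(1/(4*¦u)*(1/(4*¦u)))*ε = 288*(u^37*ε) by field_simp; ring]
      have h3 : (288:ℝ) ≤ u^3 := le_trans ¡ (pow_le_pow_left₀ ¡ u1 3)
      calc 288*(u^37*ε) ≤ u^3*(u^37*ε) := by gcongr
        _ = u^40*ε := by ring
        _ ≤ 1 := hp.e2
    rw [n1, n2, n3, Ebd]
    have e4 : 2*π/(1-r0 u^2)+2*π/(1-r0 u^2) = 4*π/(1-r0 u^2) := by ring
    rw [e4]
    have m1 := mlm (add_le_add_right (mlm n4 zero_le_two) (4*π/(1-r0 u^2))) (show 0 ≤ 1+1/u by positivity)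
    rw [mul_one] at m1
    have m2 := mlm hE (show 0 ≤ 4*(1+u) by positivity)
    refine (add_le_add m1 (le_of_eq ?_)).trans (add_le_add le_rfl m2)
    ring
  · have ze : ‖z‖ ≤ 1-1/(8*¦u) := le_trans (le_mul_of_one_le_right (norm_nonneg _) (one_le_exp hd.le)) hz
    have w0 : 0 < 1/(8*¦u) := ¶
    have z1 : ‖z‖ < 1 := §
    have ckz := kk_cont z1
    have kb : ∫ φ in -π..π, ‖kk z φ‖^2 ≤ 64*¦u := by
      rw [kk_norm z1]
      have : 1/(8*¦u) ≤ 1-‖z‖^2 := by nlinarith [norm_nonneg z]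
      calc 2*π/(1-‖z‖^2) ≤ 2*4/(1/(8*¦u)) := by gcongr; exact pi_le_four
        _ = _ := by field_simp; norm_num
    have b1 : ∀ {G : ℝ → ℂ}, Continuous G → (∫ φ in -π..π, ‖G φ‖^2 ≤ u^6) → ‖∫ φ in -π..π, G φ*kk z φ‖ ≤ 8*u^9 := fun {G} hG hG2 => by
      refine le_of_sq_le_sq ((cs_circle hG.continuousOn ckz.continuousOn).trans ?_) ¶
      calc _ ≤ u^6*(64*¦u) := by gcongr; exact intervalIntegral.integral_nonneg hπ fun _ _ => by positivity
        _ = _ := by ring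
    have a1 := b1 cE hE
    have cE' : Continuous fun φ => VV n N u φ*E (-φ) := cV.mul (cE.comp continuous_neg)
    have a2 := b1 cE' (by simp only [norm_mul, Vn, one_mul]; exact (neg (fun φ => ‖E φ‖^2)).trans_le hE)
    have a3 := hp.VTc (z := z0) (w := z) (γ := 1/(4*¦u)) (γ' := 1/(8*¦u)) ¶ ¶ (by rw [hp.z0n]; exact hp.rd) hz 0
    have a4 : ‖∫ φ in -π..π, VV n N u φ*kk z0 φ*kk z φ‖ ≤ 1 := by
      simp only [Nat.cast_zero, zero_mul, neg_zero, exp_zero, mul_one, add_zero, show eI 0 = 1 by simp [eI], ← mul_assoc] at a3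
      refine a3.trans ?_
      set ε := 2*π*exp (-u)+2*¦u/(2*N)^2
      have : 0 ≤ ε := ¶
      rw [show 18*u^13/(1/(4*¦u)*(1/(8*¦u)))*ε = 576*(u^37*ε) by field_simp; ring]
      have h3 : (576:ℝ) ≤ u^3 := le_trans ¡ (pow_le_pow_left₀ ¡ u1 3)
      calc 576*(u^37*ε) ≤ u^3*(u^37*ε) := by gcongr
        _ = u^40*ε := by ring
        _ ≤ 1 := hp.e2
    have cF := cauchy_disk Fd z1
    have gd : DiffContOnCl ℂ (fun z:ℂ => 1/(1+r0 u*z)) (ball 0 1) := by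
      refine DifferentiableOn.diffContOnCl ?_
      rw [closure_ball 0 one_ne_zero]
      intro z hz
      rw [mem_closedBall_zero_iff] at hz
      have : (1:ℂ)+r0 u*z ≠ 0 := fun h => by
        have : ‖(r0 u:ℂ)*z‖ = 1 := by rw [eq_neg_of_add_eq_zero_right h]; simp
        rw [norm_mul, cno r1.le] at this
        nlinarith
      exact DifferentiableAt.differentiableWithinAt (by fun_prop (disch := exact this))
    have cg := cauchy_disk gd z1
    have ic : ∀ {f : ℝ → ℂ}, Continuous f → IntervalIntegrable f volume (-π) π := fun h => h.intervalIntegrable _ _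
    have key : 2*π*(F z-1/(1+r0 u*z)) = (∫ φ in -π..π, VV n N u φ*kk z0 φ*kk z φ)-(∫ φ in -π..π, E φ*kk z φ)-∫ φ in -π..π, VV n N u φ*E (-φ)*kk z φ := by
      have i1 : IntervalIntegrable (fun φ => VV n N u φ*kk z0 φ*kk z φ) volume (-π) π := ic ¢
      have i2 : IntervalIntegrable (fun φ => E φ*kk z φ) volume (-π) π := ic ¢
      have i3 : IntervalIntegrable (fun φ => VV n N u φ*E (-φ)*kk z φ) volume (-π) π := ic ¢
      have i4 : IntervalIntegrable (fun φ => F (eI φ)*(1/(1-z*eI (-φ)))) volume (-π) π := ic ((circ Fd).mul ckz)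
      have i5 : IntervalIntegrable (fun φ => 1/(1+r0 u*eI φ)*(1/(1-z*eI (-φ)))) volume (-π) π := ic ((circ gd).mul ckz)
      rw [← intervalIntegral.integral_sub i1 i2, ← intervalIntegral.integral_sub (i1.sub i2) i3, mul_sub, ← cF, ← cg, ← intervalIntegral.integral_sub i4 i5]
      refine integral_congr fun φ _ => ?_
      simp only [Fe, g1, kk]; ring
    have hh : 2*π*‖F z-1/(1+r0 u*z)‖ ≤ 1+8*u^9+8*u^9 := by
      calc 2*π*‖F z-1/(1+r0 u*z)‖ = ‖2*π*(F z-1/(1+r0 u*z))‖ := by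
            rw [norm_mul, show (2:ℂ)*π = ((2*π:ℝ):ℂ) by push_cast; rfl, cno ¶]
        _ ≤ _ := by rw [key]; exact (norm_sub_le _ _).trans (add_le_add ((norm_sub_le _ _).trans (add_le_add a4 a1)) a2)
    have : 1 ≤ u^9 := one_le_pow₀ §
    nlinarith [pi_gt_three, norm_nonneg (F z-1/(1+r0 u*z))]
lemma Df_norm (n : ℕ) (a κ K : ℝ) (z : ℂ) : ‖Df n a κ K z‖^2 =
    exp (a^£n*(Eh n z).re)*(1/‖1+κ*z‖)*exp (-(K/2*(1+z.re))) := by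
  unfold Df
  rw [norm_mul, norm_mul, norm_exp, norm_exp, mul_pow, mul_pow, ← exp_nat_mul, ← exp_nat_mul, norm_div, div_pow, sq1_norm, norm_one, one_pow]
  have h1 : ((a:ℂ)^£n*Eh n z/2).re = a^£n*(Eh n z).re/2 := by
    rw [← ofReal_pow, Complex.div_ofNat_re, re_ofReal_mul]
  have h2 : (-((K:ℂ)/4*(1+z))).re = -(K/4*(1+z.re)) := by
    rw [show (K:ℂ)/4 = ((K/4:ℝ):ℂ) by push_cast; rfl, neg_re, re_ofReal_mul]; simp
  rw [h1, h2]; push_cast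
  rw [show 2*(a^£n*(Eh n z).re/2) = a^£n*(Eh n z).re by ring, show 2*-(K/4*(1+z.re)) = -(K/2*(1+z.re)) by ring]
section
set_option linter.unusedSectionVars false
variable {n N : ℕ} {a κ K : ℝ} (ha : 0 < a) (k0 : 0 < κ) (k1 : κ < 1) (hK : 0 ≤ K) {P : Polynomial ℂ} {F : ℂ → ℂ}
  (hF : DiffContOnCl ℂ F (ball 0 1)) (h : ∀ z, z ≠ 0 → ‖z‖ ≤ 1 → P.eval (xx a z)*z^N = F z*Df n a κ K z)
include ha k0 k1 hK hF h
lemma PF_norm (z0 : z ≠ 0) (z1 : ‖z‖ ≤ 1) : ‖P.eval (xx a z)‖^2*(‖z‖^2)^N = ‖F z‖^2*‖Df n a κ K z‖^2 := by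
  have := congrArg (fun w => ‖w‖^2) (h z z0 z1)
  simp only [norm_mul, norm_pow, mul_pow] at this
  rw [← this, ← pow_mul, ← pow_mul, mul_comm 2]
lemma circF : Continuous fun φ:ℝ => F (eI φ) := by
  have := hF.continuousOn_ball
  exact this.comp_continuous eI_cont fun φ => by simp [eI_norm]
lemma F_even (φ : ℝ) : ‖F (eI (-φ))‖^2 = ‖F (eI φ)‖^2 := by
  have h1 := PF_norm ha k0 k1 hK hF h (eI_ne φ) (eI_norm φ).le
  have h2 := PF_norm ha k0 k1 hK hF h (eI_ne (-φ)) (eI_norm _).le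
  have h3 : ‖Df n a κ K (eI (-φ))‖ = ‖Df n a κ K (eI φ)‖ := by
    rw [eI_neg, ← Df_conj k0 k1 n a K (eI_norm φ).le, RCLike.norm_conj]
  have h4 : Df n a κ K (eI φ) ≠ 0 := left_ne_zero_of_mul_eq_one (Df_mul k0 k1 n a K (eI_norm φ).le)
  rw [h3, xx_circle, neg_div, cos_neg, ← xx_circle, eI_norm, ← eI_norm φ, h1] at h2
  exact (mul_right_cancel₀ (pow_ne_zero 2 (norm_ne_zero_iff.2 h4)) h2).symm
lemma NP_in : ∫ x in (0:ℝ)..a^2, ‖P.eval (x:ℂ)‖^2*wt n x ≤ a^2/(4*√κ)*∫ φ in -π..π, ‖F (eI φ)‖^2 := by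
  have cF := circF ha k0 k1 hK hF h
  have hs : ∫ φ in -π..π, ‖F (eI φ)‖^2 = 2*∫ φ in (0:ℝ)..π, ‖F (eI φ)‖^2 := by
    have ii : ∀ x y, IntervalIntegrable (fun φ => ‖F (eI φ)‖^2) volume x y := fun x y => (cF.norm.pow 2).intervalIntegrable x y
    rw [← integral_add_adjacent_intervals (ii (-π) 0) (ii 0 π)]
    have := integral_comp_neg (a := 0) (b := π) (fun φ => ‖F (eI φ)‖^2)
    rw [neg_zero] at this
    rw [← this]; simp only [F_even ha k0 k1 hK hF h]; ring
  have cP : Continuous fun x:ℝ => ‖P.eval (x:ℂ)‖^2 := by have := P.continuous; fun_prop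
  rw [hs, ← subst_cos (n := n) ha cP, show a^2/(4*√κ)*(2*∫ φ in (0:ℝ)..π, ‖F (eI φ)‖^2) = a^2/(2*√κ)*∫ φ in (0:ℝ)..π, ‖F (eI φ)‖^2 by ring, ← iicm]
  have cw : Continuous (wt n) := by
    unfold wt
    have : Continuous fun x:ℝ => x^((n:ℝ)+1/2) := continuous_rpow_const ¶
    fun_prop
  refine integral_mono_on pi_pos.le ?_ ?_ fun φ hφ => ?_
  · refine cii ?_ _ _
    have := P.continuous
    fun_prop
  · exact (continuous_const.mul (cF.norm.pow 2)).intervalIntegrable _ _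
  set c := cos (φ/2) with hc
  have c0 : 0 ≤ c := cos_nonneg_of_neg_pi_div_two_le_of_le (by linarith [hφ.1, pi_pos]) (by linarith [hφ.2])
  have e1 := PF_norm ha k0 k1 hK hF h (eI_ne φ) (eI_norm φ).le
  rw [eI_norm, one_pow, one_pow, mul_one, xx_circle, Df_norm] at e1
  have e2 : (Eh n (eI φ)).re = c^£n := Eh_re_circle n (abs_le.2 ⟨by linarith [hφ.1, pi_pos], hφ.2⟩)
  have ere : (eI φ).re = cos φ := by unfold eI; exact exp_ofReal_mul_I_re φ
  have eim : (eI φ).im = sin φ := by unfold eI; exact exp_ofReal_mul_I_im φ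
  have cc : cos φ = 2*c^2-1 := by rw [hc, ← cos_two_mul]; congr 1; ring
  rw [e2, ere] at e1
  rw [e1, show wt n (a^2*c^2) = exp (-(a^£n*c^£n)) by rw [← mul_pow, wt_sq n ¶, mul_pow]]
  have l1 : 2*√κ*c ≤ ‖1+(κ:ℂ)*eI φ‖ := by
    refine le_of_sq_le_sq ?_ (norm_nonneg _)
    rw [← normSq_eq_norm_sq, normSq_apply]
    simp only [add_re, Complex.one_re, re_ofReal_mul, Complex.add_im, Complex.one_im, im_ofReal_mul, ere, eim]
    have := sin_sq_add_cos_sq φ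
    have k2 := sq_sqrt k0.le
    nlinarith [sq_nonneg (1-κ)]
  have dp : 0 < ‖1+(κ:ℂ)*eI φ‖ := by
    refine norm_pos_iff.2 (slitPlane_ne_zero (one_add_slit (kz k0 k1 (eI_norm φ).le)))
  set d := ‖1+(κ:ℂ)*eI φ‖
  have sk : 0 < √κ := sqrt_pos.2 k0
  have l2 : 1/d*c ≤ 1/(2*√κ) := by rw [one_div_mul_eq_div, div_le_div_iff₀ dp ¶]; linarith
  have l3 : exp (-(K/2*(1+cos φ))) ≤ 1 := exp_le_one_iff.2 (by nlinarith [neg_one_le_cos φ])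
  have l4 : exp (a^£n*c^£n)*exp (-(a^£n*c^£n)) = 1 := by rw [← exp_add]; simp
  have l5 := sin_le_one (φ/2)
  have l6 : 0 ≤ sin (φ/2) := sin_nonneg_of_nonneg_of_le_pi (by linarith [hφ.1]) (by linarith [hφ.2, pi_pos])
  calc _ = ‖F (eI φ)‖^2*a^2*(exp (a^£n*c^£n)*exp (-(a^£n*c^£n)))*((1/d*c)*exp (-(K/2*(1+cos φ)))*sin (φ/2)) := by ring
    _ ≤ ‖F (eI φ)‖^2*a^2*1*(1/(2*√κ)*1*1) := by rw [l4]; gcongr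
    _ = _ := by ring
lemma F_pt (hz : ‖z‖ < 1) : ‖F z‖^2 ≤ (∫ φ in -π..π, ‖F (eI φ)‖^2)/(2*π*(1-‖z‖^2)) := by
  have c := cauchy_disk hF hz
  have c2 := cs_circle (F := fun φ => F (eI φ)) (circF ha k0 k1 hK hF h).continuousOn (kk_cont hz).continuousOn
  have e : ∫ φ in -π..π, F (eI φ)*kk z φ = 2*π*F z := c
  rw [e, kk_norm hz, norm_mul, mul_pow, show (2:ℂ)*π = ((2*π:ℝ):ℂ) by push_cast; rfl, cno ¶] at c2
  have p : 0 < 1-‖z‖^2 := by nlinarith [norm_nonneg z]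
  have := pi_pos
  generalize (∫ φ in -π..π, ‖F (eI φ)‖^2) = E at *
  rw [le_div_iff₀ ¶]
  rw [mul_div_assoc', le_div_iff₀ p] at c2
  nlinarith
lemma NP_out {T : ℝ} (hT : ∀ σ, 0 ≤ σ → 2*N*σ-a^£n*FR n σ+2*σ ≤ T) :
    ∫ x in Ioi (a^2), ‖P.eval (x:ℂ)‖^2*wt n x ≤ a^2/(8*π)*exp (T-K/2)*∫ φ in -π..π, ‖F (eI φ)‖^2 := by
  have im : (fun σ => a^2*cosh (σ/2)^2) '' Ioi 0 = Ioi (a^2) := by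
    ext x
    constructor
    · rintro ⟨σ, hσ, rfl⟩
      have : 1 < cosh (σ/2) := one_lt_cosh.2 (by have : 0 < σ := hσ; positivity)
      show a^2 < a^2*cosh (σ/2)^2
      exact lt_mul_of_one_lt_right (pow_pos ha 2) (one_lt_pow₀ this two_ne_zero)
    · intro hx
      have hx : a^2 < x := hx
      have s1 : 1 < √x/a := by rw [lt_div_iff₀ ha, one_mul]; exact lt_sqrt_of_sq_lt hx
      refine ⟨2*arcosh (√x/a), ?_, ?_⟩
      · have := arcosh_pos s1
        show (0:ℝ) < _; linarith
      · show a^2*cosh (2*arcosh (√x/a)/2)^2 = x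
        rw [mul_div_cancel_left₀ _ two_ne_zero, cosh_arcosh s1.le, div_pow, sq_sqrt (by nlinarith)]
        field_simp
  have hd : ∀ σ ∈ Rp, HasDerivWithinAt (fun σ => a^2*cosh (σ/2)^2) (a^2*(cosh (σ/2)*sinh (σ/2))) (Ioi 0) σ := fun σ _ => by
    have h1 : HasDerivAt (fun σ:ℝ => σ/2) (1/2) σ := (hasDerivAt_id σ).div_const 2
    have := ((h1.cosh.fun_pow 2).const_mul (a^2)).hasDerivWithinAt (s := Rp)
    refine this.congr_deriv ?_
    push_cast; ring
  have inj : Set.InjOn (fun σ => a^2*cosh (σ/2)^2) (Ioi 0) := fun x hx y hy hxy => by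
    have hx : 0 < x := hx
    have hy : 0 < y := hy
    have h1 : cosh (x/2)^2 = cosh (y/2)^2 := mul_left_cancel₀ ¶ hxy
    have h2 := (pow_left_inj₀ (cosh_pos _).le (cosh_pos _).le two_ne_zero).1 h1
    have := cosh_strictMonoOn.injOn (show 0 ≤ x/2 by positivity) (show 0 ≤ y/2 by positivity) h2
    linarith
  have key := MeasureTheory.integral_image_eq_integral_abs_deriv_smul mIo hd inj (fun x => ‖P.eval (x:ℂ)‖^2*wt n x)
  rw [im] at key
  rw [key]
  have Fp := fun {z} => F_pt ha k0 k1 hK hF h (z := z)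
  have E0 : 0 ≤ ∫ φ in -π..π, ‖F (eI φ)‖^2 := intervalIntegral.integral_nonneg (by linarith [pi_pos]) fun _ _ => by positivity
  generalize (∫ φ in -π..π, ‖F (eI φ)‖^2) = E at *
  have ie : IntegrableOn (fun σ:ℝ => exp (-σ)) (Ioi 0) := integrableOn_exp_neg_Ioi 0
  calc _ ≤ ∫ σ in Rp, a^2/(8*π)*exp (T-K/2)*E*exp (-σ) := by
        refine integral_mono_of_nonneg (Eventually.of_forall fun σ => ?_) (ie.const_mul _) ?_
        · have := wt_pos n (a^2*cosh (σ/2)^2)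
          simp only [smul_eq_mul, Pi.zero_apply]; positivity
        rw [EventuallyLE, ae_restrict_iff' mIo]
        refine Eventually.of_forall fun σ hσ => ?_
        have hσ : 0 < σ := hσ
        set e := exp (-σ) with he
        have e0 : 0 < e := exp_pos _
        have e1 : e < 1 := exp_lt_one_iff.2 §
        have ne : ‖(e:ℂ)‖ = e := cno e0.le
        have hP := PF_norm ha k0 k1 hK hF h (z := (e:ℂ)) (by exact_mod_cast e0.ne') (by rw [ne]; exact e1.le)
        have hx : xx a (e:ℂ) = ((a^2*cosh (σ/2)^2:ℝ):ℂ) := by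
          have : (1+e)^2/e = 4*cosh (σ/2)^2 := by
            rw [cosh_eq, he, show -σ = -(σ/2)+-(σ/2) by ring, exp_add, exp_neg]
            have := exp_pos (σ/2)
            field_simp; ring
          unfold xx
          rw [show a^2*cosh (σ/2)^2 = a^2/4*((1+e)^2/e) by rw [this]; ring]; push_cast; rfl
        have hf := Fp (z := (e:ℂ)) (by rw [ne]; exact e1)
        rw [ne] at hf
        rw [hx, ne, Df_norm] at hP
        have er : (Eh n (e:ℂ)).re = Er n σ := rfl
        have d1 : 1/‖1+(κ:ℂ)*e‖ ≤ 1 := by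
          rw [show 1+(κ:ℂ)*e = ((1+κ*e:ℝ):ℂ) by push_cast; rfl, cno ¶, div_le_one ¶]
          nlinarith [mul_pos k0 e0]
        have d2 : exp (-(K/2*(1+(e:ℂ).re))) ≤ exp (-(K/2)) := by
          rw [ofReal_re]; apply exp_le_exp.2; nlinarith
        rw [er] at hP
        have eN : (e^2)^N*exp (2*N*σ) = 1 := by
          rw [← pow_mul, he, ← exp_nat_mul, ← exp_add, exp_eq_one_iff]; push_cast; ring
        have p1 : 0 < 1-e^2 := by nlinarith
        have q1 : ‖P.eval ((a^2*cosh (σ/2)^2:ℝ):ℂ)‖^2 ≤ E/(2*π*(1-e^2))*(exp (a^£n*Er n σ)*1*exp (-(K/2)))*exp (2*N*σ) := by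
          calc _ = ‖P.eval ((a^2*cosh (σ/2)^2:ℝ):ℂ)‖^2*((e^2)^N*exp (2*N*σ)) := by rw [eN, mul_one]
            _ = _ := by rw [← mul_assoc, hP]
            _ ≤ _ := by gcongr
        have q2 : wt n (a^2*cosh (σ/2)^2) = exp (-(a^£n*cosh (σ/2)^£n)) := by
          rw [← mul_pow, wt_sq n (by have := cosh_pos (σ/2); positivity), mul_pow]
        have q3 : |a^2*(cosh (σ/2)*sinh (σ/2))| = a^2/4*(exp σ*(1-e^2)) := by
          have : 0 < sinh (σ/2) := sinh_pos_iff.2 ¶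
          have := cosh_pos (σ/2)
          rw [abs_of_pos ¶, cosh_eq, sinh_eq, he, show -σ = -(σ/2)+-(σ/2) by ring, exp_add, exp_neg, show exp σ = exp (σ/2)*exp (σ/2) by rw [← exp_add]; congr 1; ring]
          have := exp_pos (σ/2)
          field_simp; ring
        simp only [smul_eq_mul]
        rw [q2, q3]
        calc _ ≤ a^2/4*(exp σ*(1-e^2))*((E/(2*π*(1-e^2))*(exp (a^£n*Er n σ)*1*exp (-(K/2)))*exp (2*N*σ))*exp (-(a^£n*cosh (σ/2)^£n))) := by gcongr
          _ = a^2/(8*π)*E*(exp σ*exp (a^£n*Er n σ)*exp (-(K/2))*exp (2*N*σ)*exp (-(a^£n*cosh (σ/2)^£n))) := by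
            have := pi_pos.ne'
            have := p1.ne'
            field_simp; ring
          _ ≤ a^2/(8*π)*E*(exp (T-K/2)*e) := by
            refine mlm ?_ ¶
            simp only [he, ← exp_add]
            apply exp_le_exp.2
            have := hT σ hσ.le
            unfold FR at this
            linarith only [this]
          _ = _ := by ring
    _ = _ := by rw [integral_const_mul, integral_exp_neg_Ioi_zero]; ring
lemma NP_tot {T : ℝ} (hT : ∀ σ, 0 ≤ σ → 2*N*σ-a^£n*FR n σ+2*σ ≤ T) :
    NP n P ≤ a^2/4*(1/√κ+exp (T-K/2))*∫ φ in -π..π, ‖F (eI φ)‖^2 := by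
  have hi := NP_int n P
  have h1 := NP_in ha k0 k1 hK hF h
  have h2 := NP_out ha k0 k1 hK hF h hT
  have E0 : 0 ≤ ∫ φ in -π..π, ‖F (eI φ)‖^2 := intervalIntegral.integral_nonneg (by linarith [pi_pos]) fun _ _ => by positivity
  unfold NP
  rw [← intervalIntegral.integral_interval_add_Ioi hi (hi.mono_set (Ioi_subset_Ioi (by positivity : 0 ≤ a^2)))]
  generalize (∫ φ in -π..π, ‖F (eI φ)‖^2) = E at *
  refine (add_le_add h1 h2).trans ?_
  have : a^2/(8*π) ≤ a^2/4 := by gcongr; linarith [pi_gt_three]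
  have : a^2/(8*π)*exp (T-K/2)*E ≤ a^2/4*exp (T-K/2)*E := by gcongr
  refine (add_le_add le_rfl this).trans (le_of_eq ?_)
  have := sqrt_pos.2 k0
  field_simp
end
lemma PP.tailexp (hp : PP n N u) (h : 576 ≤ £n*nu n*u^4) {σ : ℝ} (hσ : 0 ≤ σ) :
    2*N*σ-¦u^£n*FR n σ+2*σ ≤ u^8 := by
  have u1 := hp.u1
  have hl := lam_ub n hσ
  set A := ¦u^£n with hA
  have A0 : 0 < A := ¶
  set M := u^(8*n+8) with hM
  have M1 : 1 ≤ M := one_le_pow₀ §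
  have hN : (N:ℝ) = nu n*A+M := hp.hN
  have nn := nu_pos n
  set q := £n*nu n with hq
  have hl2 := mlm hl A0.le
  have : 4*M*σ ≤ u^8+A*(q*σ^3/(3*(2+σ))) := by
    by_cases c : 4*M*σ ≤ u^8
    · have : 0 ≤ A*(q*σ^3/(3*(2+σ))) := ¶
      linarith
    · push Not at c
      have hX : u^8 = M*(1/u^(8*n)) := by rw [hM, pow_add]; field_simp
      have c2 : 1/u^(8*n)/4 ≤ σ := by
        rw [hX] at c; nlinarith
      set t := 1/u^(8*n)/4
      have t0 : 0 < t := ¶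
      have t1 : t ≤ 1 := by
        have : 1/u^(8*n) ≤ 1 := by rw [div_le_one ¶]; exact one_le_pow₀ §
        simp only [t]; linarith
      have key : t^2/3 ≤ σ^2/(2+σ) := by
        rw [div_le_div_iff₀ ¡ ¶]
        have h2 : t*2 ≤ σ*2 := §
        have h3 : t*t ≤ σ*1 := mul_le_mul c2 t1 t0.le hσ
        nlinarith [mlm c2 t0.le, mul_nonneg t0.le hσ]
      have e : A*(t^2/3) = u^4*M/48 := by
        simp only [t, hA, hM]; rw [← pow_mul]; field_simp
        ring
      have u8 : 0 ≤ u^8 := ¶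
      calc 4*M*σ = 4*(σ*M) := by ring
        _ ≤ q*u^4/144*(σ*M) := by gcongr; linarith
        _ = q*σ/3*(A*(t^2/3)) := by rw [e]; ring
        _ ≤ q*σ/3*(A*(σ^2/(2+σ))) := by gcongr
        _ = A*(q*σ^3/(3*(2+σ))) := by field_simp
        _ ≤ _ := §
  rw [hN]
  nlinarith
lemma HH_ge (hn : 1 ≤ n) {u β : ℝ} (hu : 1 ≤ u) (h0 : 0 ≤ β) (h1 : β ≤ π/4) :
    H0 n u - ¦u^¥n*β^2*(2*kap n+(C2 n+2)/¦u) ≤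
    4*Nf n u*(AA (wb (1/¦u) β)).re+¦u^£n*(Eg n (AA (wb (1/¦u) β))).re := by
  have hp : 0 < u := §
  have hn' : (1:ℝ) ≤ n := by exact_mod_cast hn
  have hρ : 0 < 1/¦u := ¶
  have hν := nu_pos n
  have hk := kap_pos hn
  have w := (abs_le.1 (W_exp hn hρ h0 h1)).1
  have r := (abs_le.1 (R6 hρ h0 h1)).1
  have e : 4*Nf n u*(AA (wb (1/¦u) β)).re+¦u^£n*(Eg n (AA (wb (1/¦u) β))).re =
    ¦u^£n*Wr n (wb (1/¦u) β) + 4*u^(8*n+8)*(AA (wb (1/¦u) β)).re := by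
    rw [Wr, Nf]; ring
  rw [e, H0]
  have cb : 1-cos β ≤ β^2/2 := by linarith [one_sub_sq_div_two_le_cos (x := β)]
  have k1 := mlm w (show 0 ≤ ¦u^£n by positivity)
  have k2 := mlm r (show 0 ≤ 4*u^(8*n+8) by positivity)
  have a1 : ¦u^£n*(4*£n*nu n/¥n*(1/¦u)*(1-cos β)) ≤ ¦u^¥n*(2*kap n*β^2) := by
    calc _ = ¦u^¥n*(4*kap n*(1-cos β)) := by rw [kap, pow_succ]; field_simp
      _ ≤ ¦u^¥n*(4*kap n*(β^2/2)) := by gcongr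
      _ = _ := by ring
  have a2 : ¦u^£n*(6*£n*nu n*(1/¦u)^2*β^2) = ¦u^¥n*((6*£n*nu n)/¦u*β^2) := by
    rw [pow_succ]; field_simp
  have a3 : 4*u^(8*n+8)*(3/2*(1/¦u)^2*β^2) ≤ ¦u^¥n*(6/¦u*β^2) := by
    have : u^(8*n+8) ≤ ¦u^¥n*¦u := by
      rw [← pow_mul, ← pow_add]; exact pnl hu ¿
    calc _ = 6*(1/¦u)^2*β^2*u^(8*n+8) := by ring
      _ ≤ 6*(1/¦u)^2*β^2*(¦u^¥n*¦u) := mlm this ¶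
      _ = _ := by field_simp
  have a4 : 4*u^(8*n+8)*(1/¦u*(1-cos β)) ≤ ¦u^¥n*(2/¦u*β^2) := by
    have : u^(8*n+8) ≤ ¦u^¥n := by
      rw [← pow_mul]; exact pnl hu ¿
    have : 0 ≤ 1-cos β := by linarith [cos_le_one β]
    calc _ ≤ 4*¦u^¥n*(1/¦u*(β^2/2)) := by gcongr
      _ = _ := by ring
  have a5 : ¦u^¥n*β^2*(2*kap n+(C2 n+2)/¦u) = ¦u^¥n*(2*kap n*β^2)+¦u^¥n*((6*£n*nu n)/¦u*β^2)+¦u^¥n*(6/¦u*β^2)+¦u^¥n*(2/¦u*β^2) := by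
    rw [C2]; ring
  rw [mul_add _ (_-_), mul_neg, a2, mul_sub] at k1
  rw [mul_add _ (_-_), mul_sub, mul_neg] at k2
  rw [a5]
  linarith
lemma xx_AA (a : ℝ) (hw : 0 < w.re) : xx a (-cexp (-(2*AA w))) = -((a:ℂ)^2*w^2) := by
  have h1 : cexp (AA w) ≠ 0 := cn0 _
  have hs := sinh_AA hw
  rw [Complex.sinh, Complex.exp_neg] at hs
  generalize AA w = A at *
  rw [xx, ← hs, show -(2*A) = -A+-A by ring, cxa, Complex.exp_neg]
  field_simp; ring
lemma xx_conj (a : ℝ) (z : ℂ) : xx a (cj z) = cj (xx a z) := by simp [xx, conj_ofNat]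
lemma one_add_AA (hw : 0 < w.re) : ‖1+-cexp (-(2*AA w))‖ ≤ 2*‖w‖ := by
  have hs := sinh_AA hw
  rw [Complex.sinh] at hs
  have : 1+-cexp (-(2*AA w)) = 2*w*cexp (-AA w) := by
    generalize AA w = A at *
    rw [← hs, show -(2*A) = -A+-A by ring, cxa]
    have : cexp A*cexp (-A) = 1 := by rw [← cxa]; simp
    linear_combination -this
  rw [this, norm_mul, norm_exp, norm_mul]
  have : exp (-AA w).re ≤ 1 := exp_le_one_iff.2 (by rw [neg_re]; linarith [AA_re hw])
  calc _ ≤ ‖(2:ℂ)‖*‖w‖*1 := by gcongr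
    _ = _ := by simp
lemma PP.core (hn : 1 ≤ n) (hp : PP n N u) {P : Polynomial ℂ} {F : ℂ → ℂ}
    (h : ∀ z, z ≠ 0 → ‖z‖ ≤ 1 → P.eval (xx ¦u z)*z^N = F z*Df n ¦u (kp u) (u^9) z)
    (hFz : ∀ z, ‖z‖*exp (dd n u) ≤ 1-1/(8*¦u) → ‖F z-1/(1+r0 u*z)‖ ≤ 3*u^9) {z : ℂ} {R : ℝ}
    (hz : ‖z‖ = exp (-(2*R))) (hR : 1/¦u ≤ 2*R) (hz1 : ‖1+z‖ ≤ 2*(1/¦u)) :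
    exp (4*N*R+¦u^£n*(Eh n z).re)*exp (-(1/u^3))*(¦u/(2+1/u))*(¦u/4-3*u^9)^2 ≤ ‖P.eval (xx ¦u z)‖^2 := by
  have u1 := hp.u1
  have u0 : 0 < u := §
  set ρ := 1/¦u with hρ
  have ρ0 : 0 < ρ := ¶
  have ρ1 : ρ ≤ 1 := by rw [hρ, div_le_one ¶]; exact one_le_pow₀ §
  obtain ⟨k0, k1⟩ := hp.kp0
  obtain ⟨r1, r2⟩ := hp.r00
  have z0 : z ≠ 0 := norm_ne_zero_iff.1 (by rw [hz]; exact (exp_pos _).ne')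
  have zl : ‖z‖ ≤ 1 := by rw [hz]; exact exp_le_one_iff.2 §
  have g1 : ‖z‖*exp (dd n u) ≤ 1-1/(8*¦u) := by
    rw [hz, ← exp_add]
    have hd : dd n u ≤ ρ/2 := by
      rw [dd, hρ, div_div]
      apply odl ¶
      calc ¦u*2 ≤ ¦u*u := by gcongr; linarith
        _ = u^13 := by ring
        _ ≤ _ := pnl § ¿
    have h3 : exp (-(2*R)+dd n u) ≤ exp (-(ρ/2)) := exp_le_exp.2 §
    have h4 : exp (-(ρ/2)) ≤ 1/(1+ρ/2) := by
      rw [exp_neg, ← one_div]; exact odl § (by linarith [add_one_le_exp (ρ/2)])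
    have h5 : 1/(1+ρ/2) ≤ 1-ρ/8 := by rw [div_le_iff₀ §]; nlinarith
    have : 1/(8*¦u) = ρ/8 := by rw [hρ]; field_simp
    linarith
  have hF := hFz z g1
  have hr : 1-r0 u ≤ 2*ρ := by
    have h1 : 1-2*arsinh (1/¦u) ≤ r0 u := by unfold r0; linarith [add_one_le_exp (-(2*arsinh (1/¦u)))]
    have h2 : arsinh (1/¦u) ≤ 1/¦u := by
      have := self_le_sinh_iff.2 (arsinh_nonneg_iff.2 ρ0.le)
      rwa [sinh_arsinh] at this
    rw [← hρ] at h1 h2; linarith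
  have n1 : ‖1+(r0 u:ℂ)*z‖ ≤ 4*ρ := by
    calc _ = ‖((1-r0 u:ℝ):ℂ)+(r0 u:ℂ)*(1+z)‖ := by congr 1; push_cast; ring
      _ ≤ (1-r0 u)+r0 u*‖1+z‖ := by
        refine (norm_add_le _ _).trans ?_
        rw [norm_mul, cno §, cno r1.le]
      _ ≤ 2*ρ+1*(2*ρ) := by gcongr
      _ = _ := by ring
  have n2 : ‖1+(kp u:ℂ)*z‖ ≤ ρ*(2+1/u) := by
    calc _ = ‖((1-kp u:ℝ):ℂ)+(kp u:ℂ)*(1+z)‖ := by congr 1; push_cast; ring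
      _ ≤ (1-kp u)+kp u*‖1+z‖ := by
        refine (norm_add_le _ _).trans ?_
        rw [norm_mul, cno §, cno k0.le]
      _ ≤ 1/u^13+1*(2*ρ) := by gcongr; unfold kp; linarith
      _ = _ := by rw [hρ]; field_simp; ring
  have p1 : 0 < ‖1+(kp u:ℂ)*z‖ := norm_pos_iff.2 (slitPlane_ne_zero (one_add_slit (kz k0 k1 zl)))
  have p2 : 0 < ‖1+(r0 u:ℂ)*z‖ := norm_pos_iff.2 (slitPlane_ne_zero (one_add_slit (kz r1 r2 zl)))
  have n3 : ¦u/4-3*u^9 ≤ ‖F z‖ := by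
    have : ¦u/4 ≤ ‖1/(1+(r0 u:ℂ)*z)‖ := by
      rw [norm_div, norm_one, show ¦u/4 = 1/(4*ρ) by rw [hρ]; field_simp]
      exact odl p2 n1
    have t := norm_sub_norm_le (1/(1+(r0 u:ℂ)*z)) (F z)
    rw [norm_sub_rev] at t
    linarith
  have n4 : 0 ≤ ¦u/4-3*u^9 := by
    have h3 : (12:ℝ) ≤ u^3 := le_trans ¡ (pow_le_pow_left₀ ¡ u1 3)
    have : 0 < u^9 := ¶
    nlinarith [show ¦u = u^3*u^9 by ring]
  have n5 : exp (-(1/u^3)) ≤ exp (-(u^9/2*(1+z.re))) := by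
    have : 1+z.re ≤ 2*ρ := by
      have := (re_le_norm (1+z)).trans hz1
      simpa using this
    apply exp_le_exp.2
    have h2 : u^9/2*(1+z.re) ≤ u^9/2*(2*ρ) := by gcongr
    have : u^9/2*(2*ρ) = 1/u^3 := by rw [hρ]; field_simp
    linarith
  have e := congrArg (fun w => ‖w‖^2) (h z z0 zl)
  simp only [norm_mul, norm_pow, mul_pow] at e
  rw [Df_norm, hz, ← pow_mul, mul_comm N 2, ← exp_nat_mul] at e
  have eN : exp (((2*N:ℕ):ℝ)*-(2*R))*exp (4*N*R) = 1 := by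
    rw [← exp_add, exp_eq_one_iff]; push_cast; ring
  have e2 : ¦u/(2+1/u) ≤ 1/‖1+(kp u:ℂ)*z‖ := by
    rw [show ¦u/(2+1/u) = 1/(ρ*(2+1/u)) by rw [hρ]; field_simp]
    exact odl p1 n2
  calc _ = (¦u/4-3*u^9)^2*(exp (¦u^£n*(Eh n z).re)*(¦u/(2+1/u))*exp (-(1/u^3)))*exp (4*N*R) := by rw [exp_add]; ring
    _ ≤ ‖F z‖^2*(exp (¦u^£n*(Eh n z).re)*(1/‖1+(kp u:ℂ)*z‖)*exp (-(u^9/2*(1+z.re))))*exp (4*N*R) := by gcongr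
    _ = ‖P.eval (xx ¦u z)‖^2*(exp (((2*N:ℕ):ℝ)*-(2*R))*exp (4*N*R)) := by rw [← e]; ring
    _ = _ := by rw [eN, mul_one]
lemma PP.ptlow (hn : 1 ≤ n) (hp : PP n N u) {P : Polynomial ℂ} {F : ℂ → ℂ}
    (h : ∀ z, z ≠ 0 → ‖z‖ ≤ 1 → P.eval (xx ¦u z)*z^N = F z*Df n ¦u (kp u) (u^9) z)
    (hFz : ∀ z, ‖z‖*exp (dd n u) ≤ 1-1/(8*¦u) → ‖F z-1/(1+r0 u*z)‖ ≤ 3*u^9) {β : ℝ} (hβ : |β| ≤ π/4) :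
    exp (H0 n u - ¦u^¥n*β^2*(2*kap n+(C2 n+2)/¦u))*exp (-(1/u^3))*(¦u/(2+1/u))*(¦u/4-3*u^9)^2 ≤ ‖P.eval (-eI (2*β))‖^2 := by
  have u1 := hp.u1
  have u0 : 0 < u := §
  have main : ∀ γ, 0 ≤ γ → γ ≤ π/4 → exp (H0 n u - ¦u^¥n*γ^2*(2*kap n+(C2 n+2)/¦u))*exp (-(1/u^3))*(¦u/(2+1/u))*(¦u/4-3*u^9)^2 ≤ ‖P.eval (-eI (2*γ))‖^2 ∧
      exp (H0 n u - ¦u^¥n*γ^2*(2*kap n+(C2 n+2)/¦u))*exp (-(1/u^3))*(¦u/(2+1/u))*(¦u/4-3*u^9)^2 ≤ ‖P.eval (-eI (-(2*γ)))‖^2 := fun γ h0 h1 => by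
    set ρ := 1/¦u with hρd
    have hρ : 0 < ρ := ¶
    have hρs : ρ ≤ 1/4 := by
      rw [hρd]; apply odl ¡
      calc (4:ℝ) ≤ 100^12 := ¡
        _ ≤ ¦u := by gcongr
    have hre := wb_re_pos hρ h0 h1
    have hc : √2/2 ≤ cos γ := by
      rw [← cos_pi_div_four]; exact cos_le_cos_of_nonneg_of_le_pi h0 (by linarith [pi_pos]) h1
    have hs2 : (1.4:ℝ) ≤ √2 := le_sqrt_of_sq_le ¡
    have hcp : 0 < cos γ := §
    have e1 : -(((¦u:ℝ):ℂ)^2*(wb ρ γ)^2) = -eI (2*γ) := by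
      rw [wb, eI, mul_pow, ← cxm, hρd]
      have : (u:ℂ) ≠ 0 := by exact_mod_cast u0.ne'
      push_cast
      rw [show (2:ℂ)*γ*I = 2*(γ*I) by ring]
      field_simp
    set w := wb ρ γ with hw
    set R := (AA w).re with hR
    have hR2 : ρ ≤ 2*R := by
      have l1 := AA_lb hre
      rw [wb_re] at l1
      have l2 := arsinh_lb (show 0 ≤ ρ*cos γ by positivity)
      have : ρ*cos γ/(1+ρ) ≤ R := by
        refine le_trans ?_ (l2.trans l1)
        gcongr
        nlinarith [cos_le_one γ]
      have : ρ/2 ≤ ρ*cos γ/(1+ρ) := by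
        rw [le_div_iff₀ §]
        have : ρ*0.7 ≤ ρ*cos γ := by gcongr; linarith
        nlinarith
      linarith
    have hE := HH_ge hn (by linarith : 1 ≤ u) h0 h1
    rw [← hρd, ← hw, ← hR, ← hp.hN] at hE
    set z := -cexp (-(2*AA w)) with hz
    have hzn : ‖z‖ = exp (-(2*R)) := by
      rw [hz, norm_neg, norm_exp, neg_re]; simp [hR]
    have h1z : ‖1+z‖ ≤ 2*ρ := by
      have := one_add_AA hre
      rwa [hw, wb_norm hρ] at this
    have hx : xx ¦u z = -eI (2*γ) := by rw [← e1, hz, xx_AA _ hre]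
    have hEg : (Eh n z).re = (Eg n (AA w)).re := rfl
    have k1 := hp.core hn h hFz hzn hR2 h1z
    have k2 := hp.core hn h hFz (z := cj z) (by rw [RCLike.norm_conj]; exact hzn) hR2 (by
      rw [show 1+cj z = cj (1+z) by simp, RCLike.norm_conj]; exact h1z)
    have hEc : (Eh n (cj z)).re = (Eg n (AA w)).re := by rw [Eh_conj, conj_re]; rfl
    rw [hEg, hx] at k1
    rw [hEc, xx_conj, hx, map_neg, ← eI_neg] at k2
    have hm := exp_le_exp.2 hE
    refine ⟨le_trans ?_ k1, le_trans ?_ k2⟩ <;> gcongr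
  rcases abs_cases β with ⟨e, h0⟩ | ⟨e, h0⟩
  · exact (main β h0 (by rwa [e] at hβ)).1
  · have := (main (-β) § (by rwa [e] at hβ)).2
    rwa [neg_sq, mul_neg, neg_neg] at this
def qf (n : ℕ) (u : ℝ) : ℝ := 2*kap n+(C2 n+2)/¦u
def Jg (n : ℕ) (u : ℝ) : ℝ := ∫ y in (-u)..u, exp (-(y^2*qf n u))
lemma qf_lim (n : ℕ) : Tendsto (qf n) atTop (𝓝 (2*kap n)) := by
  have := (tend_inv 12 ¡ (C2 n+2)).const_add (2*kap n)
  rw [add_zero] at this; exact this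
lemma Jg_lim (hn : 1 ≤ n) : Tendsto (Jg n) atTop (𝓝 (√(π/(2*kap n)))) := by
  have hk := kap_pos hn
  have hs : Tendsto (fun u => √(qf n u)) atTop (𝓝 √(2*kap n)) := (continuous_sqrt.tendsto _).comp (qf_lim n)
  have hs0 : 0 < √(2*kap n) := sqrt_pos.2 ¶
  have hu : Tendsto (fun u => √(qf n u)*u) atTop atTop := hs.pos_mul_atTop hs0 tendsto_id
  have hi : Integrable (fun x:ℝ => exp (-x^2)) := by simpa using integrable_exp_neg_mul_sq (b := 1) one_pos
  have hg : ∫ x:ℝ, exp (-x^2) = √π := by simpa using integral_gaussian 1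
  have h1 := intervalIntegral_tendsto_integral hi (tendsto_neg_atTop_atBot.comp hu) hu
  rw [hg] at h1
  have h2 := (hs.inv₀ hs0.ne').mul h1
  rw [sqrt_div' _ ¶, show √π/√(2*kap n) = (√(2*kap n))⁻¹*√π by ring]
  refine h2.congr' ?_
  filter_upwards [hs.eventually_const_lt hs0] with u h0
  have hq : 0 < qf n u := sqrt_pos.1 h0
  have := intervalIntegral.integral_comp_mul_left (a := -u) (b := u) (fun x => exp (-x^2)) h0.ne'
  rw [smul_eq_mul, mul_neg] at this
  simp only [Function.comp]
  rw [← this, Jg]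
  refine integral_congr fun y _ => ?_
  simp only [mul_pow, sq_sqrt hq.le]; ring_nf
lemma Ebd_lim : Tendsto (fun u => Ebd u/¦u) atTop (𝓝 π) := by
  have hd : HasDerivAt (fun ρ => exp (-(4*arsinh ρ))) (-4) 0 := by
    have := ((hasDerivAt_arsinh 0).const_mul 4).fun_neg.exp
    refine this.congr_deriv (by simp)
  rw [hasDerivAt_iff_tendsto_slope_zero] at hd
  have hr : Tendsto (fun u:ℝ => 1/¦u) atTop (𝓝[≠] 0) := by
    refine tendsto_nhdsWithin_iff.2 ⟨tend_inv 12 ¡ 1, ?_⟩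
    filter_upwards [eventually_gt_atTop 0] with u hu
    exact (by positivity : (1/¦u:ℝ) ≠ 0)
  have h1 := ((hd.comp hr).neg.inv₀ ¡).const_mul (4*π)
  have i1 := tend_inv 1 ¡ 1
  have h2 := ((i1.const_add 1).mul (h1.add (tend_inv 12 ¡ 2))).add ((i1.const_add 1).mul (tend_inv 5 ¡ 4))
  have e : (1+0)*(4*π*(- -4)⁻¹+0)+(1+0)*0 = π := by ring
  rw [e] at h2
  refine h2.congr' ?_
  filter_upwards [eventually_gt_atTop 0] with u hu
  have hr2 : r0 u^2 = exp (-(4*arsinh (1/¦u))) := by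
    unfold r0; rw [← exp_nat_mul]; congr 1; push_cast; ring
  have hx : 0 < 1-r0 u^2 := by
    rw [hr2, sub_pos]; apply exp_lt_one_iff.2
    have : 0 < arsinh (1/¦u) := arsinh_pos_iff.2 ¶
    linarith
  unfold Ebd
  simp only [Function.comp, zero_add, smul_eq_mul, ← hr2, arsinh_zero, mul_zero, neg_zero, exp_zero]
  rw [show -((1/¦u)⁻¹*(r0 u^2-1)) = ¦u*(1-r0 u^2) by rw [one_div, inv_inv]; ring]
  generalize 1-r0 u^2 = X at *
  field_simp; ring
def Th (n : ℕ) (u : ℝ) : ℝ := 2*exp (-(1/u^3))*(1/(2+1/u))*(1/4-3/u^3)^2*Jg n u/(1/4*(1/√(kp u)+exp (u^8-u^9/2))*(Ebd u/¦u))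
lemma Th_lim (hn : 1 ≤ n) : Tendsto (Th n) atTop (𝓝 (G0 n)) := by
  have t3 := tend_inv 3 ¡ 1
  have t1 := tend_inv 1 ¡ 1
  simp only [pow_one] at t1
  have e1 : Tendsto (fun u:ℝ => exp (-(1/u^3))) atTop (𝓝 (exp (-0))) := (continuous_exp.tendsto _).comp t3.neg
  have e2 : Tendsto (fun u:ℝ => 1/(2+1/u)) atTop (𝓝 (1/(2+0))) := tendsto_const_nhds.div (t1.const_add 2) ¡
  have e3 : Tendsto (fun u:ℝ => (1/4-3/u^3)^2) atTop (𝓝 ((1/4-0)^2)) := ((tend_inv 3 ¡ 3).const_sub (1/4)).pow 2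
  have e4 : Tendsto (fun u => 1/√(kp u)) atTop (𝓝 (1/√(1-0))) :=
    tendsto_const_nhds.div ((continuous_sqrt.tendsto _).comp ((tend_inv 13 ¡ 1).const_sub 1)) ¡
  have e5 : Tendsto (fun u:ℝ => exp (u^8-u^9/2)) atTop (𝓝 0) := by
    refine tendsto_exp_atBot.comp (tendsto_atBot_mono' _ ?_ tendsto_neg_atTop_atBot)
    filter_upwards [eventually_ge_atTop 4] with u hu
    have h7 : 1 ≤ u^7 := one_le_pow₀ §
    have h8 : u^8 = u*u^7 := by ring
    have h9 : u^8*4 ≤ u^8*u := by gcongr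
    have : u*1 ≤ u*u^7 := by gcongr
    linarith [show u^9 = u^8*u by ring]
  have := ((((e1.const_mul 2).mul e2).mul e3).mul (Jg_lim hn)).div (((e4.add e5).const_mul (1/4)).mul Ebd_lim) (by
    have := pi_pos; simp [this.ne'])
  have e : 2*exp (-0)*(1/(2+0))*(1/4-0)^2*√(π/(2*kap n))/(1/4*(1/√(1-0)+0)*π) = G0 n := by
    rw [G0, neg_zero, exp_zero, sub_zero, sub_zero, sqrt_one]
    have := pi_pos.ne'
    field_simp; norm_num
  rw [e] at this; exact this
theorem LOWER (hn : 1 ≤ n) {ε : ℝ} (hε : 0 < ε) : ∀ᶠ u in atTop, ∀ N : ℕ, (N:ℝ) = Nf n u → ∃ (P : Polynomial ℂ) (V : ℝ),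
    P.natDegree ≤ N ∧ 0 < V ∧ NP n P ≤ V ∧ V*(exp (H0 n u)*((¦u^n)⁻¹*(G0 n-ε))) ≤ ∫ θ in -π..π, ‖P.eval (eI θ)‖^2 := by
  have q4 : ∀ᶠ u:ℝ in atTop, 576 ≤ £n*nu n*u^4 := by
    have := nu_pos n
    exact ((tendsto_pow_atTop (by norm_num : (4:ℕ) ≠ 0)).const_mul_atTop (by positivity : 0 < £n*nu n)).eventually_ge_atTop 576
  filter_upwards [PP_ev hn, q4, (Th_lim hn).eventually_const_lt (show G0 n-ε < G0 n by linarith), Ebd_lim.eventually_const_lt pi_pos] with u hpp q4 hTh hE N hN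
  have hp := hpp N hN
  have u1 := hp.u1
  have u0 : 0 < u := §
  obtain ⟨P, F, hP, hF, h, hFE, hFz⟩ := hp.LOW1
  obtain ⟨k0, k1⟩ := hp.kp0
  have hE0 : 0 < Ebd u := by
    have := mul_pos hE (pow_pos u0 12)
    rwa [div_mul_cancel₀ _ ¶] at this
  have hNP := NP_tot ¶ k0 k1 ¶ hF h (fun σ hσ => hp.tailexp q4 hσ)
  have sk : 0 < √(kp u) := sqrt_pos.2 k0
  set V := ¦u^2/4*(1/√(kp u)+exp (u^8-u^9/2))*Ebd u with hV
  have V0 : 0 < V := ¶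
  refine ⟨P, V, hP, V0, hNP.trans (by rw [hV]; gcongr), ?_⟩
  have cg : Continuous fun θ => ‖P.eval (-eI θ)‖^2 := by have := P.continuous; have := eI_cont; fun_prop
  have per : ∫ θ in -π..π, ‖P.eval (eI θ)‖^2 = ∫ θ in -π..π, ‖P.eval (-eI θ)‖^2 := by
    have hper : Function.Periodic (fun θ => ‖P.eval (eI θ)‖^2) (2*π) := fun θ => by
      simp only [eI]; congr 3; push_cast
      rw [add_mul, cxa, Complex.exp_two_pi_mul_I, mul_one]
    have h1 := hper.intervalIntegral_add_eq (-π) 0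
    have h2 := intervalIntegral.integral_comp_add_right (a := -π) (b := π) (fun θ => ‖P.eval (eI θ)‖^2) π
    rw [show -π+2*π = π by ring, show (0:ℝ)+2*π = 2*π by ring] at h1
    rw [show -π+π = 0 by ring, show π+π = 2*π by ring] at h2
    rw [h1, ← h2]
    refine integral_congr fun θ _ => ?_
    simp only [eI]; push_cast
    rw [add_mul, cxa, exp_pi_mul_I, mul_neg_one]
  set A := ¦u^n with hA
  have A0 : 0 < A := ¶
  have hAu : ¦u ≤ A := le_self_pow₀ (one_le_pow₀ §) ¿
  have hb : ∀ y ∈ Icc (-u) u, |y/A| ≤ π/4 := fun y hy => by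
    rw [abs_div, abs_of_pos A0, div_le_iff₀ A0]
    have h1 : |y| ≤ u := abs_le.2 hy
    have h2 : u*2 ≤ ¦u := by
      have : 2 ≤ u^11 := by
        calc (2:ℝ) ≤ u := §
          _ ≤ u^11 := le_self_pow₀ § ¡
      nlinarith [show ¦u = u*u^11 by ring]
    have : 1/2*A ≤ π/4*A := mrm (by linarith [pi_gt_three]) A0.le
    linarith
  set c := exp (H0 n u)*exp (-(1/u^3))*(¦u/(2+1/u))*(¦u/4-3*u^9)^2 with hc
  have sub : 2/A*∫ y in (-u)..u, ‖P.eval (-eI (2*(y/A)))‖^2 ≤ ∫ θ in -π..π, ‖P.eval (eI θ)‖^2 := by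
    have e := intervalIntegral.integral_comp_mul_left (a := -u) (b := u) (fun θ => ‖P.eval (-eI θ)‖^2) (show 2/A ≠ 0 by positivity)
    rw [smul_eq_mul] at e
    have e2 : ∫ y in (-u)..u, ‖P.eval (-eI (2*(y/A)))‖^2 = ∫ y in (-u)..u, ‖P.eval (-eI (2/A*y))‖^2 := by
      refine integral_congr fun y _ => ?_
      simp only [show 2*(y/A) = 2/A*y by ring]
    rw [e2, e, ← mul_assoc, mul_inv_cancel₀ ¶, one_mul, per]
    have hu := hb u ⟨by linarith, le_rfl⟩
    rw [abs_of_pos ¶] at hu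
    have hle : 2/A*u ≤ π := by rw [show 2/A*u = 2*(u/A) by ring]; linarith [pi_pos]
    have hn0 : 0 ≤ 2/A*u := ¶
    refine intervalIntegral.integral_mono_interval § § hle ?_ (cg.intervalIntegrable _ _)
    exact Eventually.of_forall fun _ => by positivity
  have low : c*Jg n u ≤ ∫ y in (-u)..u, ‖P.eval (-eI (2*(y/A)))‖^2 := by
    unfold Jg
    rw [← iicm]
    refine integral_mono_on § ?_ ?_ fun y hy => ?_
    · exact cii ¢ _ _
    · exact (cg.comp (g := fun θ => ‖P.eval (-eI θ)‖^2) (f := fun y => 2*(y/A)) ¢).intervalIntegrable _ _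
    · have := hp.ptlow hn h hFz (hb y hy)
      refine le_trans (le_of_eq ?_) this
      rw [show H0 n u-¦u^¥n*(y/A)^2*(2*kap n+(C2 n+2)/¦u) = H0 n u+-(y^2*qf n u) by
        rw [qf, show ¦u^¥n = A^2 by rw [hA]; ring]; field_simp; ring, exp_add]
      ring
  refine le_trans ?_ ((mlm low ¶).trans sub)
  have hX : 2/A*(c*Jg n u) = V*(exp (H0 n u)*(A⁻¹*Th n u)) := by
    rw [hc, hV, Th, show ¦u/4-3*u^9 = ¦u*(1/4-3/u^3) by field_simp]
    generalize Jg n u = J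
    rw [show (¦u*(1/4-3/u^3))^2 = u^24*(1/4-3/u^3)^2 by ring]
    have : 0 < 1/√(kp u)+exp (u^8-u^9/2) := ¶
    generalize 1/√(kp u)+exp (u^8-u^9/2) = S at *
    generalize (1/4-3/u^3)^2 = Y
    generalize exp (-(1/u^3)) = Z
    generalize Ebd u = E at *
    have : 0 < 2+1/u := ¶
    generalize 2+1/u = W at *
    have : u ≠ 0 := u0.ne'
    field_simp
  rw [hX]
  gcongr
lemma rayl {ι : Type*} [Fintype ι] [DecidableEq ι] {A : Matrix ι ι ℝ} (hA : A.IsHermitian) {l : ℝ}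
    (hl : ∀ x, Module.End.HasEigenvalue (Matrix.toLin' A) x → l ≤ x) (c : ι → ℝ) :
    l*(c ⬝ᵥ c) ≤ c ⬝ᵥ A.mulVec c := by
  have hB : (A-l•(1:Matrix ι ι ℝ)).IsHermitian := by
    refine hA.sub ?_
    rw [Matrix.IsHermitian, Matrix.conjTranspose_smul]; simp
  have hp : (A-l•(1:Matrix ι ι ℝ)).PosSemidef := by
    rw [hB.posSemidef_iff_eigenvalues_nonneg]
    intro i
    have h1 := hB.mulVec_eigenvectorBasis i
    rw [Matrix.sub_mulVec, Matrix.smul_mulVec, Matrix.one_mulVec] at h1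
    have := hl (hB.eigenvalues i+l) (Module.End.hasEigenvalue_of_hasEigenvector (x := (hB.eigenvectorBasis i).ofLp) ⟨by
      rw [Module.End.mem_eigenspace_iff, Matrix.toLin'_apply, add_smul, ← h1]; simp, fun h => by
      have := hB.eigenvectorBasis.orthonormal.ne_zero i
      apply this; ext j; simpa using congrFun h j⟩)
    simp only [Pi.zero_apply]; linarith
  have := hp.dotProduct_mulVec_nonneg c
  rw [Matrix.sub_mulVec, Matrix.smul_mulVec, Matrix.one_mulVec, dotProduct_sub, dotProduct_smul] at this
  simp at this; linarith
lemma quad (n N : ℕ) (c : Fin (N+1) → ℝ) :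
    IntegrableOn (fun x:ℝ => (∑ j, c j*x^(j:ℕ))^2*wt n x) (Ioi 0) ∧
    ∫ x in Rp, (∑ j, c j*x^(j:ℕ))^2*wt n x =
      ∑ j, ∑ k, c j*c k*∫ x in Rp, x^((j:ℕ)+(k:ℕ))*wt n x := by
  have e : ∀ x:ℝ, (∑ j, c j*x^(j:ℕ))^2*wt n x = ∑ j, ∑ k, c j*c k*(x^((j:ℕ)+(k:ℕ))*wt n x) := fun x => by
    rw [sq, sum_mul_sum, sum_mul]
    refine sum_congr rfl fun j _ => ?_
    rw [sum_mul]
    refine sum_congr rfl fun k _ => by rw [pow_add]; ring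
  have i2 : ∀ j k : Fin (N+1), IntegrableOn (fun x:ℝ => c j*c k*(x^((j:ℕ)+(k:ℕ))*wt n x)) (Ioi 0) :=
    fun j k => (mom_int n _).const_mul _
  simp only [e]
  refine ⟨integrable_finsetSum _ fun j _ => integrable_finsetSum _ fun k _ => i2 j k, ?_⟩
  rw [integral_finsetSum _ fun j _ => integrable_finsetSum _ fun k _ => i2 j k]
  refine sum_congr rfl fun j _ => ?_
  rw [integral_finsetSum _ fun k _ => i2 j k]
  exact sum_congr rfl fun k _ => integral_const_mul _ _
lemma eval_fin {P : Polynomial ℂ} (h : P.natDegree ≤ N) (z : ℂ) :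
    P.eval z = ∑ j : Fin (N+1), P.coeff j*z^(j:ℕ) := by
  rw [Polynomial.eval_eq_sum_range' (Nat.lt_succ_of_le h), Finset.sum_range]
lemma eI_orth (j k : ℕ) : ∫ θ in -π..π, eI θ^j*cj (eI θ^k) = if j = k then (2*π:ℂ) else 0 := by
  have e : ∀ θ:ℝ, eI θ^j*cj (eI θ^k) = cexp (((j:ℂ)-k)*I*θ) := fun θ => by
    rw [map_pow, ← eI_neg, eI, eI, ← cxm, ← cxm, ← cxa]
    congr 1; push_cast; ring
  simp only [e]
  split_ifs with h
  · subst h; simp; ring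
  · have hz : ((j:ℂ)-k)*I ≠ 0 := mul_ne_zero (sub_ne_zero.2 (by exact_mod_cast h)) I_ne_zero
    rw [integral_exp_mul_complex hz, div_eq_zero_iff]; left
    rw [sub_eq_zero, exp_eq_exp_iff_exists_int]
    exact ⟨(j:ℤ)-k, by push_cast; ring⟩
lemma pars {P : Polynomial ℂ} (h : P.natDegree ≤ N) :
    ∫ θ in -π..π, ‖P.eval (eI θ)‖^2 = 2*π*∑ j : Fin (N+1), ‖P.coeff j‖^2 := by
  have e : ∀ θ:ℝ, ((‖P.eval (eI θ)‖^2:ℝ):ℂ) = ∑ j : Fin (N+1), ∑ k : Fin (N+1),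
      P.coeff j*cj (P.coeff k)*(eI θ^(j:ℕ)*cj (eI θ^(k:ℕ))) := fun θ => by
    rw [ofReal_pow, ← mul_conj', eval_fin h, map_sum, sum_mul_sum]
    refine sum_congr rfl fun j _ => sum_congr rfl fun k _ => by rw [map_mul]; ring
  have hc := eI_cont
  have i2 : ∀ j k : Fin (N+1), IntervalIntegrable (fun θ:ℝ => P.coeff j*cj (P.coeff k)*(eI θ^(j:ℕ)*cj (eI θ^(k:ℕ)))) volume (-π) π := fun j k =>
    cii (continuous_const.mul ((hc.pow _).mul (Complex.continuous_conj.comp (hc.pow _)))) _ _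
  have : ((∫ θ in -π..π, ‖P.eval (eI θ)‖^2 : ℝ):ℂ) = ((2*π*∑ j : Fin (N+1), ‖P.coeff j‖^2:ℝ):ℂ) := by
    rw [← intervalIntegral.integral_ofReal]
    simp only [e]
    rw [intervalIntegral.integral_finsetSum fun j _ => ?_]
    · push_cast
      rw [mul_sum]
      refine sum_congr rfl fun j _ => ?_
      rw [intervalIntegral.integral_finsetSum fun k _ => i2 j k]
      simp only [iicm, eI_orth]
      rw [sum_eq_single j]
      · simp [mul_conj']; ring
      · intro b _ hb; rw [if_neg (fun h => hb (Fin.ext h.symm))]; simp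
      · simp
    · have := IntervalIntegrable.sum Finset.univ (fun k _ => i2 j k)
      refine this.congr (fun x _ => ?_)
      simp
  exact_mod_cast this
lemma NP_split {P : Polynomial ℂ} (h : P.natDegree ≤ N) (n : ℕ) :
    NP n P = (∑ j : Fin (N+1), ∑ k : Fin (N+1), (P.coeff j).re*(P.coeff k).re*∫ x in Rp, x^((j:ℕ)+(k:ℕ))*wt n x)
      + ∑ j : Fin (N+1), ∑ k : Fin (N+1), (P.coeff j).im*(P.coeff k).im*∫ x in Rp, x^((j:ℕ)+(k:ℕ))*wt n x := by
  have q1 := quad n N (fun j => (P.coeff j).re)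
  have q2 := quad n N (fun j => (P.coeff j).im)
  rw [← q1.2, ← q2.2, ← integral_add q1.1 q2.1, NP]
  refine integral_congr_ae (Eventually.of_forall fun x => ?_)
  simp only
  rw [← add_mul, sq_norm, normSq_apply, eval_fin h]
  congr 1
  simp only [Complex.re_sum, Complex.im_sum, ← ofReal_pow, Complex.re_mul_ofReal, Complex.im_mul_ofReal]
  ring
structure HS (n N : ℕ) (A : Matrix (Fin (N+1)) (Fin (N+1)) ℝ) (l : ℝ) : Prop where
  e : ∀ j k, A j k = ∫ x in Rp, x^((j:ℕ)+(k:ℕ))*wt n x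
  pd : A.PosDef
  ev : Module.End.HasEigenvalue (Matrix.toLin' A) l
  le : ∀ x, Module.End.HasEigenvalue (Matrix.toLin' A) x → l ≤ x
lemma HS.q {A : Matrix (Fin (N+1)) (Fin (N+1)) ℝ} {l : ℝ} (h : HS n N A l) (c : Fin (N+1) → ℝ) :
    c ⬝ᵥ A.mulVec c = ∑ j, ∑ k, c j*c k*∫ x in Rp, x^((j:ℕ)+(k:ℕ))*wt n x := by
  simp only [dotProduct, Matrix.mulVec, h.e, mul_sum]
  exact sum_congr rfl fun j _ => sum_congr rfl fun k _ => by ring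
lemma HS.low {A : Matrix (Fin (N+1)) (Fin (N+1)) ℝ} {l : ℝ} (h : HS n N A l) {P : Polynomial ℂ} (hP : P.natDegree ≤ N) :
    l*(∫ θ in -π..π, ‖P.eval (eI θ)‖^2) ≤ 2*π*NP n P := by
  have h1 := rayl h.pd.1 h.le (fun j => (P.coeff j).re)
  have h2 := rayl h.pd.1 h.le (fun j => (P.coeff j).im)
  rw [h.q] at h1 h2
  rw [pars hP, NP_split hP]
  have : ∑ j : Fin (N+1), ‖P.coeff j‖^2 = (fun j : Fin (N+1) => (P.coeff j).re) ⬝ᵥ (fun j => (P.coeff j).re)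
    + (fun j : Fin (N+1) => (P.coeff j).im) ⬝ᵥ (fun j => (P.coeff j).im) := by
    simp only [dotProduct, ← sum_add_distrib, sq_norm, normSq_apply]
  rw [this]
  nlinarith [pi_pos]
lemma HS.up {A : Matrix (Fin (N+1)) (Fin (N+1)) ℝ} {l : ℝ} (h : HS n N A l) : 0 < l ∧
    ∃ P : Polynomial ℝ, P.natDegree ≤ N ∧ (0 < ∫ θ in -π..π, ‖(P.map ofRealHom).eval (eI θ)‖^2) ∧
      2*π*NP n (P.map ofRealHom) = l*∫ θ in -π..π, ‖(P.map ofRealHom).eval (eI θ)‖^2 := by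
  obtain ⟨v, hv⟩ := h.ev.exists_hasEigenvector
  have h1 : A.mulVec v = l • v := by have := hv.apply_eq_smul; rwa [Matrix.toLin'_apply] at this
  have vp : 0 < v ⬝ᵥ v := by simpa using Matrix.dotProduct_star_self_pos_iff.2 hv.2
  have h2 : v ⬝ᵥ A.mulVec v = l*(v ⬝ᵥ v) := by rw [h1, dotProduct_smul]; rfl
  have lp : 0 < l := by
    have := h.pd.dotProduct_mulVec_pos hv.2
    simp only [star_trivial] at this
    rw [h2] at this; exact pos_of_mul_pos_left this vp.le
  let P : Polynomial ℝ := ∑ j : Fin (N+1), Polynomial.monomial (j:ℕ) (v j)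
  have hd : P.natDegree ≤ N := Polynomial.natDegree_sum_le_of_forall_le _ _ fun j _ =>
    (Polynomial.natDegree_monomial_le _).trans (Nat.lt_succ_iff.1 j.2)
  have hc : ∀ j : Fin (N+1), (P.map ofRealHom).coeff j = (v j:ℂ) := fun j => by
    rw [Polynomial.coeff_map]
    simp only [P, Polynomial.finsetSum_coeff, Polynomial.coeff_monomial]
    rw [sum_eq_single j]
    · simp
    · intro b _ hb; rw [if_neg (fun h => hb (Fin.ext h))]
    · simp
  have hd2 : (P.map ofRealHom).natDegree ≤ N := (Polynomial.natDegree_map_le).trans hd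
  have e1 : ∫ θ in -π..π, ‖(P.map ofRealHom).eval (eI θ)‖^2 = 2*π*(v ⬝ᵥ v) := by
    rw [pars hd2]; simp only [hc, dotProduct]; congr 1
    refine sum_congr rfl fun j _ => by rw [norm_real, norm_eq_abs, sq_abs, sq]
  refine ⟨lp, P, hd, by rw [e1]; positivity, ?_⟩
  rw [e1, NP_split hd2]
  simp only [hc, ofReal_re, ofReal_im]
  rw [← h.q v, h2]; simp; ring
theorem MAIN (hn : 1 ≤ n) {ε : ℝ} (hε : 0 < ε) : ∀ᶠ u in atTop, ∀ N : ℕ, (N:ℝ) = Nf n u →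
    ∀ (A : Matrix (Fin (N+1)) (Fin (N+1)) ℝ) (l : ℝ), HS n N A l →
    |2*π/l/(exp (H0 n u)*(¦u^n)⁻¹) - G0 n| ≤ ε := by
  filter_upwards [UPPER hn hε, LOWER hn hε, eventually_gt_atTop 0] with u h1 h2 u0 N hN A l h
  obtain ⟨lp, P, hd, hp, he⟩ := h.up
  obtain ⟨Q, V, hQ, hV, hV2, hV3⟩ := h2 N hN
  have h4 := h1 N hN P hd
  have h5 := h.low hQ
  have ep := exp_pos (H0 n u)
  have gp : 0 < (¦u^n)⁻¹ := ¶
  simp only [← mul_assoc] at h4 hV3 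
  set E := exp (H0 n u)*(¦u^n)⁻¹ with hE
  have Ep : 0 < E := ¶
  rw [mul_assoc _ (exp _), mul_assoc, ] at h4 hV3
  rw [← hE] at h4 hV3
  generalize (∫ θ in -π..π, ‖(P.map ofRealHom).eval (eI θ)‖^2) = I at *
  generalize (∫ θ in -π..π, ‖Q.eval (eI θ)‖^2) = J at *
  rw [div_div, abs_le]
  have lE : 0 < l*E := ¶
  constructor
  · rw [le_sub_iff_add_le, le_div_iff₀ lE]
    have a1 : l*(V*(E*(G0 n-ε))) ≤ 2*π*V := (mlm hV3 lp.le).trans (h5.trans (by nlinarith [pi_pos]))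
    have : V*((-ε+G0 n)*(l*E)) ≤ V*(2*π) := by nlinarith only [a1]
    exact le_of_mul_le_mul_left this hV
  · rw [sub_le_iff_le_add, div_le_iff₀ lE]
    have a1 : 2*π*I ≤ l*I*(E*(G0 n+ε)) := by
      rw [← he]; nlinarith only [mlm h4 (by positivity : (0:ℝ) ≤ 2*π)]
    have : I*(2*π) ≤ I*((ε+G0 n)*(l*E)) := by nlinarith only [a1]
    exact le_of_mul_le_mul_left this hp
def pp (n : ℕ) : ℝ := ∏ i ∈ range n, (2*(i:ℝ)+1)/(2*i+2)
lemma pp_pos (n : ℕ) : 0 < pp n := Finset.prod_pos fun i _ => by positivity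
lemma pp_succ (n : ℕ) : pp (n+1) = pp n*((2*(n:ℝ)+1)/(2*n+2)) := Finset.prod_range_succ _ _
lemma nu_eq (n : ℕ) : nu n = 1/(2*π*pp n) := by
  have h1 : JJ n = ∫ x in (0:ℝ)..(π/2), sin x^¥n := by
    have := integral_comp_mul_deriv (a := 0) (b := 1) (f := fun k:ℝ => 2*arctan k) (f' := fun k => 2*(1/(1+k^2))) (g := fun x => sin x^¥n)
      (fun k _ => (hasDerivAt_arctan k).const_mul 2) (by
        have : ∀ x:ℝ, 1+x^2 ≠ 0 := fun x => by positivity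
        exact Continuous.continuousOn (by fun_prop (disch := assumption))) ¢
    simp only [arctan_zero, arctan_one, mul_zero, (by ring : 2*(π/4) = π/2)] at this
    rw [← this, JJ]
    refine integral_congr fun k _ => ?_
    have : (0:ℝ) < 1+k^2 := ¶
    have s : sin (2*arctan k) = 2*k/(1+k^2) := by
      rw [sin_two_mul, sin_arctan, cos_arctan]
      have := mul_self_sqrt this.le
      field_simp
      rw [sq √(1+k^2), this]
    simp only [Function.comp, s]
    rw [mul_comm 2 k, mul_div_assoc, mul_pow, pow_succ]; ring
  have h2 : ∫ x in (0:ℝ)..π, sin x^¥n = 2*JJ n := by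
    rw [h1, ← integral_add_adjacent_intervals (b := π/2) (cii ¢ _ _) (cii ¢ _ _)]
    have : ∫ x in (π/2)..π, sin x^¥n = ∫ x in (0:ℝ)..(π/2), sin x^¥n := by
      have := intervalIntegral.integral_comp_sub_left (a := 0) (b := π/2) (fun x => sin x^¥n) π
      simp only [sin_pi_sub, sub_zero] at this
      rw [this]; congr 1; ring
    rw [this]; ring
  rw [integral_sin_pow_even] at h2
  have : 4*JJ n = 2*π*pp n := by unfold pp; linarith
  rw [nu, this]
def Ph : ℕ → ℝ → ℝ
  | 0, y => arsinh y
  | n+1, y => y^£n*√(1+y^2)/(2*n+2) - £n/(2*n+2)*Ph n y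
lemma sqrt_d (y : ℝ) : HasDerivAt (fun y:ℝ => √(1+y^2)) (y/√(1+y^2)) y := by
  have := (((hasDerivAt_id y).fun_pow 2).const_add 1).sqrt ¶
  refine this.congr_deriv ?_
  simp; field_simp
lemma Ph_deriv (n : ℕ) (y : ℝ) : HasDerivAt (Ph n) (y^¥n/√(1+y^2)) y := by
  induction n with
  | zero => simpa [Ph] using hasDerivAt_arsinh y
  | succ n ih =>
    have h := ((((hasDerivAt_id y).fun_pow £n).fun_mul (sqrt_d y)).div_const (2*n+2)).fun_sub (ih.const_mul ((2*(n:ℝ)+1)/(2*n+2)))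
    refine h.congr_deriv ?_
    have e := sq_sqrt (by positivity : (0:ℝ) ≤ 1+y^2)
    have p : 0 < √(1+y^2) := ¶
    simp only [id]
    generalize √(1+y^2) = s at *
    have : (2*n+1-1) = 2*n := ¿
    rw [this, mul_add, mul_one, pow_add _ ¥n 2, pow_succ _ ¥n]
    push_cast
    field_simp
    rw [e]; ring
lemma Ph_zero (n : ℕ) : Ph n 0 = 0 := by
  induction n with
  | zero => simp [Ph]
  | succ n ih => simp [Ph, ih]
lemma AA_arsinh {x : ℝ} (hx : 0 < x) : AA (x:ℂ) = (arsinh x:ℂ) := by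
  have h := (AA_sinh (u := (arsinh x:ℂ)) (by simpa) (by simp; positivity)).2
  rwa [← ofReal_sinh, sinh_arsinh] at h
lemma Eg_Ph (n : ℕ) {a : ℝ} (ha : 0 < a) : a^£n*(Eg n (AA ((1/a:ℝ):ℂ))).re = 4*nu n*Ph n a := by
  rw [AA_arsinh ¶, Eg]
  set A := arsinh (1/a) with hA
  have A0 : 0 < A := by simp [hA, ha]
  set s := exp (-(2*A)) with hs
  have s0 : 0 < s := exp_pos _
  have s1 : s < 1 := exp_lt_one_iff.2 §
  have e : -cexp (-(2*(A:ℂ))) = ((-s:ℝ):ℂ) := by rw [hs]; push_cast; rfl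
  rw [e, Eh_real, ofReal_re]
  have ha2 : a^2*(1-s)^2 = 4*s := by
    have h1 : sinh A = 1/a := sinh_arsinh _
    have h3 : exp (-A)^2 = s := by rw [hs, sq, ← exp_add]; congr 1; ring
    have h4 : exp A*exp (-A) = 1 := by rw [← exp_add]; simp
    rw [sinh_eq] at h1
    have h5 : a*(exp A-exp (-A)) = 2 := by field_simp at h1; linarith
    have h6 : a*(1-s) = 2*exp (-A) := by rw [← h3]; linear_combination exp (-A)*h5 - a*h4
    rw [← mul_pow, h6, mul_pow, h3]; ring
  have d : ∀ k ∈ uIcc (0:ℝ) 1, 0 < 1+-s*k^2 ∧ 0 ≤ k := fun k hk => by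
    rw [uIcc_of_le zero_le_one] at hk
    have : k^2 ≤ 1 := by nlinarith [hk.1, hk.2]
    exact ⟨by nlinarith, hk.1⟩
  have I := integral_comp_mul_deriv (a := 0) (b := 1) (f := fun k:ℝ => a*(k*(1+-s))/(1+-s*k^2))
    (f' := fun k => a*(1+-s)*(1+s*k^2)/(1+-s*k^2)^2) (g := fun x => x^¥n/√(1+x^2))
    (fun k hk => by
      have hp := (d k hk).1
      have := ((((hasDerivAt_id k).mul_const (1+-s)).const_mul a).fun_div ((((hasDerivAt_id k).fun_pow 2).const_mul (-s)).const_add 1) hp.ne')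
      refine this.congr_deriv ?_
      simp only [id]; congr 1; push_cast; ring) (by
      have : ∀ k ∈ uIcc (0:ℝ) 1, (1+-s*k^2)^2 ≠ 0 := fun k hk => (pow_pos (d k hk).1 2).ne'
      fun_prop (disch := assumption)) (by
      have : ∀ x:ℝ, √(1+x^2) ≠ 0 := fun x => by positivity
      fun_prop (disch := assumption))
  have e1 : a*(1*(1+-s))/(1+-s*1^2) = a := by field_simp [(by linarith : (0:ℝ) < 1+-s).ne']
  simp only [e1, zero_mul, mul_zero, zero_div] at I
  have J := integral_eq_sub_of_hasDerivAt (a := 0) (b := a) (fun x _ => Ph_deriv n x) (cii (by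
      have : ∀ x:ℝ, √(1+x^2) ≠ 0 := fun x => by positivity
      fun_prop (disch := assumption)) _ _)
  rw [J, Ph_zero, sub_zero] at I
  rw [← I, mul_left_comm, ← iicm]
  congr 1
  refine integral_congr fun k hk => ?_
  obtain ⟨hp, hk0⟩ := d k hk
  have q : √(1+(a*(k*(1+-s))/(1+-s*k^2))^2) = (1+s*k^2)/(1+-s*k^2) := by
    rw [← sqrt_sq (by positivity : 0 ≤ (1+s*k^2)/(1+-s*k^2))]
    congr 1; rw [div_pow, div_pow, eq_div_iff ¶, add_mul, div_mul_cancel₀ _ ¶]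
    linear_combination k^2*ha2
  simp only [Function.comp, q]
  have hp2 : (0:ℝ) < 1+s*k^2 := ¶
  rw [(by ring : a*(k*(1+-s))/(1+-s*k^2) = a*k*((1+-s)/(1+-s*k^2))), mul_pow, mul_pow, pow_succ, pow_succ ((1+-s)/(1+-s*k^2))]
  generalize ((1+-s)/(1+-s*k^2))^¥n = Q
  field_simp
lemma H0_eq (n : ℕ) (hu : 0 < u) : H0 n u = 4*Nf n u*arsinh (1/¦u) + 4*nu n*Ph n ¦u := by
  have h := Eg_Ph n (pow_pos hu 12)
  rw [H0, Wr, mul_add, h, AA_arsinh ¶, ofReal_re, Nf]; ring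
def WW (n : ℕ) (y : ℝ) : ℝ := 4*(nu n*y^£n)*arsinh (1/y) + 4*nu n*Ph n y
lemma H0_WW {u y : ℝ} (hu : 0 < u) (hy : ¦u ≤ y) (h : nu n*y^£n = Nf n u) :
    |H0 n u - WW n y| ≤ 4*(u^(8*n+8))^2/(nu n*(¦u^(2*n+2))) := by
  have n0 := nu_pos n
  rw [H0_eq n hu, WW, h]
  set a := ¦u with ha
  have a0 : 0 < a := ¶
  set M := u^(8*n+8)
  have hN : Nf n u = nu n*a^£n+M := rfl
  have M0 : 0 < M := ¶
  have D : ∀ x ∈ Icc a y, HasDerivAt (fun x => 4*Nf n u*arsinh (1/x)+4*nu n*Ph n x) (4*(nu n*x^£n-Nf n u)/(x*√(1+x^2))) x := fun x hx => by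
    have x0 : 0 < x := a0.trans_le hx.1
    have h1 : HasDerivAt (fun x:ℝ => 1/x) (-(x^2)⁻¹) x := by simpa using hasDerivAt_inv x0.ne'
    have := (((hasDerivAt_arsinh (1/x)).comp x h1).const_mul (4*Nf n u)).fun_add ((Ph_deriv n x).const_mul (4*nu n))
    refine this.congr_deriv ?_
    have : √(1+(1/x)^2) = √(1+x^2)/x := by
      rw [← sqrt_sq x0.le, ← sqrt_div ¶, sqrt_sq x0.le]; congr 1; field_simp; ring
    rw [this, pow_succ]
    have p : 0 < √(1+x^2) := ¶
    field_simp; ring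
  have B : ∀ x ∈ Icc a y, ‖4*(nu n*x^£n-Nf n u)/(x*√(1+x^2))‖ ≤ 4*M/a^2 := fun x hx => by
    have x0 : 0 < x := a0.trans_le hx.1
    have h2 : nu n*x^£n ≤ Nf n u := by rw [← h]; gcongr; exact hx.2
    have h3 : nu n*a^£n ≤ nu n*x^£n := by gcongr; exact hx.1
    have p : x ≤ √(1+x^2) := le_sqrt_of_sq_le §
    rw [norm_div, norm_mul, norm_of_nonpos (by linarith : nu n*x^£n-Nf n u ≤ 0), norm_of_nonneg (by positivity : 0 ≤ x*√(1+x^2))]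
    simp only [norm_ofNat]
    have : a^2 ≤ x*√(1+x^2) := by rw [sq]; exact mul_le_mul hx.1 (hx.1.trans p) a0.le x0.le
    gcongr; linarith
  have := (convex_Icc a y).norm_image_sub_le_of_norm_hasDerivWithin_le (fun x hx => (D x hx).hasDerivWithinAt) B (right_mem_Icc.2 hy) (left_mem_Icc.2 hy)
  rw [norm_eq_abs] at this
  refine this.trans ?_
  rw [norm_of_nonpos §]
  have h4 : nu n*a^¥n*(y-a) ≤ M := by
    have h5 : nu n*(y^¥n*y) = nu n*(a^¥n*a)+M := by rw [← pow_succ, ← pow_succ, h, hN]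
    have h6 : a^¥n*y ≤ y^¥n*y := by gcongr; linarith
    nlinarith
  rw [div_mul_eq_mul_div, div_le_div_iff₀ ¶ ¶, pow_add a ¥n 2]
  have : 0 < M*a^2 := ¶
  nlinarith [mlm h4 this.le]
lemma L_eq (s : ℕ) : Lcoef (((s+1:ℕ):ℝ)-1/2) = ((s+1:ℕ):ℝ)*pp (s+1) := by
  induction s with
  | zero => 
    rw [Lcoef, pp_succ]
    have : (4:ℝ)^(1/2:ℝ) = 2 := by rw [← sqrt_eq_rpow, (by norm_num : (4:ℝ) = 2^2)]; simp
    norm_num [pp, Gamma_one_half_eq, sq_sqrt pi_pos.le, this]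
    field_simp
  | succ s ih =>
    set x : ℝ := (s:ℝ)+1/2 with hx
    have x0 : 0 < x := ¶
    rw [(by push_cast; ring : ((s+1+1:ℕ):ℝ)-1/2 = x+1)]
    rw [(by push_cast; ring : ((s+1:ℕ):ℝ)-1/2 = x)] at ih
    have e : Lcoef (x+1) = Lcoef x*((x+1)/(x+1/2)) := by
      rw [Lcoef, Lcoef, rpow_add ¡, rpow_one, Gamma_add_one x0.ne',
        (by ring : 2*(x+1) = 2*x+1+1), Gamma_add_one ¶, Gamma_add_one ¶]
      have := Gamma_pos_of_pos (by positivity : 0 < 2*x)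
      field_simp
      ring
    rw [e, ih, pp_succ (s+1), hx]; push_cast
    field_simp; ring
lemma L_pos' {s : ℕ} (h : 1 ≤ s) : Lcoef ((s:ℝ)-1/2) = s*pp s := by
  obtain ⟨k, rfl⟩ := Nat.exists_eq_add_of_le' h
  exact L_eq k
lemma L_beta (n : ℕ) : Lcoef ((n:ℝ)+1/2)/(2*((n:ℝ)+1/2)) = pp n/2 := by
  have := L_eq n
  rw [(by push_cast; ring : ((n+1:ℕ):ℝ)-1/2 = (n:ℝ)+1/2), pp_succ] at this
  rw [this]; push_cast; field_simp
lemma binexp (a : ℝ) (c : ℕ → ℝ) (h0 : c 0 = 1) (hc : ∀ j:ℕ, ((j:ℝ)+1)*c (j+1) = (a-j)*c j) (k : ℕ) :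
    ∃ K, 0 ≤ K ∧ ∀ t, 0 ≤ t → t ≤ 1 → |(1+t)^a - ∑ j ∈ range (k+1), c j*t^j| ≤ K*t^(k+1) := by
  have key : ∀ (k:ℕ) (t:ℝ), (1+t)*(∑ j ∈ range (k+1), c j*((j:ℝ)*t^(j-1))) - a*∑ j ∈ range (k+1), c j*t^j = (k-a)*c k*t^k := fun k t => by
    induction k with
    | zero => simp
    | succ k ih =>
      rw [sum_range_succ _ (k+1), sum_range_succ _ (k+1)]
      have := hc k
      simp only [Nat.add_sub_cancel]; push_cast
      rw [pow_succ]
      linear_combination ih + t^k*this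
  have pb : ∀ b t:ℝ, 0 ≤ t → t ≤ 1 → (1+t)^b ≤ 2^|b| := fun b t t0 t1 => by
    calc (1+t)^b ≤ (1+t)^|b| := rpow_le_rpow_of_exponent_le § (le_abs_self b)
      _ ≤ 2^|b| := rpow_le_rpow § § (abs_nonneg b)
  set K' : ℝ := (2:ℝ)^(|(-a-1)|) * |((k:ℝ)-a)*c k| with hK'
  refine ⟨2^|a| * K', by positivity, fun t t0 t1 => ?_⟩
  set S : ℝ → ℝ := fun t => ∑ j ∈ range (k+1), c j*t^j with hS
  have D : ∀ x ∈ Icc 0 t, HasDerivWithinAt (fun x => (1+x)^(-a)*S x) ((1+x)^(-a-1)*(((k:ℝ)-a)*c k*x^k)) (Icc 0 t) x := fun x hx => by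
    have p : 0 < 1+x := by linarith [hx.1]
    have h1 : HasDerivAt (fun x:ℝ => (1+x)^(-a)) (1*(-a)*(1+x)^(-a-1)) x := ((hasDerivAt_id x).const_add 1).rpow_const (Or.inl p.ne')
    have h2 : HasDerivAt S (∑ j ∈ range (k+1), c j*((j:ℝ)*x^(j-1))) x := by
      have := HasDerivAt.fun_sum (u := range (k+1)) (fun j _ => ((hasDerivAt_pow j x).const_mul (c j)))
      exact this
    refine ((h1.fun_mul h2).congr_deriv ?_).hasDerivWithinAt
    rw [← key k x, (by rw [← rpow_add_one p.ne']; congr 1; ring : (1+x)^(-a) = (1+x)^(-a-1)*(1+x))]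
    ring
  have := (convex_Icc 0 t).norm_image_sub_le_of_norm_hasDerivWithin_le (C := K'*t^k) D (fun x hx => by
    rw [norm_mul, norm_mul, norm_pow, norm_of_nonneg (rpow_nonneg (by linarith [hx.1]) _), norm_of_nonneg hx.1, norm_eq_abs, hK', mul_assoc]
    have := hx.1; have := hx.2
    have := pb (-a-1) x § §
    gcongr) (left_mem_Icc.2 t0) (right_mem_Icc.2 t0)
  have S0 : S 0 = 1 := by
    simp only [hS]; rw [sum_eq_single 0]
    · simp [h0]
    · intro b _ hb; simp [hb]
    · simp
  rw [S0, norm_eq_abs, norm_eq_abs, sub_zero, abs_of_nonneg t0] at this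
  simp only [add_zero, one_rpow, mul_one] at this
  have p : 0 < 1+t := §
  have e : (1+t)^a-S t = -((1+t)^a*((1+t)^(-a)*S t-1)) := by
    rw [mul_sub, ← mul_assoc, ← rpow_add p]; simp
  rw [e, abs_neg, abs_mul, abs_of_nonneg (rpow_nonneg p.le _), mul_assoc, pow_succ, ← mul_assoc K']
  exact mul_le_mul (pb a t t0 t1) this (abs_nonneg _) ¶
def gm (j : ℕ) : ℝ := Gamma ((j:ℝ)-1/2)/Gamma ((j:ℝ)+1)
lemma gm_zero : gm 0 = -(2*√π) := by
  have := Gamma_add_one (s := (-1/2:ℝ)) ¡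
  rw [(by norm_num : (-1/2:ℝ)+1 = 1/2), Gamma_one_half_eq] at this
  simp only [gm, Nat.cast_zero, zero_add, zero_sub, Gamma_one, div_one]
  rw [(by norm_num : (-(1/2):ℝ) = -1/2)]; linarith
lemma gm_succ (j : ℕ) : ((j:ℝ)+1)*gm (j+1) = ((j:ℝ)-1/2)*gm j := by
  have h : ((j:ℝ)-1/2) ≠ 0 := fun h => by
    have : (2*j:ℝ) = 1 := §
    have : 2*j = 1 := by exact_mod_cast this
    omega
  rw [gm, gm]; push_cast
  rw [(by ring : (j:ℝ)+1-1/2 = j-1/2+1), Gamma_add_one h, Gamma_add_one (s := (j:ℝ)+1) ¶]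
  have := Gamma_pos_of_pos (by positivity : 0 < (j:ℝ)+1)
  field_simp
lemma tz {f : ℝ → ℝ} (K : ℝ) (h : ∀ y, 1 ≤ y → |f y| ≤ K/y^2) : Tendsto f atTop (𝓝 0) :=
  squeeze_zero_norm' ((eventually_ge_atTop 1).mono fun y hy => h y hy) (tend_inv 2 two_ne_zero K)
def sgm (s : ℕ) (y : ℝ) : ℝ := ∑ j ∈ range (s+1), (-1)^j*gm j*(y^(2*s)/y^(2*j))
lemma sq_lim {s : ℕ} (hs : 1 ≤ s) : Tendsto (fun y => y^(2*s-1)*√(1+y^2) + sgm s y/(2*√π)) atTop (𝓝 0) := by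
  have p0 : 0 < √π := ¶
  obtain ⟨K, K0, hK⟩ := binexp (1/2) (fun j => -((-1)^j*gm j)/(2*√π)) (by simp [gm_zero, p0.ne']) (fun j => by
    have := gm_succ j
    simp only [pow_succ]; field_simp; linear_combination 2*this) s
  refine tz K fun y hy => ?_
  have y0 : 0 < y := §
  have := hK ((1/y)^2) ¶ (pow_le_one₀ ¶ (by rw [div_le_one y0]; exact hy))
  have e : y^(2*s-1)*√(1+y^2) + sgm s y/(2*√π) = y^(2*s)*((1+(1/y)^2)^(1/2:ℝ) - ∑ j ∈ range (s+1), -((-1)^j*gm j)/(2*√π)*((1/y)^2)^j) := by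
    have e1 : √(1+y^2) = y*√(1+(1/y)^2) := by
      nth_rw 2 [← sqrt_sq y0.le]
      rw [← sqrt_mul ¶]; congr 1; field_simp; ring
    rw [← sqrt_eq_rpow, mul_sub, e1, ← mul_assoc, ← pow_succ, Nat.sub_add_cancel ¿, mul_sum, sgm, sum_div, sub_eq_add_neg, ← Finset.sum_neg_distrib]
    congr 1
    refine sum_congr rfl fun j _ => ?_
    rw [← pow_mul, one_div_pow]; ring
  rw [e, abs_mul, abs_of_pos ¶]
  refine (mlm this ¶).trans (le_of_eq ?_)
  rw [← pow_mul, one_div_pow, mul_add, pow_add]; field_simp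
lemma ash_lim (n : ℕ) : Tendsto (fun y => y^£n*arsinh (1/y) - y^¥n/(2*√π)*∑ r ∈ range (n+1), (-1)^r*aCoef r/y^(2*r)) atTop (𝓝 0) := by
  have p0 : 0 < √π := ¶
  set c : ℕ → ℝ := fun r => (-1)^r*(Gamma ((r:ℝ)+1/2)/Gamma ((r:ℝ)+1))/√π with hc
  obtain ⟨K, K0, hK⟩ := binexp (-1/2) c (by
    simp only [hc, pow_zero, one_mul, Nat.cast_zero, zero_add, Gamma_one, div_one, Gamma_one_half_eq, div_self p0.ne']) (fun j => by
    simp only [hc]; push_cast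
    rw [(by ring : (j:ℝ)+1+1/2 = j+1/2+1), Gamma_add_one (s := (j:ℝ)+1/2) ¶, Gamma_add_one (s := (j:ℝ)+1) ¶]
    have := Gamma_pos_of_pos (by positivity : 0 < (j:ℝ)+1)
    simp only [pow_succ]; field_simp; ring) n
  refine tz K fun y hy => ?_
  have y0 : 0 < y := §
  set x := 1/y with hx
  have x0 : 0 < x := ¶
  have x1 : x ≤ 1 := by rw [hx, div_le_one y0]; exact hy
  have b := (convex_Icc 0 x).norm_image_sub_le_of_norm_hasDerivWithin_le (C := K*(x^2)^(n+1))
    (f := fun x => arsinh x - ∑ j ∈ range (n+1), c j*(x^(2*j+1)/(2*j+1)))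
    (f' := fun t => (1+t^2)^(-1/2:ℝ) - ∑ j ∈ range (n+1), c j*(t^2)^j) (fun t ht => by
      refine HasDerivAt.hasDerivWithinAt ?_
      have := (hasDerivAt_arsinh t).fun_sub (HasDerivAt.fun_sum (u := range (n+1)) (fun j _ => (((hasDerivAt_pow (2*j+1) t).div_const (2*(j:ℝ)+1)).const_mul (c j))))
      refine this.congr_deriv ?_
      rw [sqrt_eq_rpow, ← rpow_neg ¶, neg_div]
      congr 1
      refine sum_congr rfl fun j _ => ?_
      rw [Nat.add_sub_cancel, pow_mul]; push_cast; field_simp) (fun t ht => by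
      have := ht.1; have := ht.2
      refine (hK (t^2) ¶ (by nlinarith)).trans ?_
      gcongr) (left_mem_Icc.2 x0.le) (right_mem_Icc.2 x0.le)
  simp only [arsinh_zero, norm_eq_abs, sub_zero, abs_of_pos x0, zero_pow (Nat.succ_ne_zero _), zero_div, mul_zero, Finset.sum_const_zero] at b
  have e : y^£n*arsinh x - y^¥n/(2*√π)*∑ r ∈ range (n+1), (-1)^r*aCoef r/y^(2*r) =
      y^£n*(arsinh x - ∑ j ∈ range (n+1), c j*(x^(2*j+1)/(2*j+1))) := by
    rw [mul_sub, mul_sum, mul_sum]; congr 1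
    refine sum_congr rfl fun j _ => ?_
    simp only [hc, aCoef, hx, one_div_pow]
    have := Gamma_pos_of_pos (by positivity : 0 < (j:ℝ)+1)
    rw [pow_succ, pow_succ]; field_simp
  rw [e, abs_mul, abs_of_pos ¶]
  refine (mlm b ¶).trans (le_of_eq ?_)
  rw [← pow_mul, hx, one_div_pow, mul_add, pow_add, pow_succ]; field_simp; ring
lemma Ph_closed (n : ℕ) (y : ℝ) : Ph n y = (-1)^n*pp n*(∑ s ∈ Finset.Icc 1 n, (-1)^s/(2*s*pp s)*(y^(2*s-1)*√(1+y^2)) + arsinh y) := by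
  induction n with
  | zero => simp [Ph, pp]
  | succ n ih =>
    rw [Ph, ih, Finset.sum_Icc_succ_top ¿, pp_succ, (by omega : 2*(n+1)-1 = 2*n+1)]
    have := pp_pos n
    have h1 : ((-1:ℝ)^n)^2 = 1 := by rw [← pow_mul, mul_comm, pow_mul]; simp
    push_cast
    rw [pow_succ (-1:ℝ) n]
    generalize (∑ s ∈ Finset.Icc 1 n, (-1:ℝ)^s/(2*s*pp s)*(y^(2*s-1)*√(1+y^2))) = S
    generalize (-1:ℝ)^n = σ at *
    field_simp
    linear_combination (-√(1+y^2)*y^£n)*h1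
lemma ash_log : Tendsto (fun y => arsinh y - log (2*y)) atTop (𝓝 0) := by
  have h : Tendsto (fun y:ℝ => log ((1+√(1+1/y^2))/2)) atTop (𝓝 0) := by
    have h1 := tend_inv 2 two_ne_zero 1
    have := (((((h1.const_add 1).sqrt).const_add 1).div_const 2).log ¡)
    norm_num at this ⊢
    exact this
  refine h.congr' ((eventually_gt_atTop 0).mono fun y hy => ?_)
  beta_reduce
  rw [arsinh, ← log_div ¶ ¶]
  congr 1
  have e1 : √(1+y^2) = y*√(1+1/y^2) := by
    nth_rw 2 [← sqrt_sq hy.le]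
    rw [← sqrt_mul ¶]; congr 1; field_simp; ring
  rw [e1]; field_simp
lemma del_eq {n s : ℕ} (hs : s ≤ n) {y : ℝ} (hy : 0 < y) : ∑ r ∈ range (n+1), (-1)^r*gammaCoef ((s:ℤ)-((n:ℤ)-(r:ℤ)))*(y^¥n/y^(2*r)) = (-1)^(n+s)*sgm s y := by
  obtain ⟨k, rfl⟩ := Nat.exists_eq_add_of_le' hs
  rw [add_assoc k s 1, Finset.sum_range_add, sum_eq_zero, zero_add, sgm, mul_sum]
  · refine sum_congr rfl fun j _ => ?_
    have e1 : ((s:ℤ)-(((k+s:ℕ):ℤ)-((k+j:ℕ):ℤ))) = (j:ℤ) := by push_cast; ring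
    have e2 : y^(2*(k+s))/y^(2*(k+j)) = y^(2*s)/y^(2*j) := by
      rw [mul_add, mul_add, pow_add, pow_add]; field_simp
    have e3 : (-1:ℝ)^(k+s+s) = (-1)^k := by rw [add_assoc, pow_add, ← two_mul, pow_mul]; simp
    rw [e1, e2, e3, gammaCoef, if_pos ¶, pow_add, gm]; push_cast; ring
  · intro r hr
    rw [mem_range] at hr
    rw [gammaCoef, if_neg (by push_cast; omega)]; simp
def br (n : ℕ) (y : ℝ) : ℝ := 2*nu n*y^¥n/√π*(∑ r ∈ range (n+1), (-1)^r*BCoef n ((n:ℝ)+1/2) r/y^(2*r)) + (-1)^n/π*log (4*y^2)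
theorem WW_lim (n : ℕ) : Tendsto (fun y => WW n y - br n y) atTop (𝓝 0) := by
  have h1 := (ash_lim n).const_mul (4*nu n)
  have h2 : Tendsto (fun y => 2*(-1)^n/π*(∑ s ∈ Finset.Icc 1 n, (-1)^s/(2*s*pp s)*(y^(2*s-1)*√(1+y^2) + sgm s y/(2*√π)) + (arsinh y - log (2*y)))) atTop (𝓝 (2*(-1)^n/π*(∑ s ∈ Finset.Icc 1 n, (-1)^s/(2*s*pp s)*0 + 0))) :=
    ((tendsto_finsetSum _ fun s hs => (sq_lim (mem_Icc.1 hs).1).const_mul _).add ash_log).const_mul _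
  have h3 := h1.add h2
  simp only [mul_zero, Finset.sum_const_zero, add_zero] at h3
  refine h3.congr' ((eventually_gt_atTop 0).mono fun y hy => ?_)
  have q0 := pp_pos n
  have p0 : 0 < √π := ¶
  have e4 : ∑ r ∈ range (n+1), (-1)^r*BCoef n ((n:ℝ)+1/2) r/y^(2*r) = (∑ r ∈ range (n+1), (-1)^r*aCoef r/y^(2*r))
     - pp n/2*∑ r ∈ range (n+1), (-1)^r*deltaCoef n ((n:ℤ)-(r:ℤ))/y^(2*r) := by
    rw [mul_sum, ← Finset.sum_sub_distrib]
    refine sum_congr rfl fun r _ => ?_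
    rw [BCoef, L_beta]; ring
  have e5 : y^¥n*∑ r ∈ range (n+1), (-1)^r*deltaCoef n ((n:ℤ)-(r:ℤ))/y^(2*r) = (-1)^n*∑ s ∈ Finset.Icc 1 n, (-1)^s/(s*pp s)*sgm s y := by
    simp only [deltaCoef, mul_sum, sum_div]
    rw [Finset.sum_comm]
    refine sum_congr rfl fun s hs => ?_
    obtain ⟨s1, s2⟩ := mem_Icc.1 hs
    have := del_eq s2 hy
    rw [pow_add] at this
    rw [(by ring : (-1)^n*((-1)^s/(s*pp s)*sgm s y) = ((-1)^n*(-1)^s*sgm s y)/(s*pp s)), ← this, sum_div]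
    refine sum_congr rfl fun r _ => ?_
    rw [L_pos' s1]; ring
  have e6 : log (4*y^2) = 2*log (2*y) := by rw [(by ring : 4*y^2 = (2*y)^2), log_pow]; norm_num
  have e7 : ∑ s ∈ Finset.Icc 1 n, (-1)^s/(2*s*pp s)*(y^(2*s-1)*√(1+y^2) + sgm s y/(2*√π)) = (∑ s ∈ Finset.Icc 1 n, (-1)^s/(2*s*pp s)*(y^(2*s-1)*√(1+y^2)))
     + 1/(4*√π)*∑ s ∈ Finset.Icc 1 n, (-1)^s/(s*pp s)*sgm s y := by
    rw [mul_sum, ← sum_add_distrib]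
    refine sum_congr rfl fun s hs => ?_
    have := pp_pos s
    have := (mem_Icc.1 hs).1
    field_simp; ring
  beta_reduce
  rw [e7, br, e4, e6, WW, Ph_closed, nu_eq]
  generalize (∑ s ∈ Finset.Icc 1 n, (-1:ℝ)^s/(s*pp s)*sgm s y) = S1 at *
  generalize (∑ s ∈ Finset.Icc 1 n, (-1:ℝ)^s/(2*s*pp s)*(y^(2*s-1)*√(1+y^2))) = S2 at *
  generalize (∑ r ∈ range (n+1), (-1:ℝ)^r*deltaCoef n ((n:ℤ)-(r:ℤ))/y^(2*r)) = S3 at *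
  generalize (∑ r ∈ range (n+1), (-1:ℝ)^r*aCoef r/y^(2*r)) = S4 at *
  generalize log (2*y) = l
  generalize arsinh y = l1
  generalize arsinh (1/y) = l2
  rw [← sub_eq_zero]
  have : 2*(1/(2*π*pp n))*y^¥n/√π*(S4 - pp n/2*S3) = 2*(1/(2*π*pp n))*y^¥n/√π*S4 - 1/(2*π*√π)*((-1)^n*S1) := by
    rw [← e5]; field_simp
  rw [this]
  field_simp; ring
lemma qex (n : ℕ) : ∃ q : ℝ, 0 < q ∧ Ccoef ((n:ℝ)+1/2) = q^4 ∧ nu n = 1/q^(4*n+2) := by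
  set β : ℝ := (n:ℝ)+1/2 with hβ
  have b0 : 0 < β := ¶
  have g1 := Gamma_pos_of_pos b0
  have g2 := Gamma_pos_of_pos (by positivity : 0 < 2*β)
  have c0 : 0 < Ccoef β := by unfold Ccoef; positivity
  have h4 : (Ccoef β ^ (1/4:ℝ))^4 = Ccoef β := by
    rw [← rpow_natCast, ← rpow_mul c0.le]; norm_num
  refine ⟨Ccoef β ^ (1/4:ℝ), by positivity, h4.symm, ?_⟩
  have h5 : (Ccoef β ^ (1/4:ℝ))^(4*n+2) = Ccoef β ^ β := by
    rw [← rpow_natCast, ← rpow_mul c0.le]; congr 1; rw [hβ]; push_cast; ring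
  have h6 : Ccoef β ^ β = 4^β*(Gamma β ^ 2 / Gamma (2 * β)) := by
    rw [Ccoef, mul_rpow ¡ ¶, ← rpow_mul ¶]
    rw [one_div_mul_cancel b0.ne', rpow_one]
  have h7 := L_beta n
  rw [← hβ, Lcoef] at h7
  have := pp_pos n
  have := pi_pos
  rw [h5, h6, nu_eq]
  congr 1
  field_simp at h7 ⊢
  linarith
lemma B0_eq (hn : 1 ≤ n) : BCoef n ((n:ℝ)+1/2) 0 = √π*£n/n := by
  have n0 : (0:ℝ) < n := by exact_mod_cast hn
  have := pp_pos n
  rw [BCoef, L_beta, deltaCoef, sum_eq_single n]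
  · rw [L_pos' hn, gammaCoef, if_pos (by simp), aCoef]
    have := gm_zero
    rw [gm] at this
    push_cast at this ⊢
    simp only [sub_zero, sub_self] at this ⊢
    rw [this]
    norm_num [Gamma_one_half_eq]
    field_simp; ring
  · intro s hs hs'
    have := (mem_Icc.1 hs).2
    rw [gammaCoef, if_neg (by push_cast; omega)]; simp
  · intro h; exact absurd (mem_Icc.2 ⟨hn, le_rfl⟩) h
lemma G0_pos (hn : 1 ≤ n) : 0 < G0 n := by
  have := kap_pos hn
  have := pi_pos
  unfold G0; positivity
def RR (n : ℕ) (β N : ℝ) : ℝ := (1/4) * π ^ (-(1/4) : ℝ) * Ccoef β ^ ((1/4) : ℝ) *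
          BCoef n β 0 ^ (-(1/2) : ℝ) * N ^ (-(1/2) + 1 / (4 * β)) *
          (4 * Ccoef β * N ^ (1 / β)) ^ ((-1 : ℝ) ^ n / π) *
          exp ((2 * N ^ (1 - 1 / (2 * β)) / sqrt (π * Ccoef β)) *
            ∑ r ∈ range (n + 1),
              (-1 : ℝ) ^ r * (BCoef n β r / Ccoef β ^ r) * N ^ (-(r : ℝ) / β))
lemma RR_eq (hn : 1 ≤ n) {y : ℝ} (hy : 0 < y) :
    RR n ((n:ℝ)+1/2) (nu n*y^£n) = G0 n*(y^n)⁻¹*exp (br n y) := by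
  obtain ⟨q, q0, hC, hν⟩ := qex n
  have n0 : (0:ℝ) < n := by exact_mod_cast hn
  have p0 := pi_pos
  obtain ⟨z, z0, rfl⟩ : ∃ z, 0 < z ∧ y = q^2*z := ⟨y/q^2, by positivity, by field_simp⟩
  have hN : nu n*(q^2*z)^£n = z^£n := by
    rw [hν, mul_pow, ← pow_mul, (by ring : 2*£n = 4*n+2)]; field_simp
  have hpw : ∀ t : ℝ, (z^£n)^t = z^(£n*t) := fun t => by
    rw [← rpow_natCast, ← rpow_mul z0.le]; push_cast; rfl
  have e1 : (z^£n)^(-(1/2) + 1 / (4 * ((n:ℝ)+1/2))) = (z^n)⁻¹ := by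
    rw [hpw, ← rpow_natCast, ← rpow_neg z0.le]; congr 1; field_simp; ring
  have e2 : (z^£n)^(1/((n:ℝ)+1/2)) = z^2 := by
    rw [hpw, ← rpow_natCast]; congr 1; push_cast; field_simp
  have e3 : (z^£n)^(1 - 1 / (2 * ((n:ℝ)+1/2))) = z^¥n := by
    rw [hpw, ← rpow_natCast]; congr 1; push_cast; field_simp; ring
  have e4 : ∀ r : ℕ, (z^£n)^(-(r:ℝ)/((n:ℝ)+1/2)) = (z^(2*r))⁻¹ := fun r => by
    rw [hpw, ← rpow_natCast, ← rpow_neg z0.le]; congr 1; push_cast; field_simp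
  have e5 : (q^4)^((1/4):ℝ) = q := by
    rw [← rpow_natCast, ← rpow_mul q0.le]; norm_num
  have e6 : √(π*q^4) = √π*q^2 := by
    rw [sqrt_mul p0.le, (by ring : q^4 = (q^2)^2), sqrt_sq ¶]
  have e7 : 1/4*π^(-(1/4):ℝ)*q*(√π*£n/n)^(-(1/2):ℝ)*(z^n)⁻¹ = G0 n*((q^2*z)^n)⁻¹ := by
    have a1 : π^(-(1/4):ℝ)*(√π*£n/n)^(-(1/2):ℝ) = √(n/(£n*π)) := by
      rw [sqrt_eq_rpow, sqrt_eq_rpow, mul_div_assoc, mul_rpow ¶ ¶, ← mul_assoc,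
        ← rpow_mul p0.le, ← rpow_add p0, (by field_simp : n/(£n*π) = π⁻¹*(£n/n:ℝ)⁻¹),
        mul_rpow ¶ ¶, inv_rpow p0.le, inv_rpow ¶, ← rpow_neg p0.le, ← rpow_neg ¶]
      norm_num
    have a2 : G0 n = 1/4*q^£n*√(n/(£n*π)) := by
      rw [G0, kap, hν]
      have : π/(2*(£n*(1/q^(4*n+2))/¥n)) = (q^£n*π)^2*(n/(£n*π)) := by
        rw [mul_pow, ← pow_mul, (by ring : £n*2 = 4*n+2)]; field_simp
      rw [this, sqrt_mul ¶, sqrt_sq ¶]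
      field_simp
    rw [a2, ← a1, mul_pow, pow_succ, ← pow_mul]
    field_simp
  rw [RR, hN, hC, e1, e2, e3, e5, e6, B0_eq hn, e7, br, exp_add, rpow_def_of_pos ¶, mul_assoc, ← exp_add, ← exp_add]
  congr 2
  rw [add_comm]
  congr 1
  · rw [hν, mul_sum, mul_sum]
    refine sum_congr rfl fun r _ => ?_
    rw [e4, mul_pow, mul_pow, ← pow_mul, ← pow_mul, ← pow_mul, (by ring : 2*¥n = 4*n), (by ring : 2*(2*r) = 4*r), pow_add]
    field_simp
  · rw [mul_comm]; congr 2; ring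
lemma Nf_mono (n : ℕ) {u v : ℝ} (hu : 0 ≤ u) (h : u ≤ v) : Nf n u ≤ Nf n v := by
  have := nu_pos n
  unfold Nf; gcongr
lemma uex (n : ℕ) : ∃ u : ℕ → ℝ, (∀ N, 0 ≤ u N ∧ (N:ℝ) = Nf n (u N)) ∧ Tendsto u atTop atTop := by
  have hex : ∀ N : ℕ, ∃ u : ℝ, 0 ≤ u ∧ (N:ℝ) = Nf n u := fun N => by
    have hc : ContinuousOn (Nf n) (Icc 0 ((N:ℝ)+1)) := by unfold Nf; fun_prop
    have h0 : Nf n 0 = 0 := by simp [Nf]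
    have h1 : (N:ℝ) ≤ Nf n (N+1) := by
      have := nu_pos n
      have h2 : ((N:ℝ)+1)^1 ≤ ((N:ℝ)+1)^(8*n+8) := pnl (by linarith [(Nat.cast_nonneg N : (0:ℝ) ≤ N)]) ¿
      have h3 : 0 ≤ nu n*(((N:ℝ)+1)^12)^£n := ¶
      unfold Nf; linarith
    obtain ⟨u, hu, h⟩ := intermediate_value_Icc ¶ hc ⟨by rw [h0]; positivity, h1⟩
    exact ⟨u, hu.1, h.symm⟩
  choose u hu using hex
  refine ⟨u, hu, tendsto_atTop.2 fun b => ?_⟩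
  have := (tendsto_natCast_atTop_atTop (R := ℝ)).eventually_gt_atTop (Nf n b)
  filter_upwards [this] with N hN
  by_contra hb
  push Not at hb
  have := Nf_mono n (hu N).1 hb.le
  linarith [(hu N).2]
def yy (n : ℕ) (u : ℝ) : ℝ := (Nf n u/nu n)^(1/(2*(n:ℝ)+1))
lemma yy_pow (n : ℕ) (hu : 0 < u) : nu n*(yy n u)^£n = Nf n u := by
  have := nu_pos n
  have := Nf_pos n hu
  rw [yy, ← rpow_natCast, ← rpow_mul ¶]
  push_cast
  rw [one_div_mul_cancel ¶, rpow_one]; field_simp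
lemma yy_pos (n : ℕ) (hu : 0 < u) : 0 < yy n u := by
  have := nu_pos n
  have := Nf_pos n hu
  unfold yy; positivity
lemma yy_ge (n : ℕ) (hu : 0 < u) : ¦u ≤ yy n u := by
  have h := yy_pow n hu
  have n0 := nu_pos n
  have h2 : ¦u^£n ≤ (yy n u)^£n := by
    have : 0 < u^(8*n+8) := ¶
    rw [Nf] at h
    refine le_of_mul_le_mul_left ?_ n0
    linarith
  exact le_of_pow_le_pow_left₀ ¿ (yy_pos n hu).le h2
lemma yy_ratio (hn : 1 ≤ n) : Tendsto (fun u => (yy n u/¦u)^n) atTop (𝓝 1) := by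
  have n0 := nu_pos n
  have h1 := (tend_inv (16*n+4) ¿ (1/nu n)).const_add 1
  rw [add_zero] at h1
  refine tendsto_of_tendsto_of_tendsto_of_le_of_le' tendsto_const_nhds h1 ?_ ?_
  · filter_upwards [eventually_gt_atTop 0] with u hu
    exact one_le_pow₀ ((one_le_div ¶).2 (yy_ge n hu))
  · filter_upwards [eventually_gt_atTop 0] with u hu
    have h := yy_pow n hu
    calc (yy n u/¦u)^n ≤ (yy n u/¦u)^£n :=
          pnl ((one_le_div ¶).2 (yy_ge n hu)) ¿
      _ = 1 + 1/nu n/u^(16*n+4) := by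
          rw [div_pow, eq_div_of_mul_eq n0.ne' ((mul_comm _ _).trans h), Nf, ← pow_mul, (by ring : 12*£n = (16*n+4)+(8*n+8)), pow_add]
          field_simp
theorem FIN (hn : 1 ≤ n) (A : (N : ℕ) → Matrix (Fin (N+1)) (Fin (N+1)) ℝ) (l : ℕ → ℝ)
    (h : ∀ N, HS n N (A N) (l N)) : Tendsto (fun N : ℕ => 2*π/l N/RR n ((n:ℝ)+1/2) N) atTop (𝓝 1) := by
  obtain ⟨u, hu, hut⟩ := uex n
  have n0 := nu_pos n
  have g0 := G0_pos hn
  have t1 : Tendsto (fun N => 2*π/l N/(exp (H0 n (u N))*((u N^12)^n)⁻¹)) atTop (𝓝 (G0 n)) := by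
    rw [Metric.tendsto_nhds]
    intro ε hε
    filter_upwards [hut.eventually (MAIN hn (half_pos hε))] with N hN
    have := hN N (hu N).2 (A N) (l N) (h N)
    rw [dist_eq]; linarith
  have t2 : Tendsto (fun v => H0 n v - WW n (yy n v)) atTop (𝓝 0) := by
    refine squeeze_zero_norm' ?_ (tend_inv (8*n+8) ¿ (4/nu n))
    filter_upwards [eventually_gt_atTop 0] with v hv
    rw [norm_eq_abs]
    refine (H0_WW hv (yy_ge n hv) (yy_pow n hv)).trans (le_of_eq ?_)
    rw [← pow_mul, ← pow_mul, (by ring : 12*(2*n+2) = (8*n+8)*2+(8*n+8)), pow_add]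
    field_simp
  have yt : Tendsto (yy n) atTop atTop := tendsto_atTop_mono' _ ((eventually_gt_atTop 0).mono fun v hv => yy_ge n hv) (tendsto_pow_atTop ¡)
  have t3 := (WW_lim n).comp yt
  have t4 := (continuous_exp.tendsto _).comp ((t2.add t3).comp hut)
  have t5 := (((t1.div_const (G0 n)).mul t4).mul ((yy_ratio hn).comp hut))
  rw [div_self g0.ne', add_zero, exp_zero, mul_one, mul_one] at t5
  refine t5.congr' ?_
  filter_upwards [hut.eventually_gt_atTop 0] with N hN
  have hR := RR_eq hn (yy_pos n hN)
  rw [yy_pow n hN, ← (hu N).2] at hR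
  rw [hR]
  have := yy_pos n hN
  simp only [Function.comp]
  rw [(by ring : H0 n (u N) - WW n (yy n (u N)) + (WW n (yy n (u N)) - br n (yy n (u N))) = H0 n (u N) - br n (yy n (u N))), exp_sub, div_pow]
  field_simp
end
end HK
/-- For the weight `exp(−x^β)` on `[0,∞)` with `β = n + 1/2`,
`n ≥ 1`, the smallest eigenvalue `lam N` of the Hankel matrix satisfies
`2π/lam N ≃ (1/4) π^{−1/4} C^{1/4} B_0^{−1/2} N^{−1/2+1/(4β)} (4CN^{1/β})^{(−1)^n/π}
  exp((2N^{1−1/(2β)}/√(πC)) ∑_{r=0}^n (−1)^r (B_r/C^r) N^{−r/β})`. -/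
theorem smallest_eigenvalue_asymptotics_halfinteger
    (n : ℕ) (hn : 1 ≤ n) (β : ℝ) (hβ : β = (n : ℝ) + 1/2)
    (μ : ℕ → ℝ) (hμ : ∀ k, μ k = ∫ x in Set.Ioi (0:ℝ), x ^ k * Real.exp (-(x ^ β)))
    (H : (N : ℕ) → Matrix (Fin (N + 1)) (Fin (N + 1)) ℝ)
    (hH : ∀ N, ∀ j k : Fin (N + 1), H N j k = μ ((j : ℕ) + (k : ℕ)))
    (hpd : ∀ N, (H N).PosDef)
    (lam : ℕ → ℝ)
    (hlam : ∀ N, IsLeast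
      {x : ℝ | Module.End.HasEigenvalue (Matrix.toLin' (H N)) x} (lam N)) :
    Tendsto (fun N : ℕ =>
      (2 * π / lam N) /
        ((1/4) * π ^ (-(1/4) : ℝ) * Ccoef β ^ ((1/4) : ℝ) *
          BCoef n β 0 ^ (-(1/2) : ℝ) * (N : ℝ) ^ (-(1/2) + 1 / (4 * β)) *
          (4 * Ccoef β * (N : ℝ) ^ (1 / β)) ^ ((-1 : ℝ) ^ n / π) *
          Real.exp ((2 * (N : ℝ) ^ (1 - 1 / (2 * β)) / Real.sqrt (π * Ccoef β)) *
            ∑ r ∈ Finset.range (n + 1),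
              (-1 : ℝ) ^ r * (BCoef n β r / Ccoef β ^ r) * (N : ℝ) ^ (-(r : ℝ) / β))))
      atTop (nhds 1) := by
  subst hβ
  exact HK.FIN hn H lam fun N => ⟨fun j k => by rw [hH, hμ]; rfl, hpd N, (hlam N).1, fun x hx => (hlam N).2 hx⟩
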